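/- Every triangulation of the orientable surface S_2 of genus 2 contains a noncontractible separating cycle (NSC). -/

import Mathlib

open scoped Classical

/-- A combinatorial triangulation of a closed surface: a finite set of triangular
faces (3-element subsets of `ℕ`) such that every edge lies in exactly two faces,
the faces around each vertex form a single cycle (the link condition), and the
whole complex is connected.  The underlying simple graph has as edges the
2-element subsets of faces. -/
structure Triangulation where
  faces : Finset (Finset ℕ)
  faces_nonempty : faces.Nonempty
  card_eq_three : ∀ f ∈ faces, f.card = 3
  edge_in_two_faces : ∀ e : Finset ℕ, e.card = 2 → (∃ f ∈ faces, e ⊆ f) →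
    (faces.filter (fun f => e ⊆ f)).card = 2
  link_connected : ∀ v : ℕ, ∀ f ∈ faces, ∀ g ∈ faces, v ∈ f → v ∈ g →
    Relation.ReflTransGen
      (fun f' g' => f' ∈ faces ∧ g' ∈ faces ∧ v ∈ f' ∧ v ∈ g' ∧ (f' ∩ g').card = 2) f g
  face_connected : ∀ f ∈ faces, ∀ g ∈ faces,
    Relation.ReflTransGen
      (fun f' g' => f' ∈ faces ∧ g' ∈ faces ∧ (f' ∩ g').card = 2) f g

namespace Triangulation

/-- The vertices spanned by a set of faces. -/
def vertsOf (F : Finset (Finset ℕ)) : Finset ℕ := F.sup id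

/-- The edges spanned by a set of triangular faces: all 2-element subsets of faces. -/
def edgesOf (F : Finset (Finset ℕ)) : Finset (Finset ℕ) :=
  (Finset.powersetCard 2 (vertsOf F)).filter (fun e => ∃ f ∈ F, e ⊆ f)

/-- The vertex set of a triangulation. -/
def verts (T : Triangulation) : Finset ℕ := vertsOf T.faces

/-- The edge set of a triangulation. -/
def edges (T : Triangulation) : Finset (Finset ℕ) := edgesOf T.faces

/-- The Euler characteristic `V - E + F` of a triangulation. -/
def euler (T : Triangulation) : ℤ :=
  (T.verts.card : ℤ) - (T.edges.card : ℤ) + (T.faces.card : ℤ)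

/-- The three directed edges of an ordered triple (an oriented triangle). -/
def dedges (t : ℕ × ℕ × ℕ) : Finset (ℕ × ℕ) :=
  {(t.1, t.2.1), (t.2.1, t.2.2), (t.2.2, t.1)}

/-- `σ` is a coherent orientation of the set `F` of triangular faces: it assigns to each
face an oriented triangle with that vertex set, so that no directed edge is used twice
(equivalently, the two faces sharing an edge traverse that edge in opposite directions). -/
def IsCoherent (F : Finset (Finset ℕ)) (σ : Finset ℕ → ℕ × ℕ × ℕ) : Prop :=
  (∀ f ∈ F, ({(σ f).1, (σ f).2.1, (σ f).2.2} : Finset ℕ) = f) ∧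
  (∀ f ∈ F, ∀ g ∈ F, f ≠ g → Disjoint (dedges (σ f)) (dedges (σ g)))

/-- A triangulation is orientable if its faces admit a coherent orientation. -/
def Orientable (T : Triangulation) : Prop := ∃ σ, IsCoherent T.faces σ

/-- `T` is a triangulation of the orientable surface `S_g` of genus `g`
(Euler characteristic `2 - 2g`). -/
def IsS (g : ℕ) (T : Triangulation) : Prop :=
  T.euler = 2 - 2 * (g : ℤ) ∧ T.Orientable

/-- `T` is a triangulation of the nonorientable surface `N_g` of genus `g`
(Euler characteristic `2 - g`). -/
def IsN (g : ℕ) (T : Triangulation) : Prop :=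
  T.euler = 2 - (g : ℤ) ∧ ¬ T.Orientable

/-- The edges of the cyclic vertex sequence `c`. -/
def cycEdges (c : List ℕ) : Finset (Finset ℕ) :=
  (Finset.range c.length).image
    (fun i => ({c.getD i 0, c.getD ((i + 1) % c.length) 0} : Finset ℕ))

/-- `c` is a cycle of the triangulation `T`: at least three distinct vertices,
consecutive ones (cyclically) joined by edges of `T`. -/
def IsCycle (T : Triangulation) (c : List ℕ) : Prop :=
  3 ≤ c.length ∧ c.Nodup ∧ ∀ e ∈ cycEdges c, e ∈ T.edges

/-- Faces `f` and `g` lie in the same component of `S - C`, where `C` is the closed curve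
corresponding to the cycle `c`: they are joined by a chain of faces consecutively sharing
edges that are not edges of the cycle. -/
def SameSide (T : Triangulation) (c : List ℕ) (f g : Finset ℕ) : Prop :=
  Relation.ReflTransGen
    (fun f' g' => f' ∈ T.faces ∧ g' ∈ T.faces ∧ (f' ∩ g').card = 2 ∧
      f' ∩ g' ∉ cycEdges c) f g

/-- The cycle `c` separates the surface: `S - C` is disconnected. -/
def Separating (T : Triangulation) (c : List ℕ) : Prop :=
  ∃ f ∈ T.faces, ∃ g ∈ T.faces, ¬ SameSide T c f g

/-- The faces in the component of `S - C` containing the face `f`. -/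
noncomputable def sideFaces (T : Triangulation) (c : List ℕ) (f : Finset ℕ) :
    Finset (Finset ℕ) :=
  T.faces.filter (fun g => SameSide T c f g)

/-- The Euler characteristic of the component of `f` in the surface cut along the cycle
`c`, capped with a single new face (`+1`). -/
noncomputable def sideEuler (T : Triangulation) (c : List ℕ) (f : Finset ℕ) : ℤ :=
  ((vertsOf (sideFaces T c f)).card : ℤ) - ((edgesOf (sideFaces T c f)).card : ℤ)
    + ((sideFaces T c f).card : ℤ) + 1

/-- The Euler genus `2 - χ` of the capped component of `f` in the surface cut
along the cycle `c`. -/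
noncomputable def sideEulerGenus (T : Triangulation) (c : List ℕ) (f : Finset ℕ) : ℤ :=
  2 - sideEuler T c f

/-- The capped component of `f` in the surface cut along the cycle `c` is orientable. -/
def SideOrientable (T : Triangulation) (c : List ℕ) (f : Finset ℕ) : Prop :=
  ∃ σ, IsCoherent (sideFaces T c f) σ

/-- `c` is a noncontractible separating cycle (NSC): it separates the surface and
neither capped component is a triangulation of the sphere (`χ = 2`). -/
def IsNSC (T : Triangulation) (c : List ℕ) : Prop :=
  IsCycle T c ∧ Separating T c ∧ ∀ f ∈ T.faces, sideEuler T c f ≠ 2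

/-- A coherent orientation of the faces of `T` in which the gluing across the edges of the
cycle `c` is ignored: this orients the surface obtained by cutting along `c`. -/
def IsCutCoherent (T : Triangulation) (c : List ℕ) (σ : Finset ℕ → ℕ × ℕ × ℕ) : Prop :=
  (∀ f ∈ T.faces, ({(σ f).1, (σ f).2.1, (σ f).2.2} : Finset ℕ) = f) ∧
  (∀ f ∈ T.faces, ∀ g ∈ T.faces, f ≠ g → f ∩ g ∉ cycEdges c →
    Disjoint (dedges (σ f)) (dedges (σ g)))

/-- The cycle `c` is orientable-leaving: the surface obtained by cutting along `c`
is orientable. -/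
def OrientableLeaving (T : Triangulation) (c : List ℕ) : Prop :=
  ∃ σ, IsCutCoherent T c σ

/-- A corner of the cycle `c`: a pair `(i, f)` where `f` is a face containing the `i`-th
vertex of `c`. -/
def IsCorner (T : Triangulation) (c : List ℕ) (x : ℕ × Finset ℕ) : Prop :=
  x.1 < c.length ∧ x.2 ∈ T.faces ∧ c.getD x.1 0 ∈ x.2

/-- Two corners lie on a common boundary segment of the surface cut along `c`:
either they are corners at the same cycle vertex whose faces share an edge through that
vertex not lying on the cycle, or they are corners of one face containing a cycle edge,
at the two endpoints of that edge. -/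
def CornerRel (T : Triangulation) (c : List ℕ) (x y : ℕ × Finset ℕ) : Prop :=
  IsCorner T c x ∧ IsCorner T c y ∧
  ((x.1 = y.1 ∧ (x.2 ∩ y.2).card = 2 ∧ c.getD x.1 0 ∈ x.2 ∩ y.2 ∧
      x.2 ∩ y.2 ∉ cycEdges c) ∨
    (y.1 = (x.1 + 1) % c.length ∧ x.2 = y.2 ∧
      ({c.getD x.1 0, c.getD y.1 0} : Finset ℕ) ⊆ x.2))

/-- The cycle `c` is one-sided: cutting the surface along `c` produces a single boundary
cycle, i.e. all corners along `c` lie on one boundary component (the neighborhood of the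
curve is a Möbius band).  A nonseparating cycle is two-sided iff it is not one-sided. -/
def OneSided (T : Triangulation) (c : List ℕ) : Prop :=
  ∀ x y, IsCorner T c x → IsCorner T c y → Relation.EqvGen (CornerRel T c) x y

/-- The 3-cycles (triangles) of the graph of `T`. -/
def triangles (T : Triangulation) : Finset (Finset ℕ) :=
  (Finset.powersetCard 3 T.verts).filter
    (fun t => ∀ e ∈ Finset.powersetCard 2 t, e ∈ T.edges)

/-- An edge of `T` is contractible iff it lies in exactly two 3-cycles of the graph of
`T` (for any triangulation other than `K₄` on the sphere, this is equivalent to the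
contraction of the edge yielding again a triangulation of the same surface). -/
def ContractibleEdge (T : Triangulation) (e : Finset ℕ) : Prop :=
  e ∈ T.edges ∧ (T.triangles.filter (fun t => e ⊆ t)).card = 2

/-- A triangulation is irreducible if it has no contractible edge. -/
def Irreducible (T : Triangulation) : Prop :=
  ∀ e, ¬ ContractibleEdge T e

/-- Two face sets are equivalent if some relabelling of the vertices carries one onto the
other (such a bijection carries faces to faces and hence edges to edges). -/
def FacesEquiv (F F' : Finset (Finset ℕ)) : Prop :=
  ∃ φ : ℕ ≃ ℕ, F' = F.image (fun f => f.image φ)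

/-- Two triangulations are equivalent if some vertex bijection carries faces to faces
(and hence edges to edges). -/
def EquivTri (T T' : Triangulation) : Prop := FacesEquiv T.faces T'.faces

/-- `T'` is obtained from `T` by a diagonal flip: the edge `{a,c}`, lying in the faces
`{a,b,c}` and `{a,c,d}` with `{b,d}` not an edge, is replaced by `{b,d}` and the two
faces by `{a,b,d}` and `{b,c,d}`. -/
def Flip (T T' : Triangulation) : Prop :=
  ∃ a b c d : ℕ, ({a, b, c} : Finset ℕ) ∈ T.faces ∧ ({a, c, d} : Finset ℕ) ∈ T.faces ∧
    b ≠ d ∧ ({b, d} : Finset ℕ) ∉ T.edges ∧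
    T'.faces = (T.faces \ {({a, b, c} : Finset ℕ), ({a, c, d} : Finset ℕ)}) ∪
      {({a, b, d} : Finset ℕ), ({b, c, d} : Finset ℕ)}

/-- Two triangulations are equivalent under diagonal flips if a finite sequence of
diagonal flips transforms one into a triangulation equivalent to the other. -/
def FlipEquiv (T T' : Triangulation) : Prop :=
  ∃ T'' : Triangulation, Relation.ReflTransGen Flip T T'' ∧ EquivTri T'' T'

end Triangulation

namespace NSC.Chk

/-- `k n`, evaluating `n` first -/
def force {α : Type} (n : ℕ) (k : ℕ → α) : α := Nat.casesOn n (k 0) (fun m => k (Nat.succ m))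

/-- the dart `(a,b)` of labels below 16 -/
def key (a b : ℕ) : ℕ := Nat.add (Nat.mul 16 a) b

def rev (d : ℕ) : ℕ := key (Nat.mod d 16) (Nat.div d 16)

def pw (d : ℕ) : ℕ := Nat.shiftLeft 1 d

/-- the edge of a dart, as a chain -/
def eb (d : ℕ) : ℕ := bif Nat.ble d (rev d) then pw d else pw (rev d)

def tb (x d : ℕ) : Bool := Nat.beq (Nat.mod (Nat.shiftRight x d) 2) 1

def fld (t d : ℕ) : ℕ := Nat.mod (Nat.shiftRight t (Nat.mul 8 d)) 256

def setF (t d x : ℕ) : ℕ := Nat.xor t (Nat.shiftLeft (Nat.xor (fld t d) x) (Nat.mul 8 d))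

/-- the orbit of `d`, as a set of darts and as a chain -/
def orb (t s : ℕ) : ℕ → ℕ → ℕ → ℕ → (ℕ × ℕ → Bool) → Bool
  | 0, _, _, _, _ => false
  | f + 1, d, M, C, k =>
    force (fld t d) fun e => force (Nat.lor M (pw d)) fun M => force (Nat.xor C (eb d)) fun C =>
      bif Nat.beq e s then k (M, C) else orb t s f e M C k

structure St where
  n : ℕ
  nD : ℕ
  D : ℕ
  T : ℕ
  rs : List (List (ℕ × ℕ))

def findW (d : ℕ) : List (ℕ × ℕ) → (ℕ × ℕ → List (ℕ × ℕ) → Bool) → Bool → Bool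
  | [], _, z => z
  | w :: l, k, z => bif tb w.1 d then k w l else findW d l (fun w' l' => k w' (w :: l')) z

def inR (d : ℕ) : List (ℕ × ℕ) → Bool
  | [] => false
  | w :: l => tb w.1 d || inR d l

def findR (d : ℕ) :
    List (List (ℕ × ℕ)) → (List (ℕ × ℕ) → List (List (ℕ × ℕ)) → Bool) → Bool
  | [], _ => false
  | w :: l, k => bif inR d w then k w l else findR d l (fun w' l' => k w' (w :: l'))

def parts : List (ℕ × ℕ) → (List (ℕ × ℕ) → List (ℕ × ℕ) → Bool) → Bool
  | [], k => k [] []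
  | a :: l, k => parts l (fun s t => k (a :: s) t && k s (a :: t))

/-- all outcomes of adding the edge `e` at the corners `dp` and `dq` satisfy `k` -/
def addE (o : St) (dp dq e : ℕ) (k : St → Bool) : Bool :=
  findR dp o.rs fun rg rest => findW dp rg (fun A ra =>
    force (rev e) fun e' =>
    force (setF (setF (setF (setF o.T e (fld o.T dp)) e' (fld o.T dq)) dp e') dq e) fun T =>
    force (Nat.lor (pw e) (pw e')) fun N =>
    force (Nat.lor o.D N) fun D =>
    bif tb A.1 dq then
      !tb o.D e && orb T e 256 e 0 0 fun o1 => orb T e' 256 e' 0 0 fun o2 =>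
        Nat.beq (Nat.lor o1.1 o2.1) (Nat.lor A.1 N) && Nat.beq (Nat.land o1.1 o2.1) 0 &&
        k ⟨o.n, Nat.add o.nD 2, D, T, (o1 :: o2 :: ra) :: rest⟩ &&
        parts ra fun s t => k ⟨o.n, Nat.add o.nD 2, D, T, (o1 :: s) :: (o2 :: t) :: rest⟩
    else findW dq ra (fun B rb =>
      !tb o.D e && orb T e 256 e 0 0 fun o1 =>
        Nat.beq o1.1 (Nat.lor (Nat.lor A.1 B.1) N) &&
        k ⟨o.n, Nat.add o.nD 2, D, T, (o1 :: rb) :: rest⟩) true) false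

/-- add a pendant edge to the new vertex at the corner `dp` -/
def pend (o : St) (dp : ℕ) (k : St → Bool) : Bool :=
  findR dp o.rs fun rg rest => findW dp rg (fun A ra =>
    force (key (Nat.div dp 16) o.n) fun e => force (rev e) fun e' =>
    force (setF (setF (setF o.T e (fld o.T dp)) e' e) dp e') fun T =>
    force (Nat.lor (pw e) (pw e')) fun N =>
    force (Nat.lor o.D N) fun D =>
    orb T e 256 e 0 0 fun o1 =>
      Nat.beq o1.1 (Nat.lor A.1 N) &&
        k ⟨Nat.succ o.n, Nat.add o.nD 2, D, T, (o1 :: ra) :: rest⟩) false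

def len {α : Type} : List α → ℕ
  | [] => 0
  | _ :: l => Nat.succ (len l)

def nWalks : List (List (ℕ × ℕ)) → ℕ
  | [] => 0
  | r :: l => Nat.add (len r) (nWalks l)

def tooBig (o : St) : Bool :=
  Nat.blt (Nat.mul 2 (Nat.add (Nat.add (Nat.mul 2 (len o.rs)) 2) o.n))
    (Nat.add o.nD (Nat.mul 2 (nWalks o.rs)))

def chain : List (ℕ × ℕ) → ℕ
  | [] => 0
  | w :: l => Nat.xor w.2 (chain l)

/-- `m` is a sum of boundaries of regions -/
def null (m : ℕ) : List (List (ℕ × ℕ)) → Bool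
  | [] => Nat.beq m 0
  | r :: l => null m l || force (Nat.xor m (chain r)) fun m => null m l

abbrev Cn := ℕ × ℕ × ℕ
/-- number of labels, corners grouped by regions -/
abbrev Ks := ℕ × List (List Cn)

structure Hint where
  j : ℕ
  mir : Bool
  mp : ℕ

def lab (mp v : ℕ) : ℕ := Nat.mod (Nat.shiftRight mp (Nat.mul 4 v)) 16

def mapC (mir : Bool) (mp : ℕ) (c : Cn) : Cn :=
  bif mir then (lab mp c.1, lab mp c.2.2, lab mp c.2.1)
  else (lab mp c.1, lab mp c.2.1, lab mp c.2.2)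

def mapL {α β : Type} (f : α → β) : List α → List β
  | [] => []
  | a :: l => f a :: mapL f l

def allL {α : Type} (f : α → Bool) : List α → Bool
  | [] => true
  | a :: l => f a && allL f l

def anyL {α : Type} (f : α → Bool) : List α → Bool
  | [] => false
  | a :: l => f a || anyL f l

/-- the set of starting darts of corners -/
def cMask : List Cn → ℕ
  | [] => 0
  | c :: l => Nat.lor (pw (key c.1 c.2.1)) (cMask l)

def orL : List ℕ → ℕ
  | [] => 0
  | a :: l => Nat.lor a (orL l)

def wMask : List (ℕ × ℕ) → ℕ
  | [] => 0
  | w :: l => Nat.lor w.1 (wMask l)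

def dMask : List ℕ → ℕ
  | [] => 0
  | d :: l => Nat.lor (Nat.lor (pw d) (pw (rev d))) (dMask l)

/-- one dart of each edge of a set -/
def darts : ℕ → ℕ → List ℕ
  | 0, _ => []
  | f + 1, E => bif Nat.beq E 0 then [] else force (Nat.log2 E) fun d =>
    d :: force (Nat.xor E (Nat.lor (pw d) (pw (rev d)))) fun E => darts f E

/-- the neighbour of `v` after `w` along darts in `I` is `x` -/
def rotTo (t I v x : ℕ) : ℕ → ℕ → Bool
  | 0, _ => false
  | f + 1, w =>
    force (Nat.div (fld t (key v w)) 16) fun y =>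
      bif tb I (key v y) then Nat.beq y x else rotTo t I v x f y

def injUp (mp : ℕ) : ℕ → ℕ → Bool
  | 0, _ => true
  | n + 1, a => !tb a (lab mp n) && force (Nat.lor a (pw (lab mp n))) fun a => injUp mp n a

def findX (d : ℕ) : List ℕ → (ℕ → List ℕ → Bool) → Bool
  | [], _ => false
  | w :: l, k => bif tb w d then k w l else findX d l (fun w' l' => k w' (w :: l'))

def merge : List ℕ → List ℕ → (List ℕ → Bool) → Bool
  | [], X, k => k X
  | d :: ds, X, k => findX d X fun a l =>
    bif tb a (rev d) then merge ds X k
    else findX (rev d) l fun b l => force (Nat.lor a b) fun c => merge ds (c :: l) k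

def matchK (K : Ks) (o : St) (h : Hint) : Bool :=
  injUp h.mp K.1 0 &&
  (let G := mapL (mapL (mapC h.mir h.mp)) K.2
   let Y := mapL cMask G
   force (orL Y) fun I =>
   let del := darts 24 (Nat.xor o.D I)
   force (dMask del) fun E =>
   Nat.beq (Nat.lor I E) o.D && Nat.beq (Nat.land I E) 0 &&
   allL (allL fun c => rotTo o.T I c.1 c.2.2 16 c.2.1) G &&
   merge del (mapL wMask o.rs) fun X =>
    allL (fun y => anyL (fun x => Nat.beq (Nat.land x I) y) X) Y)

def matchH (lib : List Ks) (o : St) (h : Hint) : Bool :=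
  match lib[h.j]? with
  | none => false
  | some K => matchK K o h

def closedB (lib : List Ks) (hs : List Hint) (o : St) : Bool :=
  tooBig o || anyL (matchH lib o) hs

def closed (lib : List Ks) (hs : List Hint) (o : St) (m : ℕ) : Bool :=
  null m o.rs || closedB lib hs o

/-- a library entry: corners by regions; darts in order of connectivity; masks of flagged and
starred darts; potentials; dual bits; handle edges -/
structure Ent where
  K : Ks
  ord : List ℕ
  V : ℕ
  S : ℕ
  P : ℕ
  U : ℕ
  H : ℕ
  g1 : ℕ
  g2 : ℕ
  walk : List ℕ
  hints : List Hint

def pot (e : Ent) (d : ℕ) : ℕ := Nat.mod (Nat.shiftRight e.P (Nat.mul 256 d)) (pw 256)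

/-- the facial walks of a region -/
def walks (t : ℕ) : List Cn → ℕ → List (ℕ × ℕ) → (List (ℕ × ℕ) → ℕ → Bool) → Bool
  | [], a, ws, k => k ws a
  | c :: l, a, ws, k =>
    force (key c.1 c.2.1) fun d =>
    bif tb a d then walks t l a ws k
    else orb t d 256 d 0 0 fun w =>
      Nat.beq (Nat.land a w.1) 0 && force (Nat.lor a w.1) fun a => walks t l a (w :: ws) k

def allWalks (t : ℕ) : List (List Cn) → List (List (ℕ × ℕ)) → (List (List (ℕ × ℕ)) → Bool) → Bool
  | [], rs, k => k rs
  | g :: l, rs, k => walks t g 0 [] fun ws a =>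
    Nat.beq a (cMask g) && allWalks t l (ws :: rs) k

def tbl : List Cn → ℕ → ℕ
  | [], t => t
  | c :: l, t => force (setF t (key c.1 c.2.1) (key c.2.2 c.1)) fun t => tbl l t

def app {α : Type} : List α → List α → List α
  | [], l => l
  | a :: k, l => a :: app k l

def flat {α : Type} : List (List α) → List α
  | [] => []
  | a :: l => app a (flat l)

/-- all corners match the table, and the starting darts are distinct -/
def okC (n t : ℕ) : List Cn → ℕ → (ℕ → Bool) → Bool
  | [], a, k => k a
  | c :: l, a, k => Nat.blt c.1 n && Nat.blt c.2.1 n &&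
    force (key c.1 c.2.1) fun d => !tb a d && Nat.beq (fld t d) (key c.2.2 c.1) &&
      force (Nat.lor a (pw d)) fun a => okC n t l a k

def root (K : Ks) (k : St → Bool) : Bool :=
  let L := flat K.2
  force (tbl L 0) fun T => Nat.blt K.1 16 && okC K.1 T L 0 fun D =>
    allWalks T K.2 [] fun rs => k ⟨K.1, len L, D, T, rs⟩

/-- the inverse of the table -/
def inv (t : ℕ) : List ℕ → ℕ → ℕ
  | [], p => p
  | d :: l, p => force (setF p (fld t d) d) fun p => inv t l p

def ckInv (t p D : ℕ) : List ℕ → Bool := allL fun d =>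
  tb D d && tb D (rev d) && tb D (fld t d) && Nat.beq (fld p (fld t d)) d

def ckPot (e : Ent) (t D : ℕ) : List ℕ → Bool := allL fun d => Nat.beq (Nat.lor (pot e d) D) D &&
  force (fld t d) fun f => force (rev f) fun g =>
  bif tb e.H g || tb e.H f then
    tb e.V d && tb e.V f && tb e.V g && Nat.beq (Nat.xor (pot e f) (pot e d)) (eb g)
  else (tb e.V d == tb e.V g) && (tb e.S d == tb e.S g) && Nat.beq (pot e d) (pot e g)

def ckPair (e : Ent) (l : List ℕ) : Bool := allL (fun a => allL (fun b =>
    !(Nat.beq (Nat.div a 16) (Nat.div b 16)) ||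
      ((tb e.V a == tb e.V b) && (tb e.V a || !tb e.S a) &&
        (!tb e.V a || force (Nat.xor (pot e a) (pot e b)) fun x => Nat.beq x 0 ||
          (tb e.S a || tb e.S b) && (Nat.beq x e.g1 || Nat.beq x e.g2 ||
          Nat.beq x (Nat.xor e.g1 e.g2))))) l) l

/-- the four corners along an edge -/
def clus (p d : ℕ) : ℕ :=
  Nat.lor (Nat.lor (pw d) (pw (fld p d))) (Nat.lor (pw (rev d)) (pw (fld p (rev d))))

/-- every starred corner is linked to an earlier one -/
def ckConn (e : Ent) (t p : ℕ) : List ℕ → ℕ → Bool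
  | [], _ => true
  | d :: l, a =>
    bif tb e.S d then
      (Nat.beq a 0 || !(Nat.beq (Nat.land a (Nat.lor (clus p d) (clus p (rev (fld t d))))) 0)) &&
        force (Nat.lor a (pw d)) fun a => ckConn e t p l a
    else ckConn e t p l a

def ckDual (e : Ent) (p : ℕ) : List ℕ → Bool := allL fun d =>
  ((tb e.U d ^^ tb e.U (fld p d)) == (tb e.U (rev d) ^^ tb e.U (fld p (rev d))))

/-- the left face of `d` is starred -/
def inB (e : Ent) (p d : ℕ) : Bool := tb e.S d || tb e.S (fld p d)

/-- a closed walk along the flags of starred faces with odd dual sum; the flag is that of the first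
or second end of `d`, according to `c` -/
def ckWalk (e : Ent) (t p D s : ℕ) : List ℕ → ℕ → Bool → Bool → Bool
  | [], d, c, b => Nat.beq d s && !c && b
  | k :: l, d, c, b =>
    tb D d && inB e p d &&
    bif Nat.beq k 0 then ckWalk e t p D s l d (!c) (b ^^ (tb e.U d ^^ tb e.U (fld p d)))
    else bif Nat.beq k 1 then
      inB e p (rev d) && force (rev d) fun d => ckWalk e t p D s l d (!c) b
    else bif c then tb e.S (fld p d) && force (fld p d) fun d => ckWalk e t p D s l d false b
    else tb e.S d && force (fld t d) fun d => ckWalk e t p D s l d true b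

def ckOne (lib : List Ks) (e : Ent) (o : St) : Bool :=
  allL (fun a => !tb e.V a || allL (fun b =>
    !tb e.V b || !(Nat.blt (Nat.div a 16) (Nat.div b 16)) || !(tb e.S a || tb e.S b) ||
      force (key (Nat.div a 16) (Nat.div b 16)) fun d =>
      bif tb o.D d then
        tb e.H d || !(Nat.beq a d && Nat.beq b (rev d)) ||
          force (Nat.xor (eb d) (Nat.xor (pot e a) (pot e b))) fun m => null m o.rs
      else force (Nat.xor (eb d) (Nat.xor (pot e a) (pot e b))) fun m =>
        addE o a b d fun o => closed lib e.hints o m) e.ord) e.ord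

def arc2 (e : Ent) (a b x y : ℕ) : ℕ :=
  Nat.xor (Nat.xor (eb x) (eb y)) (Nat.xor (pot e a) (pot e b))

def ckFresh (lib : List Ks) (e : Ent) (o : St) : Bool :=
  allL (fun a => !tb e.S a || pend o a fun o' =>
    force (key o.n (Nat.div a 16)) fun x => allL (fun b =>
    !tb e.S b || !(Nat.blt (Nat.div a 16) (Nat.div b 16)) ||
      force (key o.n (Nat.div b 16)) fun y =>
      force (arc2 e a b x y) fun m =>
      addE o' x b y fun o => closed lib e.hints o m) e.ord) e.ord

def ckKnown (e : Ent) (o : St) : Bool :=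
  allL (fun a => tb e.V a || allL (fun b => tb e.V b ||
    !(Nat.beq (Nat.div a 16) (Nat.div b 16)) || !(Nat.blt (Nat.mod a 16) (Nat.mod b 16)) ||
      force (rev a) fun x => force (rev b) fun y => !tb e.S x || !tb e.S y ||
      force (arc2 e x y x y) fun m => null m o.rs) e.ord) e.ord

def upTo (f : ℕ → Bool) : ℕ → Bool
  | 0 => true
  | n + 1 => f n && upTo f n

def ckOut (lib : List Ks) (e : Ent) (o : St) : Bool :=
  allL (fun a => !tb e.S a || allL (fun d => tb e.V d ||
    force (Nat.div d 16) fun v => force (key v (Nat.div a 16)) fun x =>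
    tb o.D x || addE o d a x fun o' =>
      closedB lib e.hints o' ||
      allL (fun b => !tb e.S b || Nat.beq (Nat.div b 16) (Nat.div a 16) ||
        force (key v (Nat.div b 16)) fun y => force (arc2 e a b x y) fun m =>
        bif tb o.D y then !(Nat.beq b (rev y)) || null m o'.rs
        else !(Nat.blt (Nat.div a 16) (Nat.div b 16)) || upTo (fun z =>
          !tb o'.D (key v z) ||
          addE o' (key v z) b y fun o2 => closed lib e.hints o2 m) 16) e.ord) e.ord) e.ord

def ckEnt (lib : List Ks) (e : Ent) : Bool :=
  root e.K fun o => force (inv o.T e.ord 0) fun p =>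
    upTo (fun i => anyL (fun d => Nat.beq (Nat.div d 16) i) e.ord) e.K.1 &&
    Nat.beq (orL (mapL pw e.ord)) o.D && ckInv o.T p o.D e.ord &&
    ckPot e o.T o.D e.ord && ckPair e e.ord && ckConn e o.T p e.ord 0 &&
    ckDual e p e.ord &&
    (match e.walk with
      | a :: b :: l => force (key a b) fun d => ckWalk e o.T p o.D d l d false false
      | _ => false) &&
    ckKnown e o && ckOne lib e o && ckFresh lib e o && ckOut lib e o

end NSC.Chk

namespace NSC.Chk

/-- the last digit of `n` in base `r`, and the others -/
def rd {α : Type} (r n : ℕ) (k : ℕ → ℕ → α) : α :=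
  force (Nat.mod n r) fun d => force (Nat.div n r) fun n => k d n

def rds {α : Type} (r : ℕ) : ℕ → ℕ → (List ℕ → ℕ → α) → α
  | 0, n, k => k [] n
  | c + 1, n, k => rd r n fun d n => rds r c n fun l n => k (d :: l) n

/-- an injection of `c` labels into a list of `r` labels -/
def inj {α : Type} : ℕ → ℕ → List ℕ → ℕ → (ℕ → ℕ → α) → α
  | 0, _, _, n, k => k 0 n
  | c + 1, r, l, n, k => rd r n fun i n => inj c (Nat.pred r) (l.eraseIdx i) n fun m n =>
      force (Nat.add (Nat.mul 16 m) (l.getD i 0)) fun m => k m n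

def keys : List ℕ → List ℕ
  | a :: b :: l => force (key a b) fun d => d :: keys (b :: l)
  | _ => []

/-- the chains of initial segments of a walk -/
def pre : ℕ → List ℕ → List ℕ
  | _, [] => []
  | m, d :: l => force (Nat.xor m (eb d)) fun m => m :: pre m l

/-- the potentials on reversed darts of a walk -/
def pots : List ℕ → List ℕ → ℕ
  | d :: l, m :: k => Nat.lor (Nat.shiftLeft m (Nat.mul 256 (rev d))) (pots l k)
  | _, _ => 0

/-- the corners at `v` -/
def crn (v : ℕ) : List ℕ → ℕ → ℕ → ℕ → Ent → (ℕ → Ent → Ent) → Ent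
  | w :: x :: l, f, m, N, e, k =>
    force (key v w) fun d =>
    let b := tb e.H d || tb e.H (rev d)
    force (bif b then pot e d else m) fun m =>
    let c := b || Nat.beq f 3
    rd (bif c then 3 else 1) N fun f' N => force (bif c then f' else f) fun f =>
    rd 2 N fun u N =>
    force (bif Nat.beq f 0 then e.V else Nat.lor e.V (pw d)) fun V =>
    force (bif Nat.beq f 2 then Nat.lor e.S (pw d) else e.S) fun S =>
    force (Nat.lor e.P (Nat.shiftLeft m (Nat.mul 256 d))) fun P =>
    force (Nat.lor e.U (Nat.shiftLeft u d)) fun U =>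
    crn v (x :: l) f m N ⟨(e.K.1, [(v, w, x) :: flat e.K.2]), d :: e.ord, V, S, P, U, e.H, e.g1,
      e.g2, e.walk, e.hints⟩ k
  | _, _, _, N, e, k => k N e

def vts (n : ℕ) : ℕ → ℕ → Ent → (ℕ → Ent → Ent) → Ent
  | 0, N, e, k => k N e
  | v + 1, N, e, k => rd 8 N fun c N => rds n c N fun l N =>
    crn v (app l (l.take 1)) 3 0 N e (vts n v · · k)

def orbit (t s : ℕ) : ℕ → ℕ → ℕ
  | 0, _ => 0
  | f + 1, d => Nat.lor (pw d) (bif Nat.beq d s then 0 else orbit t s f (fld t d))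

/-- `k l`, evaluating `l` first -/
def seq {α : Type} : List α → (List α → Ent) → Ent
  | [], k => k []
  | a :: l, k => seq l fun l => k (a :: l)

/-- the corners of `C` by regions -/
def grp (R : ℕ) (C : List Cn) : ℕ → List (List Cn) → (List (List Cn) → Ent) → Ent
  | 0, a, k => k a
  | i + 1, a, k =>
    seq (C.filter fun c => tb R (256 * i + key c.1 c.2.1)) fun g => grp R C i (g :: a) k

def regs (r t : ℕ) (C : List Cn) : List Cn → ℕ → ℕ → (ℕ → List (List Cn) → Ent) → Ent
  | [], N, R, k => grp R C r [] (k N)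
  | c :: l, N, R, k => force (key c.1 c.2.1) fun d =>
    bif anyL (fun i => tb R (256 * i + d)) (List.range r) then regs r t C l N R k
    else rd r N fun i N =>
      force (Nat.lor R (Nat.shiftLeft (orbit t d 256 (fld t d)) (256 * i))) fun R => regs r t C l N R k

def hts (lib : List Ks) (n : ℕ) : ℕ → ℕ → List Hint
  | 0, _ => []
  | h + 1, N => rd 2 N fun m N => rd 80 N fun j N =>
    inj (lib.getD j (0, [])).1 n (List.range n) N fun mp N => ⟨j, Nat.beq m 1, mp⟩ :: hts lib n h N

/-- put linked starred corners first -/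
def link (e : Ent) (t p : ℕ) : ℕ → List ℕ → ℕ → List ℕ
  | f + 1, d :: l, a =>
    bif ckConn e t p [d] a then
      d :: force (bif tb e.S d then Nat.lor a (pw d) else a) fun a => link e t p f l a
    else link e t p f (app l [d]) a
  | _, l, _ => l

def decode (lib : List Ks) (N : ℕ) : Ent :=
  rd 9 N fun n N => rd 17 N fun L N => rds n L N fun W N =>
  seq (keys (app W (W.take 1))) fun H => seq (pre 0 H) fun I =>
  rds L 4 N fun g N =>
  let x i := I.getD (g.getD i 0) 0
  force (pots H I) fun P => force (orL (mapL eb H)) fun h =>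
  force (Nat.xor (x 0) (x 1)) fun g1 => force (Nat.xor (x 2) (x 3)) fun g2 =>
  vts n n N ⟨(n, []), [], 0, 0, P, 0, h, g1, g2, [], []⟩ fun N e =>
  seq (flat e.K.2) fun C => force (tbl C 0) fun t =>
  rd 7 N fun r N => regs r t C C N 0 fun N K =>
  seq (link e t (inv t e.ord 0) 999 e.ord 0) fun O =>
  rds n 2 N fun v N => rd 32 N fun c N => rds 3 c N fun w N => rd 64 N fun h N =>
  seq (hts lib (Nat.succ n) h N) fun hs =>
  ⟨(n, K), O, e.V, e.S, e.P, e.U, e.H, e.g1, e.g2, app v w, hs⟩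

/-- the entries `ns` pass the checks, and the last one is `K` -/
def ckAll (K : Ks) : List Ks → List ℕ → Bool
  | lib, [] => lib.head? == some K
  | lib, n :: ns => let e := decode lib n; ckEnt lib e && ckAll K (e.K :: lib) ns

end NSC.Chk

namespace NSC.Chk

def data : List ℕ := [
  63849930683869256951479412935964464702252194569,
  63849930653754248513939847743781520883892881534,
  146159548827659653011857383553051663471792114657010727265,
  16666185647075934724201774379258281152311639422748833300807517217,
  5249297016678497728207505527079789322678035678800148159704125479795,
  7533976857975348999844954182684917517840181889752194569,
  21656376267749672325641008090746116697743781640415142881534,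
  1813773534385778524252632154182794127387876638921002194569,
  21204090370871718892539049717619693870676772033531597251132345856613774841329108064955405,
  73174999229552611482173041667916028696357411697,
  90674518932418461390834922090864742114657010727265,
  102421640902919282699226739836260397953528566807205,
  12930931896466671993865426079050813569595446244790275191214702204937612,
  1151518048527359484256601186754854273665197265831973442846557217,
  1057696892342572295364698400774531180587302133965178777,
  6686945275773126870472230592153038873382983409224795569240275191335727932640737,
  43408956010920982215876725661127962463810050648852030593408053507122337056552311645018929,
  332160255772523424424054660743533101650265885421374575,
  390395527248350571710080999955056336639779526388206730923141784694,
  5830239764026446272298782519446090169306294741314237610148060621464694,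
  41688002266324634342648961873354173411823332485784694,
  87442806552289230135595634200269553741593581968299323676319637687901,
  53406158844873522200593747729442967353156888631351113083544694,
  43389752628345954303024488616699877181468318234524479877704344694,
  47551513950170007992210120221325331545945740576545354614111874181784694,
  379194081584986680605138855228018458314236409885293221128940184694,
  270790344094976157540957551291841670037672111347329401018358836439704694,
  92852560778500124635844775443376664888530897371664058133144694,
  1586841337456504159883380118186951054845280089323409737531617875203289,
  4321110320821128882423504968944212885996621975691053091735093249536446444056943132683977,
  4173342243543278608589720890724678464912501902171778288037799,
  44448754457942012935555545321119616572485748421567865989844011583270838420034967051779436119314619795646088198368568577561124855327252194569,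
  812181531820296282761838489575467026681213751136548110270773093208657,
  279669627324271825920617396578762398228267331956597033316321479,
  37836200570183352605282371590211419036498503766210010997124,
  282742093604395414142272688313185143491506425958063986471718493,
  103988944972616513258263542438231339945733889801647380852536857911684,
  355357359668185308115983562368460252564004655198056486367502804509060,
  90774239443375340444280409858408804623163801265303269401647440260,
  45164882101892526804325651008878864359027530395793586832391519919612330238000997050574070189686374791450330115609514987561124855327252194569,
  4185875542895694824337864582869807863299723398649445368888501499489772341155675086264982965032,
  15572512910391104429570194789524603620973413069510688552867643609629145052543167415452456,
  1287662432841223273858012023967763856632282291749967812369548068123512053555246489042327789670,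
  91267767107459840838091245798439120528977523383092760917589126879044209767526335735726187551159654762696650378068002216,
  86950215986269852579575113865639534315140201613140535990209314610789242570155086053,
  615185168243110129386440058720688686056801723679943895415198745750971326083852701685438851743678486604406509670,
  13579005545123770923770191902574114768573659708074917865953820186028256345632325536982,
  3886610650511612510270781562550391684543803954970784971285442078852730000749982071134321160618543982315904467368025168396322216,
  84701024730971137478236124575696439810972855298877223334780552699273268345935949277100511,
  2324799823518536732706253704952756479699747990878008319889712857010259707604462112151789025927111450940284787179569994704830414882216,
  21640805667315147559598919287116590790578370688959550752684353645748751199,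
  512178681139879301559755240367999300877719423112866949091115042216,
  1046459048377176693603164806546164968412600173927292672530886731052032174252351869591035246315,
  126986599776619070347224873598052518194479795857953657590943109355267554283655,
  81913627130319808261986430336018059107131303429033316568937907282051268642216,
  2518784748722536625622120562862390648991476760467741668816329129,
  1715389061012246078824083808295320650338418690103062639414356081508610334417787,
  9072461304928313064292788168016261952719963570156064719590902721242713736440017613022254839556216144240069716217327268041589844273433411731312952983502194569,
  3130876901645695258904211874905347843980515581802508515682187900120972989772442964128654657630535517217,
  2621587271149725106838249686521406976588856519733841879516395987155130520037551503897682645114651406814113863258603357217,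
  1511691206276317512123326914837573563412910893500842809503137345833579339619770599693047087254632878697352811419720290981225600412836542375991630,
  257259209058121025946069498400140596369148336178290063949085397073757217,
  103116858523987590870380806308883334727402632390656265760881702224694215924422132181456035271336125108470620320169970595128976,
  11440366605781369257191852717556883520080844254328221423884121856730078516741594804801591630,
  654757930787265338275398803381058550804667280677219287721232073241280777122346401458557574844738688909527119981885977,
  65623423817288890907680690830631498416348035640972592710032920697819875124883256655868236882654726795106080378023171631168819752983466987127,
  168742845840552562774289850852179360391886375415543379937368269666701248533824037138845231174341451,
  2249536882560690185003393709374793620059684215857120478945175764926923313978922485306933509530537661663310306392899006691634476107214654575,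
  5749607727384339037573956882971010151570192218202311421365423324351769535585211194913675,
  325011966960132065678081716400717900355573331385071078779015298408548663,
  378384173779253970674827065334007437576190783867591741860100719267062171538115959568761764468015238784584317646256091,
  16833755044203819838618179457731507011970377925461340107191673323337331693670225266228979119953420095142601944685905745818299832577561124855327252194569,
  111282990473686920938183699155203297597534443024270737872781768067271,
  15983190510056996788584413953510208939775569147789455827249291769635002997,
  1813795259919651128310049152711548294659458248395071021110275866723,
  18385403452424261304996839205998914661303521021881033783035910044147655,
  191266646009240825332463515317618558264006634770809546068484126057429576450145966,
  2360417200809665017105653016496121055781788407035213669984389444122512545421606084280270817203636122379668911731312952983502194569,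
  225093880407519642163836156793650490469381233331757421264382058823517217,
  64912393158848577226182737009121636873053578325471256866814864305294466106925632807169042562103761,
  806592564770838851220642875094697294975753537337391751069442357316974491095783315188654507865381429,
  3841679362960292111912089945307672417702726592630021271783376333307680735325845029009242021596663011825936461248417539459631168819752983466987127,
  66028088602313451546080468066917696916796450007400678033423298490791630847833720,
  409833092880286619762449330631489470901046510884608099602420740609958704760,
  1075352815456865793814075375473826447288389520352462411172428816754412804844140654,
  10037882732034269895420366546779621542636112997130638678064822169041221369165432,
  7820796010721466362159167049432254166152453472027412758436226245282510488482161162781639866416424529015467361557291221601133459249012495492804996945309649077252194569,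
  17643031479598651773342171667603382600993428915219767452378500318165466053677926269714346704199241192973,
  617995278335252019004950260730324095026502317679840,
  31725828041249618425976905036395174700721507770612832610977414520,
  1218371952897050538957294069465107376270649183417620130853728049528184,
  6841585445179150065829746959965592165845849901679085902091533280288600341,
  2005265376254864366218267950367419680292408282257111186181297163566456,
  67444955852660089520700846712742223436739873145184000403262806112526462187231729448817088002136085519,
  26405695078991215380182263109098396786513696542101686714671151564563621992275948003058974947929899023580952,
  415696041584168799209194766577129782158405831729526274278186904589076314351324177229747341898436874164159601329730,
  8969186132881262631713374871915209330315399424996105721759512951584022555660617569745080147036643666064458181322930855,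
  7576146494989359410193354436277047096287108921418835098237592499323572760012487199107526,
  60668132293887714129010032868621064079730713666284900137414016919158702977637885632872673199710188020457663641476945165297001717704496031013505851080177,
  843246209509350670387845228813849759391564008900599643188876370835905034266460467548773616503176992275575090596938753336783769000663982399077294424778188033708800,
  125673085692882156050375635481710721277326617591838180537780442302117600982669837862,
  27646656391443641698712495230305666635605712694963377166343891959812822826657985013754940993545797658897041632303558,
  382645853007874581797387663887718767134440622630768275352310767119716924225139028416821028837014722157462,
  76010460207371159593339339168422070578673594181317240829827096323109035806484122032349872,
  2213931832409055379138327257326780733045393984019951992435896302409042039721790,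
  825821842216950700247768569839229164539554160422856002510276465712139189947123498193751467180266422408496192133143228008,
  40581242459482635651055570403730414373544656668041789968719205609494626837445551322345142,
  938459952055692341331129877179371499330547559637793832235751439716791601499742057918901,
  4502121515631652752007847166663702749607543509607866661955419093145572573393160540590157184792,
  13628583524840438134461477892826152945673726154787285352986122722896946748817161062127794382365542750073481586242457721069900552467367612161350560434198,
  13900023440463631769539987814005908789919644860429053336530923946215514062181579310234305675032,
  4058483965372751484636716769920140371053667248816965743799978284364677555257084726347403874376505896662988644387844547160328032575468867800739994811,
  3987188007719386526281008243163695172659959575434926546826656475353826347352397132217288057578646096446784097026974286445083361400750905393026722984743414578957187010619089723824666092073269395955258891740672674,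
  153862726281614165307502114793818992837186945892216026061243677380522030411986311443839554656710,
  3637023815356087938488673192962579094537624841281520798608095839691141910982,
  2922499954463840780937033708657849050246940203751589128835991525644082900919506896728885824514502,
  8185256089733820349894188597510598466986303487794645417284268401645809975545401363153314705083342,
  698306736239885221565947081619967698267859226488180003427755536148782871635206,
  1015008243318951681131768589844537773175054692470365510132920616670148652657042680262,
  41364627245287228138639055843471068769918511387804359159129575959420945965489394295016342862072889798,
  4095609306567430033721450300682052715875690672415057525900721512903559506345139193898983754182,
  301419788517801128582995438559994517050793287250530451266524356890132649458304844826065914320340327569784387411099659463446951948866883053372616310096756093004600380747928947227974160641485458931311703568596239,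
  10043212930162718588959442600796392303786762038559024214670912638036405770341485599578492452915196,
  895571129204829552468484005100663966811422931892640436773273270996721802247946484118852195,
  84680609710608679196981932066754950836965059492332295888433531819013393074067835841373097172803793350,
  6670345104744271855590594576298910747770748540102700649599423898046857214678526442,
  42265457619007062112989982619099593628055279561731727535691507067052304820719765016074158216112519108880359482801913285069670606819664490790457133984880505781743664839344633006684705642045243,
  3139537101000838561552009301004969044521735515636950711904054544999309814506649618952416638725523885235415,
  590056497659064591690442822131191617438712923117937107716872863848362658,
  207359078125902719431780361627437579087332850741351727958827765072498863958382671317026502,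
  272136571540698699761176189101881707071935877719800430553345546601750296481897541793586394978620838938458426092792075,
  26307258878735901241520397937327712352088962791832468381497723278327460486170717066691613397547750232308920263669789700767512,
  3943453314296734172553079719055089197886664654062618057051960862682892121569157054853078537265435358229494400327393219039871958539266887936213720567,
  15669002949075808390277151394178948145586434546092477656228599918086604824611124445333638264221103085512765755413691642033337561359338942274381,
  9969901327578076926568198647747424855438787695246718214922536831587966479873717336319139712660943554582674432030461923554611937927260240821,
  43081501171930953626543731919349976080805269543109786979245504181195371205270321902961856919592142719442593867102637631588312242448636069,
  2969352847072635896908287889462551452731685212658137665716133302164355876962816196689877244057429564648136753674805488722735969198535296043888343105380111082,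
  4495378152058611134052137353051069572760671125155798097160766093150386183742195427782,
  51019414403161573680250753620473511881684872225426413240863775698994234525805797911899703050742969208224134167426305,
  245590001488604881252042742858662642235719477288256738744756753949952346215898775703166667898647809,
  534228052480354056020582428539571474548828467942614989389585033931484693249210262450914731290656570245572397266177,
  9794009854343320122555881435237601856871366662203340110632485030202822753416002716460348184682583538678949716899568188525424053351154294753202575232055423608827305636584745435911224270,
  679779818583093981999036019648174159433463672803621610064357994127564272007607622475084507132358,
  12880791465804045593389439946746576668563808317433581306984428698072212851462483391466037030979208742272285,
  60391373455184985349317538209527838658773578570606141435432236478438486311596736394275269764250687247897885126,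
  242264649324582312214724350440525937485843278571281019511455722910931353912381598,
  24322023468305777675047660130892873194137823754351800045415560818579136392971131814813820212314781472822,
  3189353436854780842362233759517047728619277194673022028792985099748563639026780504279897848315485653418585605863368733293944475174477922479034048808628911460471110989620514582850544232863329623181845078,
  152296692360449412612137053903019633563760923268229093643320621418620456582484065081972091874239841204637658969594075746784712233939578216285978446313739581347894678855524231800790011170725002810783164631619316918447791678288325516646615692188095252096134640240260973,
  50707051864138087172446306447522674119537029772354618315526244128678965020980374521360092878823284847088473250265220560319035012366157835149001326869125533708800]

end NSC.Chk

namespace NSC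

open scoped Classical in
/-- A triangulated closed oriented surface of Euler characteristic `-2`; `t u v` is the vertex to
the left of the dart `u → v`. -/
structure Surf where
  verts : Finset ℕ
  adj : ℕ → ℕ → Prop
  t : ℕ → ℕ → ℕ
  symm : ∀ {u v}, adj u v → adj v u
  irr : ∀ v, ¬ adj v v
  mem : ∀ {u v}, adj u v → u ∈ verts
  t_adj : ∀ {u v}, adj u v → adj v (t u v)
  t_rot : ∀ {u v}, adj u v → t v (t u v) = u
  t_ne : ∀ {u v}, adj u v → t u v ≠ t v u
  cyc : ∀ {v x y}, adj v x → adj v y → ∃ k, (t v)^[k] x = y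
  conn : ∀ {u v}, u ∈ verts → v ∈ verts → Relation.ReflTransGen adj u v
  euler : ((verts ×ˢ verts).filter fun d => adj d.1 d.2).card = 6 * verts.card + 12

namespace Surf
variable (S : Surf)

theorem mem' {u v} (h : S.adj u v) : v ∈ S.verts := S.mem (S.symm h)
theorem ne {u v} (h : S.adj u v) : u ≠ v := fun e => S.irr v (e ▸ h)
theorem t_adj' {u v} (h : S.adj u v) : S.adj (S.t u v) u := by
  have := S.t_adj (S.t_adj h); rwa [S.t_rot h] at this
theorem t_rot' {u v} (h : S.adj u v) : S.t (S.t u v) u = v := by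
  have := S.t_rot (S.t_adj h); rwa [S.t_rot h] at this
theorem succ_adj {v x} (h : S.adj v x) : S.adj v (S.t v x) := S.symm (S.t_adj' h)
theorem pred_adj {v x} (h : S.adj v x) : S.adj v (S.t x v) := S.t_adj (S.symm h)
/-- the predecessor of the successor -/
theorem t_pred_succ {v x} (h : S.adj v x) : S.t (S.t v x) v = x := S.t_rot' h
theorem t_succ_pred {v x} (h : S.adj v x) : S.t v (S.t x v) = x := S.t_rot (S.symm h)
theorem succ_inj {v x y} (h : S.adj v x) (h' : S.adj v y) (e : S.t v x = S.t v y) : x = y := by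
  rw [← S.t_pred_succ h, e, S.t_pred_succ h']
theorem iter_adj {v x} (h : S.adj v x) (k : ℕ) : S.adj v ((S.t v)^[k] x) := by
  induction k with
  | zero => exact h
  | succ k ih => rw [Function.iterate_succ_apply']; exact S.succ_adj ih

/-- induction around a vertex -/
theorem cyc_ind {v x y} (hx : S.adj v x) (hy : S.adj v y) (P : ℕ → Prop) (h0 : P x)
    (h : ∀ z, S.adj v z → P z → P (S.t v z)) : P y := by
  obtain ⟨k, rfl⟩ := S.cyc hx hy
  clear hy
  induction k with
  | zero => exact h0
  | succ k ih => rw [Function.iterate_succ_apply']; exact h _ (S.iter_adj hx k) ih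

theorem exists_cyc_pos {v x y} (hx : S.adj v x) (hy : S.adj v y) :
    ∃ k, (S.t v)^[k + 1] x = y := by
  obtain ⟨k, h⟩ := S.cyc (S.succ_adj hx) hy
  exact ⟨k, by rwa [Function.iterate_succ_apply]⟩

/-- the surface with the opposite orientation -/
def mirror : Surf where
  verts := S.verts
  adj := S.adj
  t u v := S.t v u
  symm := S.symm
  irr := S.irr
  mem := S.mem
  t_adj h := S.symm (S.t_adj' (S.symm h))
  t_rot h := S.t_rot' (S.symm h)
  t_ne h := S.t_ne (S.symm h)
  cyc {v x y} hx hy := by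
    obtain ⟨k, h⟩ := S.cyc hy hx
    refine ⟨k, ?_⟩
    subst h
    clear hx
    induction k generalizing y with
    | zero => rfl
    | succ k ih =>
      rw [Function.iterate_succ_apply' (S.t v), Function.iterate_succ_apply,
        S.t_pred_succ (S.iter_adj hy k), ih hy]
  conn := S.conn
  euler := S.euler

@[simp] theorem mirror_adj : S.mirror.adj = S.adj := rfl
@[simp] theorem mirror_t (u v : ℕ) : S.mirror.t u v = S.t v u := rfl
@[simp] theorem mirror_mirror : S.mirror.mirror = S := rfl

/-- cocycles modulo 2 -/
structure Coc (φ : ℕ → ℕ → ZMod 2) : Prop where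
  symm : ∀ {u v}, S.adj u v → φ u v = φ v u
  sum : ∀ {u v}, S.adj u v → φ u v + φ v (S.t u v) + φ (S.t u v) u = 0

theorem Coc.mirror {S : Surf} {φ} (h : S.Coc φ) : S.mirror.Coc φ where
  symm := h.symm
  sum {u v} e := by
    have e' : S.adj v u := S.symm e
    have := h.sum e'
    show φ u v + φ v (S.t v u) + φ (S.t v u) u = 0
    rw [h.symm e, h.symm (S.symm (S.t_adj' e')), h.symm (S.symm (S.t_adj e'))]
    rw [← this]; ring

theorem coc_mirror {φ} : S.mirror.Coc φ ↔ S.Coc φ :=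
  ⟨fun h => by simpa using h.mirror, fun h => h.mirror⟩

/-- A set of faces (a predicate on darts) is strongly connected. -/
def StrConn (B : ℕ → ℕ → Prop) : Prop :=
  ∀ Q : ℕ → ℕ → Prop,
    (∀ {u v}, S.adj u v → B u v → (Q u v ↔ Q v (S.t u v))) →
    (∀ {u v}, S.adj u v → B u v → B v u → (Q u v ↔ Q v u)) →
    ∀ {u v x y}, S.adj u v → S.adj x y → B u v → B x y → Q u v → Q x y

/-- A witness for a noncontractible separating cycle: a strongly connected set `B` of faces. -/
def Good : Prop :=
  ∃ B : ℕ → ℕ → Prop,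
    (∀ {u v}, S.adj u v → (B u v ↔ B v (S.t u v))) ∧ S.StrConn B ∧
    (∀ φ, S.Coc φ → ∃ h : ℕ → ZMod 2, ∀ {x y}, S.adj x y → B x y → ¬ B y x → φ x y = h x + h y) ∧
    (∃ φ, S.Coc φ ∧ (¬ ∃ h : ℕ → ZMod 2, ∀ {x y}, S.adj x y → φ x y = h x + h y) ∧
      ∃ h : ℕ → ZMod 2, ∀ {x y}, S.adj x y → B x y → φ x y = h x + h y) ∧
    (∃ ψ, S.Coc ψ ∧ ¬ ∃ h : ℕ → ℕ → ZMod 2,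
      (∀ {x y}, S.adj x y → B x y → B y x → h x (S.t y x) = h x y) ∧
      ∀ {x y}, S.adj x y → B x y → ψ x y = h x y + h y (S.t x y))

theorem Good.of_mirror {S : Surf} (h : S.mirror.Good) : S.Good := by
  obtain ⟨B, hB, hc, h1, ⟨φ, hφ, h2, k, h3⟩, ⟨ψ, hψ, h4⟩⟩ := h
  refine ⟨fun x y => B y x, ?_, ?_, ?_, ⟨φ, S.coc_mirror.1 hφ, h2, k, ?_⟩,
    ⟨ψ, S.coc_mirror.1 hψ, ?_⟩⟩
  · intro u v e
    have h := hB (u := S.t u v) (v := v) (S.symm (S.t_adj e))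
    rw [mirror_t, S.t_rot e] at h
    exact h.symm
  · intro Q q1 q2 u v x y e f b b' hQ
    refine hc (fun x y => Q y x) ?_ ?_ (u := v) (v := u) (x := y) (y := x) (S.symm e) (S.symm f)
      b b' hQ
    · intro u v e b
      have e' : S.adj v u := S.symm e
      have b' : B v (S.t v u) := (hB e).1 b
      have h := q1 (u := S.t v u) (v := v) (S.t_adj' e') b'
      rw [S.t_rot' e'] at h
      exact h.symm
    · intro u v e b b'
      exact q2 (S.symm e) b b'
  · intro φ hφ
    obtain ⟨h, hh⟩ := h1 φ hφ.mirror
    refine ⟨h, fun {x y} e b nb => ?_⟩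
    rw [hφ.symm e, hh (S.symm e) b nb, add_comm]
  · intro x y e b
    rw [hφ.symm e, h3 (S.symm e) b, add_comm]
  · rintro ⟨h, h5, h6⟩
    refine h4 ⟨fun x y => h x (S.t y x), fun {x y} e b b' => ?_, fun {x y} e b => ?_⟩
    · beta_reduce
      rw [mirror_t, S.t_pred_succ e, h5 e b' b]
    · beta_reduce
      rw [hψ.symm e, h6 (S.symm e) b, add_comm, mirror_t, S.t_pred_succ (S.symm e)]

end Surf
end NSC

namespace NSC
open Module
/-! ### Linear algebra modulo 2 -/
section LinAlg
variable {E : Type*} [Fintype E]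

/-- the dot product as a bilinear form -/
noncomputable def dotB (E : Type*) [Fintype E] : LinearMap.BilinForm (ZMod 2) (E → ZMod 2) :=
  dotProductBilin (ZMod 2) (ZMod 2)

theorem dotB_apply (x y : E → ZMod 2) : dotB E x y = ∑ e, x e * y e := rfl

theorem dotB_refl : (dotB E).IsRefl := by
  intro x y h
  rw [dotB_apply] at h ⊢
  simpa [mul_comm] using h

theorem dotB_nondeg : (dotB E).Nondegenerate := by
  classical
  refine (LinearMap.IsRefl.nondegenerate_iff_separatingLeft dotB_refl).2 ?_
  intro x h
  funext e
  have := h (Pi.single e 1)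
  simpa [dotB_apply, Pi.single_apply] using this

theorem finrank_add_le_of_orthogonal {X Y : Type*} [AddCommGroup X] [Module (ZMod 2) X]
    [FiniteDimensional (ZMod 2) X] [AddCommGroup Y] [Module (ZMod 2) Y]
    [FiniteDimensional (ZMod 2) Y] (A : X →ₗ[ZMod 2] E → ZMod 2) (B : Y →ₗ[ZMod 2] E → ZMod 2)
    (h : ∀ x y, ∑ e, A x e * B y e = 0) :
    finrank (ZMod 2) X + finrank (ZMod 2) Y ≤
      Fintype.card E + finrank (ZMod 2) (LinearMap.ker A) + finrank (ZMod 2) (LinearMap.ker B) := by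
  have h1 : LinearMap.range B ≤ (dotB E).orthogonal (LinearMap.range A) := by
    rintro _ ⟨y, rfl⟩ _ ⟨x, rfl⟩
    exact h x y
  have h2 := Submodule.finrank_mono h1
  rw [LinearMap.BilinForm.finrank_orthogonal dotB_nondeg] at h2
  have h3 := A.finrank_range_add_finrank_ker
  have h4 := B.finrank_range_add_finrank_ker
  have h5 := (LinearMap.range A).finrank_le
  simp only [finrank_fintype_fun_eq_card] at h2 h5
  omega

theorem exists_eq_of_orthogonal {X : Type*} [AddCommGroup X] [Module (ZMod 2) X]
    (A : X →ₗ[ZMod 2] E → ZMod 2) (z : E → ZMod 2)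
    (h : ∀ y : E → ZMod 2, (∀ x, ∑ e, A x e * y e = 0) → ∑ e, y e * z e = 0) : ∃ x, A x = z := by
  have : z ∈ (dotB E).orthogonal ((dotB E).orthogonal (LinearMap.range A)) := by
    intro y hy
    exact h y fun x => hy _ ⟨x, rfl⟩
  rwa [LinearMap.BilinForm.orthogonal_orthogonal dotB_nondeg dotB_refl] at this

theorem finrank_ker_le {X : Type*} [AddCommGroup X] [Module (ZMod 2) X]
    [FiniteDimensional (ZMod 2) X] {Y : Type*} [AddCommGroup Y] [Module (ZMod 2) Y]
    (A : X →ₗ[ZMod 2] Y) {r : ℕ} (f : X →ₗ[ZMod 2] Fin r → ZMod 2)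
    (h : ∀ x, A x = 0 → f x = 0 → x = 0) : finrank (ZMod 2) (LinearMap.ker A) ≤ r := by
  have := LinearMap.finrank_le_finrank_of_injective (f := f ∘ₗ (LinearMap.ker A).subtype) (by
    rw [← LinearMap.ker_eq_bot, LinearMap.ker_eq_bot']
    rintro ⟨x, hx⟩ h'
    exact Subtype.ext (h x hx h'))
  simpa using this

end LinAlg

theorem z2 (x : ZMod 2) : x + x = 0 := CharTwo.add_self_eq_zero x
theorem z2_eq {x y : ZMod 2} : x + y = 0 ↔ x = y := CharTwo.add_eq_zero

namespace Surf
open scoped Classical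
variable (S : Surf)

noncomputable def darts : Finset (ℕ × ℕ) := (S.verts ×ˢ S.verts).filter fun d => S.adj d.1 d.2

theorem mem_darts {d : ℕ × ℕ} : d ∈ S.darts ↔ S.adj d.1 d.2 := by
  simp only [darts, Finset.mem_filter, Finset.mem_product]
  exact ⟨fun h => h.2, fun h => ⟨⟨S.mem h, S.mem' h⟩, h⟩⟩

theorem card_darts : S.darts.card = 6 * S.verts.card + 12 := by
  rw [← S.euler, darts]

/-- next dart around a face -/
def rho (d : ℕ × ℕ) : ℕ × ℕ := (d.2, S.t d.1 d.2)

theorem rho_mem {d} (h : d ∈ S.darts) : S.rho d ∈ S.darts := by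
  rw [mem_darts] at *; exact S.t_adj h

theorem rho3 {d} (h : d ∈ S.darts) : S.rho (S.rho (S.rho d)) = d := by
  rw [mem_darts] at h
  simp only [rho, S.t_rot h, S.t_rot' h]

theorem sum_rho {M : Type*} [AddCommMonoid M] (f : ℕ × ℕ → M) :
    ∑ d ∈ S.darts, f (S.rho d) = ∑ d ∈ S.darts, f d :=
  Finset.sum_bij' (fun d _ => S.rho d) (fun d _ => S.rho (S.rho d)) (fun _ h => S.rho_mem h)
    (fun _ h => S.rho_mem (S.rho_mem h)) (fun _ h => S.rho3 h) (fun _ h => S.rho3 h)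
    (fun _ _ => rfl)

/-- canonical dart of a face -/
noncomputable def rep (d : ℕ × ℕ) : ℕ × ℕ :=
  if d.1 < d.2 ∧ d.1 < S.t d.1 d.2 then d
  else if d.2 < d.1 ∧ d.2 < S.t d.1 d.2 then S.rho d else S.rho (S.rho d)

theorem rep_rho {d} (h : d ∈ S.darts) : S.rep (S.rho d) = S.rep d := by
  have h3 := S.rho3 h
  rw [mem_darts] at h
  have h1 := S.ne h
  have h2 := S.ne (S.t_adj h)
  have h4 := S.ne (S.t_adj' h)
  have e1 : S.t (S.rho d).1 (S.rho d).2 = d.1 := S.t_rot h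
  have e2 : (S.rho d).1 = d.2 := rfl
  have e3 : (S.rho d).2 = S.t d.1 d.2 := rfl
  unfold rep
  rw [e1, e2, e3, h3]
  split_ifs <;> first | rfl | (exfalso; omega)

theorem rep_mem {d} (h : d ∈ S.darts) : S.rep d ∈ S.darts := by
  unfold rep
  split_ifs
  exacts [h, S.rho_mem h, S.rho_mem (S.rho_mem h)]

theorem rep_cases (d) : S.rep d = d ∨ S.rep d = S.rho d ∨ S.rep d = S.rho (S.rho d) := by
  unfold rep
  split_ifs <;> simp

theorem eq_of_rep {d} (h : d ∈ S.darts) :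
    d = S.rep d ∨ d = S.rho (S.rep d) ∨ d = S.rho (S.rho (S.rep d)) := by
  have h3 := S.rho3 h
  rcases S.rep_cases d with e | e | e <;> rw [e]
  · simp
  · rw [h3]; simp
  · rw [h3]; simp

theorem rep_rep {d} (h : d ∈ S.darts) : S.rep (S.rep d) = S.rep d := by
  rcases S.rep_cases d with e | e | e
  · rw [e, e]
  · conv_lhs => rw [e]
    exact S.rep_rho h
  · conv_lhs => rw [e]
    rw [S.rep_rho (S.rho_mem h), S.rep_rho h]

noncomputable def faces : Finset (ℕ × ℕ) := S.darts.image S.rep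

theorem rep_mem_faces {d} (h : d ∈ S.darts) : S.rep d ∈ S.faces := Finset.mem_image_of_mem _ h

theorem faces_sub {d} (h : d ∈ S.faces) : d ∈ S.darts ∧ S.rep d = d := by
  obtain ⟨e, he, rfl⟩ := Finset.mem_image.1 h
  exact ⟨S.rep_mem he, S.rep_rep he⟩

theorem card_faces : 3 * S.faces.card = S.darts.card := by
  rw [Finset.card_eq_sum_card_fiberwise (f := S.rep) (t := S.faces)
    (fun d h => S.rep_mem_faces h), Finset.sum_const_nat (m := 3), mul_comm]
  intro f hf
  obtain ⟨hf, hr⟩ := S.faces_sub hf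
  have : S.darts.filter (fun d => S.rep d = f) = {f, S.rho f, S.rho (S.rho f)} := by
    ext d
    simp only [Finset.mem_filter, Finset.mem_insert, Finset.mem_singleton]
    constructor
    · rintro ⟨h, rfl⟩
      exact S.eq_of_rep h
    · rintro (rfl | rfl | rfl)
      · exact ⟨hf, hr⟩
      · exact ⟨S.rho_mem hf, by rw [S.rep_rho hf, hr]⟩
      · exact ⟨S.rho_mem (S.rho_mem hf), by rw [S.rep_rho (S.rho_mem hf), S.rep_rho hf, hr]⟩
  rw [this]
  rw [mem_darts] at hf
  have h1 := S.ne hf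
  have h2 := S.ne (S.t_adj hf)
  have h4 := S.ne (S.t_adj' hf)
  rw [Finset.card_eq_three]
  refine ⟨_, _, _, ?_, ?_, ?_, rfl⟩ <;> (intro e; simp only [rho, Prod.ext_iff] at e; omega)

/-- edges outside a symmetric set of darts, oriented upwards -/
noncomputable def upE (G : ℕ → ℕ → Prop) : Finset (ℕ × ℕ) :=
  S.darts.filter fun d => ¬ G d.1 d.2 ∧ d.1 < d.2

theorem sum_upE {M : Type*} [AddCommMonoid M] {G : ℕ → ℕ → Prop} (hG : ∀ u v, G u v → G v u)
    (f : ℕ × ℕ → M) : ∑ d ∈ S.darts.filter (fun d => ¬ G d.1 d.2), f d =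
      ∑ d ∈ S.upE G, (f d + f d.swap) := by
  rw [Finset.sum_add_distrib, ← Finset.sum_filter_add_sum_filter_not _ (fun d => d.1 < d.2),
    Finset.filter_filter, Finset.filter_filter]
  congr 1
  refine Finset.sum_bij' (fun d _ => d.swap) (fun d _ => d.swap) ?_ ?_ ?_ ?_ ?_
  · intro d hd
    simp only [Finset.mem_filter, upE, mem_darts, Prod.fst_swap, Prod.snd_swap] at hd ⊢
    have := S.ne hd.1
    exact ⟨S.symm hd.1, fun g => hd.2.1 (hG _ _ g), by omega⟩
  · intro d hd
    simp only [Finset.mem_filter, upE, mem_darts, Prod.fst_swap, Prod.snd_swap] at hd ⊢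
    have := S.ne hd.1
    exact ⟨S.symm hd.1, fun g => hd.2.1 (hG _ _ g), by omega⟩
  all_goals simp

theorem card_upE {G : ℕ → ℕ → Prop} (hG : ∀ u v, G u v → G v u) :
    2 * (S.upE G).card = (S.darts.filter fun d => ¬ G d.1 d.2).card := by
  have := S.sum_upE hG (fun _ => 1)
  simp only [Finset.sum_const, smul_eq_mul, mul_one] at this
  omega

end Surf
end NSC

namespace NSC
open Module
namespace Surf
open scoped Classical
variable (S : Surf)

/-- the symmetric function with the given values on upward darts -/
def ofUp (f : ℕ × ℕ → ZMod 2) (a b : ℕ) : ZMod 2 := if a < b then f (a, b) else f (b, a)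

theorem ofUp_symm (f : ℕ × ℕ → ZMod 2) (a b : ℕ) (h : a ≠ b) : ofUp f a b = ofUp f b a := by
  unfold ofUp
  split_ifs <;> first | rfl | (exfalso; omega)

theorem verts_nonempty : S.verts.Nonempty := by
  by_contra h
  rw [Finset.not_nonempty_iff_eq_empty] at h
  have := S.card_darts
  rw [darts, h] at this
  simp at this

theorem upE_false : 2 * (S.upE fun _ _ => False).card = S.darts.card := by
  rw [S.card_upE (by simp)]; simp

/-- a nontrivial cocycle killed by two given functionals -/
theorem exists_coc (g1 g2 : (ℕ → ℕ → ZMod 2) →ₗ[ZMod 2] ZMod 2) :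
    ∃ φ, S.Coc φ ∧ (¬ ∃ h : ℕ → ZMod 2, ∀ {x y}, S.adj x y → φ x y = h x + h y) ∧
      g1 φ = 0 ∧ g2 φ = 0 := by
  set E := S.upE fun _ _ => False with hE
  have hEm : ∀ d, d ∈ E ↔ S.adj d.1 d.2 ∧ d.1 < d.2 := by
    intro d; simp [hE, upE, mem_darts]
  let ext : (E → ZMod 2) →ₗ[ZMod 2] (ℕ → ℕ → ZMod 2) :=
    { toFun := fun f => ofUp fun d => if h : d ∈ E then f ⟨d, h⟩ else 0
      map_add' := by
        intro f g; funext a b; simp only [ofUp, Pi.add_apply]; split_ifs <;> simp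
      map_smul' := by
        intro c f; funext a b; simp only [ofUp, Pi.smul_apply, RingHom.id_apply]
        split_ifs <;> simp }
  let cob : (ℕ → ℕ → ZMod 2) →ₗ[ZMod 2] (S.faces → ZMod 2) :=
    { toFun := fun φ d => φ d.1.1 d.1.2 + φ d.1.2 (S.t d.1.1 d.1.2) + φ (S.t d.1.1 d.1.2) d.1.1
      map_add' := by intro f g; funext d; simp only [Pi.add_apply]; ring
      map_smul' := by
        intro c f; funext d; simp only [Pi.smul_apply, RingHom.id_apply, smul_eq_mul]; ring }
  let Θ : (E → ZMod 2) →ₗ[ZMod 2] (S.faces → ZMod 2) × ZMod 2 × ZMod 2 :=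
    ((cob.prod (g1.prod g2)) ∘ₗ ext)
  let δ : (S.verts → ZMod 2) →ₗ[ZMod 2] (E → ZMod 2) :=
    { toFun := fun h e => h ⟨e.1.1, S.mem ((hEm _).1 e.2).1⟩ + h ⟨e.1.2, S.mem' ((hEm _).1 e.2).1⟩
      map_add' := by intro f g; funext d; simp only [Pi.add_apply]; ring
      map_smul' := by
        intro c f; funext d; simp only [Pi.smul_apply, RingHom.id_apply, smul_eq_mul]; ring }
  have key : ¬ LinearMap.ker Θ ≤ LinearMap.range δ := by
    intro hle
    have h1 := Submodule.finrank_mono hle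
    have h2 := Θ.finrank_range_add_finrank_ker
    have h3 := (LinearMap.range Θ).finrank_le
    have h4 := δ.finrank_range_add_finrank_ker
    have h5 : 0 < finrank (ZMod 2) (LinearMap.ker δ) := by
      rw [Module.finrank_pos_iff_exists_ne_zero]
      refine ⟨⟨fun _ => 1, ?_⟩, ?_⟩
      · rw [LinearMap.mem_ker]; funext e; exact z2 1
      · intro h
        obtain ⟨v, hv⟩ := S.verts_nonempty
        have := congrFun (congrArg Subtype.val h) ⟨v, hv⟩
        exact one_ne_zero this
    simp only [finrank_prod, finrank_fintype_fun_eq_card, Fintype.card_coe, finrank_self] at h2 h3 h4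
    have h6 := S.upE_false
    rw [← hE] at h6
    have := S.card_faces
    have := S.card_darts
    omega
  rw [SetLike.not_le_iff_exists] at key
  obtain ⟨f, hf, hn⟩ := key
  rw [LinearMap.mem_ker] at hf
  have hf' : cob (ext f) = 0 ∧ g1 (ext f) = 0 ∧ g2 (ext f) = 0 := by
    simpa [Θ, Prod.ext_iff] using hf
  have hsymm : ∀ {u v}, S.adj u v → ext f u v = ext f v u := fun h =>
    ofUp_symm (fun d => if h : d ∈ E then f ⟨d, h⟩ else 0) _ _ (S.ne h)
  refine ⟨ext f, ⟨hsymm, ?_⟩, ?_, hf'.2.1, hf'.2.2⟩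
  · intro u v h
    have hd : (u, v) ∈ S.darts := (S.mem_darts).2 h
    have := congrFun hf'.1 ⟨_, S.rep_mem_faces hd⟩
    simp only [cob, LinearMap.coe_mk, AddHom.coe_mk, Pi.zero_apply] at this
    rcases S.rep_cases (u, v) with e | e | e <;> rw [e] at this <;>
      simp only [rho, S.t_rot h, S.t_rot' h] at this <;> rw [← this] <;> ring
  · rintro ⟨h, hh⟩
    refine hn ⟨fun v => h v, ?_⟩
    funext ⟨e, he⟩
    have h1 := (hEm _).1 he
    have := hh h1.1
    simp only [δ, LinearMap.coe_mk, AddHom.coe_mk]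
    rw [← this]
    simp only [ext, LinearMap.coe_mk, AddHom.coe_mk, ofUp, if_pos h1.2, dif_pos he]

/-- Handle data: the potentials of flags `(v, x)` at the vertices of the handle. -/
structure Handle where
  V : ℕ → Prop
  K : ℕ → ℕ → Prop
  s : ℕ → ℕ → Prop
  p : (ℕ → ℕ → ZMod 2) → ℕ → ℕ → ZMod 2
  g1 : (ℕ → ℕ → ZMod 2) →ₗ[ZMod 2] ZMod 2
  g2 : (ℕ → ℕ → ZMod 2) →ₗ[ZMod 2] ZMod 2
  ψ : ℕ → ℕ → ZMod 2
  Ksymm : ∀ {u v}, K u v → K v u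
  KV : ∀ {u v}, K u v → V u
  sV : ∀ {u v}, s u v → V u
  s1 : ∀ {v x}, S.adj v x → V v → ¬ K v x → (s v x ↔ s v (S.t x v))
  p1 : ∀ {φ v x}, S.Coc φ → S.adj v x → V v → ¬ K v x → p φ v x = p φ v (S.t x v)
  p2 : ∀ {φ v w}, S.Coc φ → S.adj v w → K v w → φ v w = p φ v w + p φ w (S.t v w)
  p3 : ∀ {φ v x y}, S.Coc φ → S.adj v x → S.adj v y → V v → ¬ s v x → ¬ s v y → p φ v x = p φ v y
  p4 : ∀ {φ u v}, S.Coc φ → S.adj u v → V u → V v → ¬ K u v → (s u v ∨ s v u) →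
    φ u v = p φ u v + p φ v u
  p5 : ∀ {φ u v x}, S.Coc φ → S.adj u x → S.adj v x → ¬ V x → s u x → s v x →
    φ u x + φ v x = p φ u x + p φ v x
  p8 : ∀ {φ v x y}, S.Coc φ → g1 φ = 0 → g2 φ = 0 → S.adj v x → S.adj v y → V v →
    p φ v x = p φ v y
  conn : ∀ Q : ℕ → ℕ → Prop,
    (∀ {u v}, S.adj u v → (s u v ∨ s v (S.t u v) ∨ s (S.t u v) u) → (Q u v ↔ Q v (S.t u v))) →
    (∀ {u v}, S.adj u v → (s u v ∨ s v (S.t u v) ∨ s (S.t u v) u) →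
      (s v u ∨ s u (S.t v u) ∨ s (S.t v u) v) → (Q u v ↔ Q v u)) →
    ∀ {u v x y}, S.adj u v → S.adj x y → s u v → s x y → Q u v → Q x y
  coc : S.Coc ψ
  dual : ¬ ∃ h : ℕ → ℕ → ZMod 2,
    (∀ {x y}, S.adj x y → (s x y ∨ s y (S.t x y) ∨ s (S.t x y) x) →
      (s y x ∨ s x (S.t y x) ∨ s (S.t y x) y) → h x (S.t y x) = h x y) ∧
    ∀ {x y}, S.adj x y → (s x y ∨ s y (S.t x y) ∨ s (S.t x y) x) → ψ x y = h x y + h y (S.t x y)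

namespace Handle
variable {S} (H : S.Handle)

/-- the faces with a starred flag -/
def B (x y : ℕ) : Prop := H.s x y ∨ H.s y (S.t x y) ∨ H.s (S.t x y) x

theorem B_rot {u v} (h : S.adj u v) : H.B u v ↔ H.B v (S.t u v) := by
  unfold B; rw [S.t_rot h]; tauto

theorem B_conn : S.StrConn H.B := by
  intro Q q1 q2
  have key : ∀ {u v}, S.adj u v → H.B u v → ∃ x y, S.adj x y ∧ H.s x y ∧ (Q u v ↔ Q x y) := by
    intro u v h b
    have e1 := q1 h b
    have e2 := q1 (S.t_adj h) ((H.B_rot h).1 b)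
    rw [S.t_rot h] at e2
    rcases b with b | b | b
    · exact ⟨_, _, h, b, Iff.rfl⟩
    · exact ⟨_, _, S.t_adj h, b, e1⟩
    · exact ⟨_, _, S.t_adj' h, b, e1.trans e2⟩
  intro u v x y h h' b b' q
  obtain ⟨a, c, h1, s1, i1⟩ := key h b
  obtain ⟨a', c', h2, s2, i2⟩ := key h' b'
  exact i2.2 (H.conn Q (fun h b => q1 h b) (fun h b b' => q2 h b b') h1 h2 s1 s2 (i1.1 q))

section
variable {φ : ℕ → ℕ → ZMod 2} (hφ : S.Coc φ)

/-- potential of an edge with a starred end in the left face -/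
theorem edge_star {u v} (h : S.adj u v) (hu : H.V u) (hv : H.V v)
    (hs : H.s u v ∨ H.s v (S.t u v)) (hφ : S.Coc φ) :
    φ u v = H.p φ u v + H.p φ v (S.t u v) := by
  by_cases hK : H.K u v
  · exact H.p2 hφ h hK
  · have hK' : ¬ H.K v u := fun k => hK (H.Ksymm k)
    rw [← H.p1 hφ (S.symm h) hv hK']
    exact H.p4 hφ h hu hv hK (hs.imp_right (H.s1 (S.symm h) hv hK').2)

open scoped Classical in
/-- potential of a vertex off the handle -/
noncomputable def hh (φ : ℕ → ℕ → ZMod 2) (x : ℕ) : ZMod 2 :=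
  if h : ∃ v, S.adj v x ∧ H.s v x then H.p φ h.choose x + φ h.choose x else 0

theorem hh_eq (hφ : S.Coc φ) {v x} (h : S.adj v x) (hs : H.s v x) (hx : ¬ H.V x) :
    φ v x = H.p φ v x + H.hh φ x := by
  have h' : ∃ v, S.adj v x ∧ H.s v x := ⟨v, h, hs⟩
  have h1 := h'.choose_spec
  rw [hh, dif_pos h']
  have := H.p5 hφ h h1.1 hx hs h1.2
  have e := z2 (φ h'.choose x)
  linear_combination this - e

open scoped Classical in
/-- corner potential: `w` is the next vertex after `v` around the face -/
noncomputable def P (φ : ℕ → ℕ → ZMod 2) (v w : ℕ) : ZMod 2 :=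
  if H.V v then H.p φ v w else H.hh φ v

theorem edge_one (hφ : S.Coc φ) {u v} (h : S.adj u v) (hs : H.s u v ∨ H.s v (S.t u v)) :
    φ u v = H.P φ u v + H.P φ v (S.t u v) := by
  unfold P
  have hv' : S.adj v u := S.symm h
  by_cases hu : H.V u <;> by_cases hv : H.V v <;> simp only [hu, hv, if_true, if_false]
  · exact H.edge_star h hu hv hs hφ
  · have := hs.resolve_right fun k => hv (H.sV k)
    exact H.hh_eq hφ h this hv
  · have h1 := hs.resolve_left fun k => hu (H.sV k)
    have hK : ¬ H.K v u := fun k => hu (H.KV (H.Ksymm k))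
    rw [hφ.symm h, H.hh_eq hφ hv' ((H.s1 hv' hv hK).2 h1) hu, H.p1 hφ hv' hv hK, add_comm]
  · rcases hs with k | k
    exacts [absurd (H.sV k) hu, absurd (H.sV k) hv]

theorem edge_B (hφ : S.Coc φ) {u v} (h : S.adj u v) (hs : H.B u v) :
    φ u v = H.P φ u v + H.P φ v (S.t u v) := by
  by_cases h1 : H.s u v ∨ H.s v (S.t u v)
  · exact H.edge_one hφ h h1
  · have h2 : H.s (S.t u v) u := by unfold B at hs; tauto
    have e1 := H.edge_one hφ (S.t_adj h) (by rw [S.t_rot h]; exact Or.inr h2)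
    have e2 := H.edge_one hφ (S.t_adj' h) (Or.inl h2)
    rw [S.t_rot h] at e1
    rw [S.t_rot' h] at e2
    have := hφ.sum h
    have := z2 (H.P φ v (S.t u v))
    have := z2 (H.P φ u v)
    have := z2 (H.P φ (S.t u v) u)
    linear_combination (hφ.sum h) - e1 - e2 - z2 (H.P φ v (S.t u v)) - z2 (H.P φ u v) -
      z2 (H.P φ (S.t u v) u)

end

theorem good (H : S.Handle) : S.Good := by
  refine ⟨H.B, H.B_rot, H.B_conn, ?_, ?_, ⟨H.ψ, H.coc, H.dual⟩⟩
  · intro φ hφ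
    refine ⟨fun v => if h : ∃ w, S.adj v w ∧ H.V v ∧ ¬ H.s v w then H.p φ v h.choose
      else H.hh φ v, ?_⟩
    intro x y h b nb
    have hk : ∀ {v w}, S.adj v w → ¬ H.s v w →
        (if h : ∃ w, S.adj v w ∧ H.V v ∧ ¬ H.s v w then H.p φ v h.choose else H.hh φ v) =
          H.P φ v w := by
      intro v w h hs
      unfold P
      by_cases hv : H.V v
      · have h' : ∃ w, S.adj v w ∧ H.V v ∧ ¬ H.s v w := ⟨w, h, hv, hs⟩
        rw [dif_pos h', if_pos hv]
        exact H.p3 hφ h'.choose_spec.1 h hv h'.choose_spec.2.2 hs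
      · rw [dif_neg (by tauto), if_neg hv]
    have h' := S.symm h
    have n1 : ¬ H.s y x := fun k => nb (Or.inl k)
    have n2 : ¬ H.s x (S.t y x) := fun k => nb (Or.inr (Or.inl k))
    beta_reduce
    rw [hk h' n1, hk (S.t_adj h') n2]
    by_cases hK : H.K x y
    · unfold P
      rw [if_pos (H.KV hK), if_pos (H.KV (H.Ksymm hK)), hφ.symm h, H.p2 hφ h' (H.Ksymm hK),
        add_comm]
    · have hK' : ¬ H.K y x := fun k => hK (H.Ksymm k)
      rw [H.edge_B hφ h b]
      congr 1 <;> unfold P <;> split_ifs with hv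
      · exact H.p1 hφ h hv hK
      · rfl
      · exact (H.p1 hφ h' hv hK').symm
      · rfl
  · obtain ⟨φ, hφ, hn, e1, e2⟩ := S.exists_coc H.g1 H.g2
    refine ⟨φ, hφ, hn, ?_⟩
    refine ⟨fun v => if h : ∃ w, S.adj v w ∧ H.V v then H.p φ v h.choose else H.hh φ v, ?_⟩
    intro x y h b
    have hk : ∀ {v w}, S.adj v w →
        (if h : ∃ w, S.adj v w ∧ H.V v then H.p φ v h.choose else H.hh φ v) =
          H.P φ v w := by
      intro v w h
      unfold P
      by_cases hv : H.V v
      · have h' : ∃ w, S.adj v w ∧ H.V v := ⟨w, h, hv⟩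
        rw [dif_pos h', if_pos hv]
        exact H.p8 hφ e1 e2 h'.choose_spec.1 h hv
      · rw [dif_neg (by tauto), if_neg hv]
    beta_reduce
    rw [hk h, hk (S.t_adj h)]
    exact H.edge_B hφ h b

end Handle
end Surf
end NSC

namespace NSC
open Module
namespace Surf
variable (S : Surf)

/-- symmetric sets of darts -/
structure IsSub (G : ℕ → ℕ → Prop) : Prop where
  adj : ∀ {u v}, G u v → S.adj u v
  symm : ∀ {u v}, G u v → G v u

/-- `x` lies in the corner at `v` starting with the neighbour `w` -/
def InC (G : ℕ → ℕ → Prop) (v w x : ℕ) : Prop :=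
  G v w ∧ ∃ k, (S.t v)^[k] w = x ∧ ∀ j, 0 < j → j ≤ k → ¬ G v ((S.t v)^[j] w)

/-- `y` is the neighbour of `v` following `w` in the subgraph -/
def Nx (G : ℕ → ℕ → Prop) (v w y : ℕ) : Prop := ∃ x, S.InC G v w x ∧ S.t v x = y ∧ G v y

/-- faces joined across edges outside the subgraph -/
inductive FR (G : ℕ → ℕ → Prop) : ℕ × ℕ → ℕ × ℕ → Prop
  | refl (d) : FR G d d
  | symm {d e} : FR G d e → FR G e d
  | trans {d e f} : FR G d e → FR G e f → FR G d f
  | rot {u v} : S.adj u v → FR G (u, v) (v, S.t u v)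
  | swap {u v} : S.adj u v → ¬ G u v → FR G (u, v) (v, u)

variable {S} {G : ℕ → ℕ → Prop}

theorem InC.self {v w} (h : G v w) : S.InC G v w w :=
  ⟨h, 0, rfl, fun j h1 h2 => by omega⟩

theorem InC.adj (hG : S.IsSub G) {v w x} (h : S.InC G v w x) : S.adj v x := by
  obtain ⟨h, k, rfl, -⟩ := h
  exact S.iter_adj (hG.adj h) k

theorem InC.step {v w x} (h : S.InC G v w x) (hn : ¬ G v (S.t v x)) : S.InC G v w (S.t v x) := by
  obtain ⟨h, k, rfl, hk⟩ := h
  refine ⟨h, k + 1, Function.iterate_succ_apply' _ _ _, fun j h1 h2 => ?_⟩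
  rcases Nat.lt_or_ge k j with h3 | h3
  · obtain rfl : j = k + 1 := by omega
    rwa [Function.iterate_succ_apply']
  · exact hk j h1 h3

theorem InC.cases {v w x} (h : S.InC G v w x) :
    x = w ∨ ∃ y, S.InC G v w y ∧ x = S.t v y ∧ ¬ G v x := by
  obtain ⟨h, k, rfl, hk⟩ := h
  cases k with
  | zero => exact Or.inl rfl
  | succ k =>
    refine Or.inr ⟨_, ⟨h, k, rfl, fun j h1 h2 => hk j h1 (by omega)⟩,
      Function.iterate_succ_apply' _ _ _, hk _ (by omega) le_rfl⟩

theorem InC.induct {v w x} (h : S.InC G v w x) {P : ℕ → Prop} (h0 : P w)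
    (h1 : ∀ y, S.InC G v w y → P y → ¬ G v (S.t v y) → P (S.t v y)) : P x := by
  obtain ⟨h, k, rfl, hk⟩ := h
  induction k with
  | zero => exact h0
  | succ k ih =>
    rw [Function.iterate_succ_apply']
    refine h1 _ ⟨h, k, rfl, fun j h1 h2 => hk j h1 (by omega)⟩
      (ih fun j h1 h2 => hk j h1 (by omega)) ?_
    have := hk (k + 1) (by omega) le_rfl
    rwa [Function.iterate_succ_apply'] at this

theorem InC.eq_of_mem {v w x} (h : S.InC G v w x) (hx : G v x) : w = x := by
  rcases h.cases with h | ⟨y, -, -, h⟩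
  exacts [h.symm, absurd hx h]

theorem InC.unique (hG : S.IsSub G) {v w w' x} (h : S.InC G v w x) (h' : S.InC G v w' x) :
    w = w' := by
  revert h'
  refine h.induct (P := fun x => S.InC G v w' x → w = w') (fun h' => (h'.eq_of_mem h.1).symm) ?_
  intro y hy ih hn h'
  rcases h'.cases with e | ⟨z, hz, e, -⟩
  · rw [e] at hn; exact absurd h'.1 hn
  · rw [S.succ_inj (hy.adj hG) (hz.adj hG) e] at ih
    exact ih hz

theorem InC.exists (hG : S.IsSub G) {v w x} (h : G v w) (hx : S.adj v x) : ∃ w', S.InC G v w' x := by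
  refine S.cyc_ind (hG.adj h) hx (fun x => ∃ w', S.InC G v w' x) ⟨w, InC.self h⟩ ?_
  rintro z - ⟨w', h'⟩
  by_cases hz : G v (S.t v z)
  · exact ⟨_, InC.self hz⟩
  · exact ⟨_, h'.step hz⟩

theorem Nx.exists (hG : S.IsSub G) {v w} (h : G v w) : ∃ y, S.Nx G v w y := by
  by_contra hn
  have h1 : ∀ z, S.InC G v w z → ¬ G v (S.t v z) := fun z hz hg => hn ⟨_, z, hz, rfl, hg⟩
  obtain ⟨k, hk⟩ := S.exists_cyc_pos (hG.adj h) (hG.adj h)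
  have h2 : ∀ k, S.InC G v w ((S.t v)^[k] w) := by
    intro k
    induction k with
    | zero => exact InC.self h
    | succ k ih => rw [Function.iterate_succ_apply']; exact ih.step (h1 _ ih)
  have := h1 _ (h2 k)
  rw [Function.iterate_succ_apply'] at hk
  rw [hk] at this
  exact this h

theorem Nx.unique {v w y y'} (h : S.Nx G v w y) (h' : S.Nx G v w y') : y = y' := by
  obtain ⟨x, ⟨-, k, rfl, hk⟩, rfl, hy⟩ := h
  obtain ⟨x', ⟨-, k', rfl, hk'⟩, rfl, hy'⟩ := h'
  rw [← Function.iterate_succ_apply' (S.t v)] at hy hy' ⊢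
  rcases lt_trichotomy k k' with h | h | h
  · exact absurd hy (hk' _ (by omega) (by omega))
  · rw [h, Function.iterate_succ_apply']
  · exact absurd hy' (hk _ (by omega) (by omega))

theorem Nx.inj (hG : S.IsSub G) {v w w' y} (h : S.Nx G v w y) (h' : S.Nx G v w' y) : w = w' := by
  obtain ⟨x, hx, rfl, -⟩ := h
  obtain ⟨x', hx', e, -⟩ := h'
  rw [S.succ_inj (hx'.adj hG) (hx.adj hG) e] at hx'
  exact hx.unique hG hx'

theorem Nx.left {v w y} (h : S.Nx G v w y) : G v w := by
  obtain ⟨x, hx, -⟩ := h; exact hx.1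

theorem Nx.right {v w y} (h : S.Nx G v w y) : G v y := by
  obtain ⟨x, -, -, hx⟩ := h; exact hx

/-- the corner preceding a dart of the subgraph -/
theorem Nx.of_pred (hG : S.IsSub G) {v w y} (hy : G v y) (h : S.InC G v w (S.t y v)) :
    S.Nx G v w y := ⟨_, h, S.t_succ_pred (hG.adj hy), hy⟩

theorem Nx.pred (hG : S.IsSub G) {v w y} (h : S.Nx G v w y) : S.InC G v w (S.t y v) := by
  obtain ⟨x, hx, rfl, -⟩ := h
  rwa [S.t_pred_succ (hx.adj hG)]

theorem FR.two {v x} (h : S.adj v x) : S.FR G (v, x) (S.t v x, v) := by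
  have := (FR.rot (G := G) h).trans (FR.rot (S.t_adj h))
  rwa [S.t_rot h] at this

theorem FR.flag (hG : S.IsSub G) {v w x} (h : S.InC G v w x) : S.FR G (v, w) (v, x) := by
  refine h.induct (P := fun x => S.FR G (v, w) (v, x)) (FR.refl _) ?_
  intro y hy ih hn
  have h1 := hy.adj hG
  exact ih.trans ((FR.two h1).trans (FR.swap (S.t_adj' h1) fun g => hn (hG.symm g)))

theorem FR.of_nx (hG : S.IsSub G) {v w y} (h : S.Nx G v w y) : S.FR G (v, w) (y, v) := by
  obtain ⟨x, hx, rfl, -⟩ := h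
  exact (FR.flag hG hx).trans (FR.two (hx.adj hG))

/-- functions invariant under the generating moves are invariant -/
theorem FR.lift {α : Sort*} (u : ℕ × ℕ → α) (h1 : ∀ {a b}, S.adj a b → u (a, b) = u (b, S.t a b))
    (h2 : ∀ {a b}, S.adj a b → ¬ G a b → u (a, b) = u (b, a)) {d e} (h : S.FR G d e) :
    u d = u e := by
  induction h with
  | refl => rfl
  | symm _ ih => exact ih.symm
  | trans _ _ ih ih' => exact ih.trans ih'
  | rot h => exact h1 h
  | swap h h' => exact h2 h h'

theorem FR.mono {G' : ℕ → ℕ → Prop} (hs : ∀ {u v}, G u v → G' u v) {d e} (h : S.FR G' d e) :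
    S.FR G d e := by
  induction h with
  | refl => exact .refl _
  | symm _ ih => exact ih.symm
  | trans _ _ ih ih' => exact ih.trans ih'
  | rot h => exact .rot h
  | swap h h' => exact .swap h fun g => h' (hs g)

/-- adding one edge to the subgraph -/
theorem FR.insert {G' : ℕ → ℕ → Prop} {p q : ℕ}
    (hs : ∀ {u v}, G' u v → G u v ∨ (u = p ∧ v = q) ∨ (u = q ∧ v = p)) {d e}
    (h : S.FR G d e) : S.FR G' d e ∨ (S.FR G' d (p, q) ∧ S.FR G' (q, p) e) ∨
      (S.FR G' d (q, p) ∧ S.FR G' (p, q) e) := by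
  induction h with
  | refl => exact Or.inl (.refl _)
  | symm _ ih =>
    rcases ih with h | ⟨h, h'⟩ | ⟨h, h'⟩
    exacts [Or.inl h.symm, Or.inr (Or.inr ⟨h'.symm, h.symm⟩), Or.inr (Or.inl ⟨h'.symm, h.symm⟩)]
  | trans _ _ ih ih' =>
    rcases ih with h | ⟨h, h'⟩ | ⟨h, h'⟩ <;> rcases ih' with k | ⟨k, k'⟩ | ⟨k, k'⟩ <;>
      grind [FR.symm, FR.trans]
  | rot h => exact Or.inl (.rot h)
  | @swap u v h h' =>
    by_cases hg : G' u v
    · rcases hs hg with g | ⟨rfl, rfl⟩ | ⟨rfl, rfl⟩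
      · exact absurd g h'
      · exact Or.inr (Or.inl ⟨.refl _, .refl _⟩)
      · exact Or.inr (Or.inr ⟨.refl _, .refl _⟩)
    · exact Or.inl (.swap h hg)

/-- every face is joined to the left face of a dart of the subgraph -/
theorem FR.cover (hG : S.IsSub G) {p q} (h0 : G p q) {v x} (h : S.adj v x) :
    ∃ a b, G a b ∧ S.FR G (a, b) (v, x) := by
  let P : ℕ → Prop := fun v => ∀ x, S.adj v x → ∃ a b, G a b ∧ S.FR G (a, b) (v, x)
  have hP : ∀ v, (∃ x, S.adj v x ∧ ∃ a b, G a b ∧ S.FR G (a, b) (v, x)) → P v := by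
    rintro v ⟨x, hx, a, b, hab, hr⟩ y hy
    by_cases ht : ∃ w, G v w
    · obtain ⟨w, hw⟩ := ht
      obtain ⟨w', hw'⟩ := InC.exists hG hw hy
      exact ⟨v, w', hw'.1, FR.flag hG hw'⟩
    · refine S.cyc_ind hx hy (fun y => ∃ a b, G a b ∧ S.FR G (a, b) (v, y)) ⟨a, b, hab, hr⟩ ?_
      rintro z hz ⟨a, b, hab, hr⟩
      exact ⟨a, b, hab, hr.trans ((FR.two hz).trans (FR.swap (S.t_adj' hz) fun g =>
        ht ⟨_, hG.symm g⟩))⟩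
  have key : ∀ b, Relation.ReflTransGen S.adj p b → P b := by
    intro b hb
    induction hb with
    | refl => exact hP _ ⟨q, hG.adj h0, p, q, h0, .refl _⟩
    | @tail b c _ hbc ih =>
      obtain ⟨a, a', ha, hr⟩ := ih c hbc
      exact hP _ ⟨_, S.t_adj hbc, a, a', ha, hr.trans (.rot hbc)⟩
  exact key v (S.conn (S.mem (hG.adj h0)) (S.mem h)) x h

open scoped Classical in
/-- cocycles vanish on the boundary of a region -/
theorem region_sum (hG : S.IsSub G) {φ} (hφ : S.Coc φ) (X : ℕ × ℕ → Prop)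
    (hX : ∀ {d e}, S.FR G d e → (X d ↔ X e)) :
    ∑ d ∈ S.darts.filter (fun d => G d.1 d.2), (if X d then φ d.1 d.2 else 0) = 0 := by
  set f : ℕ × ℕ → ZMod 2 := fun d => if X d then φ d.1 d.2 else 0 with hf
  have h1 : ∑ d ∈ S.darts, f d = 0 := by
    have e1 := S.sum_rho f
    have e2 := S.sum_rho (fun d => f (S.rho d))
    have e3 : ∑ d ∈ S.darts, (f d + f (S.rho d) + f (S.rho (S.rho d))) = 0 := by
      refine Finset.sum_eq_zero fun d hd => ?_
      rw [mem_darts] at hd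
      have x1 := hX (FR.rot (G := G) hd)
      have x2 := hX (FR.rot (G := G) (S.t_adj hd))
      simp only [hf, rho] at *
      rw [← x2, ← x1]
      split_ifs
      · rw [S.t_rot hd]; exact hφ.sum hd
      · simp
    rw [Finset.sum_add_distrib, Finset.sum_add_distrib, e2, e1, z2, zero_add] at e3
    exact e3
  have h2 : ∑ d ∈ S.darts.filter (fun d => ¬ G d.1 d.2), f d = 0 := by
    rw [S.sum_upE (G := G) fun _ _ => hG.symm]
    refine Finset.sum_eq_zero fun d hd => ?_
    simp only [upE, Finset.mem_filter, mem_darts] at hd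
    have := hX (FR.swap hd.1 hd.2.1)
    simp only [hf, Prod.swap, Prod.mk.eta] at *
    rw [← this, hφ.symm hd.1]
    exact z2 _
  rw [← Finset.sum_filter_add_sum_filter_not _ (fun d => G d.1 d.2), h2, add_zero] at h1
  exact h1

open scoped Classical in
theorem bound (hG : S.IsSub G) {p q : ℕ} (h0 : G p q) {W : Type*} [Fintype W] (cls : ℕ → ℕ → W)
    (hc : ∀ {v w y}, S.Nx G v w y → cls v w = cls y v)
    (hs : ∀ c, ∃ v w, G v w ∧ cls v w = c) {r n : ℕ} (reg : Fin r → ℕ × ℕ)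
    (hr : ∀ {v w}, G v w → ∃ i, S.FR G (reg i) (v, w))
    (hn : (S.verts.filter fun v => ∃ w, G v w).card ≤ n) :
    (S.darts.filter fun d => G d.1 d.2).card + 2 * Fintype.card W ≤ 2 * (2 * r + 2 + n) := by
  let U := {v // v ∈ S.verts.filter fun v => ¬ ∃ w, G v w}
  let cor : ℕ → ℕ → ℕ := fun v x => if h : ∃ w, S.InC G v w x then h.choose else 0
  have hcor : ∀ {v w x}, S.InC G v w x → cor v x = w := by
    intro v w x h
    have h' : ∃ w, S.InC G v w x := ⟨w, h⟩
    simp only [cor, dif_pos h']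
    exact h'.choose_spec.unique hG h
  let cl : ℕ × ℕ → W ⊕ U := fun d =>
    if h : d.1 ∈ S.verts.filter (fun v => ¬ ∃ w, G v w) then Sum.inr ⟨d.1, h⟩
    else Sum.inl (cls d.1 (cor d.1 d.2))
  have hcl : ∀ {v w x}, S.InC G v w x → cl (v, x) = Sum.inl (cls v w) := by
    intro v w x h
    have : ¬ v ∈ S.verts.filter (fun v => ¬ ∃ w, G v w) := fun k =>
      (Finset.mem_filter.1 k).2 ⟨w, h.1⟩
    simp only [cl, dif_neg this, hcor h]
  have hcl' : ∀ {v x}, S.adj v x → (¬ ∃ w, G v w) → ∃ h, cl (v, x) = Sum.inr ⟨v, h⟩ := by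
    intro v x h ht
    have : v ∈ S.verts.filter (fun v => ¬ ∃ w, G v w) := Finset.mem_filter.2 ⟨S.mem h, ht⟩
    exact ⟨this, by simp only [cl, dif_pos this]⟩
  have cl1 : ∀ {v x}, S.adj v x → ¬ G v x → cl (v, x) = cl (v, S.t x v) := by
    intro v x h hg
    by_cases ht : ∃ w, G v w
    · obtain ⟨w, hw⟩ := ht
      obtain ⟨w', hw'⟩ := InC.exists hG hw (S.pred_adj h)
      have := hw'.step (by rwa [S.t_succ_pred h])
      rw [S.t_succ_pred h] at this
      rw [hcl this, hcl hw']
    · obtain ⟨h1, e1⟩ := hcl' h ht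
      obtain ⟨h2, e2⟩ := hcl' (S.pred_adj h) ht
      rw [e1, e2]
  have cl2 : ∀ {v w}, G v w → cl (v, w) = cl (w, S.t v w) := by
    intro v w h
    have ha := hG.adj h
    obtain ⟨w', hw'⟩ := InC.exists hG (hG.symm h) (S.t_adj ha)
    have hx : S.Nx G w w' v := Nx.of_pred hG (hG.symm h) hw'
    rw [hcl hw', hcl (InC.self h), hc hx]
  let E := {d // d ∈ S.upE G}
  let A : (W ⊕ U → ZMod 2) →ₗ[ZMod 2] (E → ZMod 2) :=
    (AddMonoidHom.mk' (fun x (e : E) => x (cl e.1) + x (cl e.1.swap)) fun f g => by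
      funext d; simp only [Pi.add_apply]; ring).toZModLinearMap 2
  let av : (S.faces → ZMod 2) → ℕ × ℕ → ZMod 2 := fun a d =>
    if h : S.rep d ∈ S.faces then a ⟨_, h⟩ else 0
  have hav : ∀ {a d}, d ∈ S.darts → av a (S.rho d) = av a d := by
    intro a d hd
    simp only [av, S.rep_rho hd]
  have hadd : ∀ {f g d}, av (f + g) d = av f d + av g d := by
    intro f g d; simp only [av, Pi.add_apply]; split_ifs <;> simp
  let B : (S.faces → ZMod 2) →ₗ[ZMod 2] (E → ZMod 2) :=
    (AddMonoidHom.mk' (fun a (e : E) => av a e.1 + av a e.1.swap) fun f g => by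
      funext d; simp only [Pi.add_apply, hadd]; ring).toZModLinearMap 2
  have horth : ∀ x a, ∑ e, A x e * B a e = 0 := by
    intro x a
    let f : ℕ × ℕ → ZMod 2 := fun d => (x (cl d) + x (cl d.swap)) * av a d
    have e1 : ∑ e, A x e * B a e = ∑ d ∈ S.upE G, (f d + f d.swap) := by
      rw [← Finset.sum_coe_sort (S.upE G) fun d => f d + f d.swap]
      refine Finset.sum_congr rfl fun e _ => ?_
      simp only [A, B, f, AddMonoidHom.coe_toZModLinearMap, AddMonoidHom.mk'_apply, Prod.swap_swap]
      ring
    let g : ℕ × ℕ → ZMod 2 := fun d => x (cl d) * av a d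
    have e2 : ∑ d ∈ S.darts.filter (fun d => ¬ G d.1 d.2), f d =
        ∑ d ∈ S.darts.filter (fun d => ¬ G d.1 d.2), (g d + g (S.rho d)) := by
      refine Finset.sum_congr rfl fun d hd => ?_
      rw [Finset.mem_filter] at hd
      have hd' := hd.1
      rw [mem_darts] at hd'
      have : cl d.swap = cl (S.rho d) := by
        have := cl1 (S.symm hd') fun g => hd.2 (hG.symm g)
        exact this
      simp only [f, g, hav hd.1, this]
      ring
    have e3 : ∑ d ∈ S.darts.filter (fun d => G d.1 d.2), (g d + g (S.rho d)) = 0 := by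
      refine Finset.sum_eq_zero fun d hd => ?_
      rw [Finset.mem_filter] at hd
      have : cl d = cl (S.rho d) := cl2 hd.2
      simp only [g, hav hd.1, ← this]
      exact z2 _
    have e4 := Finset.sum_filter_add_sum_filter_not S.darts (fun d => G d.1 d.2)
      fun d => g d + g (S.rho d)
    have e5 : ∑ d ∈ S.darts, (g d + g (S.rho d)) = 0 := by
      rw [Finset.sum_add_distrib, S.sum_rho g, z2]
    rw [e3, zero_add, e5] at e4
    rw [e1, ← S.sum_upE fun _ _ => hG.symm, e2, e4]
  have hmem : ∀ {a b}, S.adj a b → ¬ G a b → (a, b) ∈ S.upE G ∨ (b, a) ∈ S.upE G := by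
    intro a b h hg
    simp only [upE, Finset.mem_filter, mem_darts]
    rcases lt_or_gt_of_ne (S.ne h) with k | k
    exacts [Or.inl ⟨h, hg, k⟩, Or.inr ⟨S.symm h, fun g => hg (hG.symm g), k⟩]
  have kA : finrank (ZMod 2) (LinearMap.ker A) ≤ r := by
    refine finrank_ker_le A (LinearMap.funLeft (ZMod 2) (ZMod 2) fun i => cl (reg i)) ?_
    intro x hA hf
    have sw : ∀ {a b}, S.adj a b → ¬ G a b → x (cl (a, b)) = x (cl (b, a)) := by
      intro a b h hg
      rcases hmem h hg with k | k
      · exact z2_eq.1 (congrFun hA ⟨_, k⟩)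
      · exact (z2_eq.1 (congrFun hA ⟨_, k⟩)).symm
    have inv : ∀ {d e}, S.FR G d e → x (cl d) = x (cl e) := by
      refine FR.lift (fun d => x (cl d)) (fun {a b} h => ?_) sw
      by_cases hg : G a b
      · exact congrArg x (cl2 hg)
      · exact (sw h hg).trans (congrArg x (cl1 (S.symm h) fun g => hg (hG.symm g)))
    have hz : ∀ {a b}, S.adj a b → x (cl (a, b)) = 0 := by
      intro a b h
      obtain ⟨a', b', hg, h1⟩ := FR.cover hG h0 h
      obtain ⟨i, h2⟩ := hr hg
      rw [← inv (h2.trans h1)]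
      exact congrFun hf i
    funext c
    rcases c with c | ⟨v, hv⟩
    · obtain ⟨v, w, hg, rfl⟩ := hs c
      rw [← hcl (InC.self hg)]
      exact hz (hG.adj hg)
    · obtain ⟨h1, h2⟩ := Finset.mem_filter.1 hv
      have : ∃ x, S.adj v x := by
        rcases Relation.ReflTransGen.cases_head (S.conn h1 (S.mem (hG.adj h0))) with e | ⟨c, h, -⟩
        · exact absurd ⟨q, e ▸ h0⟩ h2
        · exact ⟨c, h⟩
      obtain ⟨y, hy⟩ := this
      obtain ⟨_, e⟩ := hcl' hy h2
      rw [← e]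
      exact hz hy
  have kB : finrank (ZMod 2) (LinearMap.ker B) ≤ r := by
    refine finrank_ker_le B
      ((AddMonoidHom.mk' (fun a i => av a (reg i)) fun f g => by
        funext d; exact hadd).toZModLinearMap 2) ?_
    intro a hB hf
    have inv : ∀ {d e}, S.FR G d e → av a d = av a e := by
      refine FR.lift (av a) (fun {u v} h => (hav (d := (u, v)) (S.mem_darts.2 h)).symm) ?_
      intro u v h hg
      rcases hmem h hg with k | k
      · exact z2_eq.1 (congrFun hB ⟨_, k⟩)
      · exact (z2_eq.1 (congrFun hB ⟨_, k⟩)).symm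
    funext ⟨d, hd⟩
    obtain ⟨hd1, hd2⟩ := S.faces_sub hd
    have : av a d = a ⟨d, hd⟩ := by
      simp only [av, hd2, dif_pos hd]
    rw [← this]
    obtain ⟨a', b', hg, h1⟩ := FR.cover hG h0 (S.mem_darts.1 hd1)
    obtain ⟨i, h2⟩ := hr hg
    have h3 := inv (h2.trans h1)
    rw [Prod.mk.eta] at h3
    rw [← h3]
    exact congrFun hf i
  have h1 := (finrank_add_le_of_orthogonal A B horth).trans
    (Nat.add_le_add (Nat.add_le_add_left kA _) kB)
  have h2 := S.card_upE (G := G) fun _ _ => hG.symm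
  have h3 := S.card_faces
  have h4 := S.card_darts
  have h5 := S.darts.card_filter_add_card_filter_not (fun d => G d.1 d.2)
  have h6 := S.verts.card_filter_add_card_filter_not (fun v => ∃ w, G v w)
  simp only [finrank_fintype_fun_eq_card, Fintype.card_sum, Fintype.card_coe, U, E] at h1
  omega

end Surf
end NSC

namespace NSC
open Chk

theorem force_eq {α : Type} (n : ℕ) (k : ℕ → α) : force n k = k n := by cases n <;> rfl

theorem tb_eq (x d : ℕ) : tb x d = x.testBit d := by
  show Nat.beq ((x >>> d) % 2) 1 = _
  rw [Nat.testBit, Nat.one_and_eq_mod_two]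
  rcases Nat.mod_two_eq_zero_or_one (x >>> d) with h | h <;> rw [h] <;> rfl

theorem pw_eq (d : ℕ) : pw d = 2 ^ d := by
  show 1 <<< d = _
  rw [Nat.one_shiftLeft]

theorem tb_lor (x y d : ℕ) : tb (Nat.lor x y) d = (tb x d || tb y d) := by
  simp only [tb_eq]; exact Nat.testBit_or x y d
theorem tb_land (x y d : ℕ) : tb (Nat.land x y) d = (tb x d && tb y d) := by
  simp only [tb_eq]; exact Nat.testBit_and x y d
theorem tb_xor (x y d : ℕ) : tb (Nat.xor x y) d = (tb x d ^^ tb y d) := by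
  simp only [tb_eq]; exact Nat.testBit_xor x y d
theorem tb_pw (x d : ℕ) : tb (pw x) d = true ↔ d = x := by
  rw [tb_eq, pw_eq, Nat.testBit_two_pow]; simp [eq_comm]
theorem tb_zero (d : ℕ) : tb 0 d = false := by rw [tb_eq, Nat.zero_testBit]

theorem beq_iff {a b : ℕ} : Nat.beq a b = true ↔ a = b := by rw [Nat.beq_eq]
theorem blt_iff {a b : ℕ} : Nat.blt a b = true ↔ a < b := by rw [Nat.blt_eq]

theorem tb_congr {x y : ℕ} (h : Nat.beq x y = true) (d : ℕ) : tb x d = tb y d := by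
  rw [beq_iff.1 h]

theorem key_eq (a b : ℕ) : key a b = 16 * a + b := rfl
theorem key_div {a b : ℕ} (h : b < 16) : key a b / 16 = a := by rw [key_eq]; omega
theorem key_mod {a b : ℕ} (h : b < 16) : key a b % 16 = b := by rw [key_eq]; omega
theorem key_lt {a b : ℕ} (h : b < 16) (h' : a < 16) : key a b < 256 := by rw [key_eq]; omega
theorem rev_eq (d : ℕ) : rev d = key (d % 16) (d / 16) := rfl
theorem lt16 {d : ℕ} (h : d < 256) : d / 16 < 16 := by omega
theorem rev_div {d : ℕ} (h : d < 256) : rev d / 16 = d % 16 := key_div (lt16 h)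
theorem rev_mod {d : ℕ} (h : d < 256) : rev d % 16 = d / 16 := key_mod (lt16 h)
theorem rev_lt {d : ℕ} (h : d < 256) : rev d < 256 := key_lt (lt16 h) (Nat.mod_lt _ (by norm_num))
theorem rev_rev {d : ℕ} (h : d < 256) : rev (rev d) = d := by
  rw [rev_eq (rev d), rev_div h, rev_mod h, key_eq]; omega
theorem rev_key {a b : ℕ} (h' : b < 16) : rev (key a b) = key b a := by
  rw [rev_eq, key_div h', key_mod h']
theorem key_self (d : ℕ) : key (d / 16) (d % 16) = d := by rw [key_eq]; omega
theorem ext_dm {d e : ℕ} (h : d / 16 = e / 16) (h' : d % 16 = e % 16) : d = e := by omega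

theorem fld_lt (t d : ℕ) : fld t d < 256 := Nat.mod_lt _ (by norm_num)

theorem fld_testBit (t d i : ℕ) : (fld t d).testBit i = (decide (i < 8) && t.testBit (8 * d + i)) := by
  show ((t >>> (8 * d)) % 2 ^ 8).testBit i = _
  rw [Nat.testBit_mod_two_pow, Nat.testBit_shiftRight]

theorem fld_setF (t d x d' : ℕ) (hx : x < 256) :
    fld (setF t d x) d' = if d' = d then x else fld t d' := by
  apply Nat.eq_of_testBit_eq
  intro i
  have h1 : (setF t d x).testBit (8 * d' + i) = (t.testBit (8 * d' + i) ^^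
      (decide (8 * d ≤ 8 * d' + i) && ((fld t d).testBit (8 * d' + i - 8 * d) ^^
        x.testBit (8 * d' + i - 8 * d)))) := by
    show (t ^^^ ((fld t d ^^^ x) <<< (8 * d))).testBit _ = _
    rw [Nat.testBit_xor, Nat.testBit_shiftLeft, Nat.testBit_xor]
  rw [fld_testBit, h1]
  have hx8 : ∀ j, 8 ≤ j → x.testBit j = false := fun j hj =>
    Nat.testBit_lt_two_pow (lt_of_lt_of_le hx (by
      calc 256 = 2 ^ 8 := by norm_num
        _ ≤ 2 ^ j := Nat.pow_le_pow_right (by norm_num) hj))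
  split_ifs with h
  · subst h
    rw [Nat.add_sub_cancel_left, fld_testBit]
    by_cases hi : i < 8
    · simp [hi]
    · simp [hi, hx8 i (by omega)]
  · rw [fld_testBit]
    by_cases hi : i < 8
    · by_cases hd : 8 * d ≤ 8 * d' + i
      · rw [fld_testBit, hx8 (8 * d' + i - 8 * d) (by omega)]
        have : ¬ 8 * d' + i - 8 * d < 8 := by omega
        simp [hi, this]
      · simp [hi, hd, fld_testBit]
    · simp [hi, fld_testBit]

/-- value of a cochain on a chain of darts -/
def ev (φ : ℕ → ℕ → ZMod 2) (m : ℕ → ℕ) (x : ℕ) : ZMod 2 :=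
  ∑ d ∈ Finset.range 256, if tb x d = true then φ (m (d / 16)) (m (d % 16)) else 0

theorem ev_xor (φ m x y) : ev φ m (Nat.xor x y) = ev φ m x + ev φ m y := by
  unfold ev
  rw [← Finset.sum_add_distrib]
  refine Finset.sum_congr rfl fun d _ => ?_
  rw [tb_xor]
  cases tb x d <;> cases tb y d <;> simp [z2]

theorem ev_zero (φ m) : ev φ m 0 = 0 := by simp [ev, tb_zero]

theorem ev_pw (φ m) {d : ℕ} (h : d < 256) : ev φ m (pw d) = φ (m (d / 16)) (m (d % 16)) := by
  unfold ev
  simp only [tb_pw]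
  rw [Finset.sum_ite_eq' , if_pos (Finset.mem_range.2 h)]

theorem ev_eb {φ : ℕ → ℕ → ZMod 2} {m : ℕ → ℕ} {d : ℕ} (h : d < 256)
    (hs : φ (m (d / 16)) (m (d % 16)) = φ (m (d % 16)) (m (d / 16))) :
    ev φ m (eb d) = φ (m (d / 16)) (m (d % 16)) := by
  unfold eb
  cases Nat.ble d (rev d)
  · rw [cond_false, ev_pw _ _ (rev_lt h), rev_div h, rev_mod h, hs]
  · rw [cond_true, ev_pw _ _ h]

theorem ev_congr (φ) {m m' : ℕ → ℕ} {x : ℕ}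
    (h : ∀ d, tb x d = true → m (d / 16) = m' (d / 16) ∧ m (d % 16) = m' (d % 16)) :
    ev φ m x = ev φ m' x := by
  unfold ev
  refine Finset.sum_congr rfl fun d _ => ?_
  split_ifs with hd
  · rw [(h d hd).1, (h d hd).2]
  · rfl

/-- `ev` as a linear functional of the cochain -/
def evL (m : ℕ → ℕ) (x : ℕ) : (ℕ → ℕ → ZMod 2) →ₗ[ZMod 2] ZMod 2 where
  toFun φ := ev φ m x
  map_add' φ ψ := by
    unfold ev
    rw [← Finset.sum_add_distrib]
    refine Finset.sum_congr rfl fun d _ => ?_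
    split_ifs <;> simp
  map_smul' c φ := by
    simp only [ev, RingHom.id_apply, smul_eq_mul, Finset.mul_sum]
    refine Finset.sum_congr rfl fun d _ => ?_
    split_ifs <;> simp

theorem ev_or {φ m x y} (h : ∀ d, tb x d = true → ¬ tb y d = true) :
    ev φ m (Nat.lor x y) = ev φ m x + ev φ m y := by
  unfold ev
  rw [← Finset.sum_add_distrib]
  refine Finset.sum_congr rfl fun d _ => ?_
  rw [tb_lor]
  have := h d
  cases h1 : tb x d <;> cases h2 : tb y d <;> simp_all

theorem orb_aux {t s : ℕ} {k : ℕ × ℕ → Bool} : ∀ {f d M C : ℕ}, orb t s f d M C k = true →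
    ∃ j M' C', k (M', C') = true ∧ (fld t)^[j + 1] d = s ∧
      (∀ i, i < j → (fld t)^[i + 1] d ≠ s) ∧
      (∀ x, tb M' x = true ↔ tb M x = true ∨ ∃ i, i ≤ j ∧ (fld t)^[i] d = x) ∧
      ∀ φ m, ev φ m C' = ev φ m C + ∑ i ∈ Finset.range (j + 1), ev φ m (eb ((fld t)^[i] d)) := by
  intro f
  induction f with
  | zero => intro d M C h; simp [orb] at h
  | succ f ih =>
    intro d M C h
    simp only [orb, force_eq] at h
    by_cases he : fld t d = s
    · rw [beq_iff.2 he, cond_true] at h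
      refine ⟨0, _, _, h, he, fun i hi => by omega, fun x => ?_, fun φ m => ?_⟩
      · rw [tb_lor, Bool.or_eq_true, tb_pw]
        refine or_congr_right ⟨fun e => ⟨0, le_rfl, e.symm⟩, ?_⟩
        rintro ⟨i, hi, rfl⟩
        obtain rfl : i = 0 := by omega
        rfl
      · rw [ev_xor]; simp
    · rw [Bool.eq_false_iff.2 fun h => he (beq_iff.1 h), cond_false] at h
      obtain ⟨j, M', C', h1, h2, h3, h4, h5⟩ := ih h
      refine ⟨j + 1, M', C', h1, h2, fun i hi => ?_, fun x => ?_, fun φ m => ?_⟩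
      · cases i with
        | zero => exact he
        | succ i => exact h3 i (by omega)
      · rw [h4, tb_lor, Bool.or_eq_true, tb_pw, or_assoc]
        refine or_congr_right ⟨?_, ?_⟩
        · rintro (rfl | ⟨i, hi, rfl⟩)
          exacts [⟨0, by omega, rfl⟩, ⟨i + 1, by omega, rfl⟩]
        · rintro ⟨i, hi, rfl⟩
          cases i with
          | zero => exact Or.inl rfl
          | succ i => exact Or.inr ⟨i, by omega, rfl⟩
      · rw [h5, ev_xor, Finset.sum_range_succ' _ (j + 1), add_assoc]
        simp only [Function.iterate_succ_apply, Function.iterate_zero_apply]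
        rw [add_comm (ev φ m (eb d))]

theorem orb_spec {t f d : ℕ} {k : ℕ × ℕ → Bool} (h : orb t d f d 0 0 k = true) :
    ∃ w : ℕ × ℕ, k w = true ∧ tb w.1 d = true ∧ (∀ x, tb w.1 x = true → tb w.1 (fld t x) = true) ∧
      (∀ P : ℕ → Prop, P d → (∀ x, P x → P (fld t x)) → ∀ x, tb w.1 x = true → P x) ∧
      ∀ φ m, (∀ x, tb w.1 x = true → x < 256 ∧
        φ (m (x / 16)) (m (x % 16)) = φ (m (x % 16)) (m (x / 16))) → ev φ m w.2 = ev φ m w.1 := by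
  obtain ⟨j, M, C, h1, h2, h3, h4, h5⟩ := orb_aux h
  have h4' : ∀ x, tb M x = true ↔ ∃ i, i ≤ j ∧ (fld t)^[i] d = x := by
    intro x; rw [h4, tb_zero]; simp
  refine ⟨(M, C), h1, (h4' d).2 ⟨0, by omega, rfl⟩, fun x hx => ?_, fun P p0 p1 x hx => ?_,
    fun φ m hs => ?_⟩
  · obtain ⟨i, hi, rfl⟩ := (h4' x).1 hx
    rw [h4', ← Function.iterate_succ_apply' (fld t)]
    rcases Nat.lt_or_ge i j with k | k
    · exact ⟨i + 1, k, rfl⟩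
    · obtain rfl : i = j := by omega
      exact ⟨0, by omega, h2.symm⟩
  · obtain ⟨i, hi, rfl⟩ := (h4' x).1 hx
    clear hi hx
    induction i with
    | zero => exact p0
    | succ i ih => rw [Function.iterate_succ_apply']; exact p1 _ ih
  · have hp : Function.minimalPeriod (fld t) d = j + 1 := by
      have hpp : Function.IsPeriodicPt (fld t) (j + 1) d := h2
      have hle := hpp.minimalPeriod_le (by omega)
      have hpos := hpp.minimalPeriod_pos (by omega)
      by_contra hne
      refine h3 (Function.minimalPeriod (fld t) d - 1) (by omega) ?_
      rw [Nat.sub_add_cancel hpos]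
      exact Function.isPeriodicPt_minimalPeriod _ _
    have hinj : Set.InjOn (fun i => (fld t)^[i] d) (Finset.range (j + 1) : Set ℕ) := by
      have := Function.iterate_injOn_Iio_minimalPeriod (f := fld t) (x := d)
      rw [hp] at this
      intro a ha b hb e
      exact this (by simpa using ha) (by simpa using hb) e
    show ev φ m C = ev φ m M
    have e1 : ev φ m M = ∑ x ∈ (Finset.range (j + 1)).image (fun i => (fld t)^[i] d),
        φ (m (x / 16)) (m (x % 16)) := by
      unfold ev
      rw [← Finset.sum_filter]
      refine Finset.sum_congr ?_ fun _ _ => rfl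
      ext x
      rw [Finset.mem_filter, Finset.mem_image, h4', Finset.mem_range]
      constructor
      · rintro ⟨-, i, hi, e⟩
        exact ⟨i, Finset.mem_range.2 (by omega), e⟩
      · rintro ⟨i, hi, e⟩
        have hi' := Finset.mem_range.1 hi
        have : ∃ i ≤ j, (fld t)^[i] d = x := ⟨i, by omega, e⟩
        exact ⟨(hs x ((h4' x).2 this)).1, this⟩
    rw [h5, ev_zero, zero_add, e1, Finset.sum_image hinj]
    refine Finset.sum_congr rfl fun i hi => ?_
    have hi' := Finset.mem_range.1 hi
    obtain ⟨a, b⟩ := hs _ ((h4' _).2 ⟨i, by omega, rfl⟩)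
    exact ev_eb a b

end NSC

namespace NSC
open Chk
namespace Surf
variable {S : Surf} {G G' : ℕ → ℕ → Prop}

/-- corners not meeting the new edge survive -/
theorem Nx.keep (hs : ∀ u v, G u v → G' u v) {v w y} (h : S.Nx G v w y)
    (hn : ∀ x, S.InC G v w x → G' v x → G v x) : S.Nx G' v w y := by
  obtain ⟨x, hx, e, hy⟩ := h
  refine ⟨x, ?_, e, hs _ _ hy⟩
  have : S.InC G v w x → S.InC G' v w x := by
    intro _
    refine hx.induct (P := fun x => S.InC G' v w x) (InC.self (hs _ _ hx.1)) ?_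
    intro z hz ih hg
    exact ih.step fun g => hg (hn _ (hz.step hg) g)
  exact this hx

theorem InC.split (hs : ∀ u v, G u v → G' u v) {p q w : ℕ}
    (hn : ∀ x, G' p x → G p x ∨ x = q) (hq : G' p q) {x} (h : S.InC G p w x) :
    S.InC G' p w x ∨ S.InC G' p q x := by
  refine h.induct (P := fun x => S.InC G' p w x ∨ S.InC G' p q x) (Or.inl (InC.self (hs _ _ h.1))) ?_
  intro z hz ih hg
  by_cases e : S.t p z = q
  · rw [e]; exact Or.inr (InC.self hq)
  · have : ¬ G' p (S.t p z) := fun g => (hn _ g).elim hg e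
    exact ih.imp (fun h => h.step this) fun h => h.step this

/-- the corner before the new edge -/
theorem Nx.new (hG : S.IsSub G') (hs : ∀ u v, G u v → G' u v) {p q w : ℕ}
    (hn : ∀ x, G' p x → G p x ∨ x = q) (hq : G' p q) (hq' : ¬ G p q) (h : S.InC G p w q) :
    S.Nx G' p w q := by
  rcases h.cases with e | ⟨x, hx, e, -⟩
  · exact absurd (e ▸ h.1) hq'
  · rcases InC.split hs hn hq hx with k | k
    · exact ⟨x, k, e.symm, hq⟩
    · exfalso
      have hN : S.Nx G' p q q := ⟨x, k, e.symm, hq⟩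
      have := S.cyc_ind (hG.adj hq) (hG.adj (hs _ _ h.1)) (fun z => S.InC G' p q z) (InC.self hq) (by
        intro z hz hc
        by_cases g : G' p (S.t p z)
        · have := Nx.unique hN ⟨z, hc, rfl, g⟩
          rw [← this]; exact InC.self hq
        · exact hc.step g)
      exact hq' (by rw [this.eq_of_mem (hs _ _ h.1)]; exact h.1)

/-- the corner after the new edge -/
theorem Nx.after (hG : S.IsSub G') (hs : ∀ u v, G u v → G' u v) {p q w y : ℕ}
    (hn : ∀ x, G' p x → G p x ∨ x = q) (hq : G' p q) (hq' : ¬ G p q) (h : S.InC G p w q)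
    (hy : S.Nx G p w y) : S.Nx G' p q y := by
  have h1 := Nx.new hG hs hn hq hq' h
  obtain ⟨x, hx, e, hy⟩ := hy
  rcases InC.split hs hn hq hx with k | k
  · have := Nx.unique h1 ⟨x, k, e, hs _ _ hy⟩
    exact absurd (this ▸ hy) hq'
  · exact ⟨x, k, e, hs _ _ hy⟩

end Surf

/-- the image of a set of darts -/
def Gr (D : ℕ) (m : ℕ → ℕ) (u v : ℕ) : Prop := ∃ d, tb D d = true ∧ m (d / 16) = u ∧ m (d % 16) = v

def img (m : ℕ → ℕ) (d : ℕ) : ℕ × ℕ := (m (d / 16), m (d % 16))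

/-- the labelled rotation system `T` is embedded by `m` -/
structure Emb (S : Surf) (n D T : ℕ) (m : ℕ → ℕ) : Prop where
  n16 : n ≤ 16
  inj : ∀ {a b}, a < n → b < n → m a = m b → a = b
  lt : ∀ {d}, tb D d = true → d / 16 < n ∧ d % 16 < n
  revD : ∀ {d}, tb D d = true → tb D (rev d) = true
  adj : ∀ {d}, tb D d = true → S.adj (m (d / 16)) (m (d % 16))
  T1 : ∀ {d}, tb D d = true → tb D (fld T d) = true
  T2 : ∀ {d}, tb D d = true → fld T d % 16 = d / 16
  nx : ∀ {d}, tb D d = true → S.Nx (Gr D m) (m (d / 16)) (m (d % 16)) (m (fld T d / 16))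

structure WOk (D T : ℕ) (m : ℕ → ℕ) (w : ℕ × ℕ) : Prop where
  one : ∃ d, tb w.1 d = true ∧ ∀ P : ℕ → Prop, P d →
    (∀ x, tb w.1 x = true → P x → P (fld T x)) → ∀ x, tb w.1 x = true → P x
  sub : ∀ {d}, tb w.1 d = true → tb D d = true
  cl : ∀ {d}, tb w.1 d = true → tb w.1 (fld T d) = true
  ev : ∀ {φ : ℕ → ℕ → ZMod 2}, (∀ d, tb D d = true →
    φ (m (d / 16)) (m (d % 16)) = φ (m (d % 16)) (m (d / 16))) → ev φ m w.2 = ev φ m w.1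

def Has (r : List (ℕ × ℕ)) (d : ℕ) : Prop := ∃ w ∈ r, tb w.1 d = true

structure ROk (S : Surf) (D T : ℕ) (m : ℕ → ℕ) (r : List (ℕ × ℕ)) : Prop where
  ok : ∀ w ∈ r, WOk D T m w
  dj : r.Pairwise fun w w' => ∀ d, tb w.1 d = true → ¬ tb w'.1 d = true
  conn : ∀ {d d'}, Has r d → Has r d' → S.FR (Gr D m) (img m d) (img m d')

structure Reg (S : Surf) (D T : ℕ) (m : ℕ → ℕ) (rs : List (List (ℕ × ℕ))) : Prop where
  ok : ∀ r ∈ rs, ROk S D T m r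
  sep : rs.Pairwise fun r r' => ∀ d d', Has r d → Has r' d' → ¬ S.FR (Gr D m) (img m d) (img m d')
  cov : ∀ {d}, tb D d = true → ∃ r ∈ rs, Has r d

/-- the state `o` is realised by `m` -/
structure EmbS (S : Surf) (o : St) (m : ℕ → ℕ) : Prop where
  emb : Emb S o.n o.D o.T m
  reg : Reg S o.D o.T m o.rs
  nD : ((Finset.range 256).filter fun d => tb o.D d = true).card = o.nD

theorem Has.sub {S D T m r} (h : ROk S D T m r) {d} (hd : Has r d) : tb D d = true := by
  obtain ⟨w, hw, hd⟩ := hd; exact (h.ok w hw).sub hd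

theorem Has.perm {r r'} (h : r.Perm r') {d} : Has r d ↔ Has r' d := by
  unfold Has; simp only [h.mem_iff]

theorem ROk.perm {S D T m r r'} (h : ROk S D T m r) (hp : r.Perm r') : ROk S D T m r' where
  ok w hw := h.ok w (hp.mem_iff.2 hw)
  dj := h.dj.perm hp fun h d h1 h2 => h d h2 h1
  conn h1 h2 := h.conn ((Has.perm hp).2 h1) ((Has.perm hp).2 h2)

theorem Reg.perm {S D T m rs rs'} (h : Reg S D T m rs) (hp : rs.Perm rs') : Reg S D T m rs' where
  ok w hw := h.ok w (hp.mem_iff.2 hw)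
  sep := h.sep.perm hp fun h d d' h1 h2 e => h d' d h2 h1 e.symm
  cov hd := by obtain ⟨r, hr, h1⟩ := h.cov hd; exact ⟨r, hp.mem_iff.1 hr, h1⟩

theorem Reg.head {S D T m r r' rs} (h : Reg S D T m (r :: rs)) (hp : r.Perm r') :
    Reg S D T m (r' :: rs) where
  ok w hw := by
    rcases List.mem_cons.1 hw with rfl | hw
    · exact (h.ok r (by simp)).perm hp
    · exact h.ok w (by simp [hw])
  sep := by
    have := List.pairwise_cons.1 h.sep
    refine List.pairwise_cons.2 ⟨fun a ha d d' h1 h2 => this.1 a ha d d' ((Has.perm hp).2 h1) h2, this.2⟩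
  cov hd := by
    obtain ⟨r1, hr, h1⟩ := h.cov hd
    rcases List.mem_cons.1 hr with rfl | hr
    · exact ⟨r', by simp, (Has.perm hp).1 h1⟩
    · exact ⟨r1, by simp [hr], h1⟩

theorem inR_iff {d r} : inR d r = true ↔ Has r d := by
  induction r with
  | nil => simp [inR, Has]
  | cons w l ih => simp [inR, ih, Has]

theorem findW_spec {d : ℕ} : ∀ {l : List (ℕ × ℕ)} {k z}, findW d l k z = true →
    (∃ w l', l.Perm (w :: l') ∧ tb w.1 d = true ∧ k w l' = true) ∨ (¬ Has l d ∧ z = true) := by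
  intro l
  induction l with
  | nil => intro k z h; exact Or.inr ⟨by simp [Has], h⟩
  | cons w l ih =>
    intro k z h
    unfold findW at h
    by_cases hw : tb w.1 d = true
    · rw [hw, cond_true] at h
      exact Or.inl ⟨w, l, .refl _, hw, h⟩
    · rw [Bool.eq_false_iff.2 hw, cond_false] at h
      rcases ih h with ⟨w', l', h1, h2, h3⟩ | ⟨h1, h2⟩
      · exact Or.inl ⟨w', w :: l', (h1.cons w).trans (List.Perm.swap _ _ _), h2, h3⟩
      · exact Or.inr ⟨by simpa [Has, hw] using h1, h2⟩

theorem findR_spec {d : ℕ} : ∀ {l : List (List (ℕ × ℕ))} {k}, findR d l k = true →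
    ∃ r l', l.Perm (r :: l') ∧ Has r d ∧ k r l' = true := by
  intro l
  induction l with
  | nil => intro k h; simp [findR] at h
  | cons w l ih =>
    intro k h
    unfold findR at h
    by_cases hw : inR d w = true
    · rw [hw, cond_true] at h
      exact ⟨w, l, .refl _, inR_iff.1 hw, h⟩
    · rw [Bool.eq_false_iff.2 hw, cond_false] at h
      obtain ⟨w', l', h1, h2, h3⟩ := ih h
      exact ⟨w', w :: l', (h1.cons w).trans (List.Perm.swap _ _ _), h2, h3⟩

theorem parts_spec (P : ℕ × ℕ → Prop) : ∀ {l : List (ℕ × ℕ)} {k}, parts l k = true →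
    ∃ s t, l.Perm (s ++ t) ∧ (∀ w ∈ s, P w) ∧ (∀ w ∈ t, ¬ P w) ∧ k s t = true := by
  intro l
  induction l with
  | nil => intro k h; exact ⟨[], [], .refl _, by simp, by simp, h⟩
  | cons w l ih =>
    intro k h
    unfold parts at h
    obtain ⟨s, t, h1, h2, h3, h4⟩ := ih h
    rw [Bool.and_eq_true] at h4
    by_cases hw : P w
    · exact ⟨w :: s, t, h1.cons w, by simpa [hw] using h2, h3, h4.1⟩
    · exact ⟨s, w :: t, (h1.cons w).trans List.perm_middle.symm, h2, by simpa [hw] using h3, h4.2⟩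

namespace Emb
variable {S : Surf} {n D T : ℕ} {m : ℕ → ℕ}

theorem lt256 (h : Emb S n D T m) {d} (hd : tb D d = true) : d < 256 := by
  have := h.lt hd; have := h.n16; omega

theorem gr {d} (hd : tb D d = true) : Gr D m (m (d / 16)) (m (d % 16)) := ⟨d, hd, rfl, rfl⟩

theorem sub (h : Emb S n D T m) : S.IsSub (Gr D m) where
  adj := by rintro u v ⟨d, hd, rfl, rfl⟩; exact h.adj hd
  symm := by
    rintro u v ⟨d, hd, rfl, rfl⟩
    exact ⟨rev d, h.revD hd, by rw [rev_div (h.lt256 hd)], by rw [rev_mod (h.lt256 hd)]⟩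

theorem img_inj (h : Emb S n D T m) {d d'} (hd : tb D d = true) (hd' : tb D d' = true) (e : img m d = img m d') :
    d = d' := by
  rw [img, img, Prod.mk.injEq] at e
  exact ext_dm (h.inj (h.lt hd).1 (h.lt hd').1 e.1) (h.inj (h.lt hd).2 (h.lt hd').2 e.2)

theorem gr_key (h : Emb S n D T m) {a b} (ha : a < n) (hb : b < n) : Gr D m (m a) (m b) ↔ tb D (key a b) = true := by
  have hb' : b < 16 := hb.trans_le h.n16
  constructor
  · rintro ⟨d, hd, e1, e2⟩
    have e1 := h.inj (h.lt hd).1 ha e1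
    have e2 := h.inj (h.lt hd).2 hb e2
    rwa [← e1, ← e2, key_self]
  · intro hd
    exact ⟨_, hd, by rw [key_div hb'], by rw [key_mod hb']⟩

theorem fr_T (h : Emb S n D T m) {d} (hd : tb D d = true) : S.FR (Gr D m) (img m d) (img m (fld T d)) := by
  have := Surf.FR.of_nx h.sub (h.nx hd)
  unfold img
  rwa [h.T2 hd]

end Emb
end NSC

namespace NSC
open Chk

/-- adding an edge between two corners -/
structure Ext (S : Surf) (n D T : ℕ) (m : ℕ → ℕ) (dp dq e D' T' : ℕ) : Prop where
  emb : Emb S n D T m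
  hp : tb D dp = true
  hq : tb D dq = true
  he : e = key (dp / 16) (dq / 16)
  ne : ¬ tb D e = true
  cp : S.InC (Gr D m) (m (dp / 16)) (m (dp % 16)) (m (dq / 16))
  cq : S.InC (Gr D m) (m (dq / 16)) (m (dq % 16)) (m (dp / 16))
  hD : ∀ d, tb D' d = true ↔ tb D d = true ∨ d = e ∨ d = rev e
  t1 : fld T' e = fld T dp
  t2 : fld T' (rev e) = fld T dq
  t3 : fld T' dp = rev e
  t4 : fld T' dq = e
  t5 : ∀ d, d ≠ e → d ≠ rev e → d ≠ dp → d ≠ dq → fld T' d = fld T d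

namespace Ext
variable {S : Surf} {n D T : ℕ} {m : ℕ → ℕ} {dp dq e D' T' : ℕ}

theorem lp (h : Ext S n D T m dp dq e D' T') : dp / 16 < n := (h.emb.lt h.hp).1
theorem lq (h : Ext S n D T m dp dq e D' T') : dq / 16 < n := (h.emb.lt h.hq).1
theorem e1 (h : Ext S n D T m dp dq e D' T') : e / 16 = dp / 16 := by
  rw [h.he, key_div (h.lq.trans_le h.emb.n16)]
theorem e2 (h : Ext S n D T m dp dq e D' T') : e % 16 = dq / 16 := by
  rw [h.he, key_mod (h.lq.trans_le h.emb.n16)]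
theorem e256 (h : Ext S n D T m dp dq e D' T') : e < 256 := by
  have := h.e1; have := h.lp; have := h.emb.n16; omega
theorem e3 (h : Ext S n D T m dp dq e D' T') : rev e / 16 = dq / 16 := by
  rw [rev_div h.e256, h.e2]
theorem e4 (h : Ext S n D T m dp dq e D' T') : rev e % 16 = dp / 16 := by
  rw [rev_mod h.e256, h.e1]
theorem ad (h : Ext S n D T m dp dq e D' T') : S.adj (m (dp / 16)) (m (dq / 16)) := h.cp.adj h.emb.sub

theorem gr (h : Ext S n D T m dp dq e D' T') {u v} : Gr D' m u v ↔ Gr D m u v ∨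
    (u = m (dp / 16) ∧ v = m (dq / 16)) ∨ (u = m (dq / 16) ∧ v = m (dp / 16)) := by
  constructor
  · rintro ⟨d, hd, rfl, rfl⟩
    rcases (h.hD d).1 hd with hd | rfl | rfl
    · exact Or.inl ⟨d, hd, rfl, rfl⟩
    · rw [h.e1, h.e2]; exact Or.inr (Or.inl ⟨rfl, rfl⟩)
    · rw [h.e3, h.e4]; exact Or.inr (Or.inr ⟨rfl, rfl⟩)
  · rintro (⟨d, hd, rfl, rfl⟩ | ⟨rfl, rfl⟩ | ⟨rfl, rfl⟩)
    · exact ⟨d, (h.hD d).2 (Or.inl hd), rfl, rfl⟩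
    · exact ⟨e, (h.hD e).2 (Or.inr (Or.inl rfl)), by rw [h.e1], by rw [h.e2]⟩
    · exact ⟨rev e, (h.hD _).2 (Or.inr (Or.inr rfl)), by rw [h.e3], by rw [h.e4]⟩

theorem gr_sub (h : Ext S n D T m dp dq e D' T') (u v) (g : Gr D m u v) : Gr D' m u v :=
  h.gr.2 (Or.inl g)

theorem sub (h : Ext S n D T m dp dq e D' T') : S.IsSub (Gr D' m) where
  adj g := by
    rcases h.gr.1 g with g | ⟨rfl, rfl⟩ | ⟨rfl, rfl⟩
    exacts [h.emb.sub.adj g, h.ad, S.symm h.ad]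
  symm g := by
    rcases h.gr.1 g with g | ⟨rfl, rfl⟩ | ⟨rfl, rfl⟩
    exacts [h.gr.2 (Or.inl (h.emb.sub.symm g)), h.gr.2 (Or.inr (Or.inr ⟨rfl, rfl⟩)),
      h.gr.2 (Or.inr (Or.inl ⟨rfl, rfl⟩))]

theorem ng (h : Ext S n D T m dp dq e D' T') : ¬ Gr D m (m (dp / 16)) (m (dq / 16)) := by
  rw [h.emb.gr_key h.lp h.lq, ← h.he]; exact h.ne

theorem ng' (h : Ext S n D T m dp dq e D' T') : ¬ Gr D m (m (dq / 16)) (m (dp / 16)) :=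
  fun g => h.ng (h.emb.sub.symm g)

theorem ne_e (h : Ext S n D T m dp dq e D' T') {d} (hd : tb D d = true) : d ≠ e :=
  fun k => h.ne (k ▸ hd)
theorem ne_e' (h : Ext S n D T m dp dq e D' T') {d} (hd : tb D d = true) : d ≠ rev e := by
  rintro rfl
  have := h.emb.revD hd
  rw [rev_rev h.e256] at this
  exact h.ne this

theorem hp' (h : Ext S n D T m dp dq e D' T') {x} (g : Gr D' m (m (dp / 16)) x) :
    Gr D m (m (dp / 16)) x ∨ x = m (dq / 16) := by
  rcases h.gr.1 g with g | ⟨-, g⟩ | ⟨g, -⟩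
  exacts [Or.inl g, Or.inr g, absurd g (S.ne h.ad)]
theorem hq' (h : Ext S n D T m dp dq e D' T') {x} (g : Gr D' m (m (dq / 16)) x) :
    Gr D m (m (dq / 16)) x ∨ x = m (dp / 16) := by
  rcases h.gr.1 g with g | ⟨g, -⟩ | ⟨-, g⟩
  exacts [Or.inl g, absurd g.symm (S.ne h.ad), Or.inr g]

theorem toEmb (h : Ext S n D T m dp dq e D' T') : Emb S n D' T' m where
  n16 := h.emb.n16
  inj := h.emb.inj
  lt hd := by
    rcases (h.hD _).1 hd with hd | rfl | rfl
    · exact h.emb.lt hd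
    · rw [h.e1, h.e2]; exact ⟨h.lp, h.lq⟩
    · rw [h.e3, h.e4]; exact ⟨h.lq, h.lp⟩
  revD hd := by
    rcases (h.hD _).1 hd with hd | rfl | rfl
    · exact (h.hD _).2 (Or.inl (h.emb.revD hd))
    · exact (h.hD _).2 (by simp)
    · rw [rev_rev h.e256]; exact (h.hD _).2 (by simp)
  adj hd := by
    rcases (h.hD _).1 hd with hd | rfl | rfl
    · exact h.emb.adj hd
    · rw [h.e1, h.e2]; exact h.ad
    · rw [h.e3, h.e4]; exact S.symm h.ad
  T1 {d} hd := by
    rw [h.hD]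
    rcases (h.hD _).1 hd with hd | rfl | rfl
    · by_cases k : d = dp
      · rw [k, h.t3]; simp
      · by_cases k' : d = dq
        · rw [k', h.t4]; simp
        · rw [h.t5 d (h.ne_e hd) (h.ne_e' hd) k k']; exact Or.inl (h.emb.T1 hd)
    · rw [h.t1]; exact Or.inl (h.emb.T1 h.hp)
    · rw [h.t2]; exact Or.inl (h.emb.T1 h.hq)
  T2 {d} hd := by
    rcases (h.hD _).1 hd with hd | rfl | rfl
    · by_cases k : d = dp
      · rw [k, h.t3, h.e4]
      · by_cases k' : d = dq
        · rw [k', h.t4, h.e2]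
        · rw [h.t5 d (h.ne_e hd) (h.ne_e' hd) k k']; exact h.emb.T2 hd
    · rw [h.t1, h.emb.T2 h.hp, h.e1]
    · rw [h.t2, h.emb.T2 h.hq, h.e3]
  nx {d} hd := by
    rcases (h.hD _).1 hd with hd | rfl | rfl
    · by_cases k : d = dp
      · rw [k, h.t3, h.e3]
        exact Surf.Nx.new h.sub h.gr_sub (fun x => h.hp') (h.gr.2 (by simp)) h.ng h.cp
      · by_cases k' : d = dq
        · rw [k', h.t4, h.e1]
          exact Surf.Nx.new h.sub h.gr_sub (fun x => h.hq') (h.gr.2 (by simp)) h.ng' h.cq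
        · rw [h.t5 d (h.ne_e hd) (h.ne_e' hd) k k']
          refine Surf.Nx.keep h.gr_sub (h.emb.nx hd) ?_
          intro x hx g
          rcases h.gr.1 g with g | ⟨g', rfl⟩ | ⟨g', rfl⟩
          · exact g
          · rw [g'] at hx
            refine absurd (h.emb.img_inj hd h.hp ?_) k
            rw [img, img, g', hx.unique h.emb.sub h.cp]
          · rw [g'] at hx
            refine absurd (h.emb.img_inj hd h.hq ?_) k'
            rw [img, img, g', hx.unique h.emb.sub h.cq]
    · rw [h.t1, h.e1, h.e2]
      exact Surf.Nx.after h.sub h.gr_sub (fun x => h.hp') (h.gr.2 (by simp)) h.ng h.cp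
        (h.emb.nx h.hp)
    · rw [h.t2, h.e3, h.e4]
      exact Surf.Nx.after h.sub h.gr_sub (fun x => h.hq') (h.gr.2 (by simp)) h.ng' h.cq
        (h.emb.nx h.hq)

theorem img_e (h : Ext S n D T m dp dq e D' T') : img m e = (m (dp / 16), m (dq / 16)) := by
  rw [img, h.e1, h.e2]
theorem img_e' (h : Ext S n D T m dp dq e D' T') : img m (rev e) = (m (dq / 16), m (dp / 16)) := by
  rw [img, h.e3, h.e4]

theorem mono (h : Ext S n D T m dp dq e D' T') {x y} (k : S.FR (Gr D' m) x y) :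
    S.FR (Gr D m) x y := k.mono fun g => h.gr_sub _ _ g

theorem ins (h : Ext S n D T m dp dq e D' T') {x y} (k : S.FR (Gr D m) x y) :
    S.FR (Gr D' m) x y ∨ (S.FR (Gr D' m) x (img m e) ∧ S.FR (Gr D' m) (img m (rev e)) y) ∨
      (S.FR (Gr D' m) x (img m (rev e)) ∧ S.FR (Gr D' m) (img m e) y) := by
  rw [h.img_e, h.img_e']
  exact k.insert fun g => h.gr.1 g

theorem fr_p (h : Ext S n D T m dp dq e D' T') : S.FR (Gr D m) (img m dp) (img m e) := by
  rw [h.img_e]; exact Surf.FR.flag h.emb.sub h.cp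
theorem fr_q (h : Ext S n D T m dp dq e D' T') : S.FR (Gr D m) (img m dq) (img m (rev e)) := by
  rw [h.img_e']; exact Surf.FR.flag h.emb.sub h.cq
theorem fr_e (h : Ext S n D T m dp dq e D' T') : S.FR (Gr D m) (img m e) (img m (rev e)) := by
  rw [h.img_e, h.img_e']; exact .swap h.ad h.ng

/-- walks avoiding the two corners survive -/
theorem wok (h : Ext S n D T m dp dq e D' T') {w} (hw : WOk D T m w) (h1 : ¬ tb w.1 dp = true)
    (h2 : ¬ tb w.1 dq = true) : WOk D' T' m w where
  one := by
    obtain ⟨d, hd, h3⟩ := hw.one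
    refine ⟨d, hd, fun P p0 p1 => h3 P p0 fun x hx hP => ?_⟩
    rw [← h.t5 x (h.ne_e (hw.sub hx)) (h.ne_e' (hw.sub hx)) (fun k => h1 (k ▸ hx))
      fun k => h2 (k ▸ hx)]
    exact p1 x hx hP
  sub hd := (h.hD _).2 (Or.inl (hw.sub hd))
  cl {d} hd := by
    rw [h.t5 d (h.ne_e (hw.sub hd)) (h.ne_e' (hw.sub hd)) (fun k => h1 (k ▸ hd))
      fun k => h2 (k ▸ hd)]
    exact hw.cl hd
  ev hs := hw.ev fun d hd => hs d ((h.hD d).2 (Or.inl hd))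

/-- regions other than the subdivided one survive -/
theorem rok (h : Ext S n D T m dp dq e D' T') {r} (hr : ROk S D T m r)
    (h1 : ∀ d, Has r d → ¬ S.FR (Gr D m) (img m dp) (img m d)) : ROk S D' T' m r := by
  have h2 : ∀ d, Has r d → ¬ S.FR (Gr D m) (img m d) (img m e) := fun d hd k =>
    h1 d hd (h.fr_p.trans k.symm)
  have h3 : ∀ d, Has r d → ¬ S.FR (Gr D m) (img m d) (img m (rev e)) := fun d hd k =>
    h1 d hd (h.fr_p.trans (h.fr_e.trans k.symm))
  refine ⟨fun w hw => h.wok (hr.ok w hw) (fun k => ?_) (fun k => ?_), hr.dj, ?_⟩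
  · exact h1 dp ⟨w, hw, k⟩ (.refl _)
  · exact h3 dq ⟨w, hw, k⟩ h.fr_q
  · intro d d' hd hd'
    rcases h.ins (hr.conn hd hd') with k | ⟨k, -⟩ | ⟨k, -⟩
    · exact k
    · exact absurd (h.mono k) (h2 d hd)
    · exact absurd (h.mono k) (h3 d hd)

/-- every dart of the subdivided region sees one side of the new edge -/
theorem side (h : Ext S n D T m dp dq e D' T') {d} (hd : S.FR (Gr D m) (img m dp) (img m d)) :
    S.FR (Gr D' m) (img m d) (img m e) ∨ S.FR (Gr D' m) (img m d) (img m (rev e)) := by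
  rcases h.ins (hd.symm.trans h.fr_p) with k | ⟨k, -⟩ | ⟨k, -⟩
  exacts [Or.inl k, Or.inl k, Or.inr k]

/-- the walk through `d` computed by `orb` -/
theorem orbW (h : Ext S n D T m dp dq e D' T') {d f} {k : ℕ × ℕ → Bool} (hd : tb D' d = true)
    (ho : orb T' d f d 0 0 k = true) : ∃ w, k w = true ∧ WOk D' T' m w ∧ tb w.1 d = true ∧
      ∀ x, tb w.1 x = true → S.FR (Gr D' m) (img m d) (img m x) := by
  obtain ⟨w, h1, h2, h3, h4, h5⟩ := orb_spec ho
  have h6 := h4 (fun x => tb D' x = true ∧ S.FR (Gr D' m) (img m d) (img m x)) ⟨hd, .refl _⟩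
    fun x hx => ⟨h.toEmb.T1 hx.1, hx.2.trans (h.toEmb.fr_T hx.1)⟩
  exact ⟨w, h1, ⟨⟨d, h2, fun P p0 p1 x hx =>
    (h4 (fun x => tb w.1 x = true ∧ P x) ⟨h2, p0⟩ (fun x hx => ⟨h3 x hx.1, p1 x hx.1 hx.2⟩) x hx).2⟩,
    fun hx => (h6 _ hx).1, fun hx => h3 _ hx, fun hs => h5 _ _ fun x hx =>
    ⟨h.toEmb.lt256 (h6 x hx).1, hs x (h6 x hx).1⟩⟩, h2, fun x hx => (h6 x hx).2⟩

end Ext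
end NSC

namespace NSC
open Chk

theorem has_cons {w : ℕ × ℕ} {r d} : Has (w :: r) d ↔ tb w.1 d = true ∨ Has r d := by
  simp [Has]

theorem has_append {r r' d} : Has (r ++ r') d ↔ Has r d ∨ Has r' d := by
  simp only [Has, List.mem_append, or_and_right, exists_or]

theorem WOk.fr {S : Surf} {n D T m w} (h : WOk D T m w) (he : Emb S n D T m) {d d'}
    (hd : tb w.1 d = true) (hd' : tb w.1 d' = true) : S.FR (Gr D m) (img m d) (img m d') := by
  obtain ⟨d0, h0, h1⟩ := h.one
  have := h1 (fun x => S.FR (Gr D m) (img m d0) (img m x)) (.refl _)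
    fun x hx k => k.trans (he.fr_T (h.sub hx))
  exact (this d hd).symm.trans (this d' hd')

namespace Ext
variable {S : Surf} {n D T : ℕ} {m : ℕ → ℕ} {dp dq e D' T' : ℕ}

theorem assemble (h : Ext S n D T m dp dq e D' T') {rg rest} (hreg : Reg S D T m (rg :: rest))
    (hdp : Has rg dp) {R} (hR : ∀ r ∈ R, ROk S D' T' m r)
    (hs : R.Pairwise fun r r' => ∀ d d', Has r d → Has r' d' → ¬ S.FR (Gr D' m) (img m d) (img m d'))
    (hb : ∀ r ∈ R, ∀ d, Has r d → Has rg d ∨ d = e ∨ d = rev e)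
    (hc : ∀ d, (Has rg d ∨ d = e ∨ d = rev e) → ∃ r ∈ R, Has r d) :
    Reg S D' T' m (R ++ rest) := by
  have h0 := List.pairwise_cons.1 hreg.sep
  refine ⟨fun r hr => ?_, ?_, fun {d} hd => ?_⟩
  · rcases List.mem_append.1 hr with hr | hr
    · exact hR r hr
    · exact h.rok (hreg.ok r (by simp [hr])) fun d hd => h0.1 r hr dp d hdp hd
  · refine List.pairwise_append.2 ⟨hs, h0.2.imp fun k d d' hd hd' f => k d d' hd hd' (h.mono f), ?_⟩
    intro r hr r' hr' d d' hd hd' f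
    refine h0.1 r' hr' dp d' hdp hd' (.trans ?_ (h.mono f))
    rcases hb r hr d hd with k | rfl | rfl
    · exact (hreg.ok rg (by simp)).conn hdp k
    · exact h.fr_p
    · exact h.fr_p.trans h.fr_e
  · rcases (h.hD d).1 hd with hd | hd
    · obtain ⟨r, hr, k⟩ := hreg.cov hd
      rcases List.mem_cons.1 hr with rfl | hr
      · obtain ⟨r, hr, k⟩ := hc d (Or.inl k)
        exact ⟨r, by simp [hr], k⟩
      · exact ⟨r, by simp [hr], k⟩
    · obtain ⟨r, hr, k⟩ := hc d (Or.inr hd)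
      exact ⟨r, by simp [hr], k⟩

end Ext

theorem card_bits {S : Surf} {n D T : ℕ} {m : ℕ → ℕ} {dp dq e D' T' : ℕ}
    (h : Ext S n D T m dp dq e D' T') :
    ((Finset.range 256).filter fun d => tb D' d = true).card =
      ((Finset.range 256).filter fun d => tb D d = true).card + 2 := by
  have h1 : (Finset.range 256).filter (fun d => tb D' d = true) =
      insert e (insert (rev e) ((Finset.range 256).filter fun d => tb D d = true)) := by
    ext d
    have := h.e256
    have := rev_lt h.e256
    simp only [Finset.mem_filter, Finset.mem_insert, h.hD, Finset.mem_range]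
    constructor
    · tauto
    · rintro (rfl | rfl | k) <;> tauto
  have h2 : e ≠ rev e := fun k => by
    have k1 := congrArg (· / 16) k
    simp only [h.e1, h.e3] at k1
    have := h.ad
    rw [k1] at this
    exact S.irr _ this
  rw [h1, Finset.card_insert_of_notMem, Finset.card_insert_of_notMem]
  · intro k; exact h.ne_e' (Finset.mem_filter.1 k).2 rfl
  · rw [Finset.mem_insert, not_or]
    exact ⟨h2, fun k => h.ne (Finset.mem_filter.1 k).2⟩

set_option maxHeartbeats 2000000 in
theorem addE_spec {S : Surf} {o : St} {m : ℕ → ℕ} (ho : EmbS S o m) {dp dq e : ℕ}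
    {k : St → Bool} (h : addE o dp dq e k = true) (hp : tb o.D dp = true) (hq : tb o.D dq = true)
    (he : e = key (dp / 16) (dq / 16)) (ne : ¬ tb o.D e = true)
    (cp : S.InC (Gr o.D m) (m (dp / 16)) (m (dp % 16)) (m (dq / 16)))
    (cq : S.InC (Gr o.D m) (m (dq / 16)) (m (dq % 16)) (m (dp / 16))) :
    ∃ o', k o' = true ∧ EmbS S o' m ∧ o'.n = o.n ∧
      ∀ d, tb o'.D d = true ↔ tb o.D d = true ∨ d = e ∨ d = rev e := by
  obtain ⟨rg, rest, p1, hrg, h⟩ := findR_spec h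
  have hreg := ho.reg.perm p1
  rcases findW_spec h with ⟨A, ra, p2, hA, h⟩ | ⟨h, -⟩
  swap; · exact absurd hrg h
  have hreg := hreg.head p2
  simp only [force_eq] at h
  set T' := setF (setF (setF (setF o.T e (fld o.T dp)) (rev e) (fld o.T dq)) dp (rev e)) dq e with hT'
  set D' := Nat.lor o.D (Nat.lor (pw e) (pw (rev e))) with hD'
  have hX : Ext S o.n o.D o.T m dp dq e D' T' := by
    have l1 := ho.emb.lt hp
    have l2 := ho.emb.lt hq
    have l3 := ho.emb.n16
    have ad := cp.adj ho.emb.sub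
    have pq : dp / 16 ≠ dq / 16 := fun k => by rw [k] at ad; exact S.irr _ ad
    have e1 : e / 16 = dp / 16 := by rw [he, key_div (by omega)]
    have e2 : e % 16 = dq / 16 := by rw [he, key_mod (by omega)]
    have e256 : e < 256 := by omega
    have e3 : rev e / 16 = dq / 16 := by rw [rev_div e256, e2]
    have e4 : rev e % 16 = dp / 16 := by rw [rev_mod e256, e1]
    have n1 : e ≠ rev e := fun k => pq (by rw [← e1, ← e3, ← k])
    have ne' : ¬ tb o.D (rev e) = true := fun k => ne (by
      have := ho.emb.revD k; rwa [rev_rev e256] at this)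
    have n2 : e ≠ dp := by rintro rfl; exact ne hp
    have n3 : e ≠ dq := by rintro rfl; exact ne hq
    have n4 : rev e ≠ dp := fun k => ne' (k ▸ hp)
    have n5 : rev e ≠ dq := fun k => ne' (k ▸ hq)
    have n6 : dp ≠ dq := fun k => pq (by rw [k])
    have s4 := fun x => fld_setF (setF (setF (setF o.T e (fld o.T dp)) (rev e) (fld o.T dq)) dp (rev e))
      dq e x e256
    have s3 := fun x => fld_setF (setF (setF o.T e (fld o.T dp)) (rev e) (fld o.T dq)) dp (rev e) x
      (rev_lt e256)
    have s2 := fun x => fld_setF (setF o.T e (fld o.T dp)) (rev e) (fld o.T dq) x (fld_lt _ _)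
    have s1 := fun x => fld_setF o.T e (fld o.T dp) x (fld_lt _ _)
    refine ⟨ho.emb, hp, hq, he, ne, cp, cq, fun d => ?_, ?_, ?_, ?_, ?_, ?_⟩
    · rw [hD', tb_lor, tb_lor, Bool.or_eq_true, Bool.or_eq_true, tb_pw, tb_pw]
    · rw [hT', s4, if_neg n3, s3, if_neg n2, s2, if_neg n1, s1, if_pos rfl]
    · rw [hT', s4, if_neg n5, s3, if_neg n4, s2, if_pos rfl]
    · rw [hT', s4, if_neg n6, s3, if_pos rfl]
    · rw [hT', s4, if_pos rfl]
    · intro d k1 k2 k3 k4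
      rw [hT', s4, if_neg k4, s3, if_neg k3, s2, if_neg k2, s1, if_neg k1]
  have hcard : ((Finset.range 256).filter fun d => tb D' d = true).card = Nat.add o.nD 2 := by
    rw [card_bits hX, ho.nD]
  have hdp : Has (A :: ra) dp := has_cons.2 (Or.inl hA)
  have hok := hreg.ok _ (List.mem_cons_self ..)
  have hdj := List.pairwise_cons.1 hok.dj
  have deD : tb D' e = true := (hX.hD e).2 (by simp)
  have deD' : tb D' (rev e) = true := (hX.hD _).2 (by simp)
  by_cases hAq : tb A.1 dq = true
  · rw [hAq, cond_true, Bool.and_eq_true] at h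
    obtain ⟨o1, h, w1, m1, f1⟩ := hX.orbW deD h.2
    obtain ⟨o2, h, w2, m2, f2⟩ := hX.orbW deD' h
    simp only [Bool.and_eq_true] at h
    obtain ⟨⟨⟨h1, h2⟩, h3⟩, h4⟩ := h
    have b1 : ∀ d, (tb o1.1 d = true ∨ tb o2.1 d = true) ↔ (tb A.1 d = true ∨ d = e ∨ d = rev e) := by
      intro d
      have := tb_congr h1 d
      simp only [tb_lor] at this
      rw [← Bool.or_eq_true, this, Bool.or_eq_true, Bool.or_eq_true, tb_pw, tb_pw]
    have b2 : ∀ d, tb o1.1 d = true → ¬ tb o2.1 d = true := by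
      intro d k1 k2
      have := tb_congr h2 d
      rw [tb_land, k1, k2, tb_zero] at this
      exact absurd this (by simp)
    have wra : ∀ w ∈ ra, WOk D' T' m w := fun w hw =>
      hX.wok (hok.ok w (by simp [hw])) (hdj.1 w hw dp hA) (hdj.1 w hw dq hAq)
    have dA : ∀ w ∈ ra, ∀ d, (tb o1.1 d = true ∨ tb o2.1 d = true) → ¬ tb w.1 d = true := by
      intro w hw d k k'
      have hd := (hok.ok w (by simp [hw])).sub k'
      rcases (b1 d).1 k with k | k | k
      · exact hdj.1 w hw d k k'
      · exact hX.ne_e hd k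
      · exact hX.ne_e' hd k
    have hside : ∀ w ∈ ra, ∀ d, tb w.1 d = true → S.FR (Gr D' m) (img m d) (img m e) ∨
        S.FR (Gr D' m) (img m d) (img m (rev e)) := fun w hw d k =>
      hX.side (hok.conn hdp (has_cons.2 (Or.inr ⟨w, hw, k⟩)))
    by_cases c : S.FR (Gr D' m) (img m e) (img m (rev e))
    · refine ⟨_, h3, ⟨hX.toEmb, ?_, hcard⟩, rfl, hX.hD⟩
      refine hX.assemble (R := [o1 :: o2 :: ra]) hreg hdp ?_ (by simp) ?_ ?_
      · simp only [List.mem_singleton, forall_eq]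
        have key : ∀ d, Has (o1 :: o2 :: ra) d → S.FR (Gr D' m) (img m e) (img m d) := by
          intro d hd
          rcases has_cons.1 hd with k | hd
          · exact f1 d k
          · rcases has_cons.1 hd with k | ⟨w, hw, k⟩
            · exact c.trans (f2 d k)
            · rcases hside w hw d k with k | k
              exacts [k.symm, c.trans k.symm]
        refine ⟨?_, ?_, fun h1 h2 => (key _ h1).symm.trans (key _ h2)⟩
        · simp only [List.mem_cons, forall_eq_or_imp]
          exact ⟨w1, w2, wra⟩
        · refine List.pairwise_cons.2 ⟨?_, List.pairwise_cons.2 ⟨?_, hdj.2⟩⟩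
          · simp only [List.mem_cons, forall_eq_or_imp]
            exact ⟨b2, fun w hw d k => dA w hw d (Or.inl k)⟩
          · exact fun w hw d k => dA w hw d (Or.inr k)
      · simp only [List.mem_singleton, forall_eq]
        intro d hd
        rw [has_cons, has_cons, ← or_assoc, b1] at hd
        rw [has_cons]; tauto
      · intro d hd
        refine ⟨_, List.mem_singleton_self _, ?_⟩
        rw [has_cons, has_cons, ← or_assoc, b1]
        rw [has_cons] at hd; tauto
    · obtain ⟨s, t, p3, hs, ht, h4⟩ := parts_spec
        (fun w => ∃ d, tb w.1 d = true ∧ S.FR (Gr D' m) (img m d) (img m e)) h4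
      have hS : ∀ w ∈ s, w ∈ ra := fun w hw => p3.mem_iff.2 (by simp [hw])
      have hT : ∀ w ∈ t, w ∈ ra := fun w hw => p3.mem_iff.2 (by simp [hw])
      have hst := List.pairwise_append.1 (hdj.2.perm p3 fun h d h1 h2 => h d h2 h1)
      have hras : ∀ d, Has ra d ↔ Has s d ∨ Has t d := fun d => by
        rw [← has_append]; exact Has.perm p3
      have key1 : ∀ d, Has (o1 :: s) d → S.FR (Gr D' m) (img m e) (img m d) := by
        intro d hd
        rcases has_cons.1 hd with k | ⟨w, hw, k⟩
        · exact f1 d k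
        · obtain ⟨d', hd', k'⟩ := hs w hw
          exact k'.symm.trans ((wra w (hS w hw)).fr hX.toEmb hd' k)
      have key2 : ∀ d, Has (o2 :: t) d → S.FR (Gr D' m) (img m (rev e)) (img m d) := by
        intro d hd
        rcases has_cons.1 hd with k | ⟨w, hw, k⟩
        · exact f2 d k
        · rcases hside w (hT w hw) d k with k' | k'
          · exact absurd ⟨d, k, k'⟩ (ht w hw)
          · exact k'.symm
      refine ⟨_, h4, ⟨hX.toEmb, ?_, hcard⟩, rfl, hX.hD⟩
      refine hX.assemble (R := [o1 :: s, o2 :: t]) hreg hdp ?_ ?_ ?_ ?_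
      · simp only [List.mem_cons, forall_eq_or_imp, List.not_mem_nil, false_imp_iff,
          implies_true, and_true]
        refine ⟨⟨?_, ?_, fun h1 h2 => (key1 _ h1).symm.trans (key1 _ h2)⟩,
          ⟨?_, ?_, fun h1 h2 => (key2 _ h1).symm.trans (key2 _ h2)⟩⟩
        · simp only [List.mem_cons, forall_eq_or_imp]
          exact ⟨w1, fun w hw => wra w (hS w hw)⟩
        · exact List.pairwise_cons.2 ⟨fun w hw d k => dA w (hS w hw) d (Or.inl k), hst.1⟩
        · simp only [List.mem_cons, forall_eq_or_imp]
          exact ⟨w2, fun w hw => wra w (hT w hw)⟩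
        · exact List.pairwise_cons.2 ⟨fun w hw d k => dA w (hT w hw) d (Or.inr k), hst.2.1⟩
      · simp only [List.pairwise_cons, List.mem_singleton, forall_eq, List.not_mem_nil,
          false_imp_iff, implies_true, List.Pairwise.nil, and_true]
        exact fun d d' hd hd' f => c ((key1 d hd).trans (f.trans (key2 d' hd').symm))
      · simp only [List.mem_cons, forall_eq_or_imp, List.not_mem_nil, false_imp_iff,
          implies_true, and_true]
        constructor <;> intro d hd <;> rw [has_cons] at hd <;> rw [has_cons, hras] <;>
          have := b1 d <;> tauto
      · intro d hd
        rw [has_cons, hras] at hd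
        have : Has (o1 :: s) d ∨ Has (o2 :: t) d := by
          rw [has_cons, has_cons]; have := b1 d; tauto
        rcases this with k | k
        exacts [⟨_, by simp, k⟩, ⟨_, by simp, k⟩]
  · rw [Bool.eq_false_iff.2 hAq, cond_false] at h
    rcases findW_spec h with ⟨B, rb, p3, hB, h⟩ | ⟨h, -⟩
    · rw [Bool.and_eq_true] at h
      obtain ⟨o1, h, w1, m1, f1⟩ := hX.orbW deD h.2
      rw [Bool.and_eq_true] at h
      have b1 : ∀ d, tb o1.1 d = true ↔ ((tb A.1 d = true ∨ tb B.1 d = true) ∨ d = e ∨ d = rev e) := by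
        intro d
        rw [tb_congr h.1 d]
        simp only [tb_lor, Bool.or_eq_true, tb_pw]
      have hB' : B ∈ ra := p3.mem_iff.2 (by simp)
      have hrb : ∀ w ∈ rb, w ∈ ra := fun w hw => p3.mem_iff.2 (by simp [hw])
      have hdB := List.pairwise_cons.1 (hdj.2.perm p3 fun h d h1 h2 => h d h2 h1)
      have wrb : ∀ w ∈ rb, WOk D' T' m w := fun w hw =>
        hX.wok (hok.ok w (by simp [hrb w hw])) (hdj.1 w (hrb w hw) dp hA) (hdB.1 w hw dq hB)
      have hras : ∀ d, Has ra d ↔ tb B.1 d = true ∨ Has rb d := fun d => by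
        rw [← has_cons]; exact Has.perm p3
      have hc : S.FR (Gr D' m) (img m e) (img m (rev e)) := f1 _ ((b1 _).2 (by simp))
      refine ⟨_, h.2, ⟨hX.toEmb, ?_, hcard⟩, rfl, hX.hD⟩
      refine hX.assemble (R := [o1 :: rb]) hreg hdp ?_ (by simp) ?_ ?_
      · simp only [List.mem_singleton, forall_eq]
        have key : ∀ d, Has (o1 :: rb) d → S.FR (Gr D' m) (img m e) (img m d) := by
          intro d hd
          rcases has_cons.1 hd with k | ⟨w, hw, k⟩
          · exact f1 d k
          · rcases hX.side (hok.conn hdp (has_cons.2 (Or.inr ⟨w, hrb w hw, k⟩))) with k | k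
            exacts [k.symm, hc.trans k.symm]
        refine ⟨?_, ?_, fun h1 h2 => (key _ h1).symm.trans (key _ h2)⟩
        · simp only [List.mem_cons, forall_eq_or_imp]
          exact ⟨w1, wrb⟩
        · refine List.pairwise_cons.2 ⟨?_, hdB.2⟩
          intro w hw d k k'
          have hd := (hok.ok w (by simp [hrb w hw])).sub k'
          rcases (b1 d).1 k with (k | k) | k | k
          exacts [hdj.1 w (hrb w hw) d k k', hdB.1 w hw d k k', hX.ne_e hd k, hX.ne_e' hd k]
      · simp only [List.mem_singleton, forall_eq]
        intro d hd
        rw [has_cons, b1] at hd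
        rw [has_cons, hras]; tauto
      · intro d hd
        refine ⟨_, List.mem_singleton_self _, ?_⟩
        rw [has_cons, b1]
        rw [has_cons, hras] at hd; tauto
    · exfalso
      have h1 : ¬ Has (A :: ra) dq := by rw [has_cons]; tauto
      obtain ⟨r, hr, k⟩ := hreg.cov hq
      rcases List.mem_cons.1 hr with rfl | hr
      · exact h1 k
      · exact (List.pairwise_cons.1 hreg.sep).1 r hr dp dq hdp k
          (hX.fr_p.trans (hX.fr_e.trans hX.fr_q.symm))

end NSC

namespace NSC
open Chk

/-- a new vertex attached by a pendant edge -/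
structure Pnd (S : Surf) (n D T : ℕ) (m : ℕ → ℕ) (dp e D' T' : ℕ) : Prop where
  emb : Emb S n D T m
  n16 : n < 16
  hp : tb D dp = true
  he : e = key (dp / 16) n
  cp : S.InC (Gr D m) (m (dp / 16)) (m (dp % 16)) (m n)
  new : ∀ {a}, a < n → m a ≠ m n
  hD : ∀ d, tb D' d = true ↔ tb D d = true ∨ d = e ∨ d = rev e
  t1 : fld T' e = fld T dp
  t2 : fld T' (rev e) = e
  t3 : fld T' dp = rev e
  t5 : ∀ d, d ≠ e → d ≠ rev e → d ≠ dp → fld T' d = fld T d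

namespace Pnd
variable {S : Surf} {n D T : ℕ} {m : ℕ → ℕ} {dp e D' T' : ℕ}

theorem lp (h : Pnd S n D T m dp e D' T') : dp / 16 < n := (h.emb.lt h.hp).1
theorem e1 (h : Pnd S n D T m dp e D' T') : e / 16 = dp / 16 := by
  rw [h.he, key_div h.n16]
theorem e2 (h : Pnd S n D T m dp e D' T') : e % 16 = n := by
  rw [h.he, key_mod h.n16]
theorem e256 (h : Pnd S n D T m dp e D' T') : e < 256 := by
  have := h.e1; have := h.lp; have := h.emb.n16; omega
theorem e3 (h : Pnd S n D T m dp e D' T') : rev e / 16 = n := by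
  rw [rev_div h.e256, h.e2]
theorem e4 (h : Pnd S n D T m dp e D' T') : rev e % 16 = dp / 16 := by
  rw [rev_mod h.e256, h.e1]
theorem ad (h : Pnd S n D T m dp e D' T') : S.adj (m (dp / 16)) (m n) := h.cp.adj h.emb.sub

theorem gr (h : Pnd S n D T m dp e D' T') {u v} : Gr D' m u v ↔ Gr D m u v ∨
    (u = m (dp / 16) ∧ v = m n) ∨ (u = m n ∧ v = m (dp / 16)) := by
  constructor
  · rintro ⟨d, hd, rfl, rfl⟩
    rcases (h.hD d).1 hd with hd | rfl | rfl
    · exact Or.inl ⟨d, hd, rfl, rfl⟩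
    · rw [h.e1, h.e2]; exact Or.inr (Or.inl ⟨rfl, rfl⟩)
    · rw [h.e3, h.e4]; exact Or.inr (Or.inr ⟨rfl, rfl⟩)
  · rintro (⟨d, hd, rfl, rfl⟩ | ⟨rfl, rfl⟩ | ⟨rfl, rfl⟩)
    exacts [⟨d, (h.hD d).2 (Or.inl hd), rfl, rfl⟩, ⟨e, (h.hD e).2 (by simp), by rw [h.e1], by rw [h.e2]⟩,
      ⟨rev e, (h.hD _).2 (by simp), by rw [h.e3], by rw [h.e4]⟩]

theorem gr_sub (h : Pnd S n D T m dp e D' T') (u v) (g : Gr D m u v) : Gr D' m u v :=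
  h.gr.2 (Or.inl g)

theorem sub (h : Pnd S n D T m dp e D' T') : S.IsSub (Gr D' m) where
  adj g := by
    rcases h.gr.1 g with g | ⟨rfl, rfl⟩ | ⟨rfl, rfl⟩
    exacts [h.emb.sub.adj g, h.ad, S.symm h.ad]
  symm g := by
    rcases h.gr.1 g with g | ⟨rfl, rfl⟩ | ⟨rfl, rfl⟩
    exacts [h.gr.2 (Or.inl (h.emb.sub.symm g)), h.gr.2 (Or.inr (Or.inr ⟨rfl, rfl⟩)),
      h.gr.2 (Or.inr (Or.inl ⟨rfl, rfl⟩))]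

theorem no (h : Pnd S n D T m dp e D' T') {x} : ¬ Gr D m (m n) x := by
  rintro ⟨d, hd, k, -⟩
  exact h.new (h.emb.lt hd).1 k

theorem ng (h : Pnd S n D T m dp e D' T') : ¬ Gr D m (m (dp / 16)) (m n) :=
  fun g => h.no (h.emb.sub.symm g)

theorem ne_e (h : Pnd S n D T m dp e D' T') {d} (hd : tb D d = true) : d ≠ e := by
  rintro rfl
  have := (h.emb.lt hd).2
  rw [h.e2] at this
  omega
theorem ne_e' (h : Pnd S n D T m dp e D' T') {d} (hd : tb D d = true) : d ≠ rev e := by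
  rintro rfl
  have := (h.emb.lt hd).1
  rw [h.e3] at this
  omega
theorem nee (h : Pnd S n D T m dp e D' T') : e ≠ rev e := fun k => by
  have := h.e1; rw [k, h.e3] at this; have := h.lp; omega

theorem hp' (h : Pnd S n D T m dp e D' T') {x} (g : Gr D' m (m (dp / 16)) x) :
    Gr D m (m (dp / 16)) x ∨ x = m n := by
  rcases h.gr.1 g with g | ⟨-, g⟩ | ⟨g, -⟩
  exacts [Or.inl g, Or.inr g, absurd g (S.ne h.ad)]

theorem toEmb (h : Pnd S n D T m dp e D' T') : Emb S (n + 1) D' T' m where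
  n16 := h.n16
  inj {a b} ha hb k := by
    have := @h.emb.inj
    have := @h.new
    grind
  lt hd := by
    have := h.lp
    rcases (h.hD _).1 hd with hd | rfl | rfl
    · have := h.emb.lt hd; omega
    · rw [h.e1, h.e2]; omega
    · rw [h.e3, h.e4]; omega
  revD hd := by
    rcases (h.hD _).1 hd with hd | rfl | rfl
    · exact (h.hD _).2 (Or.inl (h.emb.revD hd))
    · exact (h.hD _).2 (by simp)
    · rw [rev_rev h.e256]; exact (h.hD _).2 (by simp)
  adj hd := by
    rcases (h.hD _).1 hd with hd | rfl | rfl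
    · exact h.emb.adj hd
    · rw [h.e1, h.e2]; exact h.ad
    · rw [h.e3, h.e4]; exact S.symm h.ad
  T1 {d} hd := by
    rw [h.hD]
    rcases (h.hD _).1 hd with hd | rfl | rfl
    · by_cases k : d = dp
      · rw [k, h.t3]; simp
      · rw [h.t5 d (h.ne_e hd) (h.ne_e' hd) k]; exact Or.inl (h.emb.T1 hd)
    · rw [h.t1]; exact Or.inl (h.emb.T1 h.hp)
    · rw [h.t2]; simp
  T2 {d} hd := by
    rcases (h.hD _).1 hd with hd | rfl | rfl
    · by_cases k : d = dp
      · rw [k, h.t3, h.e4]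
      · rw [h.t5 d (h.ne_e hd) (h.ne_e' hd) k]; exact h.emb.T2 hd
    · rw [h.t1, h.emb.T2 h.hp, h.e1]
    · rw [h.t2, h.e2, h.e3]
  nx {d} hd := by
    have gq : Gr D' m (m n) (m (dp / 16)) := h.gr.2 (by simp)
    rcases (h.hD _).1 hd with hd | rfl | rfl
    · by_cases k : d = dp
      · rw [k, h.t3, h.e3]
        exact Surf.Nx.new h.sub h.gr_sub (fun x => h.hp') (h.gr.2 (by simp)) h.ng h.cp
      · rw [h.t5 d (h.ne_e hd) (h.ne_e' hd) k]
        refine Surf.Nx.keep h.gr_sub (h.emb.nx hd) ?_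
        intro x hx g
        rcases h.gr.1 g with g | ⟨g', rfl⟩ | ⟨g', rfl⟩
        · exact g
        · rw [g'] at hx
          refine absurd (h.emb.img_inj hd h.hp ?_) k
          rw [img, img, g', hx.unique h.emb.sub h.cp]
        · exact absurd g'.symm (fun k => h.new (h.emb.lt hd).1 k.symm)
    · rw [h.t1, h.e1, h.e2]
      exact Surf.Nx.after h.sub h.gr_sub (fun x => h.hp') (h.gr.2 (by simp)) h.ng h.cp
        (h.emb.nx h.hp)
    · rw [h.t2, h.e3, h.e4, h.e1]
      obtain ⟨y, hy⟩ := Surf.Nx.exists h.sub gq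
      have : y = m (dp / 16) := by
        rcases h.gr.1 hy.right with g | ⟨g, -⟩ | ⟨-, g⟩
        · exact absurd g h.no
        · exact absurd g (h.new h.lp).symm
        · exact g
      rwa [this] at hy

theorem img_e (h : Pnd S n D T m dp e D' T') : img m e = (m (dp / 16), m n) := by
  rw [img, h.e1, h.e2]
theorem img_e' (h : Pnd S n D T m dp e D' T') : img m (rev e) = (m n, m (dp / 16)) := by
  rw [img, h.e3, h.e4]

theorem fr_e (h : Pnd S n D T m dp e D' T') : S.FR (Gr D' m) (img m e) (img m (rev e)) := by
  have := h.toEmb.fr_T ((h.hD (rev e)).2 (by simp))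
  rw [h.t2] at this
  exact this.symm

theorem fr (h : Pnd S n D T m dp e D' T') {x y} : S.FR (Gr D' m) x y ↔ S.FR (Gr D m) x y := by
  refine ⟨fun k => k.mono fun g => h.gr_sub _ _ g, fun k => ?_⟩
  have := h.fr_e
  rcases k.insert (fun g => h.gr.1 g) with k | ⟨k, k'⟩ | ⟨k, k'⟩
  · exact k
  · rw [← h.img_e] at k; rw [← h.img_e'] at k'; exact k.trans (this.trans k')
  · rw [← h.img_e'] at k; rw [← h.img_e] at k'; exact k.trans (this.symm.trans k')

theorem wok (h : Pnd S n D T m dp e D' T') {w} (hw : WOk D T m w) (h1 : ¬ tb w.1 dp = true) :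
    WOk D' T' m w where
  one := by
    obtain ⟨d, hd, h3⟩ := hw.one
    refine ⟨d, hd, fun P p0 p1 => h3 P p0 fun x hx hP => ?_⟩
    rw [← h.t5 x (h.ne_e (hw.sub hx)) (h.ne_e' (hw.sub hx)) (fun k => h1 (k ▸ hx))]
    exact p1 x hx hP
  sub hd := (h.hD _).2 (Or.inl (hw.sub hd))
  cl {d} hd := by
    rw [h.t5 d (h.ne_e (hw.sub hd)) (h.ne_e' (hw.sub hd)) (fun k => h1 (k ▸ hd))]
    exact hw.cl hd
  ev hs := hw.ev fun d hd => hs d ((h.hD d).2 (Or.inl hd))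

end Pnd

theorem Emb.orbW {S : Surf} {n D T m} (h : Emb S n D T m) {d f} {k : ℕ × ℕ → Bool} (hd : tb D d = true)
    (ho : orb T d f d 0 0 k = true) : ∃ w, k w = true ∧ WOk D T m w ∧ tb w.1 d = true ∧
      ∀ x, tb w.1 x = true → S.FR (Gr D m) (img m d) (img m x) := by
  obtain ⟨w, h1, h2, h3, h4, h5⟩ := orb_spec ho
  have h6 := h4 (fun x => tb D x = true ∧ S.FR (Gr D m) (img m d) (img m x)) ⟨hd, .refl _⟩
    fun x hx => ⟨h.T1 hx.1, hx.2.trans (h.fr_T hx.1)⟩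
  exact ⟨w, h1, ⟨⟨d, h2, fun P p0 p1 x hx =>
    (h4 (fun x => tb w.1 x = true ∧ P x) ⟨h2, p0⟩ (fun x hx => ⟨h3 x hx.1, p1 x hx.1 hx.2⟩) x hx).2⟩,
    fun hx => (h6 _ hx).1, fun hx => h3 _ hx, fun hs => h5 _ _ fun x hx =>
    ⟨h.lt256 (h6 x hx).1, hs x (h6 x hx).1⟩⟩, h2, fun x hx => (h6 x hx).2⟩

theorem pend_spec {S : Surf} {o : St} {m : ℕ → ℕ} (ho : EmbS S o m) {dp : ℕ}
    {k : St → Bool} (h : pend o dp k = true) (n16 : o.n < 16) (hp : tb o.D dp = true)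
    (cp : S.InC (Gr o.D m) (m (dp / 16)) (m (dp % 16)) (m o.n))
    (new : ∀ {a}, a < o.n → m a ≠ m o.n) :
    ∃ o', k o' = true ∧ EmbS S o' m ∧ o'.n = o.n + 1 ∧ ∀ d, tb o'.D d = true ↔
      tb o.D d = true ∨ d = key (dp / 16) o.n ∨ d = rev (key (dp / 16) o.n) := by
  obtain ⟨rg, rest, p1, hrg, h⟩ := findR_spec h
  have hreg := ho.reg.perm p1
  rcases findW_spec h with ⟨A, ra, p2, hA, h⟩ | ⟨h, -⟩
  swap; · exact absurd hrg h
  have hreg := hreg.head p2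
  simp only [force_eq] at h
  have hdiv : Nat.div dp 16 = dp / 16 := rfl
  rw [hdiv] at h
  set e := key (dp / 16) o.n with he
  set T' := setF (setF (setF o.T e (fld o.T dp)) (rev e) e) dp (rev e) with hT'
  set D' := Nat.lor o.D (Nat.lor (pw e) (pw (rev e))) with hD'
  have hX : Pnd S o.n o.D o.T m dp e D' T' := by
    have l1 := ho.emb.lt hp
    have e1 : e / 16 = dp / 16 := by rw [he, key_div n16]
    have e2 : e % 16 = o.n := by rw [he, key_mod n16]
    have e256 : e < 256 := by omega
    have e3 : rev e / 16 = o.n := by rw [rev_div e256, e2]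
    have n1 : e ≠ rev e := fun k => by rw [← k, e1] at e3; omega
    have n2 : e ≠ dp := by rintro k; rw [k] at e2; omega
    have n3 : rev e ≠ dp := by rintro k; rw [k] at e3; omega
    have s3 := fun x => fld_setF (setF (setF o.T e (fld o.T dp)) (rev e) e) dp (rev e) x
      (rev_lt e256)
    have s2 := fun x => fld_setF (setF o.T e (fld o.T dp)) (rev e) e x e256
    have s1 := fun x => fld_setF o.T e (fld o.T dp) x (fld_lt _ _)
    refine ⟨ho.emb, n16, hp, he, cp, new, fun d => ?_, ?_, ?_, ?_, ?_⟩
    · rw [hD', tb_lor, tb_lor, Bool.or_eq_true, Bool.or_eq_true, tb_pw, tb_pw]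
    · rw [hT', s3, if_neg n2, s2, if_neg n1, s1, if_pos rfl]
    · rw [hT', s3, if_neg n3, s2, if_pos rfl]
    · rw [hT', s3, if_pos rfl]
    · intro d k1 k2 k3
      rw [hT', s3, if_neg k3, s2, if_neg k2, s1, if_neg k1]
  have deD : tb D' e = true := (hX.hD e).2 (by simp)
  have hcard : ((Finset.range 256).filter fun d => tb D' d = true).card = Nat.add o.nD 2 := by
    have h1 : (Finset.range 256).filter (fun d => tb D' d = true) =
        insert e (insert (rev e) ((Finset.range 256).filter fun d => tb o.D d = true)) := by
      ext d
      have := hX.e256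
      have := rev_lt hX.e256
      have := hX.hD d
      grind
    rw [h1, Finset.card_insert_of_notMem, Finset.card_insert_of_notMem, ho.nD]
    · intro k; exact hX.ne_e' (Finset.mem_filter.1 k).2 rfl
    · rw [Finset.mem_insert, not_or]
      exact ⟨hX.nee, fun k => hX.ne_e (Finset.mem_filter.1 k).2 rfl⟩
  obtain ⟨o1, h, w1, m1, f1⟩ := hX.toEmb.orbW deD h
  rw [Bool.and_eq_true] at h
  have b1 : ∀ d, tb o1.1 d = true ↔ (tb A.1 d = true ∨ d = e ∨ d = rev e) := by
    intro d
    rw [tb_congr h.1 d]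
    simp only [tb_lor, Bool.or_eq_true, tb_pw]
  refine ⟨_, h.2, ⟨hX.toEmb, ?_, hcard⟩, rfl, hX.hD⟩
  have hok := hreg.ok _ (List.mem_cons_self ..)
  have hdj := List.pairwise_cons.1 hok.dj
  have hsep := List.pairwise_cons.1 hreg.sep
  have hdp : Has (A :: ra) dp := has_cons.2 (Or.inl hA)
  have hh : ∀ d, Has (o1 :: ra) d ↔ Has (A :: ra) d ∨ d = e ∨ d = rev e := by
    intro d; rw [has_cons, has_cons, b1]; tauto
  have hall : ∀ d, Has (o1 :: ra) d → S.FR (Gr o.D m) (img m dp) (img m d) := by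
    intro d hd
    have fe : S.FR (Gr o.D m) (img m dp) (img m e) := by
      rw [hX.img_e]; exact Surf.FR.flag hX.emb.sub cp
    rcases (hh d).1 hd with k | rfl | rfl
    · exact hok.conn hdp k
    · exact fe
    · exact fe.trans (hX.fr.1 hX.fr_e)
  refine ⟨fun r hr => ?_, ?_, fun {d} hd => ?_⟩
  · rcases List.mem_cons.1 hr with rfl | hr
    · refine ⟨fun w hw => ?_, ?_, fun h1 h2 => hX.fr.2 ((hall _ h1).symm.trans (hall _ h2))⟩
      · rcases List.mem_cons.1 hw with rfl | hw
        · exact w1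
        · exact hX.wok (hok.ok w (by simp [hw])) (hdj.1 w hw dp hA)
      · refine List.pairwise_cons.2 ⟨fun w hw d k k' => ?_, hdj.2⟩
        have hd := (hok.ok w (by simp [hw])).sub k'
        rcases (b1 d).1 k with k | k | k
        exacts [hdj.1 w hw d k k', hX.ne_e hd k, hX.ne_e' hd k]
    · have := hreg.ok r (by simp [hr])
      refine ⟨fun w hw => hX.wok (this.ok w hw) fun k => ?_, this.dj,
        fun h1 h2 => hX.fr.2 (this.conn h1 h2)⟩
      exact hsep.1 r hr dp dp hdp ⟨w, hw, k⟩ (.refl _)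
  · refine List.pairwise_cons.2 ⟨fun r hr d d' hd hd' f => ?_, hsep.2.imp fun k d d' hd hd' f =>
      k d d' hd hd' (hX.fr.1 f)⟩
    exact hsep.1 r hr dp d' hdp hd' ((hall d hd).trans (hX.fr.1 f))
  · rcases (hX.hD d).1 hd with hd | hd
    · obtain ⟨r, hr, k⟩ := hreg.cov hd
      rcases List.mem_cons.1 hr with rfl | hr
      · exact ⟨_, by simp, (hh d).2 (Or.inl k)⟩
      · exact ⟨r, by simp [hr], k⟩
    · exact ⟨_, by simp, (hh d).2 (Or.inr hd)⟩

end NSC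

namespace NSC
open Chk

theorem pairwise_forall {α : Type*} {R : α → α → Prop} (hs : ∀ {a b}, R a b → R b a) {l : List α}
    (h : l.Pairwise R) {a b} (ha : a ∈ l) (hb : b ∈ l) (hne : a ≠ b) : R a b := by
  induction l with
  | nil => simp at ha
  | cons c l ih =>
    rw [List.pairwise_cons] at h
    rcases List.mem_cons.1 ha with ea | ha <;> rcases List.mem_cons.1 hb with eb | hb
    · exact absurd (ea.trans eb.symm) hne
    · exact ea ▸ h.1 _ hb
    · exact eb ▸ hs (h.1 _ ha)
    · exact ih h.2 ha hb

open scoped Classical in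
theorem darts_image {S : Surf} {n D T m} (h : Emb S n D T m) :
    S.darts.filter (fun d => Gr D m d.1 d.2) =
      ((Finset.range 256).filter fun d => tb D d = true).image (img m) := by
  ext ⟨u, v⟩
  simp only [Finset.mem_filter, Finset.mem_image, Finset.mem_range, Surf.mem_darts]
  constructor
  · rintro ⟨-, d, hd, e1, e2⟩
    exact ⟨d, ⟨h.lt256 hd, hd⟩, by rw [img, e1, e2]⟩
  · rintro ⟨d, ⟨-, hd⟩, e⟩
    rw [img, Prod.mk.injEq] at e
    refine ⟨?_, d, hd, e.1, e.2⟩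
    show S.adj u v
    rw [← e.1, ← e.2]; exact h.adj hd

theorem ev_chain {S : Surf} {D T m} {φ : ℕ → ℕ → ZMod 2} (hφ : ∀ d, tb D d = true →
    φ (m (d / 16)) (m (d % 16)) = φ (m (d % 16)) (m (d / 16))) {r} (h : ROk S D T m r) :
    ev φ m (chain r) = ev φ m (wMask r) ∧ ∀ d, tb (wMask r) d = true ↔ Has r d := by
  have h1 := h.ok
  have h2 := h.dj
  clear h
  induction r with
  | nil => exact ⟨rfl, fun d => by simp [wMask, Has, tb_zero]⟩
  | cons w l ih =>
    rw [List.pairwise_cons] at h2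
    obtain ⟨i1, i2⟩ := ih (fun w hw => h1 w (by simp [hw])) h2.2
    refine ⟨?_, fun d => ?_⟩
    · show ev φ m (Nat.xor w.2 (chain l)) = ev φ m (Nat.lor w.1 (wMask l))
      rw [ev_xor, ev_or, i1, (h1 w (by simp)).ev hφ]
      intro d hd k
      obtain ⟨w', hw', k⟩ := (i2 d).1 k
      exact h2.1 w' hw' d hd k
    · show tb (Nat.lor w.1 (wMask l)) d = true ↔ _
      rw [tb_lor, Bool.or_eq_true, i2, has_cons]

theorem EmbS.ev_region {S : Surf} {o m} (h : EmbS S o m) {φ} (hφ : S.Coc φ) {r} (hr : r ∈ o.rs) :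
    ev φ m (chain r) = 0 := by
  obtain ⟨h1, h2⟩ := ev_chain (φ := φ) (fun d hd => hφ.symm (h.emb.adj hd)) (h.reg.ok r hr)
  rw [h1]
  have key := Surf.region_sum h.emb.sub hφ (fun f => ∃ d, Has r d ∧ S.FR (Gr o.D m) (img m d) f)
    fun {a b} f => ⟨fun ⟨d, k, k'⟩ => ⟨d, k, k'.trans f⟩, fun ⟨d, k, k'⟩ => ⟨d, k, k'.trans f.symm⟩⟩
  rw [darts_image h.emb, Finset.sum_image] at key
  swap
  · intro a ha b hb e
    exact h.emb.img_inj (Finset.mem_filter.1 ha).2 (Finset.mem_filter.1 hb).2 e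
  rw [← key, ev, Finset.sum_filter]
  refine Finset.sum_congr rfl fun d hd => ?_
  by_cases k : Has r d
  · rw [if_pos ((h2 d).2 k), if_pos (k.sub (h.reg.ok r hr)), if_pos ⟨d, k, .refl _⟩]
    rfl
  · rw [if_neg (fun k' => k ((h2 d).1 k'))]
    split_ifs with k1 k2
    · exfalso
      obtain ⟨d', k3, k4⟩ := k2
      obtain ⟨r', hr', k5⟩ := h.reg.cov k1
      have hne : r ≠ r' := fun e => k (e ▸ k5)
      have hp := h.reg.sep.imp (S := fun r r' => (∀ d d', Has r d → Has r' d' →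
        ¬ S.FR (Gr o.D m) (img m d) (img m d')) ∧ (∀ d d', Has r' d → Has r d' →
        ¬ S.FR (Gr o.D m) (img m d) (img m d'))) fun q => ⟨q, fun d d' a b f => q d' d b a f.symm⟩
      have := pairwise_forall (fun q => ⟨q.2, q.1⟩) hp hr hr' hne
      exact this.1 d' d k3 k5 k4
    · rfl
    · rfl

theorem null_spec {S : Surf} {o m} (h : EmbS S o m) {φ} (hφ : S.Coc φ) {c : ℕ}
    (hc : null c o.rs = true) : ev φ m c = 0 := by
  have : ∀ r ∈ o.rs, ev φ m (chain r) = 0 := fun r hr => h.ev_region hφ hr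
  revert hc this
  generalize o.rs = l
  intro hc hr0
  induction l generalizing c with
  | nil =>
    have : c = 0 := by simpa [null] using hc
    rw [this, ev_zero]
  | cons r l ih =>
    rw [null, Bool.or_eq_true, force_eq] at hc
    rcases hc with hc | hc
    · exact ih hc fun r hr => hr0 r (by simp [hr])
    · have := ih hc fun r hr => hr0 r (by simp [hr])
      rw [ev_xor, hr0 r (by simp), add_zero] at this
      exact this

theorem len_eq {α : Type} (l : List α) : len l = l.length := by
  induction l with
  | nil => rfl
  | cons a l ih => simp [len, ih]

theorem nWalks_eq (l : List (List (ℕ × ℕ))) : nWalks l = l.flatten.length := by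
  induction l with
  | nil => rfl
  | cons a l ih =>
    show len a + nWalks l = _
    rw [len_eq, ih]; simp

theorem tooBig_spec {S : Surf} {o m} (h : EmbS S o m) : tooBig o = false := by
  rw [Bool.eq_false_iff]
  intro hb
  have hb : 2 * (2 * o.rs.length + 2 + o.n) < o.nD + 2 * o.rs.flatten.length := by
    rw [← nWalks_eq, ← len_eq]
    exact blt_iff.1 hb
  set L := o.rs.flatten with hL
  have hok : ∀ w ∈ L, WOk o.D o.T m w := by
    intro w hw
    obtain ⟨r, hr, hw⟩ := List.mem_flatten.1 hw
    exact (h.reg.ok r hr).ok w hw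
  have hdj : L.Pairwise fun w w' => ∀ d, tb w.1 d = true → ¬ tb w'.1 d = true := by
    rw [hL, List.pairwise_flatten]
    refine ⟨fun r hr => (h.reg.ok r hr).dj, h.reg.sep.imp ?_⟩
    intro r r' q w hw w' hw' d k k'
    exact q d d ⟨w, hw, k⟩ ⟨w', hw', k'⟩ (.refl _)
  have hcov : ∀ {d}, tb o.D d = true → ∃ i : Fin L.length, tb (L[i]).1 d = true := by
    intro d hd
    obtain ⟨r, hr, w, hw, k⟩ := h.reg.cov hd
    obtain ⟨i, hi, e⟩ := List.mem_iff_getElem.1 (List.mem_flatten.2 ⟨r, hr, hw⟩ : w ∈ L)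
    exact ⟨⟨i, hi⟩, by rw [← e] at k; exact k⟩
  have huniq : ∀ {d} {i j : Fin L.length}, tb (L[i]).1 d = true → tb (L[j]).1 d = true → i = j := by
    intro d i j hi hj
    by_contra hne
    rw [List.pairwise_iff_getElem] at hdj
    rcases Nat.lt_or_gt_of_ne (fun e => hne (Fin.ext e)) with k | k
    · exact hdj i j i.2 j.2 k d hi hj
    · exact hdj j i j.2 i.2 k d hj hi
  by_cases hD : ∃ d, tb o.D d = true
  · obtain ⟨d0, h0⟩ := hD
    classical
    let cls : ℕ → ℕ → Fin L.length := fun v w =>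
      if k : ∃ i : Fin L.length, ∃ d, tb (L[i]).1 d = true ∧ img m d = (v, w) then k.choose
      else (hcov h0).choose
    have hcls : ∀ {i : Fin L.length} {d}, tb (L[i]).1 d = true →
        cls (m (d / 16)) (m (d % 16)) = i := by
      intro i d hd
      have k : ∃ i : Fin L.length, ∃ d', tb (L[i]).1 d' = true ∧
        img m d' = (m (d / 16), m (d % 16)) := ⟨i, d, hd, rfl⟩
      simp only [cls, dif_pos k]
      obtain ⟨d', k1, k2⟩ := k.choose_spec
      have s1 := (hok _ (List.getElem_mem k.choose.2)).sub k1
      have s2 := (hok _ (List.getElem_mem i.2)).sub hd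
      rw [h.emb.img_inj s1 s2 k2] at k1
      exact huniq k1 hd
    let reg : Fin o.rs.length → ℕ × ℕ := fun i =>
      if k : ∃ d, Has (o.rs[i]) d then img m k.choose else (0, 0)
    have := Surf.bound h.emb.sub (Emb.gr h0) cls (W := Fin L.length) ?_ ?_ reg ?_ (n := o.n) ?_
    · rw [darts_image h.emb, Finset.card_image_of_injOn, h.nD, Fintype.card_fin] at this
      · omega
      · intro a ha b hb e
        exact h.emb.img_inj (Finset.mem_filter.1 ha).2 (Finset.mem_filter.1 hb).2 e
    · intro v w y hN
      obtain ⟨d, hd, rfl, rfl⟩ := hN.left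
      have e := hN.unique (h.emb.nx hd)
      obtain ⟨i, hi⟩ := hcov hd
      have h2 := (hok _ (List.getElem_mem i.2)).cl hi
      have h3 := hcls (i := i) h2
      rw [h.emb.T2 hd] at h3
      rw [hcls hi, e, h3]
    · intro i
      obtain ⟨d, hd, -⟩ := (hok _ (List.getElem_mem i.2)).one
      exact ⟨_, _, Emb.gr ((hok _ (List.getElem_mem i.2)).sub hd), hcls (i := i) hd⟩
    · rintro v w ⟨d, hd, rfl, rfl⟩
      obtain ⟨r, hr, k⟩ := h.reg.cov hd
      obtain ⟨i, hi, rfl⟩ := List.mem_iff_getElem.1 hr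
      refine ⟨⟨i, hi⟩, ?_⟩
      have k' : ∃ d, Has (o.rs[i]) d := ⟨d, k⟩
      have e : reg ⟨i, hi⟩ = img m k'.choose := dif_pos k'
      rw [e]
      exact (h.reg.ok _ (List.getElem_mem hi)).conn k'.choose_spec k
    · calc _ ≤ ((Finset.range o.n).image m).card := Finset.card_le_card ?_
        _ ≤ _ := Finset.card_image_le.trans (by simp)
      intro v hv
      obtain ⟨-, w, d, hd, rfl, -⟩ := Finset.mem_filter.1 hv
      exact Finset.mem_image_of_mem _ (Finset.mem_range.2 (h.emb.lt hd).1)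
  · have h1 : L = [] := by
      rw [List.eq_nil_iff_forall_not_mem]
      intro w hw
      obtain ⟨d, hd, -⟩ := (hok w hw).one
      exact hD ⟨d, (hok w hw).sub hd⟩
    have h2 : o.nD = 0 := by
      rw [← h.nD, Finset.card_eq_zero, Finset.filter_eq_empty_iff]
      exact fun d _ k => hD ⟨d, k⟩
    rw [h1, h2] at hb
    simp at hb

end NSC

namespace NSC
open Chk

/-- the starting dart of a corner -/
def dart (c : Cn) : ℕ := key c.1 c.2.1

/-- `w` is an orbit of the table `T`, with its boundary -/
structure OrbW (T : ℕ) (w : ℕ × ℕ) : Prop where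
  cl : ∀ x, tb w.1 x = true → tb w.1 (fld T x) = true
  one : ∃ d, tb w.1 d = true ∧ ∀ P : ℕ → Prop, P d → (∀ x, P x → P (fld T x)) →
    ∀ x, tb w.1 x = true → P x
  ev : ∀ φ m, (∀ x, tb w.1 x = true → x < 256 ∧
        φ (m (x / 16)) (m (x % 16)) = φ (m (x % 16)) (m (x / 16))) → ev φ m w.2 = ev φ m w.1

/-- `r` lists the facial walks of the region with corners `g` -/
structure WR (T : ℕ) (g : List Cn) (r : List (ℕ × ℕ)) : Prop where
  ok : ∀ w ∈ r, OrbW T w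
  dj : r.Pairwise fun w w' => ∀ d, tb w.1 d = true → ¬ tb w'.1 d = true
  has : ∀ d, Has r d ↔ ∃ c ∈ g, dart c = d

/-- the state `o` describes the corners `K` -/
structure RootOk (K : Ks) (o : St) : Prop where
  n : o.n = K.1
  n16 : K.1 < 16
  lt : ∀ g ∈ K.2, ∀ c ∈ g, c.1 < K.1 ∧ c.2.1 < K.1
  D : ∀ d, tb o.D d = true ↔ ∃ g ∈ K.2, ∃ c ∈ g, dart c = d
  T : ∀ g ∈ K.2, ∀ c ∈ g, fld o.T (dart c) = key c.2.2 c.1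
  nD : ((Finset.range 256).filter fun d => tb o.D d = true).card = o.nD
  rs : List.Forall₂ (WR o.T) K.2.reverse o.rs
  dj : K.2.Pairwise fun g g' => ∀ c ∈ g, ∀ c' ∈ g', dart c ≠ dart c'

theorem app_eq {α : Type} (k l : List α) : app k l = k ++ l := by
  induction k with
  | nil => rfl
  | cons a k ih => simp [app, ih]

theorem flat_eq {α : Type} (l : List (List α)) : flat l = l.flatten := by
  induction l with
  | nil => rfl
  | cons a k ih => simp [flat, ih, app_eq]

theorem cMask_spec (g : List Cn) (d : ℕ) : tb (cMask g) d = true ↔ ∃ c ∈ g, dart c = d := by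
  induction g with
  | nil => simp [cMask, tb_zero]
  | cons c l ih =>
    unfold cMask
    rw [tb_lor, Bool.or_eq_true, tb_pw, ih]
    simp only [List.mem_cons, exists_eq_or_imp, dart, eq_comm (a := d)]

theorem okC_spec {n t : ℕ} : ∀ {l : List Cn} {a : ℕ} {k}, okC n t l a k = true →
    ∃ a', k a' = true ∧ (∀ c ∈ l, c.1 < n ∧ c.2.1 < n ∧ ¬ tb a (dart c) = true ∧
      fld t (dart c) = key c.2.2 c.1) ∧ (l.map dart).Nodup ∧
      ∀ d, tb a' d = true ↔ tb a d = true ∨ ∃ c ∈ l, dart c = d := by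
  intro l
  induction l with
  | nil => intro a k h; exact ⟨a, h, by simp, by simp, by simp⟩
  | cons c l ih =>
    intro a k h
    unfold okC at h
    simp only [force_eq, Bool.and_eq_true, blt_iff, beq_iff, Bool.not_eq_true'] at h
    obtain ⟨⟨h1, h2⟩, ⟨h3, h4⟩, h5⟩ := h
    obtain ⟨a', k1, k2, k3, k4⟩ := ih h5
    have k2' : ∀ c' ∈ l, ¬ tb a (dart c') = true ∧ dart c' ≠ dart c := by
      intro c' hc
      have := (k2 c' hc).2.2.1
      rw [tb_lor, Bool.or_eq_true, tb_pw] at this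
      exact ⟨fun e => this (Or.inl e), fun e => this (Or.inr e)⟩
    refine ⟨a', k1, ?_, ?_, ?_⟩
    · intro c' hc
      rcases List.mem_cons.1 hc with rfl | hc
      · exact ⟨h1, h2, by rw [dart, h3]; simp, h4⟩
      · exact ⟨(k2 _ hc).1, (k2 _ hc).2.1, (k2' _ hc).1, (k2 _ hc).2.2.2⟩
    · rw [List.map_cons, List.nodup_cons]
      refine ⟨?_, k3⟩
      rw [List.mem_map]
      rintro ⟨c', hc, e⟩
      exact (k2' c' hc).2 e
    · intro d
      rw [k4, tb_lor, Bool.or_eq_true, tb_pw]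
      simp only [List.mem_cons, exists_eq_or_imp, dart, or_assoc, eq_comm (a := d)]

theorem walks_spec {t : ℕ} : ∀ {l : List Cn} {a : ℕ} {ws : List (ℕ × ℕ)} {k},
    walks t l a ws k = true → (∀ w ∈ ws, OrbW t w) →
    (ws.Pairwise fun w w' => ∀ d, tb w.1 d = true → ¬ tb w'.1 d = true) →
    (∀ d, Has ws d ↔ tb a d = true) →
    ∃ ws' a', k ws' a' = true ∧ (∀ w ∈ ws', OrbW t w) ∧
    (ws'.Pairwise fun w w' => ∀ d, tb w.1 d = true → ¬ tb w'.1 d = true) ∧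
    (∀ d, Has ws' d ↔ tb a' d = true) := by
  intro l
  induction l with
  | nil => intro a ws k h h1 h2 h3; exact ⟨ws, a, h, h1, h2, h3⟩
  | cons c l ih =>
    intro a ws k h h1 h2 h3
    unfold walks at h
    simp only [force_eq] at h
    by_cases hd : tb a (key c.1 c.2.1) = true
    · rw [hd, cond_true] at h
      exact ih h h1 h2 h3
    · rw [Bool.eq_false_iff.2 hd, cond_false] at h
      obtain ⟨w, k1, k2, k3, k4, k5⟩ := orb_spec h
      rw [Bool.and_eq_true, beq_iff] at k1
      refine ih k1.2 ?_ ?_ ?_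
      · intro w' hw
        rcases List.mem_cons.1 hw with rfl | hw
        · exact ⟨k3, ⟨_, k2, k4⟩, k5⟩
        · exact h1 _ hw
      · refine List.pairwise_cons.2 ⟨?_, h2⟩
        intro w' hw d hd1 hd2
        have h4 := (h3 d).1 ⟨w', hw, hd2⟩
        have h5 := tb_land a w.1 d
        rw [k1.1, tb_zero, h4, hd1] at h5
        simp at h5
      · intro d
        rw [tb_lor, Bool.or_eq_true, ← h3]
        simp only [Has, List.mem_cons, exists_eq_or_imp]
        exact or_comm

theorem allWalks_spec {t : ℕ} : ∀ {l : List (List Cn)} {rs : List (List (ℕ × ℕ))} {k},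
    allWalks t l rs k = true → ∀ l0, List.Forall₂ (WR t) l0 rs →
    ∃ rs', k rs' = true ∧ List.Forall₂ (WR t) (l.reverse ++ l0) rs' := by
  intro l
  induction l with
  | nil => intro rs k h l0 h0; exact ⟨rs, h, by simpa using h0⟩
  | cons g l ih =>
    intro rs k h l0 h0
    unfold allWalks at h
    obtain ⟨ws, a, k1, k2, k3, k4⟩ := walks_spec h (by simp) (by simp) (by simp [Has, tb_zero])
    rw [Bool.and_eq_true, beq_iff] at k1
    obtain ⟨rs', k5, k6⟩ := ih k1.2 (g :: l0) (List.Forall₂.cons ⟨k2, k3, fun d => by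
      rw [k4, k1.1, cMask_spec]⟩ h0)
    exact ⟨rs', k5, by simpa using k6⟩

theorem root_spec {K : Ks} {k : St → Bool} (h : root K k = true) :
    ∃ o, k o = true ∧ RootOk K o := by
  unfold root at h
  simp only [force_eq, Bool.and_eq_true, blt_iff] at h
  obtain ⟨h1, h2⟩ := h
  obtain ⟨D, h3, h4, h5, h6⟩ := okC_spec h2
  obtain ⟨rs, h7, h8⟩ := allWalks_spec h3 [] .nil
  rw [List.append_nil] at h8
  have hm : ∀ c, c ∈ flat K.2 ↔ ∃ g ∈ K.2, c ∈ g := by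
    intro c; rw [flat_eq, List.mem_flatten]
  refine ⟨_, h7, rfl, h1, fun g hg c hc => ?_, fun d => ?_, fun g hg c hc => ?_, ?_, h8, ?_⟩
  · have := h4 c ((hm c).2 ⟨g, hg, hc⟩); exact ⟨this.1, this.2.1⟩
  · rw [h6]
    simp only [tb_zero, Bool.false_eq_true, false_or, hm]
    exact ⟨fun ⟨c, ⟨g, hg, hc⟩, e⟩ => ⟨g, hg, c, hc, e⟩, fun ⟨g, hg, c, hc, e⟩ => ⟨c, ⟨g, hg, hc⟩, e⟩⟩
  · exact (h4 c ((hm c).2 ⟨g, hg, hc⟩)).2.2.2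
  · show _ = len (flat K.2)
    rw [len_eq, ← List.length_map (f := dart), ← List.toFinset_card_of_nodup h5]
    congr 1
    ext d
    simp only [Finset.mem_filter, Finset.mem_range, List.mem_toFinset, List.mem_map]
    rw [h6]
    simp only [tb_zero, Bool.false_eq_true, false_or, and_iff_right_iff_imp]
    rintro ⟨c, hc, rfl⟩
    have := h4 c hc
    exact key_lt (this.2.1.trans h1) (this.1.trans h1)
  · rw [flat_eq, List.Nodup, List.pairwise_map, List.pairwise_flatten] at h5
    exact h5.2

/-- the edges of the image of `K` -/
def GK (K : Ks) (m : ℕ → ℕ) (u v : ℕ) : Prop := ∃ g ∈ K.2, ∃ c ∈ g, m c.1 = u ∧ m c.2.1 = v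

/-- the corners `K` are realised by `m` -/
structure EmbK (S : Surf) (K : Ks) (m : ℕ → ℕ) : Prop where
  inj : ∀ {a b}, a < K.1 → b < K.1 → m a = m b → a = b
  adj : ∀ g ∈ K.2, ∀ c ∈ g, S.adj (m c.1) (m c.2.1)
  nx : ∀ g ∈ K.2, ∀ c ∈ g, S.Nx (GK K m) (m c.1) (m c.2.1) (m c.2.2)
  conn : ∀ g ∈ K.2, ∀ c ∈ g, ∀ c' ∈ g, S.FR (GK K m) (m c.1, m c.2.1) (m c'.1, m c'.2.1)
  sep : K.2.Pairwise fun g g' => ∀ c ∈ g, ∀ c' ∈ g',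
    ¬ S.FR (GK K m) (m c.1, m c.2.1) (m c'.1, m c'.2.1)

/-- the table of `K` is a permutation of a symmetric set of darts -/
structure RootInv (K : Ks) (o : St) (p : ℕ) : Prop where
  revD : ∀ {d}, tb o.D d = true → tb o.D (rev d) = true
  T1 : ∀ {d}, tb o.D d = true → tb o.D (fld o.T d) = true
  p : ∀ {d}, tb o.D d = true → fld p (fld o.T d) = d
  full : ∀ {i}, i < K.1 → ∃ d, tb o.D d = true ∧ d / 16 = i

namespace RootOk
variable {K : Ks} {o : St}

theorem dart_div (h : RootOk K o) {g c} (hg : g ∈ K.2) (hc : c ∈ g) :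
    dart c / 16 = c.1 ∧ dart c % 16 = c.2.1 := by
  have := (h.lt g hg c hc).2.trans h.n16
  exact ⟨key_div this, key_mod this⟩

theorem lt256 (h : RootOk K o) {d} (hd : tb o.D d = true) : d < 256 := by
  obtain ⟨g, hg, c, hc, rfl⟩ := (h.D d).1 hd
  have h2 := h.lt g hg c hc
  have := h.n16
  exact key_lt (by omega) (by omega)

theorem gr (h : RootOk K o) (m : ℕ → ℕ) : GK K m = Gr o.D m := by
  funext u v
  apply propext
  constructor
  · rintro ⟨g, hg, c, hc, rfl, rfl⟩
    have := h.dart_div hg hc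
    exact ⟨dart c, (h.D _).2 ⟨g, hg, c, hc, rfl⟩, by rw [this.1], by rw [this.2]⟩
  · rintro ⟨d, hd, rfl, rfl⟩
    obtain ⟨g, hg, c, hc, rfl⟩ := (h.D d).1 hd
    have := h.dart_div hg hc
    exact ⟨g, hg, c, hc, by rw [this.1], by rw [this.2]⟩

theorem img_dart (h : RootOk K o) {g c} (hg : g ∈ K.2) (hc : c ∈ g) (m : ℕ → ℕ) :
    img m (dart c) = (m c.1, m c.2.1) := by
  rw [img, (h.dart_div hg hc).1, (h.dart_div hg hc).2]

theorem lt3 (h : RootOk K o) {p} (hi : RootInv K o p) {g c} (hg : g ∈ K.2) (hc : c ∈ g) :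
    c.2.2 < K.1 := by
  have h1 := hi.T1 ((h.D _).2 ⟨g, hg, c, hc, rfl⟩)
  rw [h.T g hg c hc] at h1
  obtain ⟨g', hg', c', hc', e⟩ := (h.D _).1 h1
  have h2 := h.lt g hg c hc
  have h3 := h.lt g' hg' c' hc'
  have := h.n16
  have e2 : key c'.1 c'.2.1 = key c.2.2 c.1 := e
  rw [key_eq, key_eq] at e2
  omega

theorem embS (h : RootOk K o) {p} (hi : RootInv K o p) {S : Surf} {m} (he : EmbK S K m) :
    EmbS S o m := by
  have hn := h.n
  have h16 := h.n16
  have hT : ∀ {g c}, g ∈ K.2 → c ∈ g → fld o.T (dart c) / 16 = c.2.2 ∧ fld o.T (dart c) % 16 = c.1 := by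
    intro g c hg hc
    have h2 := h.lt g hg c hc
    rw [h.T g hg c hc, key_div (h2.1.trans h16), key_mod (h2.1.trans h16)]
    exact ⟨rfl, rfl⟩
  have hE : Emb S o.n o.D o.T m := by
    have hD : ∀ {d}, tb o.D d = true →
        ∃ g ∈ K.2, ∃ c ∈ g, dart c = d ∧ d / 16 = c.1 ∧ d % 16 = c.2.1 := fun hd => by
      obtain ⟨g, hg, c, hc, rfl⟩ := (h.D _).1 hd
      exact ⟨g, hg, c, hc, rfl, h.dart_div hg hc⟩
    refine ⟨by omega, hn ▸ he.inj, ?_, hi.revD, ?_, hi.T1, ?_, ?_⟩ <;>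
      intro d hd <;> obtain ⟨g, hg, c, hc, rfl, e1, e2⟩ := hD hd
    · rw [e1, e2, hn]
      exact h.lt g hg c hc
    · rw [e1, e2]
      exact he.adj g hg c hc
    · rw [(hT hg hc).2, e1]
    · rw [e1, e2, (hT hg hc).1, ← h.gr]
      exact he.nx g hg c hc
  refine ⟨hE, ?_, h.nD⟩
  have hmem : ∀ r ∈ o.rs, ∃ g ∈ K.2, WR o.T g r := by
    intro r hr
    obtain ⟨i, hi, rfl⟩ := List.getElem_of_mem hr
    have hl := h.rs.length_eq
    refine ⟨K.2.reverse[i]'(by omega), ?_, ?_⟩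
    · rw [← List.mem_reverse]; exact List.getElem_mem _
    · have := (List.forall₂_iff_get.1 h.rs).2 i (by omega) hi
      simpa using this
  refine ⟨?_, ?_, ?_⟩
  · intro r hr
    obtain ⟨g, hg, hw⟩ := hmem r hr
    have hs : ∀ d, Has r d → tb o.D d = true := fun d hd => by
      obtain ⟨c, hc, e⟩ := (hw.has d).1 hd
      exact (h.D d).2 ⟨g, hg, c, hc, e⟩
    refine ⟨?_, hw.dj, ?_⟩
    · intro w hwr
      have h1 := hw.ok w hwr
      have hs' : ∀ d, tb w.1 d = true → tb o.D d = true := fun d hd => hs d ⟨w, hwr, hd⟩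
      obtain ⟨d, h2, h3⟩ := h1.one
      refine ⟨⟨d, h2, fun P p0 p1 x hx =>
        (h3 (fun x => tb w.1 x = true ∧ P x) ⟨h2, p0⟩ (fun x hx => ⟨h1.cl x hx.1, p1 x hx.1 hx.2⟩) x hx).2⟩,
        hs' _, h1.cl _, fun hφ => h1.ev _ _ fun x hx => ⟨hE.lt256 (hs' x hx), hφ x (hs' x hx)⟩⟩
    · intro d d' hd hd'
      obtain ⟨c, hc, rfl⟩ := (hw.has d).1 hd
      obtain ⟨c', hc', rfl⟩ := (hw.has d').1 hd'
      rw [h.img_dart hg hc, h.img_dart hg hc', ← h.gr]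
      exact he.conn g hg c hc c' hc'
  · have hs : K.2.reverse.Pairwise fun g g' => ∀ c ∈ g, ∀ c' ∈ g',
        ¬ S.FR (GK K m) (m c.1, m c.2.1) (m c'.1, m c'.2.1) := by
      rw [List.pairwise_reverse]
      exact he.sep.imp fun hab c hc c' hc' e => hab c' hc' c hc e.symm
    rw [List.pairwise_iff_getElem] at hs ⊢
    intro i j hi hj hij d d' hd hd'
    have hl := h.rs.length_eq
    have h1 := (List.forall₂_iff_get.1 h.rs).2 i (by omega) hi
    have h2 := (List.forall₂_iff_get.1 h.rs).2 j (by omega) hj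
    obtain ⟨c, hc, rfl⟩ := (h1.has d).1 hd
    obtain ⟨c', hc', rfl⟩ := (h2.has d').1 hd'
    have hg1 := List.mem_reverse.1 (List.get_mem K.2.reverse ⟨i, by omega⟩)
    have hg2 := List.mem_reverse.1 (List.get_mem K.2.reverse ⟨j, by omega⟩)
    rw [h.img_dart hg1 hc, h.img_dart hg2 hc', ← h.gr]
    exact hs i j (by omega) (by omega) hij c hc c' hc'
  · intro d hd
    obtain ⟨g, hg, hc⟩ := (h.D d).1 hd
    obtain ⟨i, hi, rfl⟩ := List.getElem_of_mem (List.mem_reverse.2 hg)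
    have hl := h.rs.length_eq
    have h1 := (List.forall₂_iff_get.1 h.rs).2 i hi (by omega)
    exact ⟨_, List.get_mem _ _, (h1.has d).2 (by simpa using hc)⟩

end RootOk
end NSC

namespace NSC
open Chk
namespace Surf
variable {S : Surf} {G G' : ℕ → ℕ → Prop}

theorem IsSub.mirror (h : S.IsSub G) : S.mirror.IsSub G := ⟨h.adj, h.symm⟩

theorem Nx.mirror (hG : S.IsSub G) {v w y} (h : S.Nx G v w y) : S.mirror.Nx G v y w := by
  obtain ⟨x, hx, rfl, hy⟩ := h
  obtain ⟨z, x', h1, h2, h3⟩ := Nx.exists hG.mirror hy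
  have hx0 := hx.adj hG
  have key : S.InC G v w (S.t x' v) := by
    refine h1.induct (P := fun x' => S.InC G v w (S.t x' v)) ?_ ?_
    · rwa [S.t_pred_succ hx0]
    · intro u hu ih hn
      have ha : S.adj v u := hu.adj hG.mirror
      have h4 : ¬ G v (S.t u v) := hn
      show S.InC G v w (S.t (S.t u v) v)
      rcases ih.cases with e | ⟨x2, h5, e, -⟩
      · exact absurd (e ▸ ih.1) h4
      · rw [e, S.t_pred_succ (h5.adj hG)]; exact h5
  have h4 : S.t x' v = z := h2
  rw [h4] at key
  have := key.eq_of_mem h3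
  rw [this]
  exact ⟨x', h1, h2, h3⟩

theorem FR.mirror (hG : S.IsSub G) {d e} (h : S.FR G d e) :
    S.mirror.FR G (d.2, d.1) (e.2, e.1) := by
  induction h with
  | refl => exact .refl _
  | symm _ ih => exact ih.symm
  | trans _ _ ih ih' => exact ih.trans ih'
  | @rot u v h =>
    have h1 : S.mirror.adj (S.t u v) v := S.symm (S.t_adj h)
    have := FR.rot (S := S.mirror) (G := G) h1
    rw [mirror_t, S.t_rot h] at this
    exact this.symm
  | @swap u v h h' => exact .swap (S := S.mirror) (S.symm h) fun g => h' (hG.symm g)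

/-- corners of a subgraph of a subgraph -/
theorem InC.next (hs : ∀ {u v}, G' u v → G u v) {v w x y} (h : S.InC G' v w x)
    (hn : S.Nx G v x y) : (G' v y → S.Nx G' v w y) ∧ (¬ G' v y → S.InC G' v w y) := by
  obtain ⟨z, hz, rfl, hy⟩ := hn
  have h1 : S.InC G' v w z := by
    refine hz.induct (P := fun z => S.InC G' v w z) h ?_
    intro u _ ih hg
    exact ih.step fun g => hg (hs g)
  exact ⟨fun g => ⟨z, h1, rfl, g⟩, fun g => h1.step g⟩

end Surf

theorem lab_lt (mp v : ℕ) : lab mp v < 16 := Nat.mod_lt _ (by norm_num)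

theorem mapL_eq {α β : Type} (f : α → β) (l : List α) : mapL f l = l.map f := by
  induction l with
  | nil => rfl
  | cons a l ih => simp [mapL, ih]

theorem mapL_fun {α β : Type} (f : α → β) : mapL f = List.map f := funext (mapL_eq f)

theorem allL_iff {α : Type} (f : α → Bool) (l : List α) : allL f l = true ↔ ∀ a ∈ l, f a = true := by
  induction l with
  | nil => simp [allL]
  | cons a l ih => simp [allL, ih]

theorem anyL_iff {α : Type} (f : α → Bool) (l : List α) : anyL f l = true ↔ ∃ a ∈ l, f a = true := by
  induction l with
  | nil => simp [anyL]
  | cons a l ih => simp [anyL, ih]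

theorem tb_orL (l : List ℕ) (d : ℕ) : tb (orL l) d = true ↔ ∃ x ∈ l, tb x d = true := by
  induction l with
  | nil => simp [orL, tb_zero]
  | cons a l ih => rw [orL, tb_lor, Bool.or_eq_true, ih]; simp only [List.mem_cons, exists_eq_or_imp]

theorem tb_wMask (l : List (ℕ × ℕ)) (d : ℕ) : tb (wMask l) d = true ↔ Has l d := by
  induction l with
  | nil => simp [wMask, tb_zero, Has]
  | cons a l ih =>
    unfold Has at *
    rw [wMask, tb_lor, Bool.or_eq_true, ih]; simp only [List.mem_cons, exists_eq_or_imp]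

theorem tb_dMask (l : List ℕ) (d : ℕ) : tb (dMask l) d = true ↔ ∃ x ∈ l, d = x ∨ d = rev x := by
  induction l with
  | nil => simp [dMask, tb_zero]
  | cons a l ih => simp only [dMask, tb_lor, Bool.or_eq_true, tb_pw, ih, List.mem_cons, exists_eq_or_imp]

theorem injUp_spec {mp : ℕ} : ∀ {n a : ℕ}, injUp mp n a = true →
    (∀ i < n, ¬ tb a (lab mp i) = true) ∧ ∀ i < n, ∀ j < n, lab mp i = lab mp j → i = j := by
  intro n
  induction n with
  | zero => intro a _; simp
  | succ n ih =>
    intro a h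
    unfold injUp at h
    simp only [force_eq, Bool.and_eq_true, Bool.not_eq_true'] at h
    obtain ⟨h1, h2⟩ := h
    obtain ⟨h3, h4⟩ := ih h2
    have h5 : ∀ i < n, ¬ tb a (lab mp i) = true ∧ lab mp i ≠ lab mp n := by
      intro i hi
      simpa only [tb_lor, Bool.or_eq_true, tb_pw, not_or] using h3 i hi
    grind

theorem rotTo_spec {S : Surf} {n D T I : ℕ} {m} (he : Emb S n D T m)
    (hI : ∀ d, tb I d = true → tb D d = true) {v w x : ℕ} :
    ∀ {f w' : ℕ}, rotTo T I v x f w' = true → w' < 16 → tb D (key v w') = true →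
      S.InC (Gr I m) (m v) (m w) (m w') → S.Nx (Gr I m) (m v) (m w) (m x) := by
  have hs : ∀ {u v}, Gr I m u v → Gr D m u v := by
    rintro u v ⟨d, h1, h2⟩; exact ⟨d, hI d h1, h2⟩
  intro f
  induction f with
  | zero => intro w' h; simp [rotTo] at h
  | succ f ih =>
    intro w' h h16 hd hc
    unfold rotTo at h
    rw [force_eq] at h
    have h1 := he.nx hd
    have h2 := he.T2 hd
    have h3 := he.T1 hd
    have h4 : fld T (key v w') / 16 < 16 := lt16 (fld_lt _ _)
    rw [key_div h16, key_mod h16] at h1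
    rw [key_div h16] at h2
    set y := fld T (key v w') / 16 with hy
    have hv := (he.lt hd).1
    have hvn : v < n := by rwa [key_div h16] at hv
    have hyn : y < n := (he.lt h3).1
    have hg : Gr I m (m v) (m y) ↔ tb I (key v y) = true := by
      constructor
      · rintro ⟨d, e1, e2, e3⟩
        have e2 := he.inj (he.lt (hI _ e1)).1 hvn e2
        have e3 := he.inj (he.lt (hI _ e1)).2 hyn e3
        rw [← e2, ← e3, key_self]; exact e1
      · intro e
        exact ⟨_, e, by rw [key_div h4], by rw [key_mod h4]⟩
    have h5 := Surf.InC.next (G' := Gr I m) hs hc h1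
    have hy' : fld T (key v w') = key y v := by
      conv_rhs => rw [← h2]
      rw [key_self]
    have hh : (bif tb I (key v y) then Nat.beq y x else rotTo T I v x f y) = true := h
    by_cases hi : tb I (key v y) = true
    · rw [hi, cond_true, beq_iff] at hh
      rw [← hh]
      exact h5.1 (hg.2 hi)
    · rw [Bool.eq_false_iff.2 hi, cond_false] at hh
      refine ih hh h4 ?_ (h5.2 fun g => hi (hg.1 g))
      have := he.revD h3
      rwa [hy', rev_key (by have := he.n16; omega)] at this

theorem findX_spec {d : ℕ} : ∀ {l : List ℕ} {k}, findX d l k = true →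
    ∃ w l', l.Perm (w :: l') ∧ tb w d = true ∧ k w l' = true := by
  intro l
  induction l with
  | nil => intro k h; simp [findX] at h
  | cons w l ih =>
    intro k h
    unfold findX at h
    by_cases hw : tb w d = true
    · rw [hw, cond_true] at h
      exact ⟨w, l, .refl _, hw, h⟩
    · rw [Bool.eq_false_iff.2 hw, cond_false] at h
      obtain ⟨w', l', h1, h2, h3⟩ := ih h
      exact ⟨w', w :: l', (h1.cons w).trans (.swap _ _ _), h2, h3⟩

/-- `X` consists of unions of regions which are connected outside `I` -/
structure Mrg (S : Surf) (D I : ℕ) (m : ℕ → ℕ) (X : List ℕ) : Prop where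
  sub : ∀ x ∈ X, ∀ d, tb x d = true → tb D d = true
  sat : ∀ x ∈ X, ∀ d d', tb x d = true → tb D d' = true →
    S.FR (Gr D m) (img m d) (img m d') → tb x d' = true
  conn : ∀ x ∈ X, ∀ d d', tb x d = true → tb x d' = true →
    S.FR (Gr I m) (img m d) (img m d')
  dj : X.Pairwise fun x y => ∀ d, tb x d = true → ¬ tb y d = true

theorem Mrg.perm {S : Surf} {D I m X Y} (h : Mrg S D I m X) (hp : X.Perm Y) : Mrg S D I m Y where
  sub x hx := h.sub x (hp.mem_iff.2 hx)
  sat x hx := h.sat x (hp.mem_iff.2 hx)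
  conn x hx := h.conn x (hp.mem_iff.2 hx)
  dj := h.dj.perm hp fun h d h1 h2 => h d h2 h1

theorem Mrg.init {S : Surf} {D T I : ℕ} {m rs} (hr : Reg S D T m rs)
    (hI : ∀ d, tb I d = true → tb D d = true) : Mrg S D I m (rs.map wMask) := by
  have hs : ∀ {u v}, Gr I m u v → Gr D m u v := by
    rintro u v ⟨d, h1, h2⟩; exact ⟨d, hI d h1, h2⟩
  refine ⟨?_, ?_, ?_, ?_⟩
  · intro x hx d hd
    obtain ⟨r, h1, rfl⟩ := List.mem_map.1 hx
    exact ((tb_wMask _ _).1 hd).sub (hr.ok r h1)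
  · intro x hx d d' hd hd' hf
    obtain ⟨r, h1, rfl⟩ := List.mem_map.1 hx
    rw [tb_wMask] at hd ⊢
    obtain ⟨r', h2, h3⟩ := hr.cov hd'
    by_cases e : r = r'
    · rwa [e]
    · exact absurd hf (pairwise_forall (R := fun r r' => ∀ d d', Has r d → Has r' d' →
        ¬ S.FR (Gr D m) (img m d) (img m d')) (fun q d d' h1 h2 h3 => q _ _ h2 h1 h3.symm)
        hr.sep h1 h2 e d d' hd h3)
  · intro x hx d d' hd hd'
    obtain ⟨r, h1, rfl⟩ := List.mem_map.1 hx
    rw [tb_wMask] at hd hd'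
    exact ((hr.ok r h1).conn hd hd').mono hs
  · rw [List.pairwise_map]
    refine hr.sep.imp ?_
    intro r r' q d hd hd'
    rw [tb_wMask] at hd hd'
    exact q d d hd hd' (.refl _)

theorem merge_spec {S : Surf} {n D T I : ℕ} {m} (he : Emb S n D T m)
    (hI : ∀ d, tb I d = true → tb D d = true) :
    ∀ {del X : List ℕ} {k}, merge del X k = true → Mrg S D I m X →
    (∀ d ∈ del, tb D d = true ∧ ¬ tb I d = true) → ∀ done : List ℕ,
    (∀ d ∈ done, ∀ x ∈ X, (tb x d = true ↔ tb x (rev d) = true)) →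
    ∃ X', k X' = true ∧ Mrg S D I m X' ∧
      ∀ d, d ∈ done ∨ d ∈ del → ∀ x ∈ X', (tb x d = true ↔ tb x (rev d) = true) := by
  intro del
  induction del with
  | nil => intro X k h hM _ done hd; exact ⟨X, h, hM, by simpa using hd⟩
  | cons d ds ih =>
    intro X k h hM hdel done hdone
    unfold merge at h
    obtain ⟨a, l, hp, ha, h⟩ := findX_spec h
    have hM1 := hM.perm hp
    have hdj := List.pairwise_cons.1 hM1.dj
    have hdel' : ∀ d ∈ ds, tb D d = true ∧ ¬ tb I d = true := fun d hd => hdel d (by simp [hd])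
    by_cases hr : tb a (rev d) = true
    · rw [hr, cond_true] at h
      obtain ⟨X', h1, h2, h3⟩ := ih h hM hdel' (d :: done) (by have := fun x => hp.mem_iff (a := x); grind)
      exact ⟨X', h1, h2, by grind⟩
    · rw [Bool.eq_false_iff.2 hr, cond_false] at h
      obtain ⟨b, l', hp', hb, h⟩ := findX_spec h
      rw [force_eq] at h
      have hp2 : X.Perm (a :: b :: l') := hp.trans (hp'.cons a)
      have hM2 := hM.perm hp2
      have hdj := List.pairwise_cons.1 hM2.dj
      have hdj2 := List.pairwise_cons.1 hdj.2
      have hdD := hdel d (by simp)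
      have hbr : S.FR (Gr I m) (img m d) (img m (rev d)) := by
        have hlt := he.lt256 hdD.1
        unfold img
        rw [rev_div hlt, rev_mod hlt]
        refine .swap (he.adj hdD.1) ?_
        rintro ⟨d', e1, e2⟩
        have : d' = d := he.img_inj (hI _ e1) hdD.1 (by rw [img, img, e2.1, e2.2])
        exact hdD.2 (this ▸ e1)
      have hab : ∀ x y, tb a x = true → tb b y = true → S.FR (Gr I m) (img m x) (img m y) :=
        fun x y h1 h2 => (hM2.conn a (by simp) x d h1 ha).trans
          (hbr.trans (hM2.conn b (by simp) _ y hb h2))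
      have hlor : ∀ x, tb (Nat.lor a b) x = true ↔ tb a x = true ∨ tb b x = true := fun x => by
        rw [tb_lor, Bool.or_eq_true]
      have hmem : ∀ x ∈ l', x ∈ a :: b :: l' := fun x hx => by simp [hx]
      have hM3 : Mrg S D I m (Nat.lor a b :: l') := by
        obtain ⟨s1, s2, s3, -⟩ := hM2
        refine ⟨?_, ?_, ?_, List.pairwise_cons.2 ⟨?_, hdj2.2⟩⟩
        · grind
        · grind
        · have := @Surf.FR.symm S (Gr I m)
          grind
        · grind
      have := fun x => hp2.mem_iff (a := x)
      obtain ⟨X', h1, h2, h3⟩ := ih h hM3 hdel' (d :: done) (by grind)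
      exact ⟨X', h1, h2, by grind⟩

end NSC

namespace NSC
open Chk
namespace RootOk
variable {K : Ks} {o : St} {p : ℕ}

theorem surj (h : RootOk K o) (hi : RootInv K o p) {d} (hd : tb o.D d = true) :
    ∃ d', tb o.D d' = true ∧ fld o.T d' = d := by
  let s := (Finset.range 256).filter fun d => tb o.D d = true
  have hs : ∀ {d}, d ∈ s ↔ tb o.D d = true := by
    intro d
    simp only [s, Finset.mem_filter, Finset.mem_range, and_iff_right_iff_imp]
    exact h.lt256
  have h1 : Set.MapsTo (fld o.T) s s := fun d hd => hs.2 (hi.T1 (hs.1 hd))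
  have h2 : Set.InjOn (fld o.T) s := fun d hd d' hd' e => by
    rw [← hi.p (hs.1 hd), e, hi.p (hs.1 hd')]
  obtain ⟨d', h3, h4⟩ := Finset.surjOn_of_injOn_of_card_le _ h1 h2 le_rfl (hs.2 hd)
  exact ⟨d', hs.1 h3, h4⟩

theorem prev (h : RootOk K o) (hi : RootInv K o p) {g c} (hg : g ∈ K.2) (hc : c ∈ g) :
    ∃ g' ∈ K.2, ∃ c' ∈ g', c'.1 = c.1 ∧ c'.2.2 = c.2.1 := by
  have h16 := h.n16
  have h2 := h.lt g hg c hc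
  have h3 := hi.revD ((h.D (dart c)).2 ⟨g, hg, c, hc, rfl⟩)
  rw [dart, rev_key (by omega)] at h3
  obtain ⟨d', h4, h5⟩ := h.surj hi h3
  obtain ⟨g', hg', c', hc', rfl⟩ := (h.D _).1 h4
  have h6 := h.lt g' hg' c' hc'
  rw [h.T g' hg' c' hc', key_eq, key_eq] at h5
  exact ⟨g', hg', c', hc', by omega, by omega⟩

theorem next (h : RootOk K o) (hi : RootInv K o p) {g c} (hg : g ∈ K.2) (hc : c ∈ g) :
    ∃ g' ∈ K.2, ∃ c' ∈ g', c'.1 = c.1 ∧ c'.2.1 = c.2.2 := by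
  have h16 := h.n16
  have h2 := h.lt g hg c hc
  have h0 := h.lt3 hi hg hc
  have h3 := hi.T1 ((h.D (dart c)).2 ⟨g, hg, c, hc, rfl⟩)
  rw [h.T g hg c hc] at h3
  have h3 := hi.revD h3
  rw [rev_key (by omega)] at h3
  obtain ⟨g', hg', c', hc', h5⟩ := (h.D _).1 h3
  have h6 := h.lt g' hg' c' hc'
  rw [dart, key_eq, key_eq] at h5
  exact ⟨g', hg', c', hc', by omega, by omega⟩

theorem corner_inj (h : RootOk K o) (hi : RootInv K o p) {g c g' c'} (hg : g ∈ K.2) (hc : c ∈ g)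
    (hg' : g' ∈ K.2) (hc' : c' ∈ g') (e1 : c.1 = c'.1) (e2 : c.2.2 = c'.2.2) : dart c = dart c' := by
  have h3 := hi.p ((h.D (dart c)).2 ⟨g, hg, c, hc, rfl⟩)
  have h4 := hi.p ((h.D (dart c')).2 ⟨g', hg', c', hc', rfl⟩)
  rw [h.T g hg c hc] at h3
  rw [h.T g' hg' c' hc', ← e1, ← e2] at h4
  rw [← h3, ← h4]

end RootOk

theorem mapC_fst (mir mp c) : (mapC mir mp c).1 = lab mp c.1 := by
  unfold mapC; cases mir <;> rfl

theorem mapC_true (mp c) : mapC true mp c = (lab mp c.1, lab mp c.2.2, lab mp c.2.1) := rfl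
theorem mapC_false (mp c) : mapC false mp c = (lab mp c.1, lab mp c.2.1, lab mp c.2.2) := rfl

theorem mapC_lt (mir mp c) : (mapC mir mp c).2.1 < 16 := by
  cases mir <;> exact lab_lt _ _

theorem matchK_spec {S : Surf} {o m K oK pK h} (hE : EmbS S o m) (hK : RootOk K oK)
    (hi : RootInv K oK pK) (hm : matchK K o h = true) :
    ∃ f, EmbK S K f ∨ EmbK S.mirror K f := by
  obtain ⟨j, mir, mp⟩ := h
  unfold matchK at hm
  simp only [force_eq, Bool.and_eq_true, beq_iff, mapL_fun, allL_iff] at hm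
  obtain ⟨h1, ⟨⟨h2, h3⟩, h4⟩, h5⟩ := hm
  obtain ⟨-, hinj⟩ := injUp_spec h1
  have he := hE.emb
  set I := orL (((K.2.map (List.map (mapC mir mp))).map cMask)) with hIdef
  generalize darts 24 (Nat.xor o.D I) = del at *
  have hI0 : ∀ d, tb I d = true ↔ ∃ g ∈ K.2, ∃ c ∈ g, dart (mapC mir mp c) = d := by
    intro d
    rw [hIdef, tb_orL]
    simp only [List.map_map, List.mem_map, Function.comp, exists_exists_and_eq_and, cMask_spec]
  have hID : ∀ d, tb I d = true → tb o.D d = true := by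
    intro d hd
    rw [← h2, tb_lor, hd, Bool.true_or]
  have hED : ∀ d, tb (dMask del) d = true → tb o.D d = true := by
    intro d hd
    rw [← h2, tb_lor, hd, Bool.or_true]
  have hEI : ∀ d, tb (dMask del) d = true → ¬ tb I d = true := by
    intro d hd hi'
    have := tb_land I (dMask del) d
    rw [h3, tb_zero, hd, hi'] at this
    simp at this
  have hDd : ∀ d, tb o.D d = true → tb I d = true ∨ tb (dMask del) d = true := by
    intro d hd
    rwa [← h2, tb_lor, Bool.or_eq_true] at hd
  have hdiv : ∀ c, dart (mapC mir mp c) / 16 = lab mp c.1 := fun c => by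
    rw [dart, key_div (mapC_lt _ _ _), mapC_fst]
  have hmod : ∀ c, dart (mapC mir mp c) % 16 = (mapC mir mp c).2.1 := fun c => by
    rw [dart, key_mod (mapC_lt _ _ _)]
  have hlab : ∀ i < K.1, lab mp i < o.n := by
    intro i hi1
    obtain ⟨d, hd, rfl⟩ := hi.full hi1
    obtain ⟨g, hg, c, hc, rfl⟩ := (hK.D d).1 hd
    have h6 := hK.lt g hg c hc
    have := (he.lt (hID _ ((hI0 _).2 ⟨g, hg, c, hc, rfl⟩))).1
    rw [hdiv] at this
    rwa [dart, key_div (h6.2.trans hK.n16)]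
  let f : ℕ → ℕ := fun v => m (lab mp v)
  have himg : ∀ c, img m (dart (mapC mir mp c)) = (f c.1, m (mapC mir mp c).2.1) := fun c => by
    rw [img, hdiv, hmod]
  have hG : GK K f = Gr I m := by
    funext u v
    apply propext
    constructor
    · rintro ⟨g, hg, c, hc, rfl, rfl⟩
      cases mir
      · exact ⟨_, (hI0 _).2 ⟨g, hg, c, hc, rfl⟩, by rw [hdiv], by rw [hmod, mapC_false]⟩
      · obtain ⟨g', hg', c', hc', e1, e2⟩ := hK.prev hi hg hc
        exact ⟨_, (hI0 _).2 ⟨g', hg', c', hc', rfl⟩, by rw [hdiv, e1], by rw [hmod, mapC_true, e2]⟩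
    · rintro ⟨d, hd, rfl, rfl⟩
      obtain ⟨g, hg, c, hc, rfl⟩ := (hI0 _).1 hd
      rw [hdiv, hmod]
      cases mir
      · exact ⟨g, hg, c, hc, rfl, rfl⟩
      · obtain ⟨g', hg', c', hc', e1, e2⟩ := hK.next hi hg hc
        exact ⟨g', hg', c', hc', by rw [e1], by rw [mapC_true, ← e2]⟩
  have hsub : S.IsSub (Gr I m) := by
    refine ⟨?_, ?_⟩
    · rintro u v ⟨d, hd, rfl, rfl⟩; exact he.adj (hID _ hd)
    · rw [← hG]
      rintro u v ⟨g, hg, c, hc, rfl, rfl⟩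
      have h6 := hK.lt g hg c hc
      have h7 := hi.revD ((hK.D (dart c)).2 ⟨g, hg, c, hc, rfl⟩)
      rw [dart, rev_key (h6.2.trans hK.n16)] at h7
      obtain ⟨g', hg', c', hc', e⟩ := (hK.D _).1 h7
      have h8 := hK.lt g' hg' c' hc'
      have := hK.n16
      rw [dart, key_eq, key_eq] at e
      exact ⟨g', hg', c', hc', by congr 1; omega, by congr 1; omega⟩
  have hnx : ∀ g ∈ K.2, ∀ c ∈ g, S.Nx (Gr I m) (f c.1) (m (mapC mir mp c).2.1)
      (m (mapC mir mp c).2.2) := by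
    intro g hg c hc
    have h6 := h4 _ (List.mem_map.2 ⟨g, hg, rfl⟩) _ (List.mem_map.2 ⟨c, hc, rfl⟩)
    have h7 := (hI0 _).2 ⟨g, hg, c, hc, rfl⟩
    have := rotTo_spec he hID (w := (mapC mir mp c).2.1) h6 (mapC_lt _ _ _) (hID _ h7)
      (Surf.InC.self ⟨_, h7, by rw [hdiv, mapC_fst], by rw [hmod]⟩)
    rwa [mapC_fst] at this
  obtain ⟨X, h6, hM, hdel⟩ := merge_spec he hID h5 (Mrg.init hE.reg hID) (by
    intro d hd
    have := (tb_dMask del d).2 ⟨d, hd, .inl rfl⟩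
    exact ⟨hED _ this, hEI _ this⟩) [] (by simp)
  simp only [allL_iff, anyL_iff, beq_iff] at h6
  have hX : ∀ g ∈ K.2, ∃ x ∈ X, ∀ d, (∃ c ∈ g, dart (mapC mir mp c) = d) ↔
      tb x d = true ∧ tb I d = true := by
    intro g hg
    obtain ⟨x, hx, e⟩ := h6 _ (List.mem_map.2 ⟨_, List.mem_map.2 ⟨g, hg, rfl⟩, rfl⟩)
    refine ⟨x, hx, fun d => ?_⟩
    rw [← Bool.and_eq_true, ← tb_land, e, cMask_spec]
    simp only [List.mem_map, exists_exists_and_eq_and]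
  have hlift : ∀ x ∈ X, ∀ d d', tb x d = true → tb I d' = true →
      S.FR (Gr I m) (img m d) (img m d') → tb x d' = true := by
    intro x hx d d' hd hd' hf
    let u : ℕ × ℕ → Prop := fun e => ∃ d, tb x d = true ∧ S.FR (Gr o.D m) (img m d) e
    have hsw : ∀ {a b}, S.adj a b → ¬ Gr I m a b → u (a, b) → u (b, a) := by
      rintro a b hab hn ⟨d, e1, e2⟩
      by_cases hg : Gr o.D m a b
      · obtain ⟨d0, k1, rfl, rfl⟩ := hg
        have k2 := (hDd _ k1).resolve_left fun e => hn ⟨d0, e, rfl, rfl⟩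
        have hlt := he.lt256 k1
        refine ⟨rev d0, ?_, by rw [img, rev_div hlt, rev_mod hlt]; exact .refl _⟩
        have k5 := hM.sat x hx d d0 e1 k1 e2
        obtain ⟨d1, k3, rfl | rfl⟩ := (tb_dMask _ _).1 k2
        · exact (hdel _ (.inr k3) x hx).1 k5
        · rw [rev_rev (he.lt256 (hED _ ((tb_dMask _ _).2 ⟨d1, k3, .inl rfl⟩)))]
          exact (hdel _ (.inr k3) x hx).2 k5
      · exact ⟨d, e1, e2.trans (.swap hab hg)⟩
    have hu := Surf.FR.lift u (fun {a b} h => propext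
        ⟨fun ⟨d, e1, e2⟩ => ⟨d, e1, e2.trans (.rot h)⟩,
          fun ⟨d, e1, e2⟩ => ⟨d, e1, e2.trans (Surf.FR.rot h).symm⟩⟩)
      (fun {a b} hab hn => propext ⟨hsw hab hn, hsw (S.symm hab) fun g => hn (hsub.symm g)⟩) hf
    obtain ⟨d2, k1, k2⟩ := hu.mp ⟨d, hd, .refl _⟩
    exact hM.sat x hx d2 d' k1 (hID _ hd') k2
  have hconn : ∀ g ∈ K.2, ∀ c ∈ g, ∀ c' ∈ g,
      S.FR (Gr I m) (f c.1, m (mapC mir mp c).2.1) (f c'.1, m (mapC mir mp c').2.1) := by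
    intro g hg c hc c' hc'
    obtain ⟨x, hx, e⟩ := hX g hg
    rw [← himg, ← himg]
    exact hM.conn x hx _ _ ((e _).1 ⟨c, hc, rfl⟩).1 ((e _).1 ⟨c', hc', rfl⟩).1
  have hdart : ∀ g ∈ K.2, ∀ c ∈ g, ∀ g' ∈ K.2, ∀ c' ∈ g',
      dart (mapC mir mp c) = dart (mapC mir mp c') → dart c = dart c' := by
    intro g hg c hc g' hg' c' hc' e
    have e1 : lab mp c.1 = lab mp c'.1 := by rw [← hdiv, e, hdiv]
    have e2 : (mapC mir mp c).2.1 = (mapC mir mp c').2.1 := by rw [← hmod, e, hmod]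
    have k1 := hK.lt g hg c hc
    have k2 := hK.lt g' hg' c' hc'
    have e3 := hinj _ k1.1 _ k2.1 e1
    cases mir
    · have e4 := hinj _ k1.2 _ k2.2 e2
      rw [dart, dart, e3, e4]
    · have e4 := hinj _ (hK.lt3 hi hg hc) _ (hK.lt3 hi hg' hc') e2
      exact hK.corner_inj hi hg hc hg' hc' e3 e4
  have hsep : K.2.Pairwise fun g g' => ∀ c ∈ g, ∀ c' ∈ g',
      ¬ S.FR (Gr I m) (f c.1, m (mapC mir mp c).2.1) (f c'.1, m (mapC mir mp c').2.1) := by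
    refine List.Pairwise.imp_of_mem ?_ hK.dj
    intro g g' hg hg' hdj c hc c' hc' hf
    obtain ⟨x, hx, e⟩ := hX g hg
    rw [← himg, ← himg] at hf
    have k1 := (hI0 _).2 ⟨g', hg', c', hc', rfl⟩
    have k2 := hlift x hx _ _ ((e _).1 ⟨c, hc, rfl⟩).1 k1 hf
    obtain ⟨c2, hc2, e2⟩ := (e _).2 ⟨k2, k1⟩
    exact hdj c2 hc2 c' hc' (hdart g hg c2 hc2 g' hg' c' hc' e2)
  have hadj : ∀ g ∈ K.2, ∀ c ∈ g, S.adj (f c.1) (f c.2.1) := by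
    intro g hg c hc
    refine hsub.adj ?_
    rw [← hG]
    exact ⟨g, hg, c, hc, rfl, rfl⟩
  have hfinj : ∀ {a b}, a < K.1 → b < K.1 → f a = f b → a = b := fun ha hb e =>
    hinj _ ha _ hb (he.inj (hlab _ ha) (hlab _ hb) e)
  refine ⟨f, ?_⟩
  cases mir
  · left
    refine ⟨hfinj, hadj, ?_, ?_, ?_⟩
    · rw [hG]; exact hnx
    · rw [hG]; exact hconn
    · rw [hG]; exact hsep
  · right
    have hN : ∀ g ∈ K.2, ∀ c ∈ g, S.FR (Gr I m) (f c.1, m (mapC true mp c).2.1) (f c.2.1, f c.1) :=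
      fun g hg c hc => Surf.FR.of_nx hsub (hnx g hg c hc)
    refine ⟨hfinj, hadj, ?_, ?_, ?_⟩
    · rw [hG]; exact fun g hg c hc => (hnx g hg c hc).mirror hsub
    · rw [hG]
      intro g hg c hc c' hc'
      exact (((hN g hg c hc).symm.trans (hconn g hg c hc c' hc')).trans (hN g hg c' hc')).mirror hsub
    · rw [hG]
      refine List.Pairwise.imp_of_mem ?_ hsep
      intro g g' hg hg' hs c hc c' hc' hf
      refine hs c hc c' hc' (((hN g hg c hc).trans ?_).trans (hN g' hg' c' hc').symm)
      have := hf.mirror (S := S.mirror) hsub.mirror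
      rwa [Surf.mirror_mirror] at this

/-- none of the configurations in `lib` occurs in a surface without a good set of faces -/
def Avoid (K : Ks) : Prop := (∃ o p, RootOk K o ∧ RootInv K o p) ∧
  ∀ (S : Surf) (m : ℕ → ℕ), EmbK S K m → S.Good

theorem closedB_spec {S : Surf} {o m lib hs} (hE : EmbS S o m) (hl : ∀ K ∈ lib, Avoid K)
    (h : closedB lib hs o = true) : S.Good := by
  unfold closedB at h
  rw [Bool.or_eq_true, anyL_iff] at h
  rcases h with h | ⟨hh, -, h⟩
  · rw [tooBig_spec hE] at h; simp at h
  · unfold matchH at h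
    split at h
    · simp at h
    · rename_i K hK
      obtain ⟨⟨oK, pK, h1, h2⟩, h3⟩ := hl K (List.mem_of_getElem? hK)
      obtain ⟨f, h4 | h4⟩ := matchK_spec hE h1 h2 h
      · exact h3 _ _ h4
      · exact (h3 _ _ h4).of_mirror

theorem closed_spec {S : Surf} {o m lib hs c} (hE : EmbS S o m) (hl : ∀ K ∈ lib, Avoid K)
    (hS : ¬ S.Good) (h : closed lib hs o c = true) {φ} (hφ : S.Coc φ) : ev φ m c = 0 := by
  unfold closed at h
  rw [Bool.or_eq_true] at h
  rcases h with h | h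
  · exact null_spec hE hφ h
  · exact absurd (closedB_spec hE hl h) hS

end NSC

namespace NSC
open Chk

theorem upTo_iff (f : ℕ → Bool) (n : ℕ) : upTo f n = true ↔ ∀ i < n, f i = true := by
  induction n with
  | zero => simp [upTo]
  | succ n ih =>
    simp only [upTo, Bool.and_eq_true, ih, Nat.lt_succ_iff_lt_or_eq]
    constructor
    · rintro ⟨h1, h2⟩ i (h | rfl)
      exacts [h2 i h, h1]
    · intro h; exact ⟨h n (.inr rfl), fun i hi => h i (.inl hi)⟩

/-- `d` or its reverse is a handle dart -/
def Hd (e : Ent) (d : ℕ) : Prop := tb e.H d = true ∨ tb e.H (rev d) = true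

/-- the library entry `e` passes the checks -/
structure EntOk (lib : List Ks) (e : Ent) (o : St) (p : ℕ) : Prop where
  root : RootOk e.K o
  inv : RootInv e.K o p
  ord : ∀ d, d ∈ e.ord ↔ tb o.D d = true
  potD : ∀ d, tb o.D d = true → ∀ x, tb (pot e d) x = true → tb o.D x = true
  potH : ∀ d, tb o.D d = true → Hd e (rev (fld o.T d)) → tb e.V d = true ∧ tb e.V (fld o.T d) = true ∧
    tb e.V (rev (fld o.T d)) = true ∧
    Nat.xor (pot e (fld o.T d)) (pot e d) = eb (rev (fld o.T d))
  potN : ∀ d, tb o.D d = true → ¬ Hd e (rev (fld o.T d)) →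
    tb e.V d = tb e.V (rev (fld o.T d)) ∧ tb e.S d = tb e.S (rev (fld o.T d)) ∧
    pot e d = pot e (rev (fld o.T d))
  pairV : ∀ a b, tb o.D a = true → tb o.D b = true → a / 16 = b / 16 → tb e.V a = tb e.V b
  SV : ∀ a, tb o.D a = true → tb e.S a = true → tb e.V a = true
  pair : ∀ a b, tb o.D a = true → tb o.D b = true → a / 16 = b / 16 → tb e.V a = true →
    Nat.xor (pot e a) (pot e b) = 0 ∨ (tb e.S a = true ∨ tb e.S b = true) ∧
    (Nat.xor (pot e a) (pot e b) = e.g1 ∨ Nat.xor (pot e a) (pot e b) = e.g2 ∨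
      Nat.xor (pot e a) (pot e b) = Nat.xor e.g1 e.g2)
  conn : ckConn e o.T p e.ord 0 = true
  dual : ∀ d, tb o.D d = true →
    ((tb e.U d ^^ tb e.U (fld p d)) = (tb e.U (rev d) ^^ tb e.U (fld p (rev d))))
  walk : ∃ d l, ckWalk e o.T p o.D d l d false false = true
  known : ckKnown e o = true
  one : ckOne lib e o = true
  fresh : ckFresh lib e o = true
  out : ckOut lib e o = true

theorem ckEnt_spec {lib e} (h : ckEnt lib e = true) : ∃ o p, EntOk lib e o p := by
  unfold ckEnt at h
  obtain ⟨o, h, hr⟩ := root_spec h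
  simp only [force_eq] at h
  set p := inv o.T e.ord 0
  iterate 11 rw [Bool.and_eq_true] at h
  obtain ⟨⟨⟨⟨⟨⟨⟨⟨⟨⟨⟨k1, k2⟩, k3⟩, k4⟩, k5⟩, k6⟩, k7⟩, k8⟩, k9⟩, k10⟩, k11⟩, k12⟩ := h
  rw [ckInv, allL_iff] at k3
  simp only [Bool.and_eq_true, beq_iff] at k3
  have hord : ∀ d, d ∈ e.ord ↔ tb o.D d = true := by
    intro d
    rw [beq_iff] at k2
    rw [← k2, tb_orL, mapL_eq]
    simp only [List.mem_map, exists_exists_and_eq_and, tb_pw]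
    simp
  have hrev : ∀ {d}, tb o.D d = true → tb o.D (rev d) = true := fun hd => (k3 _ ((hord _).2 hd)).1.1.2
  have hT : ∀ {d}, tb o.D d = true → tb o.D (fld o.T d) = true := fun hd => (k3 _ ((hord _).2 hd)).1.2
  rw [ckPot, allL_iff] at k4
  rw [ckPair, allL_iff] at k5
  simp only [allL_iff] at k5
  rw [ckDual, allL_iff] at k7
  rw [upTo_iff] at k1
  have hrr : ∀ {d}, tb o.D d = true → rev (rev (fld o.T d)) = fld o.T d := fun hd =>
    rev_rev (hr.lt256 (hT hd))
  have h5 : ∀ a b, tb o.D a = true → tb o.D b = true → a / 16 = b / 16 → _ := fun a b ha hb hab =>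
    (Bool.or_eq_true _ _ ▸ k5 a ((hord a).2 ha) b ((hord b).2 hb)).resolve_left (by
      rw [show Nat.div a 16 = Nat.div b 16 from hab]; simp)
  simp only [Bool.and_eq_true, Bool.or_eq_true, beq_iff_eq, Bool.not_eq_true', force_eq, beq_iff] at h5
  have hpot : ∀ d, tb o.D d = true → _ := fun d hd => k4 d ((hord d).2 hd)
  simp only [Bool.and_eq_true, beq_iff, force_eq] at hpot
  have hHd : ∀ {d}, tb o.D d = true →
      ((tb e.H (rev (fld o.T d)) || tb e.H (fld o.T d)) = true ↔ Hd e (rev (fld o.T d))) :=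
    fun hd => by rw [Bool.or_eq_true, Hd, hrr hd]
  refine ⟨o, p, hr, ⟨hrev, hT, fun hd => (k3 _ ((hord _).2 hd)).2, ?_⟩, hord, ?_, ?_, ?_, ?_, ?_, ?_,
    k6, ?_, ?_, k9, k10, k11, k12⟩
  · intro i hi
    have := k1 i hi
    rw [anyL_iff] at this
    obtain ⟨d, h1, h2⟩ := this
    exact ⟨d, (hord d).1 h1, beq_iff.1 h2⟩
  · intro d hd x hx
    rw [← (hpot d hd).1, tb_lor, hx, Bool.true_or]
  · intro d hd hH
    have h2 := (hpot d hd).2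
    rw [(hHd hd).2 hH, cond_true] at h2
    simp only [Bool.and_eq_true, beq_iff] at h2
    exact ⟨h2.1.1.1, h2.1.1.2, h2.1.2, h2.2⟩
  · intro d hd hH
    have h2 := (hpot d hd).2
    rw [Bool.eq_false_iff.2 fun k => hH ((hHd hd).1 k), cond_false] at h2
    simp only [Bool.and_eq_true, beq_iff, beq_iff_eq] at h2
    exact ⟨h2.1.1, h2.1.2, h2.2⟩
  · intro a b ha hb hab
    exact (h5 a b ha hb hab).1.1
  · intro a ha hs
    rcases (h5 a a ha ha rfl).1.2 with h | h
    · exact h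
    · rw [hs] at h; simp at h
  · intro a b ha hb hab hV
    rcases (h5 a b ha hb hab).2 with h | h
    · rw [hV] at h; simp at h
    · rcases h with h | h
      · exact .inl h
      · refine .inr ⟨h.1, ?_⟩
        rcases h.2 with (h | h) | h
        exacts [.inl h, .inr (.inl h), .inr (.inr h)]
  · intro d hd
    have := k7 d ((hord d).2 hd)
    simpa using this
  · split at k8
    · exact ⟨_, _, k8⟩
    · simp at k8

end NSC

namespace NSC
open Chk
open Surf

theorem InC.keep {S : Surf} {G G' : ℕ → ℕ → Prop} {v w x} (h : S.InC G v w x) (hw : G' v w)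
    (hn : ∀ y, G' v y → G v y) : S.InC G' v w x := by
  obtain ⟨-, k, e, hk⟩ := h
  exact ⟨hw, k, e, fun j h1 h2 h3 => hk j h1 h2 (hn _ h3)⟩

/-- the corner of the dart `d` contains the flag `(v,x)` -/
def Cr (S : Surf) (o : St) (m : ℕ → ℕ) (d v x : ℕ) : Prop :=
  tb o.D d = true ∧ m (d / 16) = v ∧ S.InC (Gr o.D m) v (m (d % 16)) x

namespace EntOk
variable {lib : List Ks} {e : Ent} {o : St} {p : ℕ} {S : Surf} {m : ℕ → ℕ}

theorem cr_unique (E : EmbS S o m) {d d' v x} (h1 : Cr S o m d v x) (h2 : Cr S o m d' v x) : d = d' := by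
  obtain ⟨h3, h4, h5⟩ := h1
  obtain ⟨k3, k4, k5⟩ := h2
  exact E.emb.img_inj h3 k3 (by rw [img, img, h4, k4, h5.unique E.emb.sub k5])

theorem cr_adj (E : EmbS S o m) {d v x} (h1 : Cr S o m d v x) : S.adj v x := h1.2.2.adj E.emb.sub

theorem cr_exists (h : EntOk lib e o p) (E : EmbS S o m) {i x} (hi : i < o.n) (hx : S.adj (m i) x) : ∃ d, Cr S o m d (m i) x := by
  obtain ⟨d, hd, rfl⟩ := h.inv.full (h.root.n ▸ hi)
  obtain ⟨w, hw⟩ := InC.exists E.emb.sub (Emb.gr hd) hx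
  obtain ⟨d', h1, h2, rfl⟩ := hw.1
  exact ⟨d', h1, h2, hw⟩

theorem cr_self (_ : EmbS S o m) {d} (hd : tb o.D d = true) : Cr S o m d (m (d / 16)) (m (d % 16)) :=
  ⟨hd, rfl, InC.self (Emb.gr hd)⟩

theorem cr_step (h : EntOk lib e o p) (E : EmbS S o m) {i x} (hi : i < o.n) (hx : S.adj (m i) x) :
    (¬ Gr o.D m (m i) x ∧ ∃ d, Cr S o m d (m i) x ∧ Cr S o m d (m i) (S.t x (m i))) ∨
    ∃ d, tb o.D d = true ∧ Cr S o m (rev (fld o.T d)) (m i) x ∧ Cr S o m d (m i) (S.t x (m i)) ∧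
      m (rev (fld o.T d) / 16) = m i ∧ m (rev (fld o.T d) % 16) = x := by
  have hy : S.adj (m i) (S.t x (m i)) := S.symm (S.t_adj (S.symm hx)) |> S.symm
  obtain ⟨d, hd⟩ := h.cr_exists E hi hy
  by_cases hg : Gr o.D m (m i) x
  · right
    have h1 := Nx.of_pred E.emb.sub hg hd.2.2
    have h2 := E.emb.nx hd.1
    rw [hd.2.1] at h2
    have h3 := h1.unique h2
    have hT := h.inv.T1 hd.1
    have hl := h.root.lt256 hT
    have h4 : m (rev (fld o.T d) / 16) = m i := by rw [rev_div hl, E.emb.T2 hd.1, hd.2.1]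
    have h5 : m (rev (fld o.T d) % 16) = x := by rw [rev_mod hl, h3]
    have := cr_self E (h.inv.revD hT)
    rw [h4, h5] at this
    exact ⟨d, hd.1, this, hd, h4, h5⟩
  · left
    have e1 : S.t (m i) (S.t x (m i)) = x := S.t_succ_pred hx
    refine ⟨hg, d, ⟨hd.1, hd.2.1, ?_⟩, hd⟩
    have := hd.2.2.step (by rwa [e1])
    rwa [e1] at this

/-- handle vertices -/
def HV (e : Ent) (o : St) (m : ℕ → ℕ) (v : ℕ) : Prop :=
  ∃ d, tb o.D d = true ∧ tb e.V d = true ∧ m (d / 16) = v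

/-- handle edges -/
def HK (e : Ent) (o : St) (m : ℕ → ℕ) (u v : ℕ) : Prop :=
  ∃ d, tb o.D d = true ∧ Hd e d ∧ m (d / 16) = u ∧ m (d % 16) = v

/-- starred flags -/
def Hs (S : Surf) (e : Ent) (o : St) (m : ℕ → ℕ) (v x : ℕ) : Prop :=
  ∃ d, Cr S o m d v x ∧ tb e.S d = true

open scoped Classical in
/-- potentials -/
noncomputable def Hp (S : Surf) (e : Ent) (o : St) (m : ℕ → ℕ) (φ : ℕ → ℕ → ZMod 2) (v x : ℕ) : ZMod 2 :=
  if h : ∃ d, Cr S o m d v x then ev φ m (pot e h.choose) else 0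

theorem hp_eq (E : EmbS S o m) {d v x φ} (h1 : Cr S o m d v x) : Hp S e o m φ v x = ev φ m (pot e d) := by
  have h2 : ∃ d, Cr S o m d v x := ⟨d, h1⟩
  rw [Hp, dif_pos h2, cr_unique E h1 h2.choose_spec]

theorem hs_iff (E : EmbS S o m) {d v x} (h1 : Cr S o m d v x) : Hs S e o m v x ↔ tb e.S d = true :=
  ⟨fun ⟨d', h2, h3⟩ => cr_unique E h1 h2 ▸ h3, fun h2 => ⟨d, h1, h2⟩⟩

theorem hv_iff (h : EntOk lib e o p) (E : EmbS S o m) {d} (hd : tb o.D d = true) : HV e o m (m (d / 16)) ↔ tb e.V d = true := by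
  constructor
  · rintro ⟨d', h1, h2, h3⟩
    rw [← h.pairV d' d h1 hd (E.emb.inj (E.emb.lt h1).1 (E.emb.lt hd).1 h3), h2]
  · exact fun h2 => ⟨d, hd, h2, rfl⟩

theorem hv_cr (h : EntOk lib e o p) (E : EmbS S o m) {d v x} (hd : Cr S o m d v x) : HV e o m v ↔ tb e.V d = true := by
  rw [← hd.2.1]; exact h.hv_iff E hd.1

theorem hv_lt (E : EmbS S o m) {v} (hv : HV e o m v) : ∃ i, i < o.n ∧ m i = v := by
  obtain ⟨d, h1, -, h3⟩ := hv
  exact ⟨_, (E.emb.lt h1).1, h3⟩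

theorem hk_rev (E : EmbS S o m) {d} (hd : tb o.D d = true) : HK e o m (m (d / 16)) (m (d % 16)) ↔ Hd e d := by
  constructor
  · rintro ⟨d', h1, h2, h3, h4⟩
    rwa [E.emb.img_inj hd h1 (by rw [img, img, h3, h4])]
  · exact fun h => ⟨d, hd, h, rfl, rfl⟩

theorem hd_rev {d} (hd : d < 256) : Hd e (rev d) ↔ Hd e d := by
  unfold Hd; rw [rev_rev hd]; tauto

theorem hk_symm (h : EntOk lib e o p) {u v} (hk : HK e o m u v) : HK e o m v u := by
  obtain ⟨d, h1, h2, rfl, rfl⟩ := hk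
  have := h.root.lt256 h1
  exact ⟨rev d, h.inv.revD h1, (hd_rev this).2 h2, by rw [rev_div this], by rw [rev_mod this]⟩

theorem hk_hv (h : EntOk lib e o p) (E : EmbS S o m) {u v} (hk : HK e o m u v) : HV e o m u := by
  obtain ⟨d, h1, h2, rfl, rfl⟩ := hk
  have hl := h.root.lt256 h1
  obtain ⟨d', h3, h4⟩ := h.root.surj h.inv (h.inv.revD h1)
  have := (h.potH d' h3 (by rw [h4, rev_rev hl]; exact h2)).2.2.1
  rw [h4, rev_rev hl] at this
  exact (h.hv_iff E h1).2 this

theorem h_s1 (h : EntOk lib e o p) (E : EmbS S o m) {v x} (hx : S.adj v x) (hv : HV e o m v) (hk : ¬ HK e o m v x) :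
    (Hs S e o m v x ↔ Hs S e o m v (S.t x v)) ∧
    ∀ φ, Hp S e o m φ v x = Hp S e o m φ v (S.t x v) := by
  obtain ⟨i, hi, rfl⟩ := hv_lt E hv
  rcases h.cr_step E hi hx with ⟨-, d, h1, h2⟩ | ⟨d, hd, h1, h2, h3, h4⟩
  · exact ⟨by rw [hs_iff E h1, hs_iff E h2], fun φ => by rw [hp_eq E h1, hp_eq E h2]⟩
  · rw [← h3, ← h4] at hk
    rw [hk_rev E h1.1] at hk
    have := h.potN d hd hk
    exact ⟨by rw [hs_iff E h1, hs_iff E h2, this.2.1], fun φ => by rw [hp_eq E h1, hp_eq E h2, this.2.2]⟩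

theorem two_cancel {a b : ZMod 2} (h : a + b = 0) : a = b := by
  revert a b; decide

theorem h_p2 (h : EntOk lib e o p) (E : EmbS S o m) {φ v w} (hφ : S.Coc φ) (hk : HK e o m v w) :
    φ v w = Hp S e o m φ v w + Hp S e o m φ w (S.t v w) := by
  obtain ⟨g, h1, h2, rfl, rfl⟩ := hk
  have hl := h.root.lt256 h1
  obtain ⟨d, h3, h4⟩ := h.root.surj h.inv h1
  have hr := h.inv.revD h1
  have hlr := rev_lt hl
  have h5 := (h.potH d h3 (by rw [h4]; exact (hd_rev hl).2 h2)).2.2.2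
  rw [h4] at h5
  have hn := (E.emb.nx h3).pred E.emb.sub
  rw [h4] at hn
  have e1 : d / 16 = g % 16 := by rw [← h4, E.emb.T2 h3]
  rw [e1] at hn
  have c1 : Cr S o m d (m (g % 16)) (S.t (m (g / 16)) (m (g % 16))) := ⟨h3, by rw [e1], hn⟩
  rw [hp_eq E c1, hp_eq E (cr_self E h1)]
  have h6 := congrArg (ev φ m) h5
  rw [ev_xor, ev_eb hlr (hφ.symm (E.emb.adj hr)), rev_div hl, rev_mod hl,
    hφ.symm (S.symm (E.emb.adj h1))] at h6
  exact h6.symm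

theorem h_pair (h : EntOk lib e o p) (E : EmbS S o m) {v x y} (hx : S.adj v x) (hy : S.adj v y) (hv : HV e o m v) :
    ∃ a b, Cr S o m a v x ∧ Cr S o m b v y ∧ (Nat.xor (pot e a) (pot e b) = 0 ∨ (tb e.S a = true ∨ tb e.S b = true) ∧
    (Nat.xor (pot e a) (pot e b) = e.g1 ∨ Nat.xor (pot e a) (pot e b) = e.g2 ∨
      Nat.xor (pot e a) (pot e b) = Nat.xor e.g1 e.g2)) := by
  obtain ⟨i, hi, rfl⟩ := hv_lt E hv
  obtain ⟨a, ha⟩ := h.cr_exists E hi hx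
  obtain ⟨b, hb⟩ := h.cr_exists E hi hy
  refine ⟨a, b, ha, hb, h.pair a b ha.1 hb.1 ?_ ((h.hv_cr E ha).1 hv)⟩
  exact E.emb.inj (E.emb.lt ha.1).1 (E.emb.lt hb.1).1 (by rw [ha.2.1, hb.2.1])

theorem ev_zero' (φ : ℕ → ℕ → ZMod 2) (m : ℕ → ℕ) : ev φ m 0 = 0 := by
  have h := ev_xor φ m 0 0
  have h2 : Nat.xor 0 0 = 0 := by decide
  rw [h2] at h
  generalize ev φ m 0 = a at h; revert a; decide

theorem h_p3 (h : EntOk lib e o p) (E : EmbS S o m) {φ v x y} (hx : S.adj v x) (hy : S.adj v y) (hv : HV e o m v) (h1 : ¬ Hs S e o m v x)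
    (h2 : ¬ Hs S e o m v y) : Hp S e o m φ v x = Hp S e o m φ v y := by
  obtain ⟨a, b, ha, hb, hh⟩ := h.h_pair E hx hy hv
  rw [hs_iff E ha] at h1
  rw [hs_iff E hb] at h2
  have h3 := hh.resolve_right (by tauto)
  have := congrArg (ev φ m) h3
  rw [ev_xor, ev_zero'] at this
  rw [hp_eq E ha, hp_eq E hb]
  exact two_cancel this

theorem h_p8 (h : EntOk lib e o p) (E : EmbS S o m) {φ v x y} (g1 : ev φ m e.g1 = 0) (g2 : ev φ m e.g2 = 0) (hx : S.adj v x) (hy : S.adj v y)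
    (hv : HV e o m v) : Hp S e o m φ v x = Hp S e o m φ v y := by
  obtain ⟨a, b, ha, hb, hh⟩ := h.h_pair E hx hy hv
  rw [hp_eq E ha, hp_eq E hb]
  apply two_cancel
  rw [← ev_xor]
  rcases hh with k | ⟨-, k | k | k⟩ <;> rw [k]
  · exact ev_zero' _ _
  · exact g1
  · exact g2
  · rw [ev_xor, g1, g2, add_zero]

end EntOk
end NSC

namespace NSC
open Chk
open Surf
namespace EntOk
variable {lib : List Ks} {e : Ent} {o : St} {p : ℕ} {S : Surf} {m : ℕ → ℕ}

theorem ev_arc2 {φ : ℕ → ℕ → ZMod 2} (hφ : S.Coc φ) {a b x y u v w z : ℕ} (hx : x < 256) (hy : y < 256)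
    (hu : m (x / 16) = u) (hv : m (x % 16) = v) (hw : m (y / 16) = w) (hz : m (y % 16) = z)
    (a1 : S.adj u v) (a2 : S.adj w z) (h0 : ev φ m (arc2 e a b x y) = 0) :
    φ u v + φ w z = ev φ m (pot e a) + ev φ m (pot e b) := by
  subst hu hv hw hz
  unfold arc2 at h0
  rw [ev_xor, ev_xor, ev_xor, ev_eb hx (hφ.symm a1), ev_eb hy (hφ.symm a2)] at h0
  exact two_cancel h0

theorem p4_aux (h : EntOk lib e o p) (E : EmbS S o m) (hl : ∀ K ∈ lib, Avoid K) (hS : ¬ S.Good) {φ}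
    (hφ : S.Coc φ) {a b u v : ℕ} (ha : Cr S o m a u v) (hb : Cr S o m b v u) (hVa : tb e.V a = true)
    (hVb : tb e.V b = true) (hlt : a / 16 < b / 16) (hs : tb e.S a = true ∨ tb e.S b = true)
    (hk : ¬ HK e o m u v) : φ u v = ev φ m (pot e a) + ev φ m (pot e b) := by
  have h1 := h.one
  unfold ckOne at h1
  rw [allL_iff] at h1
  have h1 := (Bool.or_eq_true _ _ ▸ h1 a ((h.ord a).2 ha.1)).resolve_left (by simp [hVa])
  rw [allL_iff] at h1
  have h1 := (Bool.or_eq_true _ _ ▸ h1 b ((h.ord b).2 hb.1)).resolve_left (by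
    rw [show Nat.blt (Nat.div a 16) (Nat.div b 16) = true from blt_iff.2 hlt, hVb]
    rcases hs with hs | hs <;> rw [hs] <;> simp)
  simp only [force_eq] at h1
  have hadj := cr_adj E ha
  obtain ⟨ha1, rfl, ha3⟩ := ha
  obtain ⟨hb1, rfl, hb3⟩ := hb
  have a16 : a / 16 < 16 := by have := h.root.lt256 ha1; omega
  have b16 : b / 16 < 16 := by have := h.root.lt256 hb1; omega
  change (bif tb o.D (key (a / 16) (b / 16)) then _ else _) = true at h1
  have hd : (key (a / 16) (b / 16)) / 16 = a / 16 := key_div b16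
  have hm : (key (a / 16) (b / 16)) % 16 = b / 16 := key_mod b16
  have hfin : ev φ m (Nat.xor (eb (key (a / 16) (b / 16))) (Nat.xor (pot e a) (pot e b))) = 0 →
      φ (m (a / 16)) (m (b / 16)) = ev φ m (pot e a) + ev φ m (pot e b) := by
    intro h0
    rw [ev_xor, ev_xor, ev_eb (d := key (a / 16) (b / 16)) (by rw [key_eq]; omega) (by rw [hd, hm]; exact hφ.symm hadj), hd, hm] at h0
    exact two_cancel h0
  apply hfin
  cases hD : tb o.D (key (a / 16) (b / 16)) with
  | true =>
    rw [hD, cond_true, Bool.or_eq_true, Bool.or_eq_true] at h1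
    have ea : a = key (a / 16) (b / 16) := by
      refine E.emb.img_inj ha1 hD ?_
      rw [img, img, hd, hm, ha3.eq_of_mem ⟨_, hD, by rw [hd], by rw [hm]⟩]
    have eb' : b = rev (key (a / 16) (b / 16)) := by
      have hr := h.inv.revD hD
      have hl := h.root.lt256 hD
      refine E.emb.img_inj hb1 hr ?_
      rw [img, img, rev_div hl, rev_mod hl, hd, hm,
        hb3.eq_of_mem ⟨_, hr, by rw [rev_div hl, hm], by rw [rev_mod hl, hd]⟩]
    rcases h1 with (h1 | h1) | h1
    · exact absurd ⟨_, hD, .inl h1, by rw [hd], by rw [hm]⟩ hk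
    · rw [Bool.not_eq_true', Bool.and_eq_false_iff] at h1
      change Nat.beq a (key (a / 16) (b / 16)) = false ∨ Nat.beq b (rev (key (a / 16) (b / 16))) = false at h1
      rw [← ea] at h1
      rw [show Nat.beq a a = true from beq_iff.2 rfl] at h1
      rw [ea] at eb'
      rw [hd, ← ea] at eb'
      rw [← eb', show Nat.beq b b = true from beq_iff.2 rfl] at h1
      simp at h1
    · exact null_spec E hφ h1
  | false =>
    rw [hD, cond_false] at h1
    obtain ⟨o', k1, k2, -, -⟩ := addE_spec E h1 ha1 hb1 rfl (by rw [show Nat.div a 16 = a / 16 from rfl, show Nat.div b 16 = b / 16 from rfl, hD]; simp) ha3 hb3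
    exact closed_spec k2 hl hS k1 hφ

theorem h_p4 (h : EntOk lib e o p) (E : EmbS S o m) (hl : ∀ K ∈ lib, Avoid K) (hS : ¬ S.Good) {φ}
    (hφ : S.Coc φ) {u v : ℕ} (hx : S.adj u v) (hu : HV e o m u) (hv : HV e o m v)
    (hk : ¬ HK e o m u v) (hs : Hs S e o m u v ∨ Hs S e o m v u) :
    φ u v = Hp S e o m φ u v + Hp S e o m φ v u := by
  obtain ⟨i, hi, rfl⟩ := hv_lt E hu
  obtain ⟨j, hj, rfl⟩ := hv_lt E hv
  obtain ⟨a, ha⟩ := h.cr_exists E hi hx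
  obtain ⟨b, hb⟩ := h.cr_exists E hj (S.symm hx)
  rw [hs_iff E ha, hs_iff E hb] at hs
  rw [hp_eq E ha, hp_eq E hb]
  have hVa := (h.hv_cr E ha).1 hu
  have hVb := (h.hv_cr E hb).1 hv
  rcases Nat.lt_trichotomy (a / 16) (b / 16) with h1 | h1 | h1
  · exact h.p4_aux E hl hS hφ ha hb hVa hVb h1 hs hk
  · have := S.ne hx
    rw [← ha.2.1, ← hb.2.1, h1] at this
    exact absurd rfl this
  · rw [hφ.symm hx, add_comm]
    exact h.p4_aux E hl hS hφ hb ha hVb hVa h1 hs.symm fun k => hk (h.hk_symm k)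

end EntOk
end NSC

namespace NSC
open Chk
open Surf

theorem EmbK.congr {S : Surf} {K : Ks} {o : St} {p : ℕ} {m m' : ℕ → ℕ} (h : RootOk K o) (hi : RootInv K o p) (he : EmbK S K m)
    (hm : ∀ i, i < K.1 → m' i = m i) : EmbK S K m' := by
  have h1 : ∀ g ∈ K.2, ∀ c ∈ g, m' c.1 = m c.1 := fun g hg c hc => hm _ (h.lt g hg c hc).1
  have h2 : ∀ g ∈ K.2, ∀ c ∈ g, m' c.2.1 = m c.2.1 := fun g hg c hc => hm _ (h.lt g hg c hc).2
  have h3 : ∀ g ∈ K.2, ∀ c ∈ g, m' c.2.2 = m c.2.2 := fun g hg c hc => hm _ (h.lt3 hi hg hc)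
  have hG : GK K m' = GK K m := by
    funext u v
    apply propext
    constructor
    · rintro ⟨g, hg, c, hc, rfl, rfl⟩
      exact ⟨g, hg, c, hc, (h1 g hg c hc).symm, (h2 g hg c hc).symm⟩
    · rintro ⟨g, hg, c, hc, rfl, rfl⟩
      exact ⟨g, hg, c, hc, (h1 g hg c hc), (h2 g hg c hc)⟩
  constructor
  · intro a b ha hb hab
    rw [hm a ha, hm b hb] at hab
    exact he.inj ha hb hab
  · intro g hg c hc
    rw [h1 g hg c hc, h2 g hg c hc]; exact he.adj g hg c hc
  · intro g hg c hc
    rw [hG, h1 g hg c hc, h2 g hg c hc, h3 g hg c hc]; exact he.nx g hg c hc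
  · intro g hg c hc c' hc'
    rw [hG, h1 g hg c hc, h2 g hg c hc, h1 g hg c' hc', h2 g hg c' hc']; exact he.conn g hg c hc c' hc'
  · refine he.sep.imp_of_mem ?_
    intro g g' hg hg' hh c hc c' hc'
    rw [hG, h1 g hg c hc, h2 g hg c hc, h1 g' hg' c' hc', h2 g' hg' c' hc']; exact hh c hc c' hc'

namespace EntOk
variable {lib : List Ks} {e : Ent} {o : St} {p : ℕ} {S : Surf} {m : ℕ → ℕ}

theorem cr_eq_rev (E : EmbS S o m) {b v x c : ℕ} (hb : Cr S o m b v x) (hc : tb o.D c = true)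
    (h1 : m (c / 16) = x) (h2 : m (c % 16) = v) : b = rev c := by
  have hr := E.emb.revD hc
  have hl := E.emb.lt256 hc
  obtain ⟨hb1, rfl, hb3⟩ := hb
  refine E.emb.img_inj hb1 hr ?_
  rw [img, img, rev_div hl, rev_mod hl, h1, h2,
        hb3.eq_of_mem ⟨_, hr, by rw [rev_div hl, h2], by rw [rev_mod hl, h1]⟩]

theorem p5_out (h : EntOk lib e o p) (E : EmbS S o m) (hl : ∀ K ∈ lib, Avoid K) (hS : ¬ S.Good) {φ}
    (hφ : S.Coc φ) {a b i u v : ℕ} (hi : i < o.n) (ha : Cr S o m a u (m i)) (hb : Cr S o m b v (m i)) (hsa : tb e.S a = true)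
    (hsb : tb e.S b = true) (hne : u ≠ v) (hx : ¬ HV e o m (m i))
    (hna : ¬ tb o.D (key i (a / 16)) = true)
    (hlt : ¬ tb o.D (key i (b / 16)) = true → a / 16 < b / 16) :
    φ u (m i) + φ v (m i) = ev φ m (pot e a) + ev φ m (pot e b) := by
  have hau := cr_adj E ha
  have hbv := cr_adj E hb
  obtain ⟨d, hd⟩ := h.cr_exists E hi (S.symm hau)
  have hdi : d / 16 = i := E.emb.inj (E.emb.lt hd.1).1 hi hd.2.1
  have hVd : tb e.V d = false := by
    rw [h.hv_cr E hd] at hx; simpa using hx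
  have h1 := h.out
  unfold ckOut at h1
  rw [allL_iff] at h1
  have h1 := (Bool.or_eq_true _ _ ▸ h1 a ((h.ord a).2 ha.1)).resolve_left (by simp [hsa])
  rw [allL_iff] at h1
  have h1 := (Bool.or_eq_true _ _ ▸ h1 d ((h.ord d).2 hd.1)).resolve_left (by simp [hVd])
  simp only [force_eq] at h1
  rw [show Nat.div d 16 = i from hdi, show Nat.div a 16 = a / 16 from rfl, Bool.or_eq_true] at h1
  have h1 := h1.resolve_left hna
  have hVa := h.SV a ha.1 hsa
  have hVb := h.SV b hb.1 hsb
  have hxu : m i ≠ u := fun k => hx (by rw [k]; exact (h.hv_cr E ha).2 hVa)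
  have hxv : m i ≠ v := fun k => hx (by rw [k]; exact (h.hv_cr E hb).2 hVb)
  have hai := E.emb.lt ha.1
  have hbi := E.emb.lt hb.1
  have hn16 := E.emb.n16
  have e1 : ∀ j, key i (j / 16) / 16 = i ∨ 256 ≤ j := by intro j; rw [key_eq]; omega
  have kd : ∀ j, j < 256 → key i (j / 16) / 16 = i ∧ key i (j / 16) % 16 = j / 16 ∧ key i (j / 16) < 256 := by
    intro j hj; rw [key_eq]; omega
  obtain ⟨ka1, ka2, ka3⟩ := kd a (E.emb.lt256 ha.1)
  obtain ⟨kb1, kb2, kb3⟩ := kd b (E.emb.lt256 hb.1)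
  have ra : rev (key i (a / 16)) = key (a / 16) i := rev_key (by omega)
  obtain ⟨o', k1, E', hn', hD'⟩ := addE_spec E h1 hd.1 ha.1 (by rw [hdi]) hna (by
      have := hd.2.2; rw [← ha.2.1] at this; rwa [hdi]) (by
      have := ha.2.2; rw [← ha.2.1] at this; rwa [hdi])
  rw [Bool.or_eq_true] at k1
  have k1 := k1.resolve_left fun k => hS (closedB_spec E' hl k)
  rw [allL_iff] at k1
  have k1 := k1 b ((h.ord b).2 hb.1)
  have hab : b / 16 ≠ a / 16 := fun k => hne (by rw [← ha.2.1, ← hb.2.1, k])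
  rw [Bool.or_eq_true, Bool.or_eq_true] at k1
  have k1 := k1.resolve_left (by
    rintro (k | k)
    · simp [hsb] at k
    · exact hab (beq_iff.1 k))
  change (bif tb o.D (key i (b / 16)) then _ else _) = true at k1
  apply ev_arc2 hφ (a := a) (b := b) (x := rev (key i (a / 16))) (y := rev (key i (b / 16)))
    (rev_lt ka3) (rev_lt kb3) (by rw [rev_div ka3, ka2, ha.2.1]) (by rw [rev_mod ka3, ka1])
    (by rw [rev_div kb3, kb2, hb.2.1]) (by rw [rev_mod kb3, kb1]) hau hbv
  have ebr : ∀ {φ} {c : ℕ}, S.Coc φ → c < 256 → S.adj (m (c / 16)) (m (c % 16)) → ev φ m (eb (rev c)) = ev φ m (eb c) := by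
    intro φ c hφ hc hadj
    rw [ev_eb hc (hφ.symm hadj), ev_eb (rev_lt hc) (by rw [rev_div hc, rev_mod hc]; exact (hφ.symm hadj).symm),
      rev_div hc, rev_mod hc, hφ.symm hadj]
  have hgoal : ev φ m (arc2 e a b (key i (a / 16)) (key i (b / 16))) = 0 := by
    by_cases hy : tb o.D (key i (b / 16)) = true
    · rw [hy, cond_true, Bool.or_eq_true] at k1
      rcases k1 with k1 | k1
      · have := cr_eq_rev E hb hy (by rw [kb1]) (by rw [kb2, hb.2.1])
        rw [Bool.not_eq_true', ← Bool.not_eq_true] at k1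
        exact absurd (beq_iff.2 this) k1
      · exact null_spec E' hφ k1
    · have hlt := hlt hy
      rw [Bool.not_eq_true] at hy
      rw [hy, cond_false, Bool.or_eq_true] at k1
      have k1 := k1.resolve_left (by
        rw [show Nat.blt (a / 16) (Nat.div b 16) = true from blt_iff.2 hlt]; simp)
      rw [upTo_iff] at k1
      have hGx : Gr o'.D m (m i) u :=
        ⟨key i (a / 16), (hD' _).2 (.inr (.inl rfl)), by rw [ka1], by rw [ka2, ha.2.1]⟩
      obtain ⟨w, hw⟩ := InC.exists E'.emb.sub hGx (S.symm hbv)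
      obtain ⟨f, hf1, hf2, hf3⟩ := hw.1
      have hfl := E'.emb.lt hf1
      have hfi : f / 16 = i := E'.emb.inj hfl.1 (by omega) hf2
      have hfk : key i (f % 16) = f := by rw [key_eq]; omega
      have k1 := k1 (f % 16) (by omega)
      rw [hfk, Bool.or_eq_true] at k1
      have k1 := k1.resolve_left (by simp [hf1])
      have hny : ¬ tb o'.D (key i (b / 16)) = true := by
        rw [hD', hy, ra, key_eq, key_eq, key_eq]
        intro hh
        have hia : i ≠ a / 16 := fun k => hxu (by rw [k, ha.2.1])
        rcases hh with hh | hh | hh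
        · simp at hh
        · omega
        · omega
      obtain ⟨o2, k2, E2, -, -⟩ := addE_spec E' k1 hf1 ((hD' _).2 (.inl hb.1)) (by rw [hfi]; rfl) hny (by
        rw [hfi, hf3]; rw [← hb.2.1] at hw; exact hw) (by
        rw [hfi]
        have := hb.2.2
        rw [← hb.2.1] at this
        refine InC.keep this ⟨b, (hD' _).2 (.inl hb.1), rfl, rfl⟩ ?_
        rintro y ⟨f, hf1, hf2, hf3⟩
        rcases (hD' _).1 hf1 with hf1 | rfl | rfl
        · exact ⟨f, hf1, hf2, hf3⟩
        · rw [ka1, hb.2.1] at hf2; exact absurd hf2 hxv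
        · rw [rev_div ka3, ka2, ha.2.1, hb.2.1] at hf2; exact absurd hf2 hne)
      exact closed_spec E2 hl hS k2 hφ
  rw [← hgoal]
  unfold arc2
  rw [ev_xor, ev_xor, ev_xor, ev_xor (φ := φ) (x := (eb (key i (a / 16))).xor _),
    ev_xor (φ := φ) (x := eb (key i (a / 16))), ebr hφ ka3 (by rw [ka1, ka2, ha.2.1]; exact S.symm hau),
    ebr hφ kb3 (by rw [kb1, kb2, hb.2.1]; exact S.symm hbv), ev_xor]

end EntOk
end NSC

namespace NSC
open Chk
open Surf
namespace EntOk
variable {lib : List Ks} {e : Ent} {o : St} {p : ℕ} {S : Surf} {m : ℕ → ℕ}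

theorem p5_known (h : EntOk lib e o p) (E : EmbS S o m) {φ}
    (hφ : S.Coc φ) {a b i u v : ℕ} (ha : Cr S o m a u (m i)) (hb : Cr S o m b v (m i)) (hsa : tb e.S a = true)
    (hsb : tb e.S b = true) (hx : ¬ HV e o m (m i))
    (hna : tb o.D (key i (a / 16)) = true) (hnb : tb o.D (key i (b / 16)) = true)
    (hlt : a / 16 < b / 16) :
    φ u (m i) + φ v (m i) = ev φ m (pot e a) + ev φ m (pot e b) := by
  have hau := cr_adj E ha
  have hbv := cr_adj E hb
  have kd : ∀ j, j < 256 → key i (j / 16) / 16 = i ∧ key i (j / 16) % 16 = j / 16 := by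
    intro j hj; rw [key_eq]; omega
  have la := E.emb.lt256 ha.1
  have lb := E.emb.lt256 hb.1
  obtain ⟨ka1, ka2⟩ := kd a la
  obtain ⟨kb1, kb2⟩ := kd b lb
  have ea := cr_eq_rev E ha hna (by rw [ka1]) (by rw [ka2, ha.2.1])
  have eb' := cr_eq_rev E hb hnb (by rw [kb1]) (by rw [kb2, hb.2.1])
  set A := key i (a / 16)
  set B := key i (b / 16)
  have lA := E.emb.lt256 hna
  have lB := E.emb.lt256 hnb
  have vA : tb e.V A = false := by
    have := h.hv_iff E hna
    rw [ka1] at this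
    rw [this] at hx
    simpa using hx
  have vB : tb e.V B = false := by
    have := h.hv_iff E hnb
    rw [kb1] at this
    rw [this] at hx
    simpa using hx
  have h1 := h.known
  unfold ckKnown at h1
  rw [allL_iff] at h1
  have h1 := (Bool.or_eq_true _ _ ▸ h1 A ((h.ord A).2 hna)).resolve_left (by simp [vA])
  rw [allL_iff] at h1
  have h1 := (h1 B ((h.ord B).2 hnb))
  simp only [force_eq] at h1
  rw [vB, show Nat.beq (Nat.div A 16) (Nat.div B 16) = true from beq_iff.2 (ka1.trans kb1.symm),
    show Nat.blt (Nat.mod A 16) (Nat.mod B 16) = true from blt_iff.2 (by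
      change A % 16 < B % 16; rw [ka2, kb2]; exact hlt), ← ea, ← eb', hsa, hsb] at h1
  simp only [Bool.not_true, Bool.false_or] at h1
  have ra : a % 16 = i := by rw [ea, rev_mod lA, ka1]
  have rb : b % 16 = i := by rw [eb', rev_mod lB, kb1]
  exact ev_arc2 hφ la lb ha.2.1 (by rw [ra]) hb.2.1 (by rw [rb]) hau hbv (null_spec E hφ h1)

theorem p5_fresh (h : EntOk lib e o p) (he : EmbK S e.K m) (hl : ∀ K ∈ lib, Avoid K) (hS : ¬ S.Good) {φ}
    (hφ : S.Coc φ) {a b u v x : ℕ} (ha : Cr S o m a u x) (hb : Cr S o m b v x) (hsa : tb e.S a = true)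
    (hsb : tb e.S b = true) (hx : ∀ i, i < o.n → m i ≠ x)
    (hlt : a / 16 < b / 16) :
    φ u x + φ v x = ev φ m (pot e a) + ev φ m (pot e b) := by
  have E := h.root.embS h.inv he
  have hau := cr_adj E ha
  have hbv := cr_adj E hb
  have hlD : ∀ {d}, tb o.D d = true → d / 16 < o.n ∧ d % 16 < o.n := fun hd => E.emb.lt hd
  have hal := hlD ha.1
  have hbl := hlD hb.1
  have hne : u ≠ v := fun k => by
    have := E.emb.inj hal.1 hbl.1 (by rw [ha.2.1, hb.2.1, k]); omega
  have la := E.emb.lt256 ha.1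
  have lb := E.emb.lt256 hb.1
  have hn16 : o.n < 16 := by rw [h.root.n]; exact h.root.n16
  obtain ⟨m', hm', hmn⟩ : ∃ m' : ℕ → ℕ, (∀ i, i < o.n → m' i = m i) ∧ m' o.n = x :=
    ⟨Function.update m o.n x, fun i hi => Function.update_of_ne (by omega) _ _, Function.update_self _ _ _⟩
  have he' := he.congr h.root h.inv (m' := m') fun i hi => hm' i (by rw [h.root.n]; exact hi)
  have E' := h.root.embS h.inv he'
  have hG : Gr o.D m' = Gr o.D m := by
    funext u v
    apply propext
    constructor
    · rintro ⟨d, hd, rfl, rfl⟩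
      exact ⟨d, hd, (hm' _ (hlD hd).1).symm, (hm' _ (hlD hd).2).symm⟩
    · rintro ⟨d, hd, rfl, rfl⟩
      exact ⟨d, hd, hm' _ (hlD hd).1, hm' _ (hlD hd).2⟩
  have hev : ∀ {d}, tb o.D d = true → ev φ m' (pot e d) = ev φ m (pot e d) := by
    intro d hd
    refine ev_congr φ fun d' hd' => ?_
    have := hlD (h.potD d hd d' hd')
    exact ⟨hm' _ this.1, hm' _ this.2⟩
  have ha' : Cr S o m' a u x := ⟨ha.1, by rw [hm' _ hal.1, ha.2.1], by rw [hG, hm' _ hal.2]; exact ha.2.2⟩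
  have hb' : Cr S o m' b v x := ⟨hb.1, by rw [hm' _ hbl.1, hb.2.1], by rw [hG, hm' _ hbl.2]; exact hb.2.2⟩
  rw [← hev ha.1, ← hev hb.1]
  have h1 := h.fresh
  unfold ckFresh at h1
  rw [allL_iff] at h1
  have h1 := (Bool.or_eq_true _ _ ▸ h1 a ((h.ord a).2 ha.1)).resolve_left (by simp [hsa])
  have hux : u ≠ x := S.ne hau
  have hvx : v ≠ x := S.ne hbv
  obtain ⟨o1, k1, E1, hn1, hD1⟩ := pend_spec E' h1 hn16 ha.1 (by
    rw [hmn, ha'.2.1]; exact ha'.2.2) (fun hi => by rw [hm' _ hi, hmn]; exact hx _ hi)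
  simp only [force_eq] at k1
  rw [allL_iff] at k1
  have k1 := (Bool.or_eq_true _ _ ▸ k1 b ((h.ord b).2 hb.1)).resolve_left (by
    rw [show Nat.blt (Nat.div a 16) (Nat.div b 16) = true from blt_iff.2 hlt, hsb]; simp)
  have X1 : key o.n (a / 16) / 16 = o.n := by rw [key_eq]; omega
  have X2 : key o.n (a / 16) % 16 = a / 16 := by rw [key_eq]; omega
  have Y1 : key o.n (b / 16) / 16 = o.n := by rw [key_eq]; omega
  have Y2 : key o.n (b / 16) % 16 = b / 16 := by rw [key_eq]; omega
  have rx : rev (key (a / 16) o.n) = key o.n (a / 16) := rev_key (by omega)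
  have P1 : key (a / 16) o.n / 16 = a / 16 := by rw [key_eq]; omega
  have hXD : tb o1.D (key o.n (a / 16)) = true := (hD1 _).2 (.inr (.inr rx.symm))
  have hbD : tb o1.D b = true := (hD1 _).2 (.inl hb.1)
  have hny : ¬ tb o1.D (key o.n (b / 16)) = true := by
    rw [hD1]
    rintro (k | k | k)
    · have := (hlD k).1; omega
    · have := congrArg (· / 16) k; simp only [Y1, P1] at this; omega
    · rw [rx] at k; have := congrArg (· % 16) k; simp only [X2, Y2] at this; omega
  obtain ⟨o2, k2, E2, -, -⟩ := addE_spec E1 k1 hXD hbD (by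
      change key o.n (b / 16) = key (key o.n (a / 16) / 16) _; rw [X1]) hny (by
    change S.InC (Gr o1.D m') (m' (key o.n (a / 16) / 16)) (m' (key o.n (a / 16) % 16)) _
    rw [X1, X2, hmn, ha'.2.1, hb'.2.1]
    have hgx : Gr o1.D m' x u := ⟨_, hXD, by rw [X1, hmn], by rw [X2, ha'.2.1]⟩
    obtain ⟨w, hw⟩ := InC.exists E1.emb.sub hgx (S.symm hbv)
    obtain ⟨f, hf1, hf2, hf3⟩ := hw.1
    have : w = u := by
      rcases (hD1 _).1 hf1 with k | k | k
      · have := (hlD k).1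
        rw [hm' _ this] at hf2
        exact absurd hf2 (hx _ this)
      · rw [k, P1, ha'.2.1] at hf2
        exact absurd hf2 hux
      · rw [k, rx, X2, ha'.2.1] at hf3
        exact hf3.symm
    rwa [this] at hw) (by
    change S.InC (Gr o1.D m') _ _ (m' (key o.n (a / 16) / 16))
    rw [X1, hmn, hb'.2.1]
    refine InC.keep hb'.2.2 ⟨b, hbD, hb'.2.1, rfl⟩ ?_
    rintro y ⟨f, hf1, hf2, hf3⟩
    rcases (hD1 _).1 hf1 with k | k | k
    · exact ⟨f, k, hf2, hf3⟩
    · rw [k, P1, ha'.2.1] at hf2; exact absurd hf2 hne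
    · rw [k, rx, X1, hmn] at hf2; exact absurd hf2.symm hvx)
  have h0 := closed_spec E2 hl hS k2 hφ
  have := ev_arc2 (m := m') hφ (x := key o.n (a / 16)) (y := key o.n (b / 16)) (by rw [key_eq]; omega)
    (by rw [key_eq]; omega) (by rw [X1, hmn]) (by rw [X2, ha'.2.1]) (by rw [Y1, hmn]) (by rw [Y2, hb'.2.1])
    (S.symm hau) (S.symm hbv) h0
  rw [← this, hφ.symm hau, hφ.symm hbv]

theorem h_p5 (h : EntOk lib e o p) (he : EmbK S e.K m) (hl : ∀ K ∈ lib, Avoid K) (hS : ¬ S.Good) {φ}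
    (hφ : S.Coc φ) {u v x : ℕ} (hx : ¬ HV e o m x) (hu : Hs S e o m u x) (hv : Hs S e o m v x) :
    φ u x + φ v x = Hp S e o m φ u x + Hp S e o m φ v x := by
  have E := h.root.embS h.inv he
  obtain ⟨a, ha, sa⟩ := hu
  obtain ⟨b, hb, sb⟩ := hv
  rw [hp_eq E ha, hp_eq E hb]
  by_cases huv : u = v
  · subst huv
    rw [CharTwo.add_self_eq_zero, cr_unique E ha hb, CharTwo.add_self_eq_zero]
  have hne : a / 16 ≠ b / 16 := fun k => huv (by rw [← ha.2.1, ← hb.2.1, k])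
  by_cases hn : ∃ i, i < o.n ∧ m i = x
  · obtain ⟨i, hi, rfl⟩ := hn
    have hsw : ∀ {A B C D : ZMod 2}, B + A = D + C → A + B = C + D := by
      intro A B C D k; rw [add_comm A, add_comm C, k]
    rcases Nat.lt_or_gt_of_ne hne with hlt | hlt
    · by_cases h1 : tb o.D (key i (a / 16)) = true
      · by_cases h2 : tb o.D (key i (b / 16)) = true
        · exact h.p5_known E hφ ha hb sa sb hx h1 h2 hlt
        · exact hsw (h.p5_out E hl hS hφ hi hb ha sb sa (Ne.symm huv) hx h2 fun k => absurd h1 k)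
      · exact h.p5_out E hl hS hφ hi ha hb sa sb huv hx h1 fun _ => hlt
    · apply hsw
      by_cases h1 : tb o.D (key i (b / 16)) = true
      · by_cases h2 : tb o.D (key i (a / 16)) = true
        · exact h.p5_known E hφ hb ha sb sa hx h1 h2 hlt
        · exact hsw (h.p5_out E hl hS hφ hi ha hb sa sb huv hx h2 fun k => absurd h1 k)
      · exact h.p5_out E hl hS hφ hi hb ha sb sa (Ne.symm huv) hx h1 fun _ => hlt
  · have hn : ∀ i, i < o.n → m i ≠ x := fun i hi k => hn ⟨i, hi, k⟩
    rcases Nat.lt_or_gt_of_ne hne with hlt | hlt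
    · exact h.p5_fresh he hl hS hφ ha hb sa sb hn hlt
    · rw [add_comm (φ u x), add_comm (ev φ m _)]
      exact h.p5_fresh he hl hS hφ hb ha sb sa hn hlt

end EntOk
end NSC

namespace NSC
open Chk
open Surf
namespace EntOk
variable {lib : List Ks} {e : Ent} {o : St} {p : ℕ} {S : Surf} {m : ℕ → ℕ}

theorem p_mem (h : EntOk lib e o p) {g} (hg : tb o.D g = true) :
    tb o.D (fld p g) = true ∧ fld o.T (fld p g) = g := by
  obtain ⟨d, h1, rfl⟩ := h.root.surj h.inv hg
  rw [h.inv.p h1]; exact ⟨h1, rfl⟩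

theorem cr_p (h : EntOk lib e o p) (E : EmbS S o m) {g} (hg : tb o.D g = true) :
    Cr S o m (fld p g) (m (g % 16)) (S.t (m (g / 16)) (m (g % 16))) := by
  obtain ⟨h1, h2⟩ := h.p_mem hg
  have hn := (E.emb.nx h1).pred E.emb.sub
  rw [h2] at hn
  have e1 : fld p g / 16 = g % 16 := by rw [← E.emb.T2 h1, h2]
  rw [e1] at hn
  exact ⟨h1, by rw [e1], hn⟩

theorem cr_p_rev (h : EntOk lib e o p) (E : EmbS S o m) {g} (hg : tb o.D g = true) :
    Cr S o m (fld p (rev g)) (m (g / 16)) (S.t (m (g % 16)) (m (g / 16))) := by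
  have := h.cr_p E (h.inv.revD hg)
  have hl := E.emb.lt256 hg
  rwa [rev_div hl, rev_mod hl] at this

theorem cr_rev (h : EntOk lib e o p) (E : EmbS S o m) {g} (hg : tb o.D g = true) :
    Cr S o m (rev g) (m (g % 16)) (m (g / 16)) := by
  have := cr_self E (h.inv.revD hg)
  have hl := E.emb.lt256 hg
  rwa [rev_div hl, rev_mod hl] at this

theorem tb_clus {p d x : ℕ} : tb (clus p d) x = true ↔ x = d ∨ x = fld p d ∨ x = rev d ∨ x = fld p (rev d) := by
  unfold clus
  simp only [tb_lor, Bool.or_eq_true, tb_pw]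
  tauto

theorem exists_of_land {x y : ℕ} (h : (!(Nat.beq (Nat.land x y) 0)) = true) : ∃ d, tb x d = true ∧ tb y d = true := by
  by_contra hn
  have : Nat.land x y = 0 := by
    apply Nat.eq_of_testBit_eq
    intro i
    rw [← tb_eq, ← tb_eq, tb_land, tb_eq 0, Nat.zero_testBit]
    by_contra hc
    rw [Bool.not_eq_false, Bool.and_eq_true] at hc
    exact hn ⟨i, hc⟩
  rw [this] at h
  simp at h

/-- the faces with a starred flag -/
def HB (S : Surf) (e : Ent) (o : St) (m : ℕ → ℕ) (u v : ℕ) : Prop :=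
  Hs S e o m u v ∨ Hs S e o m v (S.t u v) ∨ Hs S e o m (S.t u v) u

theorem clus_B (h : EntOk lib e o p) (E : EmbS S o m) {g a} (hg : tb o.D g = true) (ha : tb (clus p g) a = true)
    (hs : tb e.S a = true) : (HB S e o m (m (g / 16)) (m (g % 16)) ∧ (a = g ∨ a = fld p g)) ∨
      (HB S e o m (m (g % 16)) (m (g / 16)) ∧ (a = rev g ∨ a = fld p (rev g))) := by
  rcases tb_clus.1 ha with rfl | rfl | rfl | rfl
  · exact .inl ⟨.inl ⟨_, cr_self E hg, hs⟩, .inl rfl⟩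
  · exact .inl ⟨.inr (.inl ⟨_, h.cr_p E hg, hs⟩), .inr rfl⟩
  · exact .inr ⟨.inl ⟨_, h.cr_rev E hg, hs⟩, .inl rfl⟩
  · exact .inr ⟨.inr (.inl ⟨_, h.cr_p_rev E hg, hs⟩), .inr rfl⟩

section conn
variable {Q : ℕ → ℕ → Prop}

theorem conn_cr (E : EmbS S o m)
    (q1 : ∀ {u v}, S.adj u v → HB S e o m u v → (Q u v ↔ Q v (S.t u v)))
    (q2 : ∀ {u v}, S.adj u v → HB S e o m u v → HB S e o m v u → (Q u v ↔ Q v u))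
    {a v x} (ha : Cr S o m a v x) (hs : tb e.S a = true) : Q v (m (a % 16)) ↔ Q v x := by
  refine ha.2.2.induct (P := fun x => Q v (m (a % 16)) ↔ Q v x) Iff.rfl ?_
  intro y hy ih hn
  have hyv := hy.adj E.emb.sub
  have s1 : Hs S e o m v y := ⟨a, ⟨ha.1, ha.2.1, hy⟩, hs⟩
  have s2 : Hs S e o m v (S.t v y) := ⟨a, ⟨ha.1, ha.2.1, hy.step hn⟩, hs⟩
  have a1 := S.t_adj hyv
  have a2 := S.t_adj' hyv
  have r1 : S.t y (S.t v y) = v := S.t_rot hyv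
  have r2 : S.t (S.t v y) v = y := S.t_rot' hyv
  rw [ih, q1 hyv (.inl s1), q1 a1 (.inr (.inr (by rw [r1]; exact s1))), r1]
  exact q2 a2 (.inr (.inl (by rw [r2]; exact s1))) (.inl s2)

theorem conn_clus (h : EntOk lib e o p) (E : EmbS S o m)
    (q1 : ∀ {u v}, S.adj u v → HB S e o m u v → (Q u v ↔ Q v (S.t u v)))
    (q2 : ∀ {u v}, S.adj u v → HB S e o m u v → HB S e o m v u → (Q u v ↔ Q v u))
    {a b g} (hg : tb o.D g = true) (ha : tb (clus p g) a = true) (hb : tb (clus p g) b = true)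
    (sa : tb e.S a = true) (sb : tb e.S b = true) :
    Q (m (a / 16)) (m (a % 16)) ↔ Q (m (b / 16)) (m (b % 16)) := by
  have hadj := E.emb.adj hg
  have k1 : ∀ {a}, tb e.S a = true → HB S e o m (m (g / 16)) (m (g % 16)) → (a = g ∨ a = fld p g) →
      (Q (m (a / 16)) (m (a % 16)) ↔ Q (m (g / 16)) (m (g % 16))) := by
    rintro a sa hB (rfl | rfl)
    · rfl
    · have := h.cr_p E hg
      rw [q1 hadj hB, this.2.1]
      exact conn_cr E q1 q2 this sa
  have k2 : ∀ {a}, tb e.S a = true → HB S e o m (m (g % 16)) (m (g / 16)) → (a = rev g ∨ a = fld p (rev g)) →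
      (Q (m (a / 16)) (m (a % 16)) ↔ Q (m (g % 16)) (m (g / 16))) := by
    have hl := E.emb.lt256 hg
    rintro a sa hB (rfl | rfl)
    · rw [rev_div hl, rev_mod hl]
    · have := h.cr_p_rev E hg
      rw [q1 (S.symm hadj) hB, this.2.1]
      exact conn_cr E q1 q2 this sa
  rcases h.clus_B E hg ha sa with ⟨B1, c1⟩ | ⟨B1, c1⟩ <;> rcases h.clus_B E hg hb sb with ⟨B2, c2⟩ | ⟨B2, c2⟩
  · rw [k1 sa B1 c1, k1 sb B2 c2]
  · rw [k1 sa B1 c1, k2 sb B2 c2, q2 hadj B1 B2]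
  · rw [k2 sa B1 c1, k1 sb B2 c2, q2 hadj B2 B1]
  · rw [k2 sa B1 c1, k2 sb B2 c2]

theorem conn_aux (h : EntOk lib e o p) (q : ℕ → Prop)
    (hq : ∀ {g a b}, tb o.D g = true → tb (clus p g) a = true → tb (clus p g) b = true →
      tb e.S a = true → tb e.S b = true → (q a ↔ q b)) :
    ∀ (l : List ℕ) (A : ℕ), ckConn e o.T p l A = true → (∀ d ∈ l, tb o.D d = true) →
      (∀ d, tb A d = true → tb e.S d = true) → (∀ d d', tb A d = true → tb A d' = true → (q d ↔ q d')) →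
      ∀ d d', (tb A d = true ∨ d ∈ l ∧ tb e.S d = true) → (tb A d' = true ∨ d' ∈ l ∧ tb e.S d' = true) →
        (q d ↔ q d') := by
  intro l
  induction l with
  | nil =>
    intro A _ _ _ h3 d d' h1 h2
    simp only [List.not_mem_nil, false_and, or_false] at h1 h2
    exact h3 d d' h1 h2
  | cons x l ih =>
    intro A h0 h1 h2 h3 d d'
    unfold ckConn at h0
    have hx := h1 x (by simp)
    cases hS : tb e.S x with
    | false =>
      rw [hS, cond_false] at h0
      have := ih A h0 (fun d hd => h1 d (by simp [hd])) h2 h3 d d'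
      intro k1 k2
      refine this (k1.imp_right ?_) (k2.imp_right ?_)
      · rintro ⟨k, k'⟩
        rcases List.mem_cons.1 k with rfl | k
        · rw [hS] at k'; simp at k'
        · exact ⟨k, k'⟩
      · rintro ⟨k, k'⟩
        rcases List.mem_cons.1 k with rfl | k
        · rw [hS] at k'; simp at k'
        · exact ⟨k, k'⟩
    | true =>
      rw [hS, cond_true] at h0
      simp only [force_eq] at h0
      rw [Bool.and_eq_true, Bool.or_eq_true] at h0
      obtain ⟨h0, h4⟩ := h0
      have hxq : ∀ d, tb A d = true → (q d ↔ q x) := by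
        intro d hd
        rcases h0 with h0 | h0
        · rw [beq_iff] at h0
          rw [h0, tb_eq, Nat.zero_testBit] at hd
          simp at hd
        · obtain ⟨f, hf1, hf2⟩ := exists_of_land h0
          rw [h3 d f hd hf1]
          rw [tb_lor, Bool.or_eq_true] at hf2
          rcases hf2 with hf2 | hf2
          · exact hq hx hf2 (tb_clus.2 (.inl rfl)) (h2 f hf1) hS
          · have hT := h.inv.T1 hx
            refine hq (h.inv.revD hT) hf2 (tb_clus.2 (.inr (.inr (.inr ?_)))) (h2 f hf1) hS
            rw [rev_rev (h.root.lt256 hT), h.inv.p hx]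
      have hA : ∀ d, tb (Nat.lor A (pw x)) d = true ↔ tb A d = true ∨ d = x := by
        intro d; rw [tb_lor, Bool.or_eq_true, tb_pw]
      have := ih _ h4 (fun d hd => h1 d (by simp [hd])) (fun d hd => ?_) (fun d d' hd hd' => ?_) d d'
      · intro k1 k2
        simp only [hA] at this
        refine this ?_ ?_
        · rcases k1 with k | ⟨k, k'⟩
          · exact .inl (.inl k)
          · rcases List.mem_cons.1 k with rfl | k
            exacts [.inl (.inr rfl), .inr ⟨k, k'⟩]
        · rcases k2 with k | ⟨k, k'⟩
          · exact .inl (.inl k)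
          · rcases List.mem_cons.1 k with rfl | k
            exacts [.inl (.inr rfl), .inr ⟨k, k'⟩]
      · rcases (hA d).1 hd with k | rfl
        exacts [h2 d k, hS]
      · have : ∀ d, tb (Nat.lor A (pw x)) d = true → (q d ↔ q x) := by
          intro d hd
          rcases (hA d).1 hd with k | rfl
          exacts [hxq d k, Iff.rfl]
        rw [this d hd, this d' hd']

theorem h_conn (h : EntOk lib e o p) (E : EmbS S o m)
    (q1 : ∀ {u v}, S.adj u v → HB S e o m u v → (Q u v ↔ Q v (S.t u v)))
    (q2 : ∀ {u v}, S.adj u v → HB S e o m u v → HB S e o m v u → (Q u v ↔ Q v u))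
    {u v x y} (h1 : Hs S e o m u v) (h2 : Hs S e o m x y) (h3 : Q u v) : Q x y := by
  obtain ⟨a, ha, sa⟩ := h1
  obtain ⟨b, hb, sb⟩ := h2
  rw [← conn_cr E q1 q2 hb sb, ← hb.2.1]
  rw [← conn_cr E q1 q2 ha sa, ← ha.2.1] at h3
  refine (h.conn_aux (fun a => Q (m (a / 16)) (m (a % 16))) (fun hg k1 k2 k3 k4 => h.conn_clus E q1 q2 hg k1 k2 k3 k4)
    e.ord 0 h.conn (fun d hd => (h.ord d).1 hd) ?_ ?_ a b (.inr ⟨(h.ord a).2 ha.1, sa⟩) (.inr ⟨(h.ord b).2 hb.1, sb⟩)).1 h3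
  · intro d hd; rw [tb_eq, Nat.zero_testBit] at hd; simp at hd
  · intro d d' hd; rw [tb_eq, Nat.zero_testBit] at hd; simp at hd

end conn
end EntOk
end NSC

namespace NSC
open Chk
open Surf

def bz (b : Bool) : ZMod 2 := if b = true then 1 else 0

theorem bz_xor (a b : Bool) : bz (a ^^ b) = bz a + bz b := by
  revert a b; decide

namespace EntOk
variable {lib : List Ks} {e : Ent} {o : St} {p : ℕ} {S : Surf} {m : ℕ → ℕ}

open scoped Classical in
/-- dual bits of flags -/
noncomputable def HU (S : Surf) (e : Ent) (o : St) (m : ℕ → ℕ) (v x : ℕ) : ZMod 2 :=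
  if ∃ d, Cr S o m d v x ∧ tb e.U d = true then 1 else 0

theorem hu_eq (E : EmbS S o m) {d v x} (h1 : Cr S o m d v x) : HU S e o m v x = bz (tb e.U d) := by
  unfold HU bz
  congr 1
  apply propext
  exact ⟨fun ⟨d', h2, h3⟩ => cr_unique E h1 h2 ▸ h3, fun h => ⟨d, h1, h⟩⟩

theorem hu_step (h : EntOk lib e o p) (E : EmbS S o m) {v x} (hx : S.adj v x) (hg : ¬ Gr o.D m v x) :
    HU S e o m v x = HU S e o m v (S.t x v) := by
  by_cases hi : ∃ i, i < o.n ∧ m i = v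
  · obtain ⟨i, hi, rfl⟩ := hi
    rcases h.cr_step E hi hx with ⟨-, d, h1, h2⟩ | ⟨d, hd, h1, h2, h3, h4⟩
    · rw [hu_eq E h1, hu_eq E h2]
    · exact absurd ⟨_, h1.1, h3, h4⟩ hg
  · have : ∀ d y, ¬ Cr S o m d v y := fun d y h => hi ⟨_, (E.emb.lt h.1).1, h.2.1⟩
    unfold HU
    rw [if_neg (fun ⟨d, h, _⟩ => this _ _ h), if_neg (fun ⟨d, h, _⟩ => this _ _ h)]

/-- the dual cocycle -/
noncomputable def HD (S : Surf) (e : Ent) (o : St) (m : ℕ → ℕ) (v x : ℕ) : ZMod 2 :=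
  HU S e o m v x + HU S e o m x (S.t v x)

theorem hd_dart (h : EntOk lib e o p) (E : EmbS S o m) {d} (hd : tb o.D d = true) :
    HD S e o m (m (d / 16)) (m (d % 16)) = bz (tb e.U d ^^ tb e.U (fld p d)) := by
  rw [HD, hu_eq E (cr_self E hd), hu_eq E (h.cr_p E hd), bz_xor]

theorem hd_symm (h : EntOk lib e o p) (E : EmbS S o m) {v x} (hx : S.adj v x) :
    HD S e o m v x = HD S e o m x v := by
  by_cases hg : Gr o.D m v x
  · obtain ⟨d, hd, rfl, rfl⟩ := hg
    have hl := E.emb.lt256 hd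
    have := h.hd_dart E (h.inv.revD hd)
    rw [rev_div hl, rev_mod hl] at this
    rw [this, h.hd_dart E hd, h.dual d hd]
  · have hg' : ¬ Gr o.D m x v := fun hn => hg (by
      obtain ⟨d, hd, rfl, rfl⟩ := hn
      have hl := E.emb.lt256 hd
      exact ⟨rev d, h.inv.revD hd, by rw [rev_div hl], by rw [rev_mod hl]⟩)
    rw [HD, HD, h.hu_step E hx hg, h.hu_step E (S.symm hx) hg', add_comm]

theorem hd_coc (h : EntOk lib e o p) (E : EmbS S o m) : S.Coc (HD S e o m) where
  symm := h.hd_symm E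
  sum {u v} hu := by
    unfold HD
    rw [S.t_rot hu, S.t_rot' hu]
    generalize HU S e o m u v = a
    generalize HU S e o m v (S.t u v) = b
    generalize HU S e o m (S.t u v) u = c
    revert a b c; decide

theorem inB_HB (h : EntOk lib e o p) (E : EmbS S o m) {d} (hd : tb o.D d = true)
    (hb : inB e p d = true) : HB S e o m (m (d / 16)) (m (d % 16)) := by
  unfold inB at hb
  rw [Bool.or_eq_true] at hb
  rcases hb with hb | hb
  · exact .inl ((hs_iff E (cr_self E hd)).2 hb)
  · exact .inr (.inl ((hs_iff E (h.cr_p E hd)).2 hb))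

/-- a function on flags, at the ends of a dart -/
def val (S : Surf) (m : ℕ → ℕ) (q : ℕ → ℕ → ZMod 2) (d : ℕ) (c : Bool) : ZMod 2 :=
  bif c then q (m (d % 16)) (S.t (m (d / 16)) (m (d % 16))) else q (m (d / 16)) (m (d % 16))

theorem val_corner (E : EmbS S o m) {q : ℕ → ℕ → ZMod 2}
    (hq : ∀ {x y}, S.adj x y → HB S e o m x y → HB S e o m y x → q x (S.t y x) = q x y)
    {d v x : ℕ} (hc : Cr S o m d v x) (hs : tb e.S d = true) : q v x = q v (m (d % 16)) := by
  obtain ⟨h1, h2, h3⟩ := hc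
  have := h3.induct (P := fun x => S.InC (Gr o.D m) v (m (d % 16)) x ∧ q v x = q v (m (d % 16)))
    ⟨InC.self h3.1, rfl⟩ (fun x _ hx hn => ⟨hx.1.step hn, ?_⟩)
  · exact this.2
  · have hx' := hx.1.adj E.emb.sub
    have a1 : Hs S e o m v x := (hs_iff E ⟨h1, h2, hx.1⟩).2 hs
    have a2 : Hs S e o m v (S.t v x) := (hs_iff E ⟨h1, h2, hx.1.step hn⟩).2 hs
    rw [← hx.2, ← hq (S.succ_adj hx') (.inl a2) (.inr (.inl (by rwa [S.t_pred_succ hx']))),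
      S.t_pred_succ hx']

theorem walk_aux (h : EntOk lib e o p) (E : EmbS S o m) {q : ℕ → ℕ → ZMod 2}
    (hq : ∀ {x y}, S.adj x y → HB S e o m x y → HB S e o m y x → q x (S.t y x) = q x y)
    (hq' : ∀ {x y}, S.adj x y → HB S e o m x y → HD S e o m x y = q x y + q y (S.t x y)) {s : ℕ} :
    ∀ (l : List ℕ) (d : ℕ) (c b : Bool), ckWalk e o.T p o.D s l d c b = true →
      bz b + val S m q d c + val S m q s false = 1 := by
  intro l
  induction l with
  | nil =>
    intro d c b hw
    unfold ckWalk at hw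
    rw [Bool.and_eq_true, Bool.and_eq_true, beq_iff, Bool.not_eq_true'] at hw
    rw [hw.1.1, hw.1.2, hw.2, add_assoc, CharTwo.add_self_eq_zero]
    rfl
  | cons k l ih =>
    intro d c b hw
    unfold ckWalk at hw
    rw [Bool.and_eq_true, Bool.and_eq_true] at hw
    obtain ⟨⟨h1, h2⟩, h3⟩ := hw
    have hB := h.inB_HB E h1 h2
    have hadj := E.emb.adj h1
    have hl := E.emb.lt256 h1
    have step : ∀ {d' c'}, bz b + val S m q d' c' + val S m q s false = 1 →
        val S m q d c = val S m q d' c' → bz b + val S m q d c + val S m q s false = 1 :=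
      fun h e => e ▸ h
    rcases Bool.eq_false_or_eq_true (Nat.beq k 0) with k0 | k0
    · rw [k0, cond_true] at h3
      have h4 := ih _ _ _ h3
      have h5 := hq' hadj hB
      rw [h.hd_dart E h1] at h5
      rw [bz_xor, h5] at h4
      rw [← h4]
      unfold val
      cases c <;> simp only [Bool.not_true, Bool.not_false, cond_true, cond_false]
      · linear_combination -CharTwo.add_self_eq_zero (q (m (d % 16)) (S.t (m (d / 16)) (m (d % 16))))
      · linear_combination -CharTwo.add_self_eq_zero (q (m (d / 16)) (m (d % 16)))
    rw [k0, cond_false] at h3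
    rcases Bool.eq_false_or_eq_true (Nat.beq k 1) with k1 | k1
    · rw [k1, cond_true, Bool.and_eq_true, force_eq] at h3
      have hr := h.inv.revD h1
      have hB' := h.inB_HB E hr h3.1
      refine step (ih _ _ _ h3.2) ?_
      rw [rev_div hl, rev_mod hl] at hB'
      unfold val
      rw [rev_div hl, rev_mod hl]
      cases c <;> simp only [Bool.not_true, Bool.not_false, cond_true, cond_false]
      · exact (hq hadj hB hB').symm
      · exact hq (S.symm hadj) hB' hB
    rw [k1, cond_false] at h3
    cases c
    · rw [cond_false, Bool.and_eq_true, force_eq] at h3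
      refine step (ih _ _ _ h3.2) ?_
      have hc := h.cr_p E (h.inv.T1 h1)
      rw [h.inv.p h1] at hc
      have := val_corner E hq hc h3.1
      unfold val
      rw [cond_true, cond_false, this, hc.2.1]
    · rw [cond_true, Bool.and_eq_true, force_eq] at h3
      refine step (ih _ _ _ h3.2) ?_
      have hc := h.cr_p E h1
      have := val_corner E hq hc h3.1
      unfold val
      rw [cond_true, cond_false, this, hc.2.1]

theorem h_dual (h : EntOk lib e o p) (E : EmbS S o m) : ¬ ∃ q : ℕ → ℕ → ZMod 2,
    (∀ {x y}, S.adj x y → (Hs S e o m x y ∨ Hs S e o m y (S.t x y) ∨ Hs S e o m (S.t x y) x) →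
      (Hs S e o m y x ∨ Hs S e o m x (S.t y x) ∨ Hs S e o m (S.t y x) y) →
      q x (S.t y x) = q x y) ∧
    ∀ {x y}, S.adj x y → (Hs S e o m x y ∨ Hs S e o m y (S.t x y) ∨ Hs S e o m (S.t x y) x) →
      HD S e o m x y = q x y + q y (S.t x y) := by
  rintro ⟨q, hq, hq'⟩
  obtain ⟨d, l, hw⟩ := h.walk
  have := h.walk_aux E (fun hx => hq hx) (fun hx hb => hq' hx hb) l d false false hw
  rw [add_assoc, CharTwo.add_self_eq_zero] at this
  revert this; decide

end EntOk

open EntOk in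
theorem ckEnt_avoid {lib : List Ks} {e : Ent} (hc : ckEnt lib e = true) (hl : ∀ K ∈ lib, Avoid K) :
    Avoid e.K := by
  obtain ⟨o, p, h⟩ := ckEnt_spec hc
  refine ⟨⟨o, p, h.root, h.inv⟩, fun S m he => ?_⟩
  by_contra hS
  have E := h.root.embS h.inv he
  let H : S.Handle := {
    V := HV e o m
    K := HK e o m
    s := Hs S e o m
    p := Hp S e o m
    g1 := evL m e.g1
    g2 := evL m e.g2
    ψ := HD S e o m
    Ksymm := h.hk_symm
    KV := h.hk_hv E
    sV := fun ⟨d, h1, h2⟩ => (h.hv_cr E h1).2 (h.SV d h1.1 h2)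
    s1 := fun hx hv hk => (h.h_s1 E hx hv hk).1
    p1 := fun _ hx hv hk => (h.h_s1 E hx hv hk).2 _
    p2 := fun hφ _ hk => h.h_p2 E hφ hk
    p3 := fun _ hx hy hv h1 h2 => h.h_p3 E hx hy hv h1 h2
    p4 := fun hφ hx hu hv hk hs => h.h_p4 E hl hS hφ hx hu hv hk hs
    p5 := fun hφ _ _ hx hu hv => h.h_p5 he hl hS hφ hx hu hv
    p8 := fun _ g1 g2 hx hy hv => h.h_p8 E g1 g2 hx hy hv
    conn := fun Q q1 q2 {u v x y} _ _ h1 h2 h3 => h.h_conn E q1 q2 h1 h2 h3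
    coc := h.hd_coc E
    dual := h.h_dual E }
  exact hS H.good

end NSC

namespace NSC
open Chk

theorem ckAll_avoid {K : Ks} : ∀ {l : List ℕ} {lib : List Ks}, ckAll K lib l = true →
    (∀ K ∈ lib, Avoid K) → Avoid K
  | [], lib, h, hl => hl K (List.mem_of_mem_head? (beq_iff_eq.1 h))
  | n :: l, lib, h, hl => by
    unfold ckAll at h
    rw [Bool.and_eq_true] at h
    exact ckAll_avoid h.2 (List.forall_mem_cons.2 ⟨ckEnt_avoid h.1 hl, hl⟩)

/-- two crossing chords in the link of `0` -/
def bow : Ks := (5, [[(0, 4, 1), (0, 3, 4), (0, 2, 3), (0, 1, 2), (1, 0, 3), (1, 3, 0), (2, 0, 4),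
  (2, 4, 0), (3, 0, 1), (3, 1, 0), (4, 0, 2), (4, 2, 0)]])

set_option maxRecDepth 100000 in
theorem ckAll_data : ckAll bow [] data = true := by decide +kernel

theorem good_of_bow {S : Surf} {m : ℕ → ℕ} (h : EmbK S bow m) : S.Good :=
  (ckAll_avoid ckAll_data (by simp)).2 S m h

end NSC

namespace NSC
open Chk
open Surf

namespace Surf
variable {S : Surf} {G : ℕ → ℕ → Prop}

/-- a set of neighbours closed under succession is everything -/
theorem Nx.closed (hG : S.IsSub G) {v : ℕ} {P : ℕ → Prop} {w : ℕ} (hw : G v w) (hP : P w)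
    (h : ∀ w y, P w → S.Nx G v w y → P y) {x : ℕ} (hx : G v x) : P x := by
  obtain ⟨w', h1, h2⟩ := S.cyc_ind (hG.adj hw) (hG.adj hx) (fun x => ∃ w, P w ∧ S.InC G v w x)
    ⟨w, hP, InC.self hw⟩ (fun z _ ⟨w', h1, h2⟩ => by
      by_cases hz : G v (S.t v z)
      · exact ⟨_, h _ _ h1 ⟨z, h2, rfl, hz⟩, InC.self hz⟩
      · exact ⟨_, h1, h2.step hz⟩)
  rwa [h2.eq_of_mem hx] at h1

/-- succession at a vertex of degree two -/
theorem Nx.two (hG : S.IsSub G) {v a b : ℕ} (ha : G v a) (hb : G v b) (hab : a ≠ b)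
    (h : ∀ y, G v y → y = a ∨ y = b) : S.Nx G v a b := by
  obtain ⟨y, hy⟩ := Nx.exists hG ha
  rcases h y hy.right with rfl | rfl
  · exact absurd (Nx.closed hG (P := (· = y)) ha rfl (fun w z h1 h2 => by
      subst h1; exact h2.unique hy) hb) hab.symm
  · exact hy

theorem forall_bow {P : Cn → Prop} (h : P (4, 0, 2) ∧ P (3, 0, 1) ∧ P (2, 0, 4) ∧ P (1, 0, 3) ∧
    P (0, 2, 3) ∧ P (0, 3, 4) ∧ P (4, 2, 0) ∧ P (3, 1, 0) ∧ P (2, 4, 0) ∧ P (1, 3, 0) ∧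
    P (0, 4, 1) ∧ P (0, 1, 2)) : ∀ g ∈ bow.2, ∀ c ∈ g, P c := by
  simp only [bow, List.mem_singleton, forall_eq, List.forall_mem_cons, List.not_mem_nil,
    false_imp_iff, implies_true, and_true]
  tauto

variable (S)

/-- a chord in the link of `v` from `a` to `(t v)^[k] a` -/
def Chord (v a k : ℕ) : Prop :=
  S.adj v a ∧ 2 ≤ k ∧ S.adj a ((S.t v)^[k] a) ∧ (S.t v)^[k] a ≠ S.t v a ∧ (S.t v)^[k] a ≠ S.t a v

theorem iter_inj {v a : ℕ} (h : S.adj v a) {i j : ℕ} (hij : i ≤ j) (e : (S.t v)^[i] a = (S.t v)^[j] a) :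
    (S.t v)^[j - i] a = a := by
  induction i generalizing j with
  | zero => exact e.symm
  | succ i ih =>
    obtain ⟨j, rfl⟩ : ∃ j', j = j' + 1 := ⟨j - 1, by omega⟩
    rw [Function.iterate_succ_apply', Function.iterate_succ_apply'] at e
    rw [Nat.add_sub_add_right]
    exact ih (by omega) (S.succ_inj (S.iter_adj h i) (S.iter_adj h j) e)

theorem chord_exists {v a : ℕ} (ha : S.adj v a)
    (h : ∃ c, S.adj v c ∧ S.adj a c ∧ c ≠ S.t v a ∧ c ≠ S.t a v) : ∃ k, S.Chord v a k := by
  obtain ⟨c, h1, h2, h3, h4⟩ := h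
  obtain ⟨k, rfl⟩ := S.cyc ha h1
  refine ⟨k, ha, ?_, h2, h3, h4⟩
  rcases k with _ | _ | k
  · exact absurd h2 (S.irr _)
  · exact absurd rfl h3
  · omega

/-- four neighbours of `v` in cyclic order, opposite ones being adjacent -/
theorem exists_crossing {v a₀ : ℕ} (ha₀ : S.adj v a₀)
    (h : ∀ a, S.adj v a → ∃ c, S.adj v c ∧ S.adj a c ∧ c ≠ S.t v a ∧ c ≠ S.t a v) :
    ∃ a k d, S.adj v a ∧ 2 ≤ k ∧ S.adj v d ∧ S.adj a ((S.t v)^[k] a) ∧ S.adj (S.t v a) d ∧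
      (∀ j ≤ k, d ≠ (S.t v)^[j] a) ∧ ∀ i j, i < j → j ≤ k → (S.t v)^[i] a ≠ (S.t v)^[j] a := by
  classical
  have hex : ∃ k a, S.Chord v a k := by
    obtain ⟨k, hk⟩ := S.chord_exists ha₀ (h _ ha₀)
    exact ⟨k, _, hk⟩
  obtain ⟨a, ha, hk, hc, hn1, hn2⟩ := Nat.find_spec hex
  have hmin := fun m (hm : m < Nat.find hex) => Nat.find_min hex hm
  generalize Nat.find hex = k at *
  have hb : S.adj v (S.t v a) := S.succ_adj ha
  have hinj : ∀ i j, i < j → j ≤ k → (S.t v)^[i] a ≠ (S.t v)^[j] a := by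
    intro i j hij hj e
    have e2 := S.iter_inj ha hij.le e
    have e3 : (S.t v)^[k - (j - i)] a = (S.t v)^[k] a := by
      conv_rhs => rw [show k = (k - (j - i)) + (j - i) by omega, Function.iterate_add_apply, e2]
    have := hmin (k - (j - i)) (by omega)
    rcases Nat.lt_or_ge (k - (j - i)) 2 with h2 | h2
    · obtain h3 | h3 : k - (j - i) = 0 ∨ k - (j - i) = 1 := by omega
      · rw [h3] at e3; exact S.irr _ (e3 ▸ hc)
      · rw [h3] at e3; exact hn1 e3.symm
    · refine this ⟨a, ha, h2, ?_, ?_, ?_⟩ <;> rw [e3] <;> assumption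
  obtain ⟨d, hd, hbd, n1, n2⟩ := h _ hb
  rw [S.t_pred_succ ha] at n2
  refine ⟨a, k, d, ha, hk, hd, hc, hbd, fun j hj e => ?_, hinj⟩
  rcases j with _ | _ | _ | j
  · exact n2 e
  · exact S.irr _ (e ▸ hbd)
  · exact n1 e
  · rw [Function.iterate_succ_apply] at e
    refine hmin (j + 2) (by omega) ⟨_, hb, by omega, ?_, ?_, ?_⟩ <;> rw [← e]
    · exact hbd
    · exact n1
    · rw [S.t_pred_succ ha]; exact n2

/-- some edge has only two common neighbours, or there is a witness -/
theorem good_of_chords {v a₀ : ℕ} (ha₀ : S.adj v a₀)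
    (h : ∀ a, S.adj v a → ∃ c, S.adj v c ∧ S.adj a c ∧ c ≠ S.t v a ∧ c ≠ S.t a v) : S.Good := by
  obtain ⟨a, k, d, ha, hk, hd, hac, hbd, hnd, hinj⟩ := S.exists_crossing ha₀ h
  obtain ⟨b, hb⟩ : ∃ b, S.t v a = b := ⟨_, rfl⟩
  obtain ⟨c, hc⟩ : ∃ c, (S.t v)^[k] a = c := ⟨_, rfl⟩
  have vb : S.adj v b := hb ▸ S.succ_adj ha
  have vc : S.adj v c := hc ▸ S.iter_adj ha k
  have ab : a ≠ b := hb ▸ hinj 0 1 (by omega) (by omega)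
  have ac : a ≠ c := hc ▸ hinj 0 k (by omega) le_rfl
  have bc : b ≠ c := by
    have := hinj 1 k (by omega) le_rfl
    rw [hc] at this; rw [← hb]; exact this
  have da : d ≠ a := hnd 0 (by omega)
  have db : d ≠ b := hb ▸ hnd 1 (by omega)
  have dc : d ≠ c := hc ▸ hnd k le_rfl
  have va' := S.ne ha
  have vb' := S.ne vb
  have vc' := S.ne vc
  have vd' := S.ne hd
  rw [hc] at hac
  rw [hb] at hbd
  let m : ℕ → ℕ := fun i => match i with | 0 => v | 1 => a | 2 => b | 3 => c | _ => d
  have hGK : ∀ x y, GK bow m x y ↔ (x = v ∧ (y = a ∨ y = b ∨ y = c ∨ y = d)) ∨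
      (x = a ∧ (y = v ∨ y = c)) ∨ (x = b ∧ (y = v ∨ y = d)) ∨ (x = c ∧ (y = v ∨ y = a)) ∨
      (x = d ∧ (y = v ∨ y = b)) := by
    intro x y
    simp only [GK, bow, List.mem_singleton, exists_eq_left, List.mem_cons, List.not_mem_nil, or_false,
      exists_eq_or_imp, m]
    constructor
    · rintro h
      rcases h with h | h | h | h | h | h | h | h | h | h | h | h <;> obtain ⟨rfl, rfl⟩ := h <;> simp
    · rintro (⟨rfl, rfl | rfl | rfl | rfl⟩ | ⟨rfl, rfl | rfl⟩ | ⟨rfl, rfl | rfl⟩ | ⟨rfl, rfl | rfl⟩ |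
        ⟨rfl, rfl | rfl⟩) <;> simp
  have hG : S.IsSub (GK bow m) := by
    constructor
    · intro x y hxy
      rw [hGK] at hxy
      rcases hxy with ⟨rfl, rfl | rfl | rfl | rfl⟩ | ⟨rfl, rfl | rfl⟩ | ⟨rfl, rfl | rfl⟩ |
        ⟨rfl, rfl | rfl⟩ | ⟨rfl, rfl | rfl⟩ <;> first | assumption | (apply S.symm; assumption)
    · intro x y hxy
      rw [hGK] at hxy ⊢
      rcases hxy with ⟨rfl, rfl | rfl | rfl | rfl⟩ | ⟨rfl, rfl | rfl⟩ | ⟨rfl, rfl | rfl⟩ |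
        ⟨rfl, rfl | rfl⟩ | ⟨rfl, rfl | rfl⟩ <;> simp
  have gv : ∀ y, GK bow m v y ↔ y = a ∨ y = b ∨ y = c ∨ y = d := by
    intro y; rw [hGK]; simp [va', vb', vc', vd']
  have ga : ∀ y, GK bow m a y ↔ y = v ∨ y = c := by
    intro y; rw [hGK]; simp [va'.symm, ab, ac, da.symm]
  have gb : ∀ y, GK bow m b y ↔ y = v ∨ y = d := by
    intro y; rw [hGK]; simp [vb'.symm, ab.symm, bc, db.symm]
  have gc : ∀ y, GK bow m c y ↔ y = v ∨ y = a := by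
    intro y; rw [hGK]; simp [vc'.symm, ac.symm, bc.symm, dc.symm]
  have gd : ∀ y, GK bow m d y ↔ y = v ∨ y = b := by
    intro y; rw [hGK]; simp [vd'.symm, da, db, dc]
  have two : ∀ {x p q}, p ≠ q → (∀ y, GK bow m x y ↔ y = p ∨ y = q) →
      S.Nx (GK bow m) x p q ∧ S.Nx (GK bow m) x q p := by
    intro x p q hpq hx
    exact ⟨Nx.two hG ((hx p).2 (.inl rfl)) ((hx q).2 (.inr rfl)) hpq fun y hy => (hx y).1 hy,
      Nx.two hG ((hx q).2 (.inr rfl)) ((hx p).2 (.inl rfl)) hpq.symm fun y hy => ((hx y).1 hy).symm⟩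
  have n1 : S.Nx (GK bow m) v a b := ⟨a, InC.self ((gv a).2 (by simp)), hb, (gv b).2 (by simp)⟩
  have n2 : S.Nx (GK bow m) v b c := by
    refine ⟨(S.t v)^[k - 1] a, ⟨(gv b).2 (by simp), k - 2, ?_, fun j h1 h2 => ?_⟩, ?_, (gv c).2 (by simp)⟩
    · rw [← hb, ← Function.iterate_succ_apply]; congr 2; omega
    · rw [← hb, ← Function.iterate_succ_apply, gv]
      have e0 := hinj 0 (j + 1) (by omega) (by omega)
      have e1 := hinj 1 (j + 1) (by omega) (by omega)
      have e2 := hinj (j + 1) k (by omega) (by omega)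
      have e3 := hnd (j + 1) (by omega)
      rw [hc] at e2
      rintro (h | h | h | h)
      · exact e0 h.symm
      · exact e1 (hb.trans h.symm)
      · exact e2 h
      · exact e3 h.symm
    · rw [← Function.iterate_succ_apply' (S.t v), ← hc]; congr 2; omega
  have n3 : S.Nx (GK bow m) v c d := by
    obtain ⟨y, hy⟩ := Nx.exists hG ((gv c).2 (by simp))
    rcases (gv y).1 hy.right with rfl | rfl | rfl | rfl
    · have := Nx.closed hG (P := fun x => x = y ∨ x = b ∨ x = c) n1.left (.inl rfl) (fun w z h1 h2 => by
        rcases h1 with rfl | rfl | rfl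
        · exact .inr (.inl (h2.unique n1))
        · exact .inr (.inr (h2.unique n2))
        · exact .inl (h2.unique hy)) ((gv d).2 (by simp))
      simp [da, db, dc] at this
    · exact absurd (n1.inj hG hy) ac
    · exact absurd (n2.inj hG hy) bc
    · exact hy
  have n4 : S.Nx (GK bow m) v d a := by
    obtain ⟨y, hy⟩ := Nx.exists hG ((gv d).2 (by simp))
    rcases (gv y).1 hy.right with rfl | rfl | rfl | rfl
    · exact hy
    · exact absurd (n1.inj hG hy) da.symm
    · exact absurd (n2.inj hG hy) db.symm
    · exact absurd (n3.inj hG hy) dc.symm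
  obtain ⟨a1, a2⟩ := two vc' ga
  obtain ⟨b1, b2⟩ := two vd' gb
  obtain ⟨c1, c2⟩ := two va' gc
  obtain ⟨d1, d2⟩ := two vb' gd
  have f0 : S.FR (GK bow m) (d, v) (d, v) := .refl _
  have f1 := f0.trans (.of_nx hG d1)
  have f2 := f1.trans (.of_nx hG b2)
  have f3 := f2.trans (.of_nx hG n2)
  have f4 := f3.trans (.of_nx hG c1)
  have f5 := f4.trans (.of_nx hG a2)
  have f6 := f5.trans (.of_nx hG n1)
  have f7 := f6.trans (.of_nx hG b1)
  have f8 := f7.trans (.of_nx hG d2)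
  have f9 := f8.trans (.of_nx hG n4)
  have f10 := f9.trans (.of_nx hG a1)
  have f11 := f10.trans (.of_nx hG c2)
  have hfr : ∀ g ∈ bow.2, ∀ c ∈ g, S.FR (GK bow m) (d, v) (m c.1, m c.2.1) :=
    forall_bow ⟨f0, f3, f6, f9, f2, f11, f7, f10, f1, f4, f8, f5⟩
  refine good_of_bow (m := m) ⟨?_, ?_, ?_, ?_, ?_⟩
  · intro i j hi hj e
    simp only [bow] at hi hj
    interval_cases i <;> interval_cases j <;> first | rfl | (exfalso; simp only [m] at e; simp_all)
  · intro g hg c' hc'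
    exact hG.adj ⟨g, hg, c', hc', rfl, rfl⟩
  · exact forall_bow ⟨d1, c1, b1, a1, n2, n3, d2, c2, b2, a2, n4, n1⟩
  · intro g hg c1 h1 c2 h2
    exact (hfr g hg c1 h1).symm.trans (hfr g hg c2 h2)
  · simp [bow]

end Surf
end NSC

namespace NSC
open scoped Classical

namespace Surf

/-- the two faces along an edge are distinct when the Euler characteristic is negative -/
theorem t_ne_of {verts : Finset ℕ} {adj : ℕ → ℕ → Prop} {t : ℕ → ℕ → ℕ}
    (symm : ∀ {u v}, adj u v → adj v u) (mem : ∀ {u v}, adj u v → u ∈ verts)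
    (t_rot : ∀ {u v}, adj u v → t v (t u v) = u) (t_adj : ∀ {u v}, adj u v → adj v (t u v))
    (cyc : ∀ {v x y}, adj v x → adj v y → ∃ k, (t v)^[k] x = y)
    (conn : ∀ {u v}, u ∈ verts → v ∈ verts → Relation.ReflTransGen adj u v)
    (euler : ((verts ×ˢ verts).filter fun d => adj d.1 d.2).card = 6 * verts.card + 12)
    {p q : ℕ} (h : adj p q) : t p q ≠ t q p := by
  intro e
  obtain ⟨r, hr⟩ : ∃ r, t p q = r := ⟨_, rfl⟩
  have hr' : t q p = r := e ▸ hr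
  have two : ∀ {a b c}, adj a b → t a b = c → t a c = b → ∀ d, adj a d → d = b ∨ d = c := by
    intro a b c hb h1 h2 d hd
    obtain ⟨k, rfl⟩ := cyc hb hd
    clear hd
    induction k with
    | zero => exact .inl rfl
    | succ k ih =>
      rw [Function.iterate_succ_apply']
      rcases ih with ih | ih <;> rw [ih]
      · exact .inr h1
      · exact .inl h2
  have qr : adj q r := hr ▸ t_adj h
  have pr : adj p r := hr' ▸ t_adj (symm h)
  have e1 : t q r = p := hr ▸ t_rot h
  have e2 : t p r = q := hr' ▸ t_rot (symm h)
  have e3 : t r p = q := by have := t_rot qr; rwa [e1] at this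
  have e4 : t r q = p := by have := t_rot pr; rwa [e2] at this
  have hp := two h hr e2
  have hq := two (symm h) hr' e1
  have hrr := two (symm pr) e3 e4
  have hs : verts ⊆ {p, q, r} := by
    intro z hz
    have := conn (mem h) hz
    induction this with
    | refl => simp
    | tail h1 h2 ih =>
      have := ih (mem h2)
      simp only [Finset.mem_insert, Finset.mem_singleton] at this ⊢
      rcases this with rfl | rfl | rfl
      · rcases hp _ h2 with h | h <;> simp [h]
      · rcases hq _ h2 with h | h <;> simp [h]
      · rcases hrr _ h2 with h | h <;> simp [h]
  have h3 : verts.card ≤ 3 := (Finset.card_le_card hs).trans Finset.card_le_three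
  have h4 := Finset.card_filter_le (verts ×ˢ verts) fun d => adj d.1 d.2
  rw [euler, Finset.card_product] at h4
  nlinarith

/-- a contractible edge -/
structure CE (S : Surf) (u v : ℕ) : Prop where
  adj : S.adj u v
  only : ∀ {z}, S.adj u z → S.adj v z → z = S.t u v ∨ z = S.t v u

namespace CE
variable {S : Surf} {u v : ℕ}

/-- the contraction of `u` to `v` -/
def c (u v w : ℕ) : ℕ := if w = u then v else w

theorem c_u : c u v u = v := if_pos rfl
theorem c_v : c u v v = v := by unfold c; split_ifs <;> rfl
theorem c_ne {w : ℕ} (h : w ≠ u) : c u v w = w := if_neg h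
theorem c_eq {a b : ℕ} (h : c u v a = c u v b) : a = b ∨ (a = u ∧ b = v) ∨ (a = v ∧ b = u) := by
  unfold c at h
  split_ifs at h with h1 h2 h2
  · exact .inl (h1.trans h2.symm)
  · exact .inr (.inl ⟨h1, h.symm⟩)
  · exact .inr (.inr ⟨h, h2⟩)
  · exact .inl h

/-- darts of the faces that survive the contraction -/
def ND (S : Surf) (u v a b : ℕ) : Prop :=
  S.adj a b ∧ c u v a ≠ c u v b ∧ c u v (S.t a b) ≠ c u v a ∧ c u v (S.t a b) ≠ c u v b

theorem ND.rot {a b} (h : ND S u v a b) : ND S u v b (S.t a b) := by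
  obtain ⟨h1, h2, h3, h4⟩ := h
  refine ⟨S.t_adj h1, h4.symm, ?_, ?_⟩ <;> rw [S.t_rot h1]
  exacts [h2, h3.symm]

/-- the two degenerate faces -/
def D1 (S : Surf) (u v a b : ℕ) : Prop :=
  (a = u ∧ b = v) ∨ (a = v ∧ b = S.t u v) ∨ (a = S.t u v ∧ b = u)

def D2 (S : Surf) (u v a b : ℕ) : Prop := D1 S v u a b

theorem nd_of_D (h : S.adj u v) {a b} (hd : D1 S u v a b ∨ D2 S u v a b) : ¬ ND S u v a b := by
  have e : c u v u = c u v v := c_u.trans c_v.symm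
  have e1 := S.t_rot h
  have e2 := S.t_rot' h
  have e3 := S.t_rot (S.symm h)
  have e4 := S.t_rot' (S.symm h)
  unfold D2 D1 at hd
  unfold ND
  grind

theorem nd_of_D1 (h : S.adj u v) {a b} (hd : D1 S u v a b) : ¬ ND S u v a b := nd_of_D h (.inl hd)

theorem nd_of_D2 (h : S.adj u v) {a b} (hd : D2 S u v a b) : ¬ ND S u v a b := nd_of_D h (.inr hd)

theorem nd_or {a b} (h : S.adj a b) : ND S u v a b ∨ D1 S u v a b ∨ D2 S u v a b := by
  have e1 := S.t_rot h
  have e2 := S.t_rot' h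
  have n1 := S.ne h
  have n2 := S.ne (S.t_adj h)
  have n3 := S.ne (S.t_adj' h)
  have k := @c_eq u v
  unfold ND D2 D1
  grind

theorem x_ne_y (E : CE S u v) : S.t u v ≠ S.t v u := S.t_ne E.adj

theorem distinct (E : CE S u v) : u ≠ v ∧ v ≠ S.t u v ∧ u ≠ S.t u v ∧ v ≠ S.t v u ∧ u ≠ S.t v u :=
  have h := S.symm E.adj
  ⟨S.ne E.adj, S.ne (S.t_adj E.adj), S.ne (S.succ_adj E.adj), S.ne (S.succ_adj h), S.ne (S.t_adj h)⟩

theorem nd_sides (E : CE S u v) : (ND S u v u (S.t u v) ∧ ND S u v (S.t u v) v) ∧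
    ND S u v v (S.t v u) ∧ ND S u v (S.t v u) u := by
  have h := S.symm E.adj
  have := E.distinct
  have := E.x_ne_y
  refine ⟨⟨(nd_or (S.succ_adj E.adj)).resolve_right ?_,
    (nd_or (S.symm (S.t_adj E.adj))).resolve_right ?_⟩, (nd_or (S.succ_adj h)).resolve_right ?_,
    (nd_or (S.symm (S.t_adj h))).resolve_right ?_⟩ <;> unfold D2 D1 <;> grind

theorem nd_ux (E : CE S u v) : ND S u v u (S.t u v) := E.nd_sides.1.1
theorem nd_xv (E : CE S u v) : ND S u v (S.t u v) v := E.nd_sides.1.2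
theorem nd_vy (E : CE S u v) : ND S u v v (S.t v u) := E.nd_sides.2.1
theorem nd_yu (E : CE S u v) : ND S u v (S.t v u) u := E.nd_sides.2.2

theorem c_uv : c u v u = c u v v := c_u.trans c_v.symm

theorem c_inj_right (E : CE S u v) {a b b'} (h : ND S u v a b) (h' : ND S u v a b')
    (e : c u v b = c u v b') : b = b' := by
  have key : ∀ {a}, ND S u v a u → ND S u v a v → False := by
    intro a h h'
    rcases E.only (S.symm h.1) (S.symm h'.1) with e | e
    · exact nd_of_D1 E.adj (.inr (.inr ⟨e, rfl⟩)) h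
    · exact nd_of_D2 E.adj (.inr (.inr ⟨e, rfl⟩)) h'
  rcases c_eq e with e | ⟨rfl, rfl⟩ | ⟨rfl, rfl⟩
  · exact e
  · exact (key h h').elim
  · exact (key h' h).elim

theorem c_inj (E : CE S u v) {a b a' b'} (h : ND S u v a b) (h' : ND S u v a' b')
    (e1 : c u v a = c u v a') (e2 : c u v b = c u v b') : a = a' ∧ b = b' := by
  have key : ∀ {b b'}, ND S u v u b → ND S u v v b' → c u v b = c u v b' → False := by
    intro b b' h h' e
    have e : b = b' := by
      rcases c_eq e with e | ⟨rfl, rfl⟩ | ⟨rfl, rfl⟩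
      · exact e
      · exact (S.irr _ h.1).elim
      · exact (h.2.1 (c_u.trans c_v.symm)).elim
    subst e
    rcases E.only h.1 h'.1 with e | e
    · exact nd_of_D1 E.adj (.inr (.inl ⟨rfl, e⟩)) h'
    · exact nd_of_D2 E.adj (.inr (.inl ⟨rfl, e⟩)) h
  rcases c_eq e1 with rfl | ⟨rfl, rfl⟩ | ⟨rfl, rfl⟩
  · exact ⟨rfl, E.c_inj_right h h' e2⟩
  · exact (key h h' e2).elim
  · exact (key h' h e2.symm).elim

/-- adjacency after the contraction -/
def adj' (S : Surf) (u v p q : ℕ) : Prop := ∃ a b, ND S u v a b ∧ c u v a = p ∧ c u v b = q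

/-- third vertices after the contraction -/
noncomputable def t' (S : Surf) (u v p q : ℕ) : ℕ :=
  if h : ∃ r a b, ND S u v a b ∧ c u v a = p ∧ c u v b = q ∧ r = c u v (S.t a b)
    then h.choose else 0

theorem t'_eq (E : CE S u v) {a b} (h : ND S u v a b) :
    t' S u v (c u v a) (c u v b) = c u v (S.t a b) := by
  have he : ∃ r a' b', ND S u v a' b' ∧ c u v a' = c u v a ∧ c u v b' = c u v b ∧
    r = c u v (S.t a' b') := ⟨_, a, b, h, rfl, rfl, rfl⟩
  unfold t'
  rw [dif_pos he]
  obtain ⟨a', b', h', e1, e2, e3⟩ := he.choose_spec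
  rw [e3]
  obtain ⟨rfl, rfl⟩ := E.c_inj h' h e1 e2
  rfl

theorem adj'_of_nd {a b} (h : ND S u v a b) : adj' S u v (c u v a) (c u v b) :=
  ⟨a, b, h, rfl, rfl⟩

theorem adj'_of_adj (E : CE S u v) {a b} (h : S.adj a b) (hc : c u v a ≠ c u v b) :
    adj' S u v (c u v a) (c u v b) := by
  have e : c u v u = c u v v := c_uv
  rcases nd_or (u := u) (v := v) h with h | (⟨rfl, rfl⟩ | ⟨rfl, rfl⟩ | ⟨rfl, rfl⟩) |
    (⟨rfl, rfl⟩ | ⟨rfl, rfl⟩ | ⟨rfl, rfl⟩)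
  · exact adj'_of_nd h
  · exact (hc e).elim
  · rw [← e]; exact adj'_of_nd E.nd_ux
  · rw [e]; exact adj'_of_nd E.nd_xv
  · exact (hc e.symm).elim
  · rw [e]; exact adj'_of_nd E.nd_vy
  · rw [← e]; exact adj'_of_nd E.nd_yu

theorem adj'_symm (E : CE S u v) {p q} (h : adj' S u v p q) : adj' S u v q p := by
  obtain ⟨a, b, h, rfl, rfl⟩ := h
  exact E.adj'_of_adj (S.symm h.1) h.2.1.symm

theorem c_mem (E : CE S u v) {a} (h : a ∈ S.verts) : c u v a ∈ S.verts.erase u := by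
  by_cases e : a = u
  · rw [e, c_u]; exact Finset.mem_erase.2 ⟨(S.ne E.adj).symm, S.mem' E.adj⟩
  · rw [c_ne e]; exact Finset.mem_erase.2 ⟨e, h⟩

theorem conn' (E : CE S u v) {p q} (hp : p ∈ S.verts.erase u) (hq : q ∈ S.verts.erase u) :
    Relation.ReflTransGen (adj' S u v) p q := by
  have h := S.conn (Finset.mem_of_mem_erase hp) (Finset.mem_of_mem_erase hq)
  have h' : Relation.ReflTransGen (adj' S u v) (c u v p) (c u v q) := by
    clear hq
    induction h with
    | refl => exact .refl
    | @tail b d _ h2 ih =>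
      by_cases e : c u v b = c u v d
      · rwa [← e]
      · exact ih.tail (E.adj'_of_adj h2 e)
  rwa [c_ne (Finset.ne_of_mem_erase hp), c_ne (Finset.ne_of_mem_erase hq)] at h'

theorem cyc_away (E : CE S u v) {p q r} (hp : p ≠ v) (h : adj' S u v p q) (h' : adj' S u v p r) :
    ∃ k, (t' S u v p)^[k] q = r := by
  obtain ⟨a, b, hb, ha, rfl⟩ := h
  obtain ⟨a', d, hd, ha', rfl⟩ := h'
  have key : ∀ {a}, c u v a = p → a = p ∧ p ≠ u := by
    intro a ha
    unfold c at ha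
    split_ifs at ha with e
    · exact (hp ha.symm).elim
    · exact ⟨ha, ha ▸ e⟩
  obtain ⟨rfl, hu⟩ := key ha
  obtain ⟨rfl, -⟩ := key ha'
  refine S.cyc_ind hb.1 hd.1 (fun w => ∃ k, (t' S u v a')^[k] (c u v b) = c u v w) ⟨0, rfl⟩ ?_
  rintro z hz ⟨k, hk⟩
  have e : c u v u = c u v v := c_uv
  rcases nd_or (u := u) (v := v) hz with h | (⟨rfl, rfl⟩ | ⟨rfl, rfl⟩ | ⟨rfl, rfl⟩) |
    (⟨rfl, rfl⟩ | ⟨rfl, rfl⟩ | ⟨rfl, rfl⟩)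
  · refine ⟨k + 1, ?_⟩
    rw [Function.iterate_succ_apply', hk, ← E.t'_eq h, ha]
  · exact (hu rfl).elim
  · exact (hp rfl).elim
  · exact ⟨k, by rw [S.t_rot' E.adj, hk, e]⟩
  · exact (hp rfl).elim
  · exact (hu rfl).elim
  · exact ⟨k, by rw [S.t_rot' (S.symm E.adj), hk, e]⟩

theorem reach_u (E : CE S u v) {b} (h : S.adj u b) (hb : b ≠ v) :
    ∃ k, (t' S u v v)^[k] (S.t u v) = b := by
  refine (S.cyc_ind E.adj h (fun z => z = v ∨ ∃ k, (t' S u v v)^[k] (S.t u v) = z) (.inl rfl)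
    ?_).resolve_left hb
  intro z hz ih
  by_cases e : z = v
  · rw [e]; exact .inr ⟨0, rfl⟩
  obtain ⟨k, hk⟩ := ih.resolve_left e
  by_cases e2 : S.t u z = v
  · exact .inl e2
  have h1 := E.distinct
  have h5 := S.t_rot (S.symm E.adj)
  have nd : ND S u v u z := (nd_or hz).resolve_right (by unfold D2 D1; grind)
  have := E.t'_eq nd
  rw [c_u, c_ne (S.ne hz).symm, c_ne (S.ne (S.succ_adj hz)).symm] at this
  exact .inr ⟨k + 1, by rw [Function.iterate_succ_apply', hk, this]⟩

theorem reach_v (E : CE S u v) {b} (h : S.adj v b) (hb : b ≠ u) :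
    ∃ k, (t' S u v v)^[k] (S.t v u) = b := by
  refine (S.cyc_ind (S.symm E.adj) h (fun z => z = u ∨ ∃ k, (t' S u v v)^[k] (S.t v u) = z)
    (.inl rfl) ?_).resolve_left hb
  intro z hz ih
  by_cases e : z = u
  · rw [e]; exact .inr ⟨0, rfl⟩
  obtain ⟨k, hk⟩ := ih.resolve_left e
  by_cases e2 : S.t v z = u
  · exact .inl e2
  have h1 := E.distinct
  have h5 := S.t_rot E.adj
  have nd : ND S u v v z := (nd_or hz).resolve_right (by unfold D2 D1; grind)
  have := E.t'_eq nd
  rw [c_v, c_ne e, c_ne e2] at this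
  exact .inr ⟨k + 1, by rw [Function.iterate_succ_apply', hk, this]⟩

theorem cyc' (E : CE S u v) {p q r} (h : adj' S u v p q) (h' : adj' S u v p r) :
    ∃ k, (t' S u v p)^[k] q = r := by
  by_cases hp : p ≠ v
  · exact E.cyc_away hp h h'
  push Not at hp
  subst hp
  set f := t' S u p p
  obtain ⟨m, hm⟩ : ∃ k, f^[k] (S.t u p) = S.t p u :=
    E.reach_u (S.pred_adj E.adj) (S.ne (S.succ_adj (S.symm E.adj))).symm
  obtain ⟨n, hn⟩ : ∃ k, f^[k] (S.t p u) = S.t u p :=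
    E.reach_v (S.t_adj E.adj) (S.ne (S.succ_adj E.adj)).symm
  have hx : f^[m + n] (S.t u p) = S.t u p := by
    rw [add_comm, Function.iterate_add_apply, hm, hn]
  have pos : 0 < m + n := by
    rcases Nat.eq_zero_or_pos m with rfl | h
    · exact (E.x_ne_y hm).elim
    · omega
  have all : ∀ {q}, adj' S u p p q → ∃ k, f^[k] (S.t u p) = q := by
    rintro q ⟨a, b, hb, ha, rfl⟩
    have hbu : b ≠ u := by
      rintro rfl
      exact hb.2.1 (ha.trans c_u.symm)
    have hbv : b ≠ p := by
      rintro rfl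
      exact hb.2.1 (ha.trans c_v.symm)
    rw [c_ne hbu]
    rcases c_eq (ha.trans c_v.symm) with rfl | ⟨rfl, -⟩ | ⟨rfl, e⟩
    · obtain ⟨k, hk⟩ := E.reach_v hb.1 hbu
      exact ⟨k + m, by rw [Function.iterate_add_apply, hm, hk]⟩
    · exact E.reach_u hb.1 hbv
    · exact (S.ne E.adj e.symm).elim
  obtain ⟨i, rfl⟩ := all h
  obtain ⟨j, rfl⟩ := all h'
  have hx' : ∀ l, f^[(m + n) * l] (S.t u p) = S.t u p := by
    intro l
    rw [Function.iterate_mul]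
    exact Function.iterate_fixed hx l
  obtain ⟨d, hd⟩ : ∃ d, d + i = (m + n) * i := ⟨(m + n) * i - i, by
    have : i ≤ (m + n) * i := Nat.le_mul_of_pos_left i pos
    omega⟩
  exact ⟨j + d, by rw [← Function.iterate_add_apply, add_assoc, hd, Function.iterate_add_apply, hx']⟩

theorem euler' (E : CE S u v) :
    (((S.verts.erase u) ×ˢ (S.verts.erase u)).filter fun d => adj' S u v d.1 d.2).card =
      6 * (S.verts.erase u).card + 12 := by
  set D := (S.verts ×ˢ S.verts).filter fun d => S.adj d.1 d.2
  set x := S.t u v with hx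
  set y := S.t v u with hy
  set six : Finset (ℕ × ℕ) := {(u, v), (v, x), (x, u), (v, u), (u, y), (y, v)} with hs
  obtain ⟨h1, h2, h3, h4, h5⟩ := E.distinct
  have h6 := E.x_ne_y
  have mD : ∀ d : ℕ × ℕ, d ∈ D ↔ S.adj d.1 d.2 := fun d => by
    simp only [D, Finset.mem_filter, Finset.mem_product, and_iff_right_iff_imp]
    exact fun h => ⟨S.mem h, S.mem' h⟩
  have msix : ∀ d : ℕ × ℕ, d ∈ six ↔ D1 S u v d.1 d.2 ∨ D2 S u v d.1 d.2 := fun ⟨a, b⟩ => by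
    simp only [hs, D2, D1, Finset.mem_insert, Finset.mem_singleton, Prod.mk.injEq, ← hx, ← hy]
    tauto
  have csix : six.card = 6 := by
    rw [hs]
    repeat rw [Finset.card_insert_of_notMem (by
      simp only [Finset.mem_insert, Finset.mem_singleton, Prod.mk.injEq, not_or, not_and]; grind)]
    rfl
  have sub : six ⊆ D := by
    intro d hd
    rw [mD]
    rw [msix] at hd
    obtain ⟨a, b⟩ := d
    dsimp only at hd ⊢
    clear_value x y
    clear msix csix hs six
    subst hx hy
    rcases hd with (⟨rfl, rfl⟩ | ⟨rfl, rfl⟩ | ⟨rfl, rfl⟩) | (⟨rfl, rfl⟩ | ⟨rfl, rfl⟩ | ⟨rfl, rfl⟩)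
    exacts [E.adj, S.t_adj E.adj, S.t_adj' E.adj, S.symm E.adj, S.t_adj (S.symm E.adj),
      S.t_adj' (S.symm E.adj)]
  have im : (((S.verts.erase u) ×ˢ (S.verts.erase u)).filter fun d => adj' S u v d.1 d.2) =
      (D \ six).image fun d => (c u v d.1, c u v d.2) := by
    ext ⟨p, q⟩
    simp only [Finset.mem_filter, Finset.mem_product, Finset.mem_image, Finset.mem_sdiff, mD, msix,
      Prod.mk.injEq, Prod.exists]
    constructor
    · rintro ⟨-, a, b, h, rfl, rfl⟩
      exact ⟨a, b, ⟨h.1, fun h' => nd_of_D E.adj h' h⟩, rfl, rfl⟩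
    · rintro ⟨a, b, ⟨h, h'⟩, rfl, rfl⟩
      exact ⟨⟨E.c_mem (S.mem h), E.c_mem (S.mem' h)⟩, adj'_of_nd ((nd_or h).resolve_right h')⟩
  rw [im, Finset.card_image_of_injOn, Finset.card_sdiff_of_subset sub, csix,
    Finset.card_erase_of_mem (S.mem E.adj)]
  · have h0 : 0 < S.verts.card := Finset.card_pos.2 ⟨u, S.mem E.adj⟩
    have e := S.euler
    have e' : D.card = 6 * S.verts.card + 12 := e
    omega
  · rintro ⟨a, b⟩ h ⟨a', b'⟩ h' e
    simp only [Finset.coe_sdiff, Set.mem_diff, Finset.mem_coe, mD, msix] at h h'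
    simp only [Prod.mk.injEq] at e ⊢
    exact E.c_inj ((nd_or h.1).resolve_right h.2) ((nd_or h'.1).resolve_right h'.2) e.1 e.2

theorem t_adj'' (E : CE S u v) {p q} (h : adj' S u v p q) : adj' S u v q (t' S u v p q) := by
  obtain ⟨a, b, h, rfl, rfl⟩ := h
  rw [E.t'_eq h]
  exact adj'_of_nd h.rot

theorem t_rot'' (E : CE S u v) {p q} (h : adj' S u v p q) : t' S u v q (t' S u v p q) = p := by
  obtain ⟨a, b, h, rfl, rfl⟩ := h
  rw [E.t'_eq h, E.t'_eq h.rot, S.t_rot h.1]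

theorem mem'' (E : CE S u v) {p q} (h : adj' S u v p q) : p ∈ S.verts.erase u := by
  obtain ⟨a, b, h, rfl, rfl⟩ := h
  exact E.c_mem (S.mem h.1)

/-- the contracted surface -/
noncomputable def contract (E : CE S u v) : Surf where
  verts := S.verts.erase u
  adj := adj' S u v
  t := t' S u v
  symm := E.adj'_symm
  irr := by
    rintro p ⟨a, b, h, h1, h2⟩
    exact h.2.1 (h1.trans h2.symm)
  mem := E.mem''
  t_adj := E.t_adj''
  t_rot := E.t_rot''
  t_ne := t_ne_of E.adj'_symm E.mem'' E.t_rot'' E.t_adj'' E.cyc' E.conn' E.euler'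
  cyc := E.cyc'
  conn := E.conn'
  euler := E.euler'

end CE
end Surf
end NSC

namespace NSC
open scoped Classical

namespace Surf
namespace CE
variable {S : Surf} {u v : ℕ} {B : ℕ → ℕ → Prop}

theorem D1.rot (h : S.adj u v) {a b} (hd : D1 S u v a b) : D1 S u v b (S.t a b) := by
  rcases hd with ⟨rfl, rfl⟩ | ⟨rfl, rfl⟩ | ⟨rfl, rfl⟩
  · exact .inr (.inl ⟨rfl, rfl⟩)
  · exact .inr (.inr ⟨rfl, S.t_rot h⟩)
  · exact .inl ⟨rfl, S.t_rot' h⟩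

theorem D2.rot (h : S.adj u v) {a b} (hd : D2 S u v a b) : D2 S u v b (S.t a b) :=
  D1.rot (S.symm h) hd

theorem not_D2 (E : CE S u v) {a b} (h : D1 S u v a b) : ¬ D2 S u v a b := by
  have h1 := E.distinct
  have h6 := E.x_ne_y
  unfold D1 at h
  unfold D2 D1
  grind

/-- a set of faces of the contracted surface, seen on the original surface -/
def lB (S : Surf) (u v : ℕ) (B : ℕ → ℕ → Prop) (a b : ℕ) : Prop :=
  (ND S u v a b ∧ B (c u v a) (c u v b)) ∨ (D1 S u v a b ∧ B v (S.t u v)) ∨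
    (D2 S u v a b ∧ B v (S.t v u))

theorem lB_nd (E : CE S u v) {a b} (h : ND S u v a b) :
    lB S u v B a b ↔ B (c u v a) (c u v b) := by
  have h1 : ¬ D1 S u v a b := fun h' => nd_of_D1 E.adj h' h
  have h2 : ¬ D2 S u v a b := fun h' => nd_of_D2 E.adj h' h
  simp [lB, h, h1, h2]

theorem lB_D1 (E : CE S u v) {a b} (h : D1 S u v a b) : lB S u v B a b ↔ B v (S.t u v) := by
  have h1 := nd_of_D1 E.adj h
  have h2 := E.not_D2 h
  simp [lB, h, h1, h2]

theorem lB_D2 (E : CE S u v) {a b} (h : D2 S u v a b) : lB S u v B a b ↔ B v (S.t v u) := by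
  have h1 := nd_of_D2 E.adj h
  have h2 : ¬ D1 S u v a b := fun h' => E.not_D2 h' h
  simp [lB, h, h1, h2]

theorem lB_rot (E : CE S u v)
    (hB : ∀ {p q}, E.contract.adj p q → (B p q ↔ B q (E.contract.t p q)))
    {a b} (h : S.adj a b) : lB S u v B a b ↔ lB S u v B b (S.t a b) := by
  rcases nd_or (u := u) (v := v) h with h | h | h
  · rw [E.lB_nd h, E.lB_nd h.rot, ← E.t'_eq h]
    exact hB (adj'_of_nd h)
  · rw [E.lB_D1 h, E.lB_D1 (h.rot E.adj)]
  · rw [E.lB_D2 h, E.lB_D2 (D2.rot E.adj h)]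

theorem c_x (E : CE S u v) : c u v (S.t u v) = S.t u v := c_ne (S.ne (S.succ_adj E.adj)).symm
theorem c_y (E : CE S u v) : c u v (S.t v u) = S.t v u :=
  c_ne (S.ne (S.t_adj (S.symm E.adj))).symm

theorem lB_ux (E : CE S u v) : lB S u v B u (S.t u v) ↔ B v (S.t u v) := by
  rw [E.lB_nd E.nd_ux, c_u, E.c_x]
theorem lB_xv (E : CE S u v) : lB S u v B (S.t u v) v ↔ B (S.t u v) v := by
  rw [E.lB_nd E.nd_xv, c_v, E.c_x]
theorem lB_vy (E : CE S u v) : lB S u v B v (S.t v u) ↔ B v (S.t v u) := by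
  rw [E.lB_nd E.nd_vy, c_v, E.c_y]
theorem lB_yu (E : CE S u v) : lB S u v B (S.t v u) u ↔ B (S.t v u) v := by
  rw [E.lB_nd E.nd_yu, c_u, E.c_y]

/-- the lifts of the two directions of an edge of the contracted surface -/
theorem opp (E : CE S u v) {a b} (h : ND S u v a b) (P : ℕ → ℕ → ℕ → ℕ → Prop)
    (h0 : ND S u v b a → P a b b a) (h1 : P (S.t u v) v u (S.t u v))
    (h2 : P u (S.t u v) (S.t u v) v) (h3 : P (S.t v u) u v (S.t v u))
    (h4 : P v (S.t v u) (S.t v u) u) : ∃ a' b', ND S u v a' b' ∧ c u v a' = c u v b ∧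
      c u v b' = c u v a ∧ P a b a' b' := by
  rcases nd_or (u := u) (v := v) (S.symm h.1) with h' | (⟨rfl, rfl⟩ | ⟨rfl, rfl⟩ | ⟨rfl, rfl⟩) |
    (⟨rfl, rfl⟩ | ⟨rfl, rfl⟩ | ⟨rfl, rfl⟩)
  · exact ⟨_, _, h', rfl, rfl, h0 h'⟩
  · exact (h.2.1 c_uv.symm).elim
  · exact ⟨_, _, E.nd_ux, c_uv, rfl, h1⟩
  · exact ⟨_, _, E.nd_xv, rfl, c_uv.symm, h2⟩
  · exact (h.2.1 c_uv).elim
  · exact ⟨_, _, E.nd_vy, c_uv.symm, rfl, h3⟩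
  · exact ⟨_, _, E.nd_yu, rfl, c_uv, h4⟩

theorem strConn (E : CE S u v)
    (hB : ∀ {p q}, E.contract.adj p q → (B p q ↔ B q (E.contract.t p q)))
    (hc : E.contract.StrConn B) : S.StrConn (lB S u v B) := by
  intro Q q1 q2
  set Q' : ℕ → ℕ → Prop := fun p q => ∃ a b, ND S u v a b ∧ c u v a = p ∧ c u v b = q ∧ Q a b
  have hQ : ∀ {a b}, ND S u v a b → (Q' (c u v a) (c u v b) ↔ Q a b) := by
    intro a b h
    refine ⟨?_, fun h' => ⟨a, b, h, rfl, rfl, h'⟩⟩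
    rintro ⟨a', b', h', e1, e2, h3⟩
    obtain ⟨rfl, rfl⟩ := E.c_inj h' h e1 e2
    exact h3
  have ax := S.succ_adj E.adj
  have ay := S.succ_adj (S.symm E.adj)
  have bx := S.t_adj E.adj
  have b_y := S.t_adj (S.symm E.adj)
  have d1 : D1 S u v v (S.t u v) := .inr (.inl ⟨rfl, rfl⟩)
  have d2 : D2 S u v u (S.t v u) := .inr (.inl ⟨rfl, rfl⟩)
  have d1' : D1 S u v (S.t u v) u := .inr (.inr ⟨rfl, rfl⟩)
  have d2' : D2 S u v (S.t v u) v := .inr (.inr ⟨rfl, rfl⟩)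
  -- the degenerate faces are linked to the surviving ones
  have l1 : B v (S.t u v) → (Q v (S.t u v) ↔ Q u (S.t u v)) := by
    intro b
    have := q1 bx ((E.lB_D1 d1).2 b)
    rw [S.t_rot E.adj] at this
    rw [this]
    exact q2 (S.symm ax) ((E.lB_D1 d1').2 b) (E.lB_ux.2 b)
  have l2 : B v (S.t v u) → (Q u (S.t v u) ↔ Q v (S.t v u)) := by
    intro b
    have := q1 b_y ((E.lB_D2 d2).2 b)
    rw [S.t_rot (S.symm E.adj)] at this
    rw [this]
    exact q2 (S.symm ay) ((E.lB_D2 d2').2 b) (E.lB_vy.2 b)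
  have k1 : B (S.t u v) v → B v (S.t u v) → (Q (S.t u v) v ↔ Q u (S.t u v)) := by
    intro b b'
    rw [← l1 b']
    exact q2 (S.symm bx) (E.lB_xv.2 b) ((E.lB_D1 d1).2 b')
  have k2 : B (S.t v u) v → B v (S.t v u) → (Q (S.t v u) u ↔ Q v (S.t v u)) := by
    intro b b'
    rw [← l2 b']
    exact q2 (S.symm b_y) (E.lB_yu.2 b) ((E.lB_D2 d2).2 b')
  have rep : ∀ {a b}, S.adj a b → lB S u v B a b →
      ∃ a' b', ND S u v a' b' ∧ lB S u v B a' b' ∧ (Q a b ↔ Q a' b') := by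
    intro a b h hb
    rcases nd_or (u := u) (v := v) h with h' | h' | h'
    · exact ⟨a, b, h', hb, Iff.rfl⟩
    · have b0 := (E.lB_D1 h').1 hb
      refine ⟨_, _, E.nd_ux, E.lB_ux.2 b0, ?_⟩
      rw [← l1 b0]
      have r1 := q1 E.adj ((E.lB_D1 (.inl ⟨rfl, rfl⟩)).2 b0)
      have r2 := q1 bx ((E.lB_D1 d1).2 b0)
      rw [S.t_rot E.adj] at r2
      rcases h' with ⟨rfl, rfl⟩ | ⟨rfl, rfl⟩ | ⟨rfl, rfl⟩
      exacts [r1, Iff.rfl, r2.symm]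
    · have b0 := (E.lB_D2 h').1 hb
      refine ⟨_, _, E.nd_vy, E.lB_vy.2 b0, ?_⟩
      rw [← l2 b0]
      have r1 := q1 (S.symm E.adj) ((E.lB_D2 (.inl ⟨rfl, rfl⟩)).2 b0)
      have r2 := q1 b_y ((E.lB_D2 d2).2 b0)
      rw [S.t_rot (S.symm E.adj)] at r2
      rcases h' with ⟨rfl, rfl⟩ | ⟨rfl, rfl⟩ | ⟨rfl, rfl⟩
      exacts [r1, Iff.rfl, r2.symm]
  have r1 : ∀ {p q}, E.contract.adj p q → B p q → (Q' p q ↔ Q' q (E.contract.t p q)) := by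
    rintro _ _ ⟨a, b, h, rfl, rfl⟩ hb
    show _ ↔ Q' _ (t' S u v _ _)
    rw [E.t'_eq h, hQ h, hQ h.rot]
    exact q1 h.1 ((E.lB_nd h).2 hb)
  have r2 : ∀ {p q}, E.contract.adj p q → B p q → B q p → (Q' p q ↔ Q' q p) := by
    rintro _ _ ⟨a, b, h, rfl, rfl⟩ hb hb'
    obtain ⟨a', b', h', e1, e2, e3⟩ := E.opp h
      (fun a b a' b' => B (c u v a) (c u v b) → B (c u v b) (c u v a) → (Q a b ↔ Q a' b'))
      (fun h' b b' => q2 h.1 ((E.lB_nd h).2 b) ((E.lB_nd h').2 b'))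
      (by rw [c_v, E.c_x]; exact k1) (by rw [c_u, E.c_x]; exact fun b b' => (k1 b' b).symm)
      (by rw [c_u, E.c_y]; exact k2) (by rw [c_v, E.c_y]; exact fun b b' => (k2 b' b).symm)
    rw [hQ h, ← e1, ← e2, hQ h']
    exact e3 hb hb'
  intro a b a' b' h h' hb hb' q
  obtain ⟨i, j, n1, g1, s1⟩ := rep h hb
  obtain ⟨i', j', n2, g2, s2⟩ := rep h' hb'
  rw [s2, ← hQ n2]
  exact hc Q' r1 r2 (adj'_of_nd n1) (adj'_of_nd n2) ((E.lB_nd n1).1 g1) ((E.lB_nd n2).1 g2)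
    ((hQ n1).2 (s1.1 q))

theorem lB_iff (E : CE S u v) {a b} (h : S.adj a b) (hc : c u v a ≠ c u v b)
    (h1 : ¬ (a = S.t u v ∧ b = u)) (h2 : ¬ (a = S.t v u ∧ b = v)) :
    lB S u v B a b ↔ B (c u v a) (c u v b) := by
  rcases nd_or (u := u) (v := v) h with h | (⟨rfl, rfl⟩ | ⟨rfl, rfl⟩ | ⟨rfl, rfl⟩) |
    (⟨rfl, rfl⟩ | ⟨rfl, rfl⟩ | ⟨rfl, rfl⟩)
  · exact E.lB_nd h
  · exact (hc c_uv).elim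
  · rw [E.lB_D1 (.inr (.inl ⟨rfl, rfl⟩)), c_v, E.c_x]
  · exact (h1 ⟨rfl, rfl⟩).elim
  · exact (hc c_uv.symm).elim
  · rw [E.lB_D2 (.inr (.inl ⟨rfl, rfl⟩)), c_u, E.c_y]
  · exact (h2 ⟨rfl, rfl⟩).elim

theorem lB_imp (E : CE S u v) {a b} (h : S.adj a b) (hc : c u v a ≠ c u v b)
    (hb : lB S u v B a b) : B (c u v a) (c u v b) ∨ B (c u v b) (c u v a) := by
  by_cases h1 : a = S.t u v ∧ b = u
  · obtain ⟨rfl, rfl⟩ := h1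
    rw [E.lB_D1 (.inr (.inr ⟨rfl, rfl⟩))] at hb
    rw [c_u, E.c_x]; exact .inr hb
  by_cases h2 : a = S.t v u ∧ b = v
  · obtain ⟨rfl, rfl⟩ := h2
    rw [E.lB_D2 (.inr (.inr ⟨rfl, rfl⟩))] at hb
    rw [c_v, E.c_y]; exact .inr hb
  exact .inl ((E.lB_iff h hc h1 h2).1 hb)

theorem lB_bd (E : CE S u v) {a b} (h : S.adj a b) (hc : c u v a ≠ c u v b)
    (hb : lB S u v B a b) (nb : ¬ lB S u v B b a) :
    B (c u v a) (c u v b) ∧ ¬ B (c u v b) (c u v a) := by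
  have i1 : lB S u v B (S.t u v) u ↔ lB S u v B u (S.t u v) := by
    rw [E.lB_D1 (.inr (.inr ⟨rfl, rfl⟩)), E.lB_ux]
  have i2 : lB S u v B (S.t v u) v ↔ lB S u v B v (S.t v u) := by
    rw [E.lB_D2 (.inr (.inr ⟨rfl, rfl⟩)), E.lB_vy]
  rw [← E.lB_iff (B := B) h hc, ← E.lB_iff (B := B) (S.symm h) hc.symm]
  · exact ⟨hb, nb⟩
  all_goals rintro ⟨rfl, rfl⟩
  exacts [nb (i1.2 hb), nb (i2.2 hb), nb (i1.1 hb), nb (i2.1 hb)]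

/-- functions on the surviving darts descend -/
theorem exists_desc (E : CE S u v) (φ : ℕ → ℕ → ZMod 2) : ∃ φ' : ℕ → ℕ → ZMod 2,
    ∀ {a b}, ND S u v a b → φ' (c u v a) (c u v b) = φ a b := by
  refine ⟨fun p q => if h : ∃ a b, ND S u v a b ∧ c u v a = p ∧ c u v b = q then
    φ h.choose h.choose_spec.choose else 0, fun {a b} h => ?_⟩
  have ex : ∃ a' b', ND S u v a' b' ∧ c u v a' = c u v a ∧ c u v b' = c u v b :=
    ⟨a, b, h, rfl, rfl⟩
  obtain ⟨h1, h2, h3⟩ := ex.choose_spec.choose_spec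
  obtain ⟨e1, e2⟩ := E.c_inj h1 h h2 h3
  beta_reduce
  rw [dif_pos ex, e2, e1]

/-- descending a cocycle -/
theorem desc (E : CE S u v) {φ} (h : S.Coc φ) (h0 : φ u v = 0) :
    ∃ φ', E.contract.Coc φ' ∧ ∀ {a b}, S.adj a b → c u v a ≠ c u v b →
      φ' (c u v a) (c u v b) = φ a b := by
  obtain ⟨φ', n⟩ := E.exists_desc φ
  have s1 := h.sum E.adj
  have s2 := h.sum (S.symm E.adj)
  rw [h0, zero_add, h.symm (S.t_adj' E.adj)] at s1
  rw [← h.symm E.adj, h0, zero_add, h.symm (S.t_adj (S.symm E.adj))] at s2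
  have z1 : φ v (S.t u v) = φ u (S.t u v) := CharTwo.add_eq_zero.1 s1
  have z2 : φ (S.t v u) u = φ (S.t v u) v := CharTwo.add_eq_zero.1 s2
  have g : ∀ {a b}, S.adj a b → c u v a ≠ c u v b → φ' (c u v a) (c u v b) = φ a b := by
    intro a b h1 hc
    rcases nd_or (u := u) (v := v) h1 with h1 | (⟨rfl, rfl⟩ | ⟨rfl, rfl⟩ | ⟨rfl, rfl⟩) |
      (⟨rfl, rfl⟩ | ⟨rfl, rfl⟩ | ⟨rfl, rfl⟩)
    · exact n h1
    · exact (hc c_uv).elim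
    · rw [← c_uv, n E.nd_ux, z1]
    · rw [c_uv, n E.nd_xv, h.symm h1, ← z1, h.symm (S.t_adj E.adj)]
    · exact (hc c_uv.symm).elim
    · rw [c_uv, n E.nd_vy, h.symm h1, z2, h.symm (S.succ_adj (S.symm E.adj))]
    · rw [← c_uv, n E.nd_yu, z2]
  refine ⟨φ', ⟨?_, ?_⟩, g⟩
  · rintro _ _ ⟨a, b, h1, rfl, rfl⟩
    rw [g h1.1 h1.2.1, g (S.symm h1.1) h1.2.1.symm, h.symm h1.1]
  · rintro _ _ ⟨a, b, h1, rfl, rfl⟩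
    show _ + φ' _ (t' S u v _ _) + φ' (t' S u v _ _) _ = 0
    rw [E.t'_eq h1, n h1, n h1.rot]
    have := n h1.rot.rot
    rw [S.t_rot h1.1] at this
    rw [this]
    exact h.sum h1.1

/-- lifting a cocycle -/
theorem lift_coc (E : CE S u v) {φ'} (h : E.contract.Coc φ') :
    S.Coc fun a b => if c u v a = c u v b then 0 else φ' (c u v a) (c u v b) := by
  have sy : ∀ {a b}, S.adj a b → c u v a ≠ c u v b →
      φ' (c u v a) (c u v b) = φ' (c u v b) (c u v a) := fun h1 h2 => h.symm (E.adj'_of_adj h1 h2)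
  refine ⟨fun {a b} h1 => ?_, fun {a b} h1 => ?_⟩
  · by_cases e : c u v a = c u v b
    · rw [if_pos e, if_pos e.symm]
    · rw [if_neg e, if_neg (Ne.symm e), sy h1 e]
  · rcases nd_or (u := u) (v := v) h1 with h1 | hd
    · have n3 := h1.rot.rot.2.1
      rw [S.t_rot h1.1] at n3
      rw [if_neg h1.2.1, if_neg h1.rot.2.1, if_neg n3, ← E.t'_eq h1]
      exact h.sum (adj'_of_nd h1)
    · have cx : c u v u ≠ c u v (S.t u v) := E.nd_ux.2.1
      have cy : c u v v ≠ c u v (S.t v u) := E.nd_vy.2.1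
      have sx := sy (S.succ_adj E.adj) cx
      have sy' := sy (S.succ_adj (S.symm E.adj)) cy
      have e : c u v u = c u v v := c_uv
      have r1 := S.t_rot E.adj
      have r2 := S.t_rot' E.adj
      have r3 := S.t_rot (S.symm E.adj)
      have r4 := S.t_rot' (S.symm E.adj)
      have a2 := fun z : ZMod 2 => CharTwo.add_self_eq_zero z
      unfold D2 D1 at hd
      grind

/-- sector functions around a collapsed face -/
theorem sector (h : S.adj u v) {L : ℕ → ℕ → Prop} {ψ : ℕ → ℕ → ZMod 2} {k : ℕ → ℕ → ZMod 2}
    (k1 : ∀ {x y}, S.adj x y → L x y → L y x → k x (S.t y x) = k x y)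
    (k2 : ∀ {x y}, S.adj x y → L x y → ψ x y = k x y + k y (S.t x y)) (h0 : ψ u v = 0)
    (a1 : L u v) (a2 : L v (S.t u v)) (a3 : L (S.t u v) u) (a4 : L u (S.t u v))
    (a5 : L (S.t u v) v) :
    k v (S.t (S.t u v) v) = k u (S.t u v) ∧ k (S.t u v) (S.t u (S.t u v)) = k (S.t u v) v := by
  have e1 := k1 (S.t_adj h) a2 a5
  have e2 := k2 h a1
  have e3 := k1 (S.succ_adj h) a4 a3
  have e4 := k1 (S.t_adj' h) a3 a4
  have e5 := k1 (S.symm (S.t_adj h)) a5 a2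
  rw [h0] at e2
  rw [S.t_rot' h] at e3
  rw [S.t_rot h] at e5
  exact ⟨by rw [e1, ← e3]; exact (CharTwo.add_eq_zero.1 e2.symm).symm, by rw [e4, ← e5]⟩

theorem good (E : CE S u v) (hg : E.contract.Good) : S.Good := by
  obtain ⟨B, hB, hc, hbd, ⟨φ, hφ, hφ1, kφ, hφ2⟩, ⟨ψ, hψ, hψ1⟩⟩ := hg
  refine ⟨lB S u v B, fun h => E.lB_rot hB h, E.strConn hB hc, ?_, ⟨_, E.lift_coc hφ, ?_, ?_⟩,
    ⟨_, E.lift_coc hψ, ?_⟩⟩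
  · intro χ hχ
    set k := χ u v with hk
    set d : ℕ → ZMod 2 := fun a => if a = u then k else 0 with hd
    have hχ' : S.Coc fun a b => χ a b + d a + d b := by
      refine ⟨fun {a b} h => ?_, fun {a b} h => ?_⟩
      · beta_reduce
        rw [hχ.symm h]; ring
      · have e := hχ.sum h
        have t1 := CharTwo.add_self_eq_zero (d a)
        have t2 := CharTwo.add_self_eq_zero (d b)
        have t3 := CharTwo.add_self_eq_zero (d (S.t a b))
        linear_combination e + t1 + t2 + t3
    have du : d u = k := if_pos rfl
    have dv : d v = 0 := if_neg (S.ne E.adj).symm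
    have h0 : χ u v + d u + d v = 0 := by
      rw [du, dv, ← hk, add_zero, CharTwo.add_self_eq_zero]
    obtain ⟨χ', h1, h2⟩ := E.desc hχ' h0
    obtain ⟨f, hf⟩ := hbd χ' h1
    refine ⟨fun a => f (c u v a) + d a, fun {a b} h hb nb => ?_⟩
    have t1 := CharTwo.add_self_eq_zero (d a)
    have t2 := CharTwo.add_self_eq_zero (d b)
    have key : χ a b + d a + d b = f (c u v a) + f (c u v b) := by
      by_cases e : c u v a = c u v b
      · rw [e, CharTwo.add_self_eq_zero]
        rcases c_eq e with rfl | ⟨rfl, rfl⟩ | ⟨rfl, rfl⟩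
        · exact (S.irr _ h).elim
        · exact h0
        · rw [← h0, hχ.symm h]; ring
      · obtain ⟨b1, b2⟩ := E.lB_bd h e hb nb
        rw [← hf (E.adj'_of_adj h e) b1 b2, h2 h e]
    linear_combination key - t1 - t2
  · rintro ⟨f, hf⟩
    refine hφ1 ⟨f, ?_⟩
    have fu : f u = f v := by
      have := hf E.adj
      rw [if_pos c_uv] at this
      exact CharTwo.add_eq_zero.1 this.symm
    have fc : ∀ a, f (c u v a) = f a := by
      intro a
      by_cases e : a = u
      · rw [e, c_u, fu]
      · rw [c_ne e]
    rintro _ _ ⟨a, b, h, rfl, rfl⟩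
    have := hf h.1
    rw [if_neg h.2.1] at this
    rw [this, fc, fc]
  · refine ⟨fun a => kφ (c u v a), fun {a b} h hb => ?_⟩
    beta_reduce
    by_cases e : c u v a = c u v b
    · rw [if_pos e, e, CharTwo.add_self_eq_zero]
    · rw [if_neg e]
      rcases E.lB_imp h e hb with h1 | h1
      · exact hφ2 (E.adj'_of_adj h e) h1
      · have := E.adj'_of_adj (S.symm h) (Ne.symm e)
        rw [← hφ.symm this, hφ2 this h1, add_comm]
  · rintro ⟨k, k1, k2⟩
    obtain ⟨k', n⟩ := E.exists_desc k
    refine hψ1 ⟨k', ?_, ?_⟩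
    · intro p q hpq b1 b2
      obtain ⟨a, b, h, rfl, rfl⟩ := E.adj'_symm hpq
      show k' _ (t' S u v _ _) = _
      rw [E.t'_eq h, n h.rot]
      have s1 : B v (S.t u v) → B (S.t u v) v → _ := fun b1 b2 => sector E.adj k1 k2 (if_pos c_uv)
        ((E.lB_D1 (.inl ⟨rfl, rfl⟩)).2 b1) ((E.lB_D1 (.inr (.inl ⟨rfl, rfl⟩))).2 b1)
        ((E.lB_D1 (.inr (.inr ⟨rfl, rfl⟩))).2 b1) (E.lB_ux.2 b1) (E.lB_xv.2 b2)
      have s2 : B v (S.t v u) → B (S.t v u) v → _ := fun b1 b2 => sector (S.symm E.adj) k1 k2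
        (if_pos c_uv.symm)
        ((E.lB_D2 (.inl ⟨rfl, rfl⟩)).2 b1) ((E.lB_D2 (.inr (.inl ⟨rfl, rfl⟩))).2 b1)
        ((E.lB_D2 (.inr (.inr ⟨rfl, rfl⟩))).2 b1) (E.lB_vy.2 b1) (E.lB_yu.2 b2)
      obtain ⟨a', b', h', e1, e2, e3⟩ := E.opp h
        (fun a b a' b' => B (c u v a) (c u v b) → B (c u v b) (c u v a) →
          k b (S.t a b) = k a' b')
        (fun h' b b' => k1 h'.1 ((E.lB_nd h').2 b') ((E.lB_nd h).2 b))
        (by rw [c_v, E.c_x]; exact fun b b' => (s1 b' b).1)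
        (by rw [c_u, E.c_x]; exact fun b b' => (s1 b b').2)
        (by rw [c_u, E.c_y]; exact fun b b' => (s2 b' b).1)
        (by rw [c_v, E.c_y]; exact fun b b' => (s2 b b').2)
      rw [← e1, ← e2, n h']
      exact e3 b2 b1
    · rintro _ _ ⟨a, b, h, rfl, rfl⟩ hb
      show _ = _ + k' _ (t' S u v _ _)
      have := k2 h.1 ((E.lB_nd h).2 hb)
      rw [if_neg h.2.1] at this
      rw [E.t'_eq h, n h, n h.rot, this]

end CE
end Surf
end NSC

namespace NSC
open scoped Classical

namespace Surf

theorem good (S : Surf) : S.Good := by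
  obtain ⟨n, hn⟩ : ∃ n, S.verts.card = n := ⟨_, rfl⟩
  induction n using Nat.strong_induction_on generalizing S with
  | _ n ih =>
    by_cases hE : ∃ u v, CE S u v
    · obtain ⟨u, v, E⟩ := hE
      refine E.good (ih _ ?_ _ rfl)
      rw [← hn]
      exact Finset.card_erase_lt_of_mem (S.mem E.adj)
    · push Not at hE
      have : 0 < ((S.verts ×ˢ S.verts).filter fun d => S.adj d.1 d.2).card := by
        rw [S.euler]; omega
      obtain ⟨⟨v, a₀⟩, hd⟩ := Finset.card_pos.1 this
      refine S.good_of_chords (Finset.mem_filter.1 hd).2 fun a ha => ?_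
      by_contra! hc
      refine hE v a ⟨ha, fun {z} h1 h2 => ?_⟩
      by_contra! h3
      exact h3.2 (hc z h1 h2 h3.1)

end Surf
end NSC

namespace NSC
open scoped Classical

/-- the oriented triangle of `f` runs through `a`, `b`, `c` -/
def Tri (σ : Finset ℕ → ℕ × ℕ × ℕ) (f : Finset ℕ) (a b c : ℕ) : Prop :=
  σ f = (a, b, c) ∨ σ f = (b, c, a) ∨ σ f = (c, a, b)

section
variable {T : Triangulation} {σ : Finset ℕ → ℕ × ℕ × ℕ}

theorem Tri.rot {f a b c} (h : Tri σ f a b c) : Tri σ f b c a := by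
  unfold Tri at *; tauto

theorem Tri.mem {f a b c} (h : Tri σ f a b c) : (a, b) ∈ Triangulation.dedges (σ f) := by
  rcases h with h | h | h <;> rw [h] <;> simp [Triangulation.dedges]

theorem Tri.eq (hσ : Triangulation.IsCoherent T.faces σ) {f a b c} (hf : f ∈ T.faces)
    (h : Tri σ f a b c) : f = {a, b, c} := by
  have := hσ.1 f hf
  rcases h with h | h | h <;> rw [h] at this <;> rw [← this] <;> ext z <;> simp <;> tauto

theorem Tri.ne (hσ : Triangulation.IsCoherent T.faces σ) {f a b c} (hf : f ∈ T.faces)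
    (h : Tri σ f a b c) : a ≠ b := by
  rintro rfl
  have := T.card_eq_three f hf
  rw [h.eq hσ hf] at this
  have h2 : ({a, a, c} : Finset ℕ).card ≤ 2 := by
    rw [Finset.insert_eq_of_mem (by simp)]; exact Finset.card_le_two
  omega

theorem Tri.uniq (hσ : Triangulation.IsCoherent T.faces σ) {f g a b c d} (hf : f ∈ T.faces)
    (hg : g ∈ T.faces) (h : Tri σ f a b c) (h' : Tri σ g a b d) : f = g ∧ c = d := by
  have e : f = g := by
    by_contra e
    exact Finset.disjoint_left.1 (hσ.2 f hf g hg e) h.mem h'.mem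
  subst e
  have := h.rot.ne hσ hf
  have := h.rot.rot.ne hσ hf
  unfold Tri at h h'
  grind

theorem Tri.exists (hσ : Triangulation.IsCoherent T.faces σ) {f a b} (hf : f ∈ T.faces)
    (ha : a ∈ f) (hb : b ∈ f) (hab : a ≠ b) : ∃ c, Tri σ f a b c ∨ Tri σ f b a c := by
  have := hσ.1 f hf
  obtain ⟨⟨p, q, r⟩, hs⟩ : ∃ s, σ f = s := ⟨_, rfl⟩
  rw [hs] at this
  rw [← this] at ha hb
  simp only [Finset.mem_insert, Finset.mem_singleton] at ha hb
  have h1 : Tri σ f p q r := .inl hs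
  have h2 := h1.rot
  have h3 := h2.rot
  rcases ha with rfl | rfl | rfl <;> rcases hb with rfl | rfl | rfl
  exacts [(hab rfl).elim, ⟨r, .inl h1⟩, ⟨q, .inr h3⟩, ⟨r, .inr h1⟩, (hab rfl).elim, ⟨p, .inl h2⟩,
    ⟨q, .inl h3⟩, ⟨p, .inr h2⟩, (hab rfl).elim]

end

namespace Model

/-- adjacency in a triangulation -/
def adj (T : Triangulation) (a b : ℕ) : Prop := a ≠ b ∧ ∃ f ∈ T.faces, a ∈ f ∧ b ∈ f

/-- third vertices in a triangulation -/
noncomputable def t (T : Triangulation) (σ : Finset ℕ → ℕ × ℕ × ℕ) (a b : ℕ) : ℕ :=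
  if h : ∃ c, ∃ f ∈ T.faces, Tri σ f a b c then h.choose else 0

variable {T : Triangulation} {σ : Finset ℕ → ℕ × ℕ × ℕ}

theorem pair_sub {a b : ℕ} {f : Finset ℕ} : {a, b} ⊆ f ↔ a ∈ f ∧ b ∈ f := by
  simp [Finset.insert_subset_iff]

theorem adj_symm {a b} (h : adj T a b) : adj T b a :=
  ⟨h.1.symm, let ⟨f, h1, h2, h3⟩ := h.2; ⟨f, h1, h3, h2⟩⟩

theorem t_eq (hσ : Triangulation.IsCoherent T.faces σ) {f a b c} (hf : f ∈ T.faces)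
    (h : Tri σ f a b c) : t T σ a b = c := by
  have he : ∃ c, ∃ f ∈ T.faces, Tri σ f a b c := ⟨c, f, hf, h⟩
  unfold t
  rw [dif_pos he]
  obtain ⟨g, hg, h'⟩ := he.choose_spec
  exact (h'.uniq hσ hg hf h).2

theorem exists_tri (hσ : Triangulation.IsCoherent T.faces σ) {a b} (h : adj T a b) :
    ∃ f ∈ T.faces, Tri σ f a b (t T σ a b) := by
  suffices ∃ f ∈ T.faces, ∃ c, Tri σ f a b c by
    obtain ⟨f, hf, c, hc⟩ := this
    exact ⟨f, hf, (t_eq hσ hf hc) ▸ hc⟩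
  obtain ⟨hab, f0, hf0, ha, hb⟩ := h
  have h2 := T.edge_in_two_faces {a, b} (Finset.card_pair hab)
    ⟨f0, hf0, pair_sub.2 ⟨ha, hb⟩⟩
  obtain ⟨f, g, hfg, e⟩ := Finset.card_eq_two.1 h2
  have hf : f ∈ T.faces.filter fun f => {a, b} ⊆ f := by rw [e]; simp
  have hg : g ∈ T.faces.filter fun f => {a, b} ⊆ f := by rw [e]; simp
  rw [Finset.mem_filter, pair_sub] at hf hg
  obtain ⟨c, hc | hc⟩ := Tri.exists hσ hf.1 hf.2.1 hf.2.2 hab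
  · exact ⟨f, hf.1, c, hc⟩
  obtain ⟨d, hd | hd⟩ := Tri.exists hσ hg.1 hg.2.1 hg.2.2 hab
  · exact ⟨g, hg.1, d, hd⟩
  exact (hfg (hc.uniq hσ hf.1 hg.1 hd).1).elim

theorem t_adj (hσ : Triangulation.IsCoherent T.faces σ) {a b} (h : adj T a b) :
    adj T b (t T σ a b) := by
  obtain ⟨f, hf, h⟩ := exists_tri hσ h
  have e := h.eq hσ hf
  exact ⟨h.rot.ne hσ hf, f, hf, by rw [e]; simp, by rw [e]; simp⟩

theorem t_rot (hσ : Triangulation.IsCoherent T.faces σ) {a b} (h : adj T a b) :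
    t T σ b (t T σ a b) = a := by
  obtain ⟨f, hf, h⟩ := exists_tri hσ h
  exact t_eq hσ hf h.rot

theorem face_mem (hσ : Triangulation.IsCoherent T.faces σ) {a b} (h : adj T a b) :
    {a, b, t T σ a b} ∈ T.faces := by
  obtain ⟨f, hf, h⟩ := exists_tri hσ h
  rwa [← h.eq hσ hf]

theorem face_eq (hσ : Triangulation.IsCoherent T.faces σ) {f a b} (hf : f ∈ T.faces)
    (ha : a ∈ f) (hb : b ∈ f) (hab : a ≠ b) : f = {a, b, t T σ a b} ∨ f = {b, a, t T σ b a} := by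
  obtain ⟨c, h | h⟩ := Tri.exists hσ hf ha hb hab
  · left; rw [t_eq hσ hf h]; exact h.eq hσ hf
  · right; rw [t_eq hσ hf h]; exact h.eq hσ hf

theorem mem {a b} (h : adj T a b) : a ∈ T.verts := by
  obtain ⟨-, f, hf, ha, -⟩ := h
  exact Finset.mem_sup.2 ⟨f, hf, ha⟩

theorem t_pred (hσ : Triangulation.IsCoherent T.faces σ) {a b} (h : adj T a b) :
    t T σ (t T σ a b) a = b := by
  have := t_rot hσ (t_adj hσ h)
  rwa [t_rot hσ h] at this

theorem succ_adj (hσ : Triangulation.IsCoherent T.faces σ) {a b} (h : adj T a b) :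
    adj T a (t T σ a b) := by
  have := adj_symm (t_adj hσ (t_adj hσ h))
  rwa [t_rot hσ h] at this

theorem iter_adj (hσ : Triangulation.IsCoherent T.faces σ) {a b} (h : adj T a b) (k : ℕ) :
    adj T a ((t T σ a)^[k] b) := by
  induction k with
  | zero => exact h
  | succ k ih => rw [Function.iterate_succ_apply']; exact succ_adj hσ ih

theorem periodic (hσ : Triangulation.IsCoherent T.faces σ) {a b} (h : adj T a b) :
    ∃ m, (t T σ a)^[m + 1] b = b := by
  obtain ⟨i, hi, j, hj, hij, e⟩ := Finset.exists_ne_map_eq_of_card_lt_of_maps_to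
    (s := Finset.range (T.verts.card + 1)) (t := T.verts) (f := fun k => (t T σ a)^[k] b)
    (by simp) (fun k _ => mem (adj_symm (iter_adj hσ h k)))
  have key : ∀ i d, (t T σ a)^[i] b = (t T σ a)^[i + d] b → (t T σ a)^[d] b = b := by
    intro i d e
    induction i with
    | zero => rw [zero_add] at e; exact e.symm
    | succ i ih =>
      apply ih
      rw [show i + 1 + d = i + d + 1 by omega, Function.iterate_succ_apply',
        Function.iterate_succ_apply'] at e
      rw [← t_pred hσ (iter_adj hσ h i), e, t_pred hσ (iter_adj hσ h _)]
  wlog h : i < j generalizing i j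
  · exact this j hj i hi hij.symm e.symm (by omega)
  exact ⟨j - i - 1, key i _ (by rw [show i + (j - i - 1 + 1) = j by omega]; exact e)⟩

theorem cyc (hσ : Triangulation.IsCoherent T.faces σ) {v x y} (hx : adj T v x) (hy : adj T v y) :
    ∃ k, (t T σ v)^[k] x = y := by
  have hp : ∀ w, adj T v w → (∃ k, (t T σ v)^[k] x = w) → ∃ k, (t T σ v)^[k] x = t T σ w v := by
    rintro _ hw ⟨k, rfl⟩
    have h' := t_adj hσ (adj_symm hw)
    obtain ⟨m, hm⟩ := periodic hσ h'
    rw [Function.iterate_succ_apply, t_rot hσ (adj_symm hw)] at hm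
    exact ⟨m + k, by rw [Function.iterate_add_apply, hm]⟩
  have key : ∀ g, Relation.ReflTransGen (fun f' g' => f' ∈ T.faces ∧ g' ∈ T.faces ∧ v ∈ f' ∧
      v ∈ g' ∧ (f' ∩ g').card = 2) {v, x, t T σ v x} g →
      ∀ w ∈ g, w ≠ v → ∃ k, (t T σ v)^[k] x = w := by
    intro g hg
    induction hg with
    | refl =>
      intro w hw hwv
      simp only [Finset.mem_insert, Finset.mem_singleton] at hw
      rcases hw with rfl | rfl | rfl
      exacts [(hwv rfl).elim, ⟨0, rfl⟩, ⟨1, rfl⟩]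
    | @tail g g' _ h2 ih =>
      obtain ⟨hg, hg', v1, v2, h3⟩ := h2
      obtain ⟨z, hz, hzv⟩ := Finset.exists_mem_ne (by omega : 1 < (g ∩ g').card) v
      rw [Finset.mem_inter] at hz
      have hz' := ih z hz.1 hzv
      have hadj : adj T v z := ⟨hzv.symm, g, hg, v1, hz.1⟩
      intro w hw hwv
      rcases face_eq hσ hg' v2 hz.2 hzv.symm with e | e <;> rw [e] at hw <;>
        simp only [Finset.mem_insert, Finset.mem_singleton] at hw
      · obtain ⟨k, hk⟩ := hz'
        rcases hw with rfl | rfl | rfl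
        exacts [(hwv rfl).elim, ⟨k, hk⟩, ⟨k + 1, by rw [Function.iterate_succ_apply', hk]⟩]
      · rcases hw with rfl | rfl | rfl
        exacts [hz', (hwv rfl).elim, hp _ hadj hz']
  exact key {v, y, t T σ v y} (T.link_connected v _ (face_mem hσ hx) _ (face_mem hσ hy) (by simp)
    (by simp)) y (by simp) hy.1.symm

theorem conn {u v} (hu : u ∈ T.verts) (hv : v ∈ T.verts) : Relation.ReflTransGen (adj T) u v := by
  obtain ⟨f, hf, hu⟩ := Finset.mem_sup.1 hu
  obtain ⟨g, hg, hv⟩ := Finset.mem_sup.1 hv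
  have := T.face_connected f hf g hg
  have key : ∀ w ∈ g, Relation.ReflTransGen (adj T) u w := by
    clear hv hg
    induction this with
    | refl =>
      intro w hw
      by_cases e : u = w
      · rw [e]
      · exact .single ⟨e, f, hf, hu, hw⟩
    | @tail g g' _ h2 ih =>
      obtain ⟨hg, hg', h3⟩ := h2
      obtain ⟨z, hz⟩ := Finset.card_pos.1 (by omega : 0 < (g ∩ g').card)
      rw [Finset.mem_inter] at hz
      intro w hw
      by_cases e : z = w
      · rw [← e]; exact ih z hz.1
      · exact (ih z hz.1).tail ⟨e, g', hg', hz.2, hw⟩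
  exact key v hv

theorem mem_edges {e : Finset ℕ} : e ∈ T.edges ↔ e.card = 2 ∧ ∃ f ∈ T.faces, e ⊆ f := by
  simp only [Triangulation.edges, Triangulation.edgesOf, Finset.mem_filter,
    Finset.mem_powersetCard]
  constructor
  · rintro ⟨⟨h1, h2⟩, h3⟩
    exact ⟨h2, h3⟩
  · rintro ⟨h2, f, hf, h3⟩
    exact ⟨⟨fun z hz => Finset.mem_sup.2 ⟨f, hf, h3 hz⟩, h2⟩, f, hf, h3⟩

theorem adj_iff {a b} : adj T a b ↔ a ≠ b ∧ {a, b} ∈ T.edges := by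
  simp only [adj, mem_edges, pair_sub]
  exact ⟨fun h => ⟨h.1, Finset.card_pair h.1, h.2⟩, fun h => ⟨h.1, h.2.2⟩⟩

theorem card_faces : 3 * T.faces.card = 2 * T.edges.card := by
  have := Finset.sum_card_bipartiteAbove_eq_sum_card_bipartiteBelow (s := T.faces) (t := T.edges)
    fun f e => e ⊆ f
  rw [Finset.sum_const_nat (m := 3), Finset.sum_const_nat (m := 2)] at this
  · omega
  · intro e he
    rw [mem_edges] at he
    exact T.edge_in_two_faces e he.1 he.2
  · intro f hf
    have : Finset.bipartiteAbove (fun f e => e ⊆ f) T.edges f = f.powersetCard 2 := by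
      ext e
      simp only [Finset.bipartiteAbove, Finset.mem_filter, mem_edges, Finset.mem_powersetCard]
      exact ⟨fun h => ⟨h.2, h.1.1⟩, fun h => ⟨⟨h.2, f, hf, h.1⟩, h.1⟩⟩
    rw [this, Finset.card_powersetCard, T.card_eq_three f hf]
    rfl

theorem card_darts :
    ((T.verts ×ˢ T.verts).filter fun d => adj T d.1 d.2).card = 2 * T.edges.card := by
  have : ((T.verts ×ˢ T.verts).filter fun d => adj T d.1 d.2) =
      T.edges.biUnion fun e => e.offDiag := by
    ext ⟨a, b⟩
    simp only [Finset.mem_filter, Finset.mem_product, Finset.mem_biUnion, Finset.mem_offDiag]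
    constructor
    · rintro ⟨-, h⟩
      exact ⟨{a, b}, (adj_iff.1 h).2, by simp, by simp, h.1⟩
    · rintro ⟨e, he, ha, hb, hab⟩
      obtain ⟨-, f, hf, hef⟩ := mem_edges.1 he
      have h : adj T a b := ⟨hab, f, hf, hef ha, hef hb⟩
      exact ⟨⟨mem h, mem (adj_symm h)⟩, h⟩
  rw [this, Finset.card_biUnion, Finset.sum_const_nat (m := 2), mul_comm]
  · intro e he
    rw [Finset.offDiag_card, (mem_edges.1 he).1]
  · intro e he e' he' hne
    refine Finset.disjoint_left.2 ?_
    rintro ⟨a, b⟩ h h'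
    rw [Finset.mem_offDiag] at h h'
    have key : ∀ {e}, e ∈ T.edges → a ∈ e ∧ b ∈ e ∧ a ≠ b → {a, b} = e := by
      intro e he h
      exact Finset.eq_of_subset_of_card_le (pair_sub.2 ⟨h.1, h.2.1⟩)
        (by rw [(mem_edges.1 he).1, Finset.card_pair h.2.2])
    exact hne ((key he h).symm.trans (key he' h'))

theorem euler (h : T.euler = -2) :
    ((T.verts ×ˢ T.verts).filter fun d => adj T d.1 d.2).card = 6 * T.verts.card + 12 := by
  have h1 := card_faces (T := T)
  rw [card_darts]
  unfold Triangulation.euler at h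
  omega

/-- the oriented surface of a triangulation -/
noncomputable def surf (hσ : Triangulation.IsCoherent T.faces σ) (h : T.euler = -2) : Surf where
  verts := T.verts
  adj := adj T
  t := t T σ
  symm := adj_symm
  irr v h := h.1 rfl
  mem := mem
  t_adj := t_adj hσ
  t_rot := t_rot hσ
  t_ne := Surf.t_ne_of adj_symm mem (t_rot hσ) (t_adj hσ) (cyc hσ) conn (euler h)
  cyc := cyc hσ
  conn := conn
  euler := euler h

end Model
end NSC

namespace NSC
open scoped Classical
open Triangulation Module

section Incidence
variable {α : Type*}

theorem sum_ite_coe (s : Finset α) (p : α → Prop) [DecidablePred p] (X : α → ZMod 2) :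
    ∑ v : s, (if p v then 1 else 0) * X v = ∑ v ∈ s.filter p, X v := by
  rw [Finset.sum_coe_sort s fun v => (if p v then 1 else 0) * X v, Finset.sum_filter]
  exact Finset.sum_congr rfl fun v _ => by split_ifs <;> simp

theorem exists_ext (s : Finset α) (x : s → ZMod 2) : ∃ X : α → ZMod 2, x = fun v : s => X v :=
  ⟨fun v => if h : v ∈ s then x ⟨v, h⟩ else 0, by funext v; simp⟩

end Incidence

theorem mem_edgesOf {F : Finset (Finset ℕ)} {e : Finset ℕ} :
    e ∈ edgesOf F ↔ e.card = 2 ∧ ∃ f ∈ F, e ⊆ f := by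
  simp only [edgesOf, Finset.mem_filter, Finset.mem_powersetCard]
  constructor
  · rintro ⟨⟨h1, h2⟩, h3⟩
    exact ⟨h2, h3⟩
  · rintro ⟨h2, f, hf, h3⟩
    exact ⟨⟨fun z hz => Finset.mem_sup.2 ⟨f, hf, h3 hz⟩, h2⟩, f, hf, h3⟩

theorem edgesOf_filter {F : Finset (Finset ℕ)} {f : Finset ℕ} (hf : f ∈ F) :
    (edgesOf F).filter (fun e => e ⊆ f) = f.powersetCard 2 := by
  ext e
  simp only [Finset.mem_filter, mem_edgesOf, Finset.mem_powersetCard]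
  exact ⟨fun h => ⟨h.2, h.1.1⟩, fun h => ⟨⟨h.2, f, hf, h.1⟩, h.1⟩⟩

/-- a set of edges that pairs trivially with all cocycles bounds a set of faces -/
theorem exists_side (F Z : Finset (Finset ℕ)) (hZ : Z ⊆ edgesOf F)
    (h : ∀ y : Finset ℕ → ZMod 2, (∀ f ∈ F, ∑ e ∈ f.powersetCard 2, y e = 0) →
      ∑ e ∈ Z, y e = 0) : ∃ A : Finset ℕ → ZMod 2,
      ∀ e ∈ edgesOf F, ∑ f ∈ F.filter (fun f => e ⊆ f), A f = if e ∈ Z then 1 else 0 := by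
  let N : Matrix (edgesOf F) F (ZMod 2) := fun e f => if (e : Finset ℕ) ⊆ f then 1 else 0
  obtain ⟨x, hx⟩ := exists_eq_of_orthogonal N.mulVecLin
    (fun e : edgesOf F => if (e : Finset ℕ) ∈ Z then 1 else 0) (by
      intro y hy
      obtain ⟨Y, rfl⟩ := exists_ext _ y
      have e1 : ∑ e : edgesOf F, Y e * (if (e : Finset ℕ) ∈ Z then 1 else 0) = ∑ e ∈ Z, Y e := by
        simp only [mul_comm (Y _)]
        rw [sum_ite_coe (edgesOf F) (fun e => e ∈ Z) Y]
        congr 1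
        ext e
        simp only [Finset.mem_filter, and_iff_right_iff_imp]
        exact fun h => hZ h
      rw [e1]
      refine h Y fun f hf => ?_
      have := hy (Pi.single ⟨f, hf⟩ 1)
      have e2 : ∀ e : edgesOf F, N.mulVecLin (Pi.single ⟨f, hf⟩ 1) e =
          if (e : Finset ℕ) ⊆ f then 1 else 0 := fun e => by
        rw [Matrix.mulVecLin_apply, Matrix.mulVec_single_one]; rfl
      simp only [e2] at this
      rw [sum_ite_coe (edgesOf F) (fun e => e ⊆ f) Y, edgesOf_filter hf] at this
      exact this)
  obtain ⟨A, rfl⟩ := exists_ext _ x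
  refine ⟨A, fun e he => ?_⟩
  have := congrFun hx ⟨e, he⟩
  rw [← this]
  exact (sum_ite_coe F (fun f => e ⊆ f) A).symm

/-- sums over the three edges of a triangle -/
theorem sum_triangle {a b c : ℕ} (hab : a ≠ b) (hac : a ≠ c) (hbc : b ≠ c)
    (Y : Finset ℕ → ZMod 2) :
    ∑ e ∈ ({a, b, c} : Finset ℕ).powersetCard 2, Y e = Y {a, b} + Y {a, c} + Y {b, c} := by
  have n1 : ({a, b} : Finset ℕ) ≠ {a, c} := by
    intro e
    have : b ∈ ({a, c} : Finset ℕ) := by rw [← e]; simp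
    simp at this; tauto
  have n2 : ({a, b} : Finset ℕ) ≠ {b, c} := by
    intro e
    have : a ∈ ({b, c} : Finset ℕ) := by rw [← e]; simp
    simp at this; tauto
  have n3 : ({a, c} : Finset ℕ) ≠ {b, c} := by
    intro e
    have : a ∈ ({b, c} : Finset ℕ) := by rw [← e]; simp
    simp at this; tauto
  have : ({a, b, c} : Finset ℕ).powersetCard 2 = {{a, b}, {a, c}, {b, c}} := by
    symm
    apply Finset.eq_of_subset_of_card_le
    · intro e he
      simp only [Finset.mem_insert, Finset.mem_singleton] at he
      rw [Finset.mem_powersetCard]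
      rcases he with rfl | rfl | rfl
      · exact ⟨by intro z; simp; tauto, Finset.card_pair hab⟩
      · exact ⟨by intro z; simp; tauto, Finset.card_pair hac⟩
      · exact ⟨by intro z; simp; tauto, Finset.card_pair hbc⟩
    · rw [Finset.card_powersetCard, Finset.card_eq_three.2 ⟨a, b, c, hab, hac, hbc, rfl⟩,
        Finset.card_eq_three.2 ⟨_, _, _, n1, n2, n3, rfl⟩]
      rfl
  rw [this, Finset.sum_insert (by rw [Finset.mem_insert, Finset.mem_singleton]
                                  exact not_or.2 ⟨n1, n2⟩), Finset.sum_pair n3, add_assoc]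

/-- on a face set with the Euler characteristic of a disk, every cocycle is a coboundary -/
theorem exists_potential {F : Finset (Finset ℕ)} (h3 : ∀ f ∈ F, f.card = 3)
    (h2 : ∀ e ∈ edgesOf F, (F.filter fun f => e ⊆ f).card ≤ 2)
    (conn : ∀ f ∈ F, ∀ g ∈ F, Relation.ReflTransGen
      (fun f' g' => f' ∈ F ∧ g' ∈ F ∧ (f' ∩ g').card = 2) f g)
    (bd : ∃ e ∈ edgesOf F, (F.filter fun f => e ⊆ f).card = 1)
    (hE : (vertsOf F).card + F.card = (edgesOf F).card + 1) (φ : Finset ℕ → ZMod 2)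
    (hφ : ∀ f ∈ F, ∑ e ∈ f.powersetCard 2, φ e = 0) :
    ∃ x : ℕ → ZMod 2, ∀ e ∈ edgesOf F, φ e = ∑ v ∈ e, x v := by
  let M : Matrix (edgesOf F) (vertsOf F) (ZMod 2) :=
    fun e v => if (v : ℕ) ∈ (e : Finset ℕ) then 1 else 0
  let N : Matrix F (edgesOf F) (ZMod 2) := fun f e => if (e : Finset ℕ) ⊆ f then 1 else 0
  have sub : ∀ e ∈ edgesOf F, (vertsOf F).filter (fun v => v ∈ e) = e := by
    intro e he
    obtain ⟨-, f, hf, hef⟩ := mem_edgesOf.1 he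
    ext v
    simp only [Finset.mem_filter, and_iff_right_iff_imp]
    exact fun hv => Finset.mem_sup.2 ⟨f, hf, hef hv⟩
  have Me : ∀ (X : ℕ → ZMod 2) (e : edgesOf F),
      M.mulVec (fun v => X v) e = ∑ v ∈ (e : Finset ℕ), X v := by
    intro X e
    rw [← sub e e.2]
    exact sum_ite_coe (vertsOf F) (fun v => v ∈ (e : Finset ℕ)) X
  have Nf : ∀ (Y : Finset ℕ → ZMod 2) (f : F),
      N.mulVec (fun e => Y e) f = ∑ e ∈ (f : Finset ℕ).powersetCard 2, Y e := by
    intro Y f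
    rw [← edgesOf_filter f.2]
    exact sum_ite_coe (edgesOf F) (fun e => e ⊆ (f : Finset ℕ)) Y
  have NM : LinearMap.range M.mulVecLin ≤ LinearMap.ker N.mulVecLin := by
    rintro _ ⟨x, rfl⟩
    obtain ⟨X, rfl⟩ := exists_ext _ x
    rw [LinearMap.mem_ker]
    funext f
    have e1 : M.mulVecLin (fun v => X v) = fun e : edgesOf F => ∑ v ∈ (e : Finset ℕ), X v :=
      funext fun e => Me X e
    rw [e1, Matrix.mulVecLin_apply, Nf fun e => ∑ v ∈ e, X v]
    obtain ⟨a, b, c, hab, hac, hbc, hf⟩ := Finset.card_eq_three.1 (h3 f f.2)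
    rw [hf, sum_triangle hab hac hbc, Finset.sum_pair hab, Finset.sum_pair hac,
      Finset.sum_pair hbc]
    have t1 := z2 (X a)
    have t2 := z2 (X b)
    have t3 := z2 (X c)
    show _ = (0 : ZMod 2)
    linear_combination t1 + t2 + t3
  obtain ⟨e0, he0, hc0⟩ := bd
  obtain ⟨f0, hf0⟩ := Finset.card_eq_one.1 hc0
  have hf0' : f0 ∈ F ∧ e0 ⊆ f0 := by
    have : f0 ∈ F.filter fun f => e0 ⊆ f := by rw [hf0]; simp
    exact Finset.mem_filter.1 this
  have col : ∀ e : edgesOf F, N.mulVecLin (Pi.single e 1) =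
      fun f : F => if (e : Finset ℕ) ⊆ f then 1 else 0 := by
    intro e
    rw [Matrix.mulVecLin_apply, Matrix.mulVec_single_one]
    rfl
  have surj : LinearMap.range N.mulVecLin = ⊤ := by
    have base : (Pi.single ⟨f0, hf0'.1⟩ 1 : F → ZMod 2) ∈ LinearMap.range N.mulVecLin := by
      refine ⟨Pi.single ⟨e0, he0⟩ 1, ?_⟩
      rw [col]
      funext ⟨f, hf⟩
      have : e0 ⊆ f ↔ f = f0 := by
        have : f ∈ F.filter (fun f => e0 ⊆ f) ↔ f = f0 := by rw [hf0]; simp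
        rw [← this, Finset.mem_filter]; tauto
      simp [Pi.single_apply, this]
    have all : ∀ g, ∀ hg : g ∈ F,
        (Pi.single ⟨g, hg⟩ 1 : F → ZMod 2) ∈ LinearMap.range N.mulVecLin := by
      intro g hg
      have := conn f0 hf0'.1 g hg
      induction this with
      | refl => exact base
      | @tail g g' _ h ih =>
        obtain ⟨hg', hg, h4⟩ := h
        specialize ih hg'
        by_cases hgg : g = g'
        · subst hgg; exact ih
        have he : g ∩ g' ∈ edgesOf F := mem_edgesOf.2 ⟨h4, g, hg', Finset.inter_subset_left⟩
        have hs : F.filter (fun f => g ∩ g' ⊆ f) = {g, g'} := by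
          symm
          apply Finset.eq_of_subset_of_card_le
          · intro z hz
            simp only [Finset.mem_insert, Finset.mem_singleton] at hz
            rw [Finset.mem_filter]
            rcases hz with rfl | rfl
            exacts [⟨hg', Finset.inter_subset_left⟩, ⟨hg, Finset.inter_subset_right⟩]
          · rw [Finset.card_pair hgg]; exact h2 _ he
        have e1 : (Pi.single ⟨g', hg⟩ 1 : F → ZMod 2) =
            N.mulVecLin (Pi.single ⟨g ∩ g', he⟩ 1) - Pi.single ⟨g, hg'⟩ 1 := by
          rw [col]
          funext ⟨f, hf⟩
          have : g ∩ g' ⊆ f ↔ f = g ∨ f = g' := by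
            have : f ∈ F.filter (fun f => g ∩ g' ⊆ f) ↔ f = g ∨ f = g' := by rw [hs]; simp
            rw [← this, Finset.mem_filter]; tauto
          simp only [Pi.sub_apply, Pi.single_apply, this, Subtype.mk.injEq]
          by_cases a1 : f = g <;> by_cases a2 : f = g' <;> simp_all
        rw [e1]
        exact sub_mem ⟨_, rfl⟩ ih
    rw [eq_top_iff]
    intro w _
    rw [← Finset.univ_sum_single w]
    refine sum_mem fun f _ => ?_
    have : (Pi.single f (w f) : F → ZMod 2) = w f • Pi.single f 1 := by
      rw [← Pi.single_smul, smul_eq_mul, mul_one]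
    rw [this]
    exact Submodule.smul_mem _ _ (all f f.2)
  obtain ⟨v0, hv0⟩ : f0.Nonempty := Finset.card_pos.1 (by rw [h3 f0 hf0'.1]; norm_num)
  have kM : finrank (ZMod 2) (LinearMap.ker M.mulVecLin) ≤ 1 := by
    have hv : v0 ∈ vertsOf F := Finset.mem_sup.2 ⟨f0, hf0'.1, hv0⟩
    refine finrank_ker_le M.mulVecLin
      (LinearMap.pi fun _ : Fin 1 => LinearMap.proj (⟨v0, hv⟩ : vertsOf F)) ?_
    intro x hx hx0
    obtain ⟨X, rfl⟩ := exists_ext _ x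
    have x0 : X v0 = 0 := congrFun hx0 0
    have xe : ∀ f ∈ F, ∀ a ∈ f, ∀ b ∈ f, X a = X b := by
      intro f hf a ha b hb
      by_cases hab : a = b
      · rw [hab]
      have he : {a, b} ∈ edgesOf F := mem_edgesOf.2 ⟨Finset.card_pair hab, f, hf, by
        simp [Finset.insert_subset_iff, ha, hb]⟩
      have := (Me X ⟨_, he⟩).symm.trans (congrFun hx ⟨_, he⟩)
      rw [Finset.sum_pair hab] at this
      exact z2_eq.1 this
    funext ⟨v, hv⟩
    obtain ⟨g, hg, hvg⟩ := Finset.mem_sup.1 hv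
    have := conn f0 hf0'.1 g hg
    have key : ∀ w ∈ g, X w = 0 := by
      clear hvg
      induction this with
      | refl => intro w hw; rw [xe f0 hf0'.1 w hw v0 hv0, x0]
      | @tail g g' _ h ih =>
        obtain ⟨hg', hg, h4⟩ := h
        obtain ⟨z, hz⟩ := Finset.card_pos.1 (by omega : 0 < (g ∩ g').card)
        rw [Finset.mem_inter] at hz
        intro w hw
        rw [xe g' hg w hw z hz.2, ih hg' z hz.1]
    exact key v hvg
  have d1 := M.mulVecLin.finrank_range_add_finrank_ker
  have d2 := N.mulVecLin.finrank_range_add_finrank_ker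
  rw [surj, finrank_top] at d2
  simp only [finrank_fintype_fun_eq_card, Fintype.card_coe] at d1 d2
  have heq : LinearMap.range M.mulVecLin = LinearMap.ker N.mulVecLin :=
    Submodule.eq_of_le_of_finrank_le NM (by omega)
  have : (fun e : edgesOf F => φ e) ∈ LinearMap.ker N.mulVecLin := by
    rw [LinearMap.mem_ker]
    funext f
    rw [Matrix.mulVecLin_apply, Nf φ]
    exact hφ f f.2
  rw [← heq] at this
  obtain ⟨x, hx⟩ := this
  obtain ⟨X, rfl⟩ := exists_ext _ x
  refine ⟨X, fun e he => ?_⟩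
  rw [← Me X ⟨e, he⟩]
  exact (congrFun hx ⟨e, he⟩).symm

end NSC

namespace NSC
open scoped Classical

namespace Surf
variable {S : Surf}

/-- the component of the dart `p → q` in the complement of a set of faces -/
def Comp (S : Surf) (B : ℕ → ℕ → Prop) (p q x y : ℕ) : Prop :=
  Relation.ReflTransGen (fun d e : ℕ × ℕ => e = (d.2, S.t d.1 d.2) ∨ e = (d.2, d.1) ∧ ¬ B d.2 d.1)
    (p, q) (x, y)

namespace Comp
variable {B : ℕ → ℕ → Prop} {p q x y : ℕ}

theorem adj_not (hB : ∀ {u v}, S.adj u v → (B u v ↔ B v (S.t u v))) (hpq : S.adj p q)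
    (hp : ¬ B p q) (h : S.Comp B p q x y) : S.adj x y ∧ ¬ B x y := by
  suffices ∀ d : ℕ × ℕ, Relation.ReflTransGen (fun d e : ℕ × ℕ =>
      e = (d.2, S.t d.1 d.2) ∨ e = (d.2, d.1) ∧ ¬ B d.2 d.1) (p, q) d →
      S.adj d.1 d.2 ∧ ¬ B d.1 d.2 from this _ h
  intro d h
  induction h with
  | refl => exact ⟨hpq, hp⟩
  | tail _ h ih =>
    rcases h with rfl | ⟨rfl, h⟩
    · exact ⟨S.t_adj ih.1, (hB ih.1).not.1 ih.2⟩
    · exact ⟨S.symm ih.1, h⟩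

theorem rot (h : S.Comp B p q x y) : S.Comp B p q y (S.t x y) := h.tail (.inl rfl)

theorem flip (h : S.Comp B p q x y) (hb : ¬ B y x) : S.Comp B p q y x := h.tail (.inr ⟨rfl, hb⟩)

theorem rot_iff (e : S.adj x y) : S.Comp B p q x y ↔ S.Comp B p q y (S.t x y) := by
  refine ⟨rot, fun h => ?_⟩
  have := h.rot.rot
  rwa [S.t_rot e, S.t_rot' e] at this

theorem strConn (hB : ∀ {u v}, S.adj u v → (B u v ↔ B v (S.t u v))) (hpq : S.adj p q)
    (hp : ¬ B p q) : S.StrConn (S.Comp B p q) := by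
  intro Q h1 h2
  have key : ∀ d : ℕ × ℕ, Relation.ReflTransGen (fun d e : ℕ × ℕ =>
      e = (d.2, S.t d.1 d.2) ∨ e = (d.2, d.1) ∧ ¬ B d.2 d.1) (p, q) d → (Q d.1 d.2 ↔ Q p q) := by
    intro d h
    induction h with
    | refl => rfl
    | @tail d e hd h ih =>
      have hd : S.Comp B p q d.1 d.2 := hd
      have a := (hd.adj_not hB hpq hp).1
      rcases h with rfl | ⟨rfl, h⟩
      · rw [← ih]; exact (h1 a hd).symm
      · rw [← ih]; exact (h2 a hd (hd.flip h)).symm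
  intro u v x y _ _ h3 h4 h5
  exact (key _ h4).2 ((key _ h3).1 h5)

end Comp

/-- a rotation invariant set of darts that is neither empty nor everything has a boundary dart -/
theorem exists_boundary {C : ℕ → ℕ → Prop} (hC : ∀ {u v}, S.adj u v → (C u v ↔ C v (S.t u v)))
    {p q x y : ℕ} (hpq : S.adj p q) (hp : C p q) (hxy : S.adj x y) (hx : ¬ C x y) :
    ∃ u v, S.adj u v ∧ C u v ∧ ¬ C v u := by
  by_contra! hc
  have all : ∀ {v a b}, S.adj v a → S.adj v b → C v a → C v b := by
    intro v a b ha hb h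
    refine S.cyc_ind ha hb (C v) h fun z hz h => hc _ _ (S.t_adj' hz) ?_
    have := (hC (S.t_adj hz)).1 ((hC hz).1 h)
    rwa [S.t_rot hz] at this
  have key : ∀ w, Relation.ReflTransGen S.adj p w → ∀ a, S.adj w a → C w a := by
    intro w h
    induction h with
    | refl => exact fun a ha => all hpq ha hp
    | tail _ h ih => exact fun a ha => all (S.symm h) ha (hc _ _ h (ih _ h))
  exact hx (key x (S.conn (S.mem hpq) (S.mem hxy)) y hxy)

/-- boundary darts continue -/
theorem boundary_next {C : ℕ → ℕ → Prop} (hC : ∀ {u v}, S.adj u v → (C u v ↔ C v (S.t u v)))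
    {u v : ℕ} (huv : S.adj u v) (h1 : C u v) (h2 : ¬ C v u) : ∃ w, S.adj v w ∧ C v w ∧ ¬ C w v := by
  by_contra! hc
  have huv' := S.symm huv
  refine S.cyc_ind huv' (S.t_adj huv) (fun x => ¬ C v x) h2 (fun z hz h3 h4 => h3 ?_) ((hC huv).1 h1)
  have a := S.succ_adj hz
  have := (hC (S.symm a)).1 (hc _ a h4)
  rwa [S.t_pred_succ hz] at this

/-- a simple cycle on the boundary of a set of faces -/
theorem exists_boundary_cycle {C : ℕ → ℕ → Prop}
    (hC : ∀ {u v}, S.adj u v → (C u v ↔ C v (S.t u v)))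
    {p q x y : ℕ} (hpq : S.adj p q) (hp : C p q) (hxy : S.adj x y) (hx : ¬ C x y) :
    ∃ (n : ℕ) (s : ℕ → ℕ), 3 ≤ n ∧ s n = s 0 ∧ (∀ i < n, ∀ j < n, s i = s j → i = j) ∧
      ∀ i, S.adj (s i) (s (i + 1)) ∧ C (s i) (s (i + 1)) ∧ ¬ C (s (i + 1)) (s i) := by
  obtain ⟨u, v, h0⟩ := exists_boundary hC hpq hp hxy hx
  have : ∀ w, ∃ w', (∃ a, S.adj a w ∧ C a w ∧ ¬ C w a) → S.adj w w' ∧ C w w' ∧ ¬ C w' w := by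
    intro w
    by_cases h : ∃ a, S.adj a w ∧ C a w ∧ ¬ C w a
    · obtain ⟨a, h1, h2, h3⟩ := h
      obtain ⟨w', h⟩ := boundary_next hC h1 h2 h3
      exact ⟨w', fun _ => h⟩
    · exact ⟨0, fun h' => absurd h' h⟩
  choose f hf using this
  have it : ∀ i, ∃ a, S.adj a (f^[i] v) ∧ C a (f^[i] v) ∧ ¬ C (f^[i] v) a := by
    intro i
    induction i with
    | zero => exact ⟨u, h0⟩
    | succ i ih => rw [Function.iterate_succ_apply']; exact ⟨_, hf _ ih⟩
  obtain ⟨i, -, j, -, hij, e⟩ := Finset.exists_ne_map_eq_of_card_lt_of_maps_to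
    (s := Finset.range (S.verts.card + 1)) (t := S.verts) (f := fun k => f^[k] v)
    (by simp) (fun k _ => S.mem' (it k).choose_spec.1)
  obtain ⟨b, k, hk, hb, hon⟩ : ∃ b k, 0 < k ∧ f^[k] b = b ∧ ∃ i, b = f^[i] v := by
    beta_reduce at e
    rcases lt_or_gt_of_ne hij with h | h
    · refine ⟨_, j - i, by omega, ?_, i, rfl⟩
      rw [← Function.iterate_add_apply, e]; congr 2; omega
    · refine ⟨_, i - j, by omega, ?_, j, rfl⟩
      rw [← Function.iterate_add_apply, ← e]; congr 2; omega
  have hz : ∀ i, S.adj (f^[i] b) (f^[i + 1] b) ∧ C (f^[i] b) (f^[i + 1] b) ∧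
      ¬ C (f^[i + 1] b) (f^[i] b) := by
    intro i
    obtain ⟨j, rfl⟩ := hon
    rw [Function.iterate_succ_apply', ← Function.iterate_add_apply]
    exact hf _ (it _)
  have pos : 0 < Function.minimalPeriod f b :=
    Function.minimalPeriod_pos_of_mem_periodicPts ⟨k, hk, hb⟩
  have per : f^[Function.minimalPeriod f b] b = b := Function.iterate_minimalPeriod
  refine ⟨Function.minimalPeriod f b, fun i => f^[i] b, ?_, per, ?_, hz⟩
  · have n1 : Function.minimalPeriod f b ≠ 1 := by
      intro h
      rw [h] at per
      have := (hz 0).1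
      rw [zero_add, per] at this
      exact S.irr _ this
    have n2 : Function.minimalPeriod f b ≠ 2 := by
      intro h
      rw [h] at per
      have := hz 1
      rw [show 1 + 1 = 2 from rfl, per] at this
      exact (hz 0).2.2 this.2.1
    omega
  · intro i hi j hj e
    exact Function.iterate_injOn_Iio_minimalPeriod hi hj e

/-- nontrivial cocycles vanishing on a set of faces -/
structure Van (S : Surf) (B : ℕ → ℕ → Prop) (φ : ℕ → ℕ → ZMod 2) : Prop where
  coc : S.Coc φ
  van : ∀ {x y}, S.adj x y → B x y → φ x y = 0
  non : ¬ ∃ h : ℕ → ZMod 2, ∀ {x y}, S.adj x y → φ x y = h x + h y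

theorem Coc.add_coboundary {φ} (h : S.Coc φ) (g : ℕ → ZMod 2) :
    S.Coc fun x y => φ x y + (g x + g y) where
  symm e := by rw [h.symm e]; ring
  sum {u v} e := by
    have := h.sum e
    have h1 := z2 (g u)
    have h2 := z2 (g v)
    have h3 := z2 (g (S.t u v))
    linear_combination this + h1 + h2 + h3

/-- a vanishing cocycle of minimal support -/
theorem Van.exists_min {B : ℕ → ℕ → Prop} (h : ∃ φ, S.Van B φ) : ∃ φ, S.Van B φ ∧
    ∀ φ', S.Van B φ' → (∀ {x y}, S.adj x y → φ x y = 0 → φ' x y = 0) →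
      ∀ {x y}, S.adj x y → φ' x y = 0 → φ x y = 0 := by
  let m : (ℕ → ℕ → ZMod 2) → ℕ := fun φ =>
    ((S.verts ×ˢ S.verts).filter fun d => S.adj d.1 d.2 ∧ φ d.1 d.2 ≠ 0).card
  obtain ⟨φ, hφ, hmin⟩ := (measure m).wf.has_min {φ | S.Van B φ} h
  refine ⟨φ, hφ, fun φ' h' hs x y e h0 => ?_⟩
  by_contra h1
  refine hmin φ' h' (Finset.card_lt_card ⟨?_, ?_⟩)
  · intro d hd
    simp only [Finset.mem_filter] at hd ⊢
    exact ⟨hd.1, hd.2.1, fun h => hd.2.2 (hs hd.2.1 h)⟩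
  · intro hsub
    have : (x, y) ∈ (S.verts ×ˢ S.verts).filter fun d => S.adj d.1 d.2 ∧ φ d.1 d.2 ≠ 0 := by
      simp only [Finset.mem_filter, Finset.mem_product]
      exact ⟨⟨S.mem e, S.mem' e⟩, e, h1⟩
    exact (Finset.mem_filter.1 (hsub this)).2.2 h0

end Surf
end NSC

namespace NSC
open scoped Classical
open Triangulation

namespace Model
variable {T : Triangulation} {σ : Finset ℕ → ℕ × ℕ × ℕ}

/-- the face to the left of a dart -/
noncomputable def face (T : Triangulation) (σ : Finset ℕ → ℕ × ℕ × ℕ) (a b : ℕ) : Finset ℕ :=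
  {a, b, t T σ a b}

theorem face_rot (hσ : IsCoherent T.faces σ) {a b} (h : adj T a b) :
    face T σ b (t T σ a b) = face T σ a b := by
  unfold face
  rw [t_rot hσ h]
  ext z; simp; tauto

theorem exists_dart (hσ : IsCoherent T.faces σ) {f} (hf : f ∈ T.faces) :
    ∃ a b, adj T a b ∧ f = face T σ a b := by
  obtain ⟨a, b, c, hab, -, -, rfl⟩ := Finset.card_eq_three.1 (T.card_eq_three f hf)
  have h : adj T a b := ⟨hab, _, hf, by simp, by simp⟩
  rcases face_eq hσ hf (a := a) (b := b) (by simp) (by simp) hab with h' | h'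
  · exact ⟨a, b, h, h'⟩
  · exact ⟨b, a, adj_symm h, h'⟩

theorem filter_pair (hσ : IsCoherent T.faces σ) {a b} (h : adj T a b) :
    T.faces.filter (fun f => {a, b} ⊆ f) = {face T σ a b, face T σ b a} := by
  ext f
  simp only [Finset.mem_filter, Finset.mem_insert, Finset.mem_singleton, pair_sub]
  constructor
  · rintro ⟨hf, ha, hb⟩
    exact face_eq hσ hf ha hb h.1
  · rintro (rfl | rfl)
    · exact ⟨face_mem hσ h, by simp [face], by simp [face]⟩
    · exact ⟨face_mem hσ (adj_symm h), by simp [face], by simp [face]⟩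

theorem face_ne (hσ : IsCoherent T.faces σ) {a b} (h : adj T a b) :
    face T σ a b ≠ face T σ b a := by
  intro e
  have := T.edge_in_two_faces {a, b} (Finset.card_pair h.1)
    (by obtain ⟨f, hf, h⟩ := h.2; exact ⟨f, hf, pair_sub.2 h⟩)
  have h2 := filter_pair hσ h
  rw [e, Finset.pair_eq_singleton] at h2
  have h3 : (T.faces.filter fun f => {a, b} ⊆ f).card = 1 := by rw [h2, Finset.card_singleton]
  convert absurd (this.symm.trans (by convert h3)) (by norm_num)

theorem inter_ne {f g : Finset ℕ} (hf : f ∈ T.faces) (h : (f ∩ g).card = 2) : f ≠ g := by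
  rintro rfl
  rw [Finset.inter_self, T.card_eq_three f hf] at h
  omega

theorem filter_inter {f g : Finset ℕ} (hf : f ∈ T.faces) (hg : g ∈ T.faces)
    (h : (f ∩ g).card = 2) : T.faces.filter (fun f' => f ∩ g ⊆ f') = {f, g} := by
  symm
  apply Finset.eq_of_subset_of_card_le
  · intro z hz
    simp only [Finset.mem_insert, Finset.mem_singleton] at hz
    rw [Finset.mem_filter]
    rcases hz with rfl | rfl
    exacts [⟨hf, Finset.inter_subset_left⟩, ⟨hg, Finset.inter_subset_right⟩]
  · rw [Finset.card_pair (inter_ne hf h)]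
    exact (le_of_eq (by convert T.edge_in_two_faces _ h ⟨f, hf, Finset.inter_subset_left⟩))

theorem face_inter (hσ : IsCoherent T.faces σ) {a b} (h : adj T a b) :
    face T σ a b ∩ face T σ b a = {a, b} := by
  symm
  apply Finset.eq_of_subset_of_card_le
  · rw [pair_sub]; simp [face]
  · rw [Finset.card_pair h.1]
    by_contra! hlt
    have h1 := T.card_eq_three _ (face_mem hσ h)
    have h2 := T.card_eq_three _ (face_mem hσ (adj_symm h))
    have h3 := Finset.eq_of_subset_of_card_le
      (Finset.inter_subset_left (s₁ := face T σ a b) (s₂ := face T σ b a)) (by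
        change (face T σ a b).card = 3 at h1; omega)
    have h4 := Finset.eq_of_subset_of_card_le
      (Finset.inter_subset_right (s₁ := face T σ a b) (s₂ := face T σ b a)) (by
        change (face T σ b a).card = 3 at h2; omega)
    exact face_ne hσ h (h3.symm.trans h4)

/-- a function on darts as a function on edges -/
noncomputable def lift (T : Triangulation) (φ : ℕ → ℕ → ZMod 2) (e : Finset ℕ) : ZMod 2 :=
  if h : ∃ d : ℕ × ℕ, adj T d.1 d.2 ∧ e = {d.1, d.2} then φ h.choose.1 h.choose.2 else 0

theorem lift_eq {φ : ℕ → ℕ → ZMod 2} (hφ : ∀ {a b}, adj T a b → φ a b = φ b a) {a b}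
    (h : adj T a b) : lift T φ {a, b} = φ a b := by
  have he : ∃ d : ℕ × ℕ, adj T d.1 d.2 ∧ ({a, b} : Finset ℕ) = {d.1, d.2} := ⟨(a, b), h, rfl⟩
  unfold lift
  rw [dif_pos he]
  obtain ⟨h1, h2⟩ := he.choose_spec
  have h2' : s(a, b) = s(he.choose.1, he.choose.2) := by
    have := congrArg (fun s : Finset ℕ => (s : Set ℕ)) h2
    simp only [Finset.coe_insert, Finset.coe_singleton] at this
    rcases Set.pair_eq_pair_iff.1 this with ⟨h3, h4⟩ | ⟨h3, h4⟩
    · exact Sym2.eq_iff.2 (.inl ⟨h3, h4⟩)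
    · exact Sym2.eq_iff.2 (.inr ⟨h3, h4⟩)
  rcases Sym2.eq_iff.1 h2' with ⟨h3, h4⟩ | ⟨h3, h4⟩
  · rw [← h3, ← h4]
  · rw [← h3, ← h4, hφ h]

theorem lift_sum (hσ : IsCoherent T.faces σ) {φ : ℕ → ℕ → ZMod 2}
    (hφ : ∀ {a b}, adj T a b → φ a b = φ b a)
    (hs : ∀ {a b}, adj T a b → φ a b + φ b (t T σ a b) + φ (t T σ a b) a = 0)
    {f} (hf : f ∈ T.faces) : ∑ e ∈ f.powersetCard 2, lift T φ e = 0 := by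
  obtain ⟨a, b, h, rfl⟩ := exists_dart hσ hf
  have h1 := t_adj hσ h
  have h2 := succ_adj hσ h
  unfold face
  rw [sum_triangle h.1 h2.1 h1.1, lift_eq hφ h, lift_eq hφ h1, lift_eq hφ h2, ← hs h,
    hφ h2]
  ring

end Model
end NSC

namespace NSC
open scoped Classical
open Triangulation

namespace Model
variable {T : Triangulation} {σ : Finset ℕ → ℕ × ℕ × ℕ} {c : List ℕ}

theorem sameSide_symm {f g} (h : SameSide T c f g) : SameSide T c g f := by
  refine (@Relation.ReflTransGen.symmetric _ _ ⟨?_⟩).symm _ _ h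
  rintro f g ⟨h1, h2, h3, h4⟩
  rw [Finset.inter_comm] at h3 h4
  exact ⟨h2, h1, h3, h4⟩

theorem sameSide_trans {f g h} (h1 : SameSide T c f g) (h2 : SameSide T c g h) :
    SameSide T c f h := Relation.ReflTransGen.trans h1 h2

theorem sameSide_flip (hσ : IsCoherent T.faces σ) {a b} (h : adj T a b)
    (hc : {a, b} ∉ cycEdges c) : SameSide T c (face T σ a b) (face T σ b a) := by
  have h2 := face_inter hσ h
  refine Relation.ReflTransGen.single ⟨face_mem hσ h, face_mem hσ (adj_symm h), ?_, ?_⟩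
  · rw [h2, Finset.card_pair h.1]
  · rwa [h2]

/-- a function on faces that only changes across the cycle -/
theorem sameSide_eq (A : Finset ℕ → ZMod 2)
    (hA : ∀ e ∈ T.edges, ∑ f ∈ T.faces.filter (fun f => e ⊆ f), A f =
      if e ∈ cycEdges c then 1 else 0) {f g} (h : SameSide T c f g) : A f = A g := by
  induction h with
  | refl => rfl
  | @tail g g' _ h ih =>
    obtain ⟨h1, h2, h3, h4⟩ := h
    have := hA (g ∩ g') (mem_edges.2 ⟨h3, g, h1, Finset.inter_subset_left⟩)
    rw [filter_inter h1 h2 h3, Finset.sum_pair (inter_ne h1 h3), if_neg h4] at this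
    rw [ih, z2_eq.1 this]

theorem not_sameSide (hσ : IsCoherent T.faces σ) (A : Finset ℕ → ZMod 2)
    (hA : ∀ e ∈ T.edges, ∑ f ∈ T.faces.filter (fun f => e ⊆ f), A f =
      if e ∈ cycEdges c then 1 else 0) {a b} (h : adj T a b) (hc : {a, b} ∈ cycEdges c) :
    ¬ SameSide T c (face T σ a b) (face T σ b a) := by
  intro hs
  have := hA {a, b} (adj_iff.1 h).2
  rw [filter_pair hσ h, Finset.sum_pair (face_ne hσ h), if_pos hc, sameSide_eq A hA hs, z2] at this
  exact zero_ne_one this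

theorem mem_side {f g} : g ∈ sideFaces T c f ↔ g ∈ T.faces ∧ SameSide T c f g := by
  simp [sideFaces]

theorem side_step {f g g'} (hg : g ∈ sideFaces T c f) (hg' : g' ∈ T.faces)
    (h : (g ∩ g').card = 2) (hc : g ∩ g' ∉ cycEdges c) : g' ∈ sideFaces T c f := by
  rw [mem_side] at *
  exact ⟨hg', hg.2.tail ⟨hg.1, hg', h, hc⟩⟩

theorem side_flip (hσ : IsCoherent T.faces σ) {f a b} (h : adj T a b) (hc : {a, b} ∉ cycEdges c)
    (hf : face T σ a b ∈ sideFaces T c f) : face T σ b a ∈ sideFaces T c f := by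
  rw [mem_side] at *
  exact ⟨face_mem hσ (adj_symm h), sameSide_trans hf.2 (sameSide_flip hσ h hc)⟩

theorem side_conn {f : Finset ℕ} (hf : f ∈ T.faces) : ∀ g ∈ sideFaces T c f,
    ∀ g' ∈ sideFaces T c f, Relation.ReflTransGen
      (fun x y => x ∈ sideFaces T c f ∧ y ∈ sideFaces T c f ∧ (x ∩ y).card = 2) g g' := by
  have key : ∀ g, SameSide T c f g → Relation.ReflTransGen
      (fun x y => x ∈ sideFaces T c f ∧ y ∈ sideFaces T c f ∧ (x ∩ y).card = 2) f g := by
    intro g h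
    induction h with
    | refl => exact .refl
    | @tail g g' hg h ih =>
      have h1 : g ∈ sideFaces T c f := mem_side.2 ⟨h.1, hg⟩
      exact ih.tail ⟨h1, side_step h1 h.2.1 h.2.2.1 h.2.2.2, h.2.2.1⟩
  intro g hg g' hg'
  refine .trans ((@Relation.ReflTransGen.symmetric _ _ ⟨?_⟩).symm _ _ (key g (mem_side.1 hg).2))
    (key g' (mem_side.1 hg').2)
  rintro x y ⟨h1, h2, h3⟩
  rw [Finset.inter_comm] at h3
  exact ⟨h2, h1, h3⟩

/-- a proper side has a face at the cycle -/
theorem side_boundary (hs : Separating T c) {f : Finset ℕ} (hf : f ∈ T.faces) :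
    ∃ g ∈ sideFaces T c f, ∃ g' ∈ T.faces, g' ∉ sideFaces T c f ∧ (g ∩ g').card = 2 ∧
      g ∩ g' ∈ cycEdges c := by
  obtain ⟨f1, hf1, f2, hf2, hn⟩ := hs
  obtain ⟨k, hk, hk'⟩ : ∃ k ∈ T.faces, k ∉ sideFaces T c f := by
    by_contra! h
    exact hn (sameSide_trans (sameSide_symm (mem_side.1 (h f1 hf1)).2) (mem_side.1 (h f2 hf2)).2)
  by_contra! h
  have : ∀ g, Relation.ReflTransGen
      (fun f' g' => f' ∈ T.faces ∧ g' ∈ T.faces ∧ (f' ∩ g').card = 2) f g →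
      g ∈ sideFaces T c f := by
    intro g hg
    induction hg with
    | refl => exact mem_side.2 ⟨hf, .refl⟩
    | tail _ h1 ih =>
      obtain ⟨-, h2, h3⟩ := h1
      by_contra h4
      exact h4 (side_step ih h2 h3 (h _ ih _ h2 h4 h3))
  exact hk' (this k (T.face_connected f hf k hk))

/-- cocycles are coboundaries on a side that is capped to a sphere -/
theorem side_potential (hσ : IsCoherent T.faces σ) (hs : Separating T c) {f : Finset ℕ}
    (hf : f ∈ T.faces) (hE : sideEuler T c f = 2) {φ : ℕ → ℕ → ZMod 2}
    (hφ : ∀ {a b}, adj T a b → φ a b = φ b a)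
    (hφ' : ∀ {a b}, adj T a b → φ a b + φ b (t T σ a b) + φ (t T σ a b) a = 0) :
    ∃ x : ℕ → ZMod 2, ∀ {a b}, adj T a b → face T σ a b ∈ sideFaces T c f →
      φ a b = x a + x b := by
  have sub : sideFaces T c f ⊆ T.faces := Finset.filter_subset _ _
  obtain ⟨x, hx⟩ := exists_potential (F := sideFaces T c f) (fun g hg => T.card_eq_three g (sub hg))
    (fun e he => by
      obtain ⟨h1, g, hg, h2⟩ := mem_edgesOf.1 he
      refine (Finset.card_le_card (Finset.filter_subset_filter _ sub)).trans (le_of_eq ?_)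
      convert T.edge_in_two_faces e h1 ⟨g, sub hg, h2⟩)
    (side_conn hf) (by
      obtain ⟨g, hg, g', hg', hn, h2, -⟩ := side_boundary hs hf
      refine ⟨g ∩ g', mem_edgesOf.2 ⟨h2, g, hg, Finset.inter_subset_left⟩,
        Finset.card_eq_one.2 ⟨g, ?_⟩⟩
      have h3 := filter_inter (sub hg) hg' h2
      ext k
      have h4 : k ∈ T.faces.filter (fun f' => g ∩ g' ⊆ f') ↔ k = g ∨ k = g' := by rw [h3]; simp
      rw [Finset.mem_filter] at h4
      rw [Finset.mem_filter, Finset.mem_singleton]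
      constructor
      · rintro ⟨h5, h6⟩
        rcases h4.1 ⟨sub h5, h6⟩ with rfl | rfl
        · rfl
        · exact absurd h5 hn
      · rintro rfl
        exact ⟨hg, Finset.inter_subset_left⟩)
    (by unfold sideEuler at hE; omega) (lift T φ) (fun g hg => lift_sum hσ hφ hφ' (sub hg))
  refine ⟨x, fun {a b} h hm => ?_⟩
  rw [← lift_eq hφ h, hx {a, b} (mem_edgesOf.2 ⟨Finset.card_pair h.1, _, hm, by
    rw [pair_sub]; simp [face]⟩), Finset.sum_pair h.1]

end Model
end NSC

namespace NSC
open scoped Classical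
open Triangulation

theorem cycEdges_map_range {n : ℕ} (s : ℕ → ℕ) (hn : 0 < n) (hs : s n = s 0) :
    cycEdges ((List.range n).map s) = (Finset.range n).image fun i => {s i, s (i + 1)} := by
  unfold cycEdges
  rw [List.length_map, List.length_range]
  refine Finset.image_congr fun i hi => ?_
  have hi : i < n := by simpa using hi
  have g : ∀ j < n, ((List.range n).map s).getD j 0 = s j := by
    intro j hj
    rw [List.getD_eq_getElem _ _ (by simpa using hj)]
    simp
  beta_reduce
  rw [g i hi, g _ (Nat.mod_lt _ hn)]
  congr 2
  rcases Nat.lt_or_ge (i + 1) n with h | h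
  · rw [Nat.mod_eq_of_lt h]
  · have : i + 1 = n := by omega
    rw [this, Nat.mod_self, hs]

theorem sum_telescope (h : ℕ → ZMod 2) (n : ℕ) :
    ∑ i ∈ Finset.range n, (h i + h (i + 1)) = h 0 + h n := by
  induction n with
  | zero => simp [z2]
  | succ n ih =>
    rw [Finset.sum_range_succ, ih]
    linear_combination z2 (h n)

theorem pair_eq {a b x y : ℕ} (h : ({a, b} : Finset ℕ) = {x, y}) :
    a = x ∧ b = y ∨ a = y ∧ b = x := by
  have := congrArg (fun s : Finset ℕ => (s : Set ℕ)) h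
  simp only [Finset.coe_insert, Finset.coe_singleton] at this
  exact Set.pair_eq_pair_iff.1 this

namespace Model
variable {T : Triangulation} {σ : Finset ℕ → ℕ × ℕ × ℕ}

/-- strongly connected sets of faces lie on one side -/
theorem side_of_strConn (hσ : IsCoherent T.faces σ) (hχ : T.euler = -2) {c : List ℕ}
    {B : ℕ → ℕ → Prop} (hB : (surf hσ hχ).StrConn B)
    (hc : ∀ {a b}, adj T a b → B a b → B b a → {a, b} ∉ cycEdges c) {f : Finset ℕ}
    {u v x y : ℕ} (h1 : adj T u v) (h2 : adj T x y) (h3 : B u v) (h4 : B x y)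
    (h5 : face T σ u v ∈ sideFaces T c f) : face T σ x y ∈ sideFaces T c f := by
  refine hB (fun u v => face T σ u v ∈ sideFaces T c f) (fun {u v} h _ => ?_)
    (fun {u v} h b b' => ?_) h1 h2 h3 h4 h5
  · show _ ↔ face T σ v (t T σ u v) ∈ _
    rw [face_rot hσ h]
  · have h : adj T u v := h
    refine ⟨side_flip hσ h (hc h b b'), side_flip hσ (adj_symm h) ?_⟩
    exact hc (adj_symm h) b' b

/-- a vertex of a side with an edge outside the side lies on the cycle -/
theorem exists_cycle_edge (hσ : IsCoherent T.faces σ) {c : List ℕ} {f g : Finset ℕ} {a b : ℕ}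
    (hg : g ∈ sideFaces T c f) (ha : a ∈ g) (h : adj T a b)
    (hn : face T σ a b ∉ sideFaces T c f) : ∃ v, adj T a v ∧ {a, v} ∈ cycEdges c := by
  by_contra! hc
  obtain ⟨b', hb', hg'⟩ : ∃ b', adj T a b' ∧ g = face T σ a b' := by
    obtain ⟨x, y, hxy, rfl⟩ := exists_dart hσ (mem_side.1 hg).1
    have h1 := t_adj hσ hxy
    have h2 := t_adj hσ h1
    have e1 := face_rot hσ hxy
    have e2 := face_rot hσ h1
    rw [t_rot hσ hxy] at h2 e2
    simp only [face, Finset.mem_insert, Finset.mem_singleton] at ha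
    rcases ha with rfl | rfl | rfl
    · exact ⟨_, hxy, rfl⟩
    · exact ⟨_, h1, e1.symm⟩
    · exact ⟨_, h2, by rw [e2, e1]⟩
  subst hg'
  obtain ⟨k, hk⟩ := cyc hσ hb' h
  apply hn
  rw [← hk]
  clear hk
  induction k with
  | zero => exact hg
  | succ k ih =>
    rw [Function.iterate_succ_apply']
    have h1 := iter_adj hσ hb' k
    have h2 := succ_adj hσ h1
    refine side_flip hσ (adj_symm h2) (by rw [Finset.pair_comm]; exact hc _ h2) ?_
    have e1 := face_rot hσ h1
    have e2 := face_rot hσ (t_adj hσ h1)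
    rw [t_rot hσ h1] at e2
    rw [e2, e1]
    exact ih

theorem exists_isNSC (hσ : IsCoherent T.faces σ) (hχ : T.euler = -2) : ∃ c, T.IsNSC c := by
  obtain ⟨B, hB, hBc, hbd, ⟨φ₀, hφ₀, hφ₁, h₀, hh₀⟩, ψ, hψ, hψn⟩ := (surf hσ hχ).good
  obtain ⟨φ, ⟨hφ, hφB, hφn⟩, hmin⟩ := Surf.Van.exists_min (S := surf hσ hχ) (B := B)
    ⟨_, hφ₀.add_coboundary h₀, fun e b => by rw [hh₀ e b, z2], fun ⟨h, hh⟩ =>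
      hφ₁ ⟨fun x => h x + h₀ x, fun {x y} e => by
        linear_combination hh e - z2 (h₀ x) - z2 (h₀ y)⟩⟩
  obtain ⟨p, q, hpq, hφpq⟩ : ∃ p q, adj T p q ∧ φ p q ≠ 0 := by
    by_contra! h
    exact hφn ⟨fun _ => 0, fun e => by rw [h _ _ e, z2]⟩
  obtain ⟨b₁, b₂, hb, hbB⟩ : ∃ x y, adj T x y ∧ B x y := by
    by_contra! h
    exact hψn ⟨fun _ _ => 0, fun _ _ _ => rfl, fun e b => absurd b (h _ _ e)⟩
  have hpB : ¬ B p q := fun h => hφpq (hφB hpq h)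
  let C := (surf hσ hχ).Comp B p q
  have hCB : ∀ {x y}, C x y → adj T x y ∧ ¬ B x y := fun h => h.adj_not hB hpq hpB
  have hCc : (surf hσ hχ).StrConn C := Surf.Comp.strConn hB hpq hpB
  have hCp : C p q := .refl
  obtain ⟨n, s, hn, hs, hinj, hz⟩ := Surf.exists_boundary_cycle (C := C)
    (fun e => Surf.Comp.rot_iff e) hpq hCp hb (fun h => (hCB h).2 hbB)
  have hzB : ∀ i, B (s (i + 1)) (s i) := fun i => by
    by_contra h
    exact (hz i).2.2 ((hz i).2.1.flip h)
  let c := (List.range n).map s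
  have hcE : cycEdges c = (Finset.range n).image fun i => {s i, s (i + 1)} :=
    cycEdges_map_range s (by omega) hs
  have hcm : ∀ {e}, e ∈ cycEdges c ↔ ∃ i < n, {s i, s (i + 1)} = e := by
    intro e
    rw [hcE, Finset.mem_image]
    simp only [Finset.mem_range]
  have hcT : ∀ e ∈ cycEdges c, e ∈ T.edges := by
    intro e he
    obtain ⟨i, -, rfl⟩ := hcm.1 he
    exact (adj_iff.1 (hz i).1).2
  have hcBC : ∀ {a b}, {a, b} ∈ cycEdges c → B a b ∧ C b a ∨ B b a ∧ C a b := by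
    intro a b h
    obtain ⟨i, -, h⟩ := hcm.1 h
    rcases pair_eq h with ⟨rfl, rfl⟩ | ⟨rfl, rfl⟩
    · exact .inr ⟨hzB i, (hz i).2.1⟩
    · exact .inl ⟨hzB i, (hz i).2.1⟩
  have hinj' : Set.InjOn (fun i => ({s i, s (i + 1)} : Finset ℕ)) (Finset.range n) := by
    intro i hi j hj h
    simp only [Finset.coe_range, Set.mem_Iio] at hi hj
    rcases pair_eq h with ⟨h, -⟩ | ⟨h1, h2⟩
    · exact hinj i hi j hj h
    · have := (hz i).2.2
      rw [h1, h2] at this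
      exact absurd (hz j).2.1 this
  -- the cycle separates
  obtain ⟨A, hA⟩ := exists_side T.faces (cycEdges c) hcT (by
    intro y hy
    obtain ⟨h, hh⟩ := hbd (fun a b => y {a, b}) ⟨fun {u v} _ => by rw [Finset.pair_comm], by
      intro u v e
      have e : adj T u v := e
      have h1 := t_adj hσ e
      have h2 := succ_adj hσ e
      have := hy _ (face_mem hσ e)
      rw [sum_triangle e.1 h2.1 h1.1] at this
      change y {u, v} + y {v, t T σ u v} + y {t T σ u v, u} = 0
      rw [Finset.pair_comm (t T σ u v) u, ← this]
      ring⟩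
    rw [hcE, Finset.sum_image hinj']
    have : ∀ i, y {s i, s (i + 1)} = h (s i) + h (s (i + 1)) := by
      intro i
      have := hh ((surf hσ hχ).symm (hz i).1) (hzB i) (hCB (hz i).2.1).2
      rw [Finset.pair_comm, this, add_comm]
    simp only [this]
    rw [sum_telescope (fun i => h (s i)), hs, z2])
  have hsep : Separating T c := ⟨_, face_mem hσ (hz 0).1, _, face_mem hσ (adj_symm (hz 0).1),
    not_sameSide hσ A hA (hz 0).1 (hcm.2 ⟨0, by omega, rfl⟩)⟩
  refine ⟨c, ⟨by simp only [c, List.length_map, List.length_range]; exact hn, ?_, hcT⟩, hsep, ?_⟩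
  · exact List.Nodup.map_on (fun i hi j hj h => hinj i (List.mem_range.1 hi) j (List.mem_range.1 hj) h)
      List.nodup_range
  intro f hf hE
  have hBs : ∀ {u v x y}, adj T u v → adj T x y → B u v → B x y →
      face T σ u v ∈ sideFaces T c f → face T σ x y ∈ sideFaces T c f :=
    side_of_strConn hσ hχ hBc fun _ h1 h2 h3 => by
      rcases hcBC h3 with h | h
      · exact (hCB h.2).2 h2
      · exact (hCB h.2).2 h1
  have hCs : ∀ {u v x y}, C u v → C x y →
      face T σ u v ∈ sideFaces T c f → face T σ x y ∈ sideFaces T c f := fun h1 h2 =>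
    side_of_strConn hσ hχ hCc (fun _ h1 h2 h3 => by
      rcases hcBC h3 with h | h
      · exact (hCB h1).2 h.1
      · exact (hCB h2).2 h.1) (hCB h1).1 (hCB h2).1 h1 h2
  have hor : (∀ {x y}, adj T x y → B x y → face T σ x y ∈ sideFaces T c f) ∨
      ∀ {x y}, C x y → face T σ x y ∈ sideFaces T c f := by
    obtain ⟨g, hg, g', hg', -, h2, h3⟩ := side_boundary hsep hf
    obtain ⟨i, -, hi⟩ := hcm.1 h3
    have : g ∈ T.faces.filter (fun f' => {s i, s (i + 1)} ⊆ f') :=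
      Finset.mem_filter.2 ⟨(mem_side.1 hg).1, by rw [hi]; exact Finset.inter_subset_left⟩
    rw [filter_pair hσ (hz i).1, Finset.mem_insert, Finset.mem_singleton] at this
    rcases this with rfl | rfl
    · exact .inr fun h => hCs (hz i).2.1 h hg
    · exact .inl fun h h' => hBs (adj_symm (hz i).1) h (hzB i) h' hg
  rcases hor with hD | hD
  · obtain ⟨x, hx⟩ := side_potential hσ hsep hf hE (φ := ψ) hψ.symm hψ.sum
    exact hψn ⟨fun v _ => x v, fun _ _ _ => rfl, fun e b => hx e (hD e b)⟩
  · obtain ⟨x, hx⟩ := side_potential hσ hsep hf hE (φ := φ) hφ.symm hφ.sum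
    have hxs : ∀ i, x (s i) = x (s 0) := by
      intro i
      induction i with
      | zero => rfl
      | succ i ih =>
        have h1 := hx (hz i).1 (hD (hz i).2.1)
        rw [hφ.symm (hz i).1, hφB ((surf hσ hχ).symm (hz i).1) (hzB i)] at h1
        rw [← z2_eq.1 h1.symm, ih]
    let g : ℕ → ZMod 2 := fun v =>
      if v ∈ vertsOf (sideFaces T c f) then x v + x (s 0) else 0
    have hmem : ∀ {g v}, g ∈ sideFaces T c f → v ∈ g → v ∈ vertsOf (sideFaces T c f) :=
      fun h1 h2 => Finset.mem_sup.2 ⟨_, h1, h2⟩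
    have hg1 : ∀ {a b}, adj T a b → face T σ a b ∈ sideFaces T c f →
        φ a b + (g a + g b) = 0 := by
      intro a b h hm
      simp only [g]
      rw [if_pos (hmem hm (by simp [face])), if_pos (hmem hm (by simp [face])), hx h hm]
      linear_combination z2 (x a) + z2 (x b) + z2 (x (s 0))
    have hg0 : ∀ {a b}, adj T a b → face T σ a b ∉ sideFaces T c f → g a = 0 := by
      intro a b h hm
      simp only [g]
      split_ifs with hv
      · obtain ⟨k, hk, hak⟩ := Finset.mem_sup.1 hv
        obtain ⟨v, -, hv⟩ := exists_cycle_edge hσ hk hak h hm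
        obtain ⟨i, -, hi⟩ := hcm.1 hv
        rcases pair_eq hi with ⟨rfl, -⟩ | ⟨-, rfl⟩
        · rw [hxs, z2]
        · rw [hxs, z2]
      · rfl
    have hg2 : ∀ {a b}, adj T a b → φ a b + (g a + g b) = 0 ∨ φ a b + (g a + g b) = φ a b := by
      intro a b h
      by_cases h1 : face T σ a b ∈ sideFaces T c f
      · exact .inl (hg1 h h1)
      by_cases h2 : face T σ b a ∈ sideFaces T c f
      · left
        rw [add_comm (g a), hφ.symm h]
        exact hg1 (adj_symm h) h2
      · right
        rw [hg0 h h1, hg0 (adj_symm h) h2, add_zero, add_zero]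
    refine hφpq (hmin (fun a b => φ a b + (g a + g b)) ⟨hφ.add_coboundary g, ?_, ?_⟩ ?_ hpq
      (hg1 hpq (hD hCp)))
    · intro a b h hb
      rcases hg2 h with h' | h'
      · exact h'
      · rw [h']; exact hφB h hb
    · rintro ⟨k, hk⟩
      exact hφn ⟨fun a => k a + g a, fun {a b} e => by
        linear_combination hk e - z2 (g a) - z2 (g b)⟩
    · intro a b h h0
      rcases hg2 h with h' | h'
      · exact h'
      · rw [h']; exact h0

end Model

end NSC

/-- Every triangulation of the orientable surface `S_2` of genus 2 contains a noncontractible separating cycle. -/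
theorem every_triangulation_s2_has_NSC :
    ∀ T : Triangulation, T.IsS 2 → ∃ c : List ℕ, T.IsNSC c := by
  rintro T ⟨h, σ, hσ⟩
  exact NSC.Model.exists_isNSC hσ (by rw [h]; norm_num)
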